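/- Let k be a field, S a polynomial ring over k in finitely many variables, and I ⊆ S a homogeneous ideal of height 3 generated by n homogeneous polynomials of degree 2. Then the projective dimension of S/I as an S-module satisfies pd_S(S/I) ≤ max{3n+1, 4n-10}. -/

import Mathlib

open CategoryTheory Opposite

universe u

/-- The height of an ideal: the infimum of the heights (in the prime spectrum,
ordered by inclusion) of the primes containing it. -/
noncomputable def Ideal.heightENat {R : Type u} [CommRing R] (I : Ideal R) : ℕ∞ :=
  ⨅ (p : PrimeSpectrum R) (_ : I ≤ p.asIdeal), Order.height p

/-- The projective dimension of an `R`-module `M`: the least `n` such that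
`Ext^i(M, N) = 0` for all `i > n` and all modules `N` (and `⊤` if no such `n` exists). -/
noncomputable def projDim (R : Type u) [CommRing R] (M : Type u) [AddCommGroup M]
    [Module R M] : ℕ∞ :=
  sInf ((↑) '' {n : ℕ | ∀ i : ℕ, n < i → ∀ N : ModuleCat.{u} R,
    Subsingleton (((Ext R (ModuleCat.{u} R) i).obj (op (ModuleCat.of R M))).obj N)})

/-- The Hilbert function of the standard graded ring `S/J`, where
`S = k[x_1, ..., x_N]`: the `k`-dimension of the degree-`d` graded piece of `S/J`. -/
noncomputable def hilbertFunction (k : Type u) [Field k] {N : ℕ}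
    (J : Ideal (MvPolynomial (Fin N) k)) (d : ℕ) : ℕ :=
  Module.finrank k (Submodule.map (Ideal.Quotient.mkₐ k J).toLinearMap
    (MvPolynomial.homogeneousSubmodule (Fin N) k d))

open scoped Classical in
/-- The Hilbert–Samuel multiplicity `e(S/J)` of the graded ring `S/J`:
`(deg P)!` times the leading coefficient of the Hilbert polynomial `P` of `S/J`,
i.e. of the polynomial agreeing with the Hilbert function in all large degrees
(the degree of the Hilbert polynomial being `dim(S/J) - 1`). -/
noncomputable def hilbertSamuelMultiplicity (k : Type u) [Field k] {N : ℕ}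
    (J : Ideal (MvPolynomial (Fin N) k)) : ℚ :=
  if h : ∃ P : Polynomial ℚ, ∀ᶠ d : ℕ in Filter.atTop,
      (hilbertFunction k J d : ℚ) = P.eval (d : ℚ)
  then (h.choose.natDegree).factorial * h.choose.leadingCoeff
  else 0

section
/-- Projective dimension at most `n`. -/
def Pd (R : Type u) [CommRing R] (M : Type u) [AddCommGroup M] [Module R M] (n : ℕ) : Prop :=
  HasProjectiveDimensionLE (ModuleCat.of R M) n

section
variable {R : Type u} [CommRing R] {A B C : Type u} [AddCommGroup A] [Module R A]
  [AddCommGroup B] [Module R B] [AddCommGroup C] [Module R C]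

theorem Pd.mono {m n : ℕ} (h : Pd R A m) (hmn : m ≤ n) : Pd R A n :=
  have : HasProjectiveDimensionLT (ModuleCat.of R A) (m + 1) := h
  hasProjectiveDimensionLT_of_ge _ (m + 1) (n + 1) (by omega)

theorem Pd.congr (e : A ≃ₗ[R] B) {n : ℕ} (h : Pd R A n) : Pd R B n :=
  have : HasProjectiveDimensionLT (ModuleCat.of R A) (n + 1) := h
  hasProjectiveDimensionLT_of_iso e.toModuleIso (n + 1)

theorem Pd.retract (i : A →ₗ[R] B) (r : B →ₗ[R] A) (hr : ∀ a, r (i a) = a) {n : ℕ}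
    (h : Pd R B n) : Pd R A n := by
  have : HasProjectiveDimensionLT (ModuleCat.of R B) (n + 1) := h
  refine Retract.hasProjectiveDimensionLT (X := ModuleCat.of R A) (Y := ModuleCat.of R B)
    ⟨ModuleCat.ofHom i, ModuleCat.ofHom r, ?_⟩ (n + 1)
  ext a
  exact hr a

theorem pd_zero_iff : Pd R A 0 ↔ Module.Projective R A := by
  unfold Pd
  rw [← projective_iff_hasProjectiveDimensionLE_zero, ← IsProjective.iff_projective]

theorem Pd.of_projective [Module.Projective R A] {n : ℕ} : Pd R A n :=
  (pd_zero_iff.2 ‹_›).mono (Nat.zero_le n)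

theorem Pd.of_subsingleton [Subsingleton A] {n : ℕ} : Pd R A n := Pd.of_projective

theorem ses_shortExact (f : A →ₗ[R] B) (g : B →ₗ[R] C) (hf : Function.Injective f)
    (hg : Function.Surjective g) (hfg : Function.Exact f g) :
    (ShortComplex.mk (ModuleCat.ofHom f) (ModuleCat.ofHom g)
      (by ext a; exact (hfg (f a)).2 ⟨a, rfl⟩)).ShortExact where
  exact := (ShortComplex.ShortExact.moduleCat_exact_iff_function_exact _).2 hfg
  mono_f := (ModuleCat.mono_iff_injective _).2 hf
  epi_g := (ModuleCat.epi_iff_surjective _).2 hg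

theorem Pd.two (f : A →ₗ[R] B) (g : B →ₗ[R] C) (hf : Function.Injective f)
    (hg : Function.Surjective g) (hfg : Function.Exact f g) {n : ℕ}
    (hA : Pd R A n) (hC : Pd R C n) : Pd R B n :=
  (ses_shortExact f g hf hg hfg).hasProjectiveDimensionLT_X₂ (n + 1) hA hC

theorem Pd.three (f : A →ₗ[R] B) (g : B →ₗ[R] C) (hf : Function.Injective f)
    (hg : Function.Surjective g) (hfg : Function.Exact f g) {n : ℕ}
    (hA : Pd R A n) (hB : Pd R B (n + 1)) : Pd R C (n + 1) :=
  (ses_shortExact f g hf hg hfg).hasProjectiveDimensionLT_X₃ (n + 1) hA hB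

theorem Pd.one (f : A →ₗ[R] B) (g : B →ₗ[R] C) (hf : Function.Injective f)
    (hg : Function.Surjective g) (hfg : Function.Exact f g) {n : ℕ}
    (hB : Pd R B n) (hC : Pd R C (n + 1)) : Pd R A n :=
  (ses_shortExact f g hf hg hfg).hasProjectiveDimensionLT_X₁ (n + 1) hB hC

end

/-- projective dimension via free covers -/
theorem pd_succ_iff {R : Type u} [CommRing R] {M : Type u} [AddCommGroup M] [Module R M] {n : ℕ} :
    Pd R M (n + 1) ↔ Pd R (LinearMap.ker (Finsupp.linearCombination R (id : M → M))) n := by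
  have hs : Function.Surjective (Finsupp.linearCombination R (id : M → M)) :=
    Finsupp.linearCombination_id_surjective R M
  have hex : Function.Exact (LinearMap.ker (Finsupp.linearCombination R (id : M → M))).subtype
      (Finsupp.linearCombination R (id : M → M)) := by
    intro x; simp
  constructor
  · intro h
    exact Pd.one _ _ (Submodule.injective_subtype _) hs hex Pd.of_projective h
  · intro h
    exact Pd.three _ _ (Submodule.injective_subtype _) hs hex h Pd.of_projective

open TensorProduct in
theorem baseChange_exact' {R : Type u} [CommRing R] (S : Type u) [CommRing S] [Algebra R S]
    {A B C : Type u} [AddCommGroup A] [Module R A] [AddCommGroup B] [Module R B]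
    [AddCommGroup C] [Module R C] (f : A →ₗ[R] B) (g : B →ₗ[R] C)
    (hex : Function.Exact f g) (hs : Function.Surjective g) :
    Function.Exact (f.baseChange S) (g.baseChange S) := by
  have h := lTensor_exact S hex hs
  exact h

open TensorProduct in
theorem Pd.baseChange_step {R : Type u} [CommRing R] (S : Type u) [CommRing S] [Algebra R S]
    [Module.Flat R S] {A B C : Type u} [AddCommGroup A] [Module R A] [AddCommGroup B] [Module R B]
    [AddCommGroup C] [Module R C] [Module.Projective R B] (f : A →ₗ[R] B) (g : B →ₗ[R] C)
    (hi : Function.Injective f)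
    (hex : Function.Exact f g) (hs : Function.Surjective g) {n : ℕ} (h : Pd S (S ⊗[R] A) n) :
    Pd S (S ⊗[R] C) (n + 1) := by
  refine Pd.three (f.baseChange S) (g.baseChange S) ?_ ?_ (baseChange_exact' S f g hex hs) h
    Pd.of_projective
  · exact Module.Flat.lTensor_preserves_injective_linearMap _ hi
  · exact LinearMap.lTensor_surjective _ hs

open TensorProduct in
theorem Pd.baseChange {R : Type u} [CommRing R] (S : Type u) [CommRing S] [Algebra R S]
    [Module.Flat R S] {n : ℕ} : ∀ {M : Type u} [AddCommGroup M] [Module R M],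
    Pd R M n → Pd S (S ⊗[R] M) n := by
  induction n with
  | zero =>
    intro M _ _ h
    have := pd_zero_iff.1 h
    exact Pd.of_projective
  | succ n ih =>
    intro M _ _ h
    have h1 := ih (pd_succ_iff.1 h)
    refine Pd.baseChange_step S _ _ (Submodule.injective_subtype _) ?_
      (Finsupp.linearCombination_id_surjective R M) h1
    intro x; simp

/-- restriction of scalars along a ring map making `S` projective. -/
theorem Pd.restrict {R : Type u} [CommRing R] {S : Type u} [CommRing S] [Algebra R S]
    [Module.Free R S] {n : ℕ} : ∀ {M : Type u} [AddCommGroup M] [Module R M] [Module S M]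
    [IsScalarTower R S M], Pd S M n → Pd R M n := by
  induction n with
  | zero =>
    intro M _ _ _ _ h
    have := pd_zero_iff.1 h
    obtain ⟨s, hs⟩ := this.out
    refine Pd.retract (B := M →₀ S) (s.restrictScalars R)
      ((Finsupp.linearCombination S (id : M → M)).restrictScalars R) hs Pd.of_projective
  | succ n ih =>
    intro M _ _ _ _ h
    have h1 := ih (pd_succ_iff.1 h)
    have hs : Function.Surjective (Finsupp.linearCombination S (id : M → M)) :=
      Finsupp.linearCombination_id_surjective S M
    exact Pd.three
      ((LinearMap.ker (Finsupp.linearCombination S (id : M → M))).subtype.restrictScalars R)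
      ((Finsupp.linearCombination S (id : M → M)).restrictScalars R)
      (Submodule.injective_subtype _) hs (fun x => by simp) h1 Pd.of_projective


open TensorProduct Polynomial in
theorem Pd.polynomial {R : Type u} [CommRing R] {d : ℕ}
    (hR : ∀ (M : Type u) [AddCommGroup M] [Module R M], Pd R M d)
    (M : Type u) [AddCommGroup M] [Module R[X] M] : Pd R[X] M (d + 1) := by
  let _ : Module R M := Module.compHom M (C : R →+* R[X])
  have : IsScalarTower R R[X] M := ⟨fun r f m => by
    rw [Polynomial.smul_eq_C_mul, mul_smul]; rfl⟩
  let φ : M →ₗ[R] M := (LinearMap.lsmul R[X] M X).restrictScalars R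
  let α : R[X] ⊗[R] M →ₗ[R[X]] R[X] ⊗[R] M := LinearMap.lsmul R[X] _ X - φ.baseChange R[X]
  let β : R[X] ⊗[R] M →ₗ[R[X]] M := LinearMap.liftBaseChange R[X] (LinearMap.id : M →ₗ[R] M)
  have hα : ∀ (f : R[X]) (m : M), α (f ⊗ₜ m) = (X * f) ⊗ₜ m - f ⊗ₜ ((X : R[X]) • m : M) := by
    intro f m
    simp [α, φ, TensorProduct.smul_tmul']
  have hβ : ∀ (f : R[X]) (m : M), β (f ⊗ₜ m) = f • m := by
    intro f m
    simp [β]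
  have h1 : Pd R[X] (R[X] ⊗[R] M) d := Pd.baseChange R[X] (hR M)
  have key2 : ∀ t, t - (1 : R[X]) ⊗ₜ[R] (β t) ∈ LinearMap.range α := by
    intro t
    induction t using TensorProduct.induction_on with
    | zero => simp
    | add a b ha hb =>
      have := add_mem ha hb
      rw [map_add, tmul_add]
      convert this using 1
      abel
    | tmul f m =>
      rw [hβ]
      induction f using Polynomial.induction_on' generalizing m with
      | add p q hp hq =>
        have := add_mem (hp m) (hq m)
        rw [add_tmul, add_smul, tmul_add]
        convert this using 1
        abel
      | monomial n a =>
        have h2 : ∀ (n : ℕ) (m : M), ((X : R[X]) ^ n) ⊗ₜ[R] m - 1 ⊗ₜ ((X : R[X]) ^ n • m)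
            ∈ LinearMap.range α := by
          intro n
          induction n with
          | zero => intro m; simp
          | succ n ih =>
            intro m
            have h3 : α (((X : R[X]) ^ n) ⊗ₜ[R] m) ∈ LinearMap.range α := ⟨_, rfl⟩
            have := add_mem h3 (ih ((X : R[X]) • m))
            rw [hα, smul_smul, ← pow_succ, ← pow_succ'] at this
            simpa using this
        have := h2 n (a • m)
        have e1 : (monomial n a : R[X]) = a • (X : R[X]) ^ n := by
          rw [← C_mul_X_pow_eq_monomial, smul_eq_C_mul]
        have e2 : (a • (X : R[X]) ^ n) • m = (X : R[X]) ^ n • (a • m) := by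
          rw [smul_assoc, smul_comm]
        rw [e1, e2, TensorProduct.smul_tmul]
        exact this
  refine Pd.three α β ?_ ?_ ?_ h1 (h1.mono (Nat.le_succ d))
  · let e : ℕ → (R[X] ⊗[R] M →ₗ[R] M) := fun n =>
      (TensorProduct.lid R M).toLinearMap ∘ₗ (lcoeff R n).rTensor M
    have he : ∀ (f : R[X]) (m : M) (n : ℕ), e n (f ⊗ₜ m) = f.coeff n • m := by
      intro f m n
      simp [e]
    have hrep : ∀ t : R[X] ⊗[R] M, ∃ N0, ∀ N, N0 ≤ N → e N t = 0 ∧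
        t = ∑ n ∈ Finset.range N, ((X : R[X]) ^ n) ⊗ₜ[R] (e n t) := by
      intro t
      induction t using TensorProduct.induction_on with
      | zero => exact ⟨0, fun N _ => by simp⟩
      | add a b ha hb =>
        obtain ⟨A, hA⟩ := ha
        obtain ⟨B, hB⟩ := hb
        refine ⟨max A B, fun N hN => ⟨?_, ?_⟩⟩
        · rw [map_add, (hA N (le_trans (le_max_left _ _) hN)).1,
            (hB N (le_trans (le_max_right _ _) hN)).1, add_zero]
        · simp only [map_add, tmul_add, Finset.sum_add_distrib]
          rw [← (hA N (le_trans (le_max_left _ _) hN)).2,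
            ← (hB N (le_trans (le_max_right _ _) hN)).2]
      | tmul f m =>
        refine ⟨f.natDegree + 1, fun N hN => ⟨?_, ?_⟩⟩
        · rw [he, coeff_eq_zero_of_natDegree_lt (by omega), zero_smul]
        · simp only [he]
          conv_lhs => rw [f.as_sum_range' N (by omega), sum_tmul]
          refine Finset.sum_congr rfl fun n _ => ?_
          rw [← C_mul_X_pow_eq_monomial, ← smul_eq_C_mul, TensorProduct.smul_tmul]
    have key : ∀ (t : R[X] ⊗[R] M) (n : ℕ), e (n + 1) (α t) = e n t - (X : R[X]) • (e (n + 1) t) := by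
      intro t n
      induction t using TensorProduct.induction_on with
      | zero => simp
      | add a b ha hb =>
        simp only [map_add, smul_add, ha, hb]; abel
      | tmul f m =>
        rw [hα, map_sub, he, he, he, he, coeff_X_mul]
        congr 1
        rw [smul_comm]
    rw [injective_iff_map_eq_zero]
    intro t ht
    obtain ⟨N0, hN0⟩ := hrep t
    have h4 : ∀ n, e n t = (X : R[X]) • e (n + 1) t := by
      intro n
      have := key t n
      rw [ht, map_zero] at this
      exact (sub_eq_zero.1 this.symm)
    have h5 : ∀ j n, e n t = (X : R[X]) ^ j • e (n + j) t := by
      intro j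
      induction j with
      | zero => intro n; simp
      | succ j ih =>
        intro n
        rw [ih n, h4 (n + j), smul_smul, ← pow_succ]; rfl
    have h6 : ∀ n, e n t = 0 := by
      intro n
      rw [h5 N0 n, (hN0 (n + N0) (by omega)).1, smul_zero]
    rw [(hN0 N0 le_rfl).2]
    simp [h6]
  · intro m
    exact ⟨1 ⊗ₜ m, by simp [hβ]⟩
  · intro t
    constructor
    · intro h
      have := key2 t
      rw [h, tmul_zero, sub_zero] at this
      exact this
    · rintro ⟨s, rfl⟩
      induction s using TensorProduct.induction_on with
      | zero => simp
      | add a b ha hb => rw [map_add, map_add, ha, hb, add_zero]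
      | tmul f m => rw [hα, map_sub, hβ, hβ, smul_smul, mul_comm, sub_self]

theorem Pd.projDim_le {R : Type u} [CommRing R] {M : Type u} [AddCommGroup M] [Module R M] {n : ℕ}
    (h : Pd R M n) : projDim R M ≤ n := by
  refine sInf_le ⟨n, ?_, rfl⟩
  intro i hi N
  obtain ⟨p, rfl⟩ : ∃ p, i = p + 1 := ⟨i - 1, by omega⟩
  let P := ProjectiveResolution.of (ModuleCat.of R M)
  have h' : HasProjectiveDimensionLT (ModuleCat.of R M) (n + 1) := h
  have hz : Limits.IsZero ((P.complex.linearYonedaObj R N).homology (p + 1)) := by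
    rw [← HomologicalComplex.exactAt_iff_isZero_homology,
      HomologicalComplex.exactAt_iff' _ p (p + 1) (p + 2) (by simp) (by simp),
      ShortComplex.moduleCat_exact_iff]
    intro (f : P.complex.X (p + 1) ⟶ N) hf
    have hf' : P.complex.d (p + 2) (p + 1) ≫ f = 0 := hf
    have h0 : P.extMk f (p + 2) rfl hf' = 0 :=
      Abelian.Ext.eq_zero_of_hasProjectiveDimensionLT _ (n + 1) (by omega)
    obtain ⟨g, hg⟩ := (P.extMk_eq_zero_iff f (p + 2) rfl hf' p rfl).1 h0
    exact ⟨g, hg⟩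
  exact (ModuleCat.subsingleton_of_isZero (hz.of_iso (P.isoExt (p + 1) N)))
end

section
theorem free_of_ringEquiv {R S : Type u} [CommRing R] [CommRing S] (e : R ≃+* S) :
    letI : Algebra R S := e.toRingHom.toAlgebra
    Module.Free R S := by
  letI : Algebra R S := e.toRingHom.toAlgebra
  let l : R ≃ₗ[R] S := LinearEquiv.ofBijective (Algebra.linearMap R S) e.bijective
  exact Module.Free.of_equiv l

/-- projective dimension of a cyclic module -/
abbrev PdI {R : Type u} [CommRing R] (I : Ideal R) (n : ℕ) : Prop := Pd R (R ⧸ I) n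

theorem Pd.transport {R S : Type u} [CommRing R] [CommRing S] (e : R ≃+* S) {d : ℕ}
    (hR : ∀ (M : Type u) [AddCommGroup M] [Module R M], Pd R M d)
    (M : Type u) [AddCommGroup M] [Module S M] : Pd S M d := by
  let _ : Algebra S R := e.symm.toRingHom.toAlgebra
  let _ : Module R M := Module.compHom M e.toRingHom
  have hsm : ∀ (r : R) (m : M), r • m = e r • m := fun _ _ => rfl
  have : IsScalarTower S R M := ⟨fun s r m => by
    rw [Algebra.smul_def, hsm, hsm, map_mul, mul_smul]
    congr 1
    exact e.apply_symm_apply s⟩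
  have hf : Module.Free S R := free_of_ringEquiv e.symm
  exact Pd.restrict (S := R) (hR M)

open MvPolynomial in
/-- The Hilbert syzygy theorem. -/
theorem syzygy_fin (k : Type u) [Field k] (D : ℕ) :
    ∀ (M : Type u) [AddCommGroup M] [Module (MvPolynomial (Fin D) k) M],
      Pd (MvPolynomial (Fin D) k) M D := by
  induction D with
  | zero =>
    refine Pd.transport (isEmptyRingEquiv k (Fin 0)).symm ?_
    intro M _ _
    exact Pd.of_projective
  | succ D ih =>
    exact Pd.transport (finSuccEquiv k D).symm.toRingEquiv (Pd.polynomial ih)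

open MvPolynomial in
theorem syzygy (k : Type u) [Field k] (σ : Type) [Fintype σ] {D : ℕ} (h : Fintype.card σ ≤ D)
    (M : Type u) [AddCommGroup M] [Module (MvPolynomial σ k) M] :
      Pd (MvPolynomial σ k) M D :=
  (Pd.transport (renameEquiv k (Fintype.equivFin σ).symm).toRingEquiv
    (syzygy_fin k (Fintype.card σ)) M).mono h

/-- flat base change for cyclic modules -/
theorem Pd.map_ideal {R S : Type u} [CommRing R] [CommRing S] [Algebra R S] [Module.Flat R S]
    (J : Ideal R) {n : ℕ} (h : Pd R (R ⧸ J) n) : Pd S (S ⧸ J.map (algebraMap R S)) n :=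
  (Pd.baseChange S h).congr
    (Algebra.TensorProduct.quotIdealMapEquivTensorQuot S J).symm.toLinearEquiv

/-- transport cyclic modules along ring isomorphisms -/
theorem Pd.equiv_ideal {R S : Type u} [CommRing R] [CommRing S] (e : R ≃+* S)
    (J : Ideal R) {n : ℕ} (h : Pd R (R ⧸ J) n) : Pd S (S ⧸ J.map (e : R →+* S)) n := by
  let _ : Algebra R S := e.toRingHom.toAlgebra
  have hf : Module.Free R S := free_of_ringEquiv e
  exact Pd.map_ideal J h

theorem Pd.congr_ideal {R : Type u} [CommRing R] {I J : Ideal R} (h : I = J) {n : ℕ}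
    (hI : Pd R (R ⧸ I) n) : Pd R (R ⧸ J) n := h ▸ hI

/-- The sequence `0 → R/(J:q) → R/J → R/(J+q) → 0`. -/
theorem Pd.colon {R : Type u} [CommRing R] (J K : Ideal R) (q : R) {n : ℕ}
    (hK : ∀ a, a ∈ K ↔ q * a ∈ J) (hJ : Pd R (R ⧸ J) (n + 1)) (hc : Pd R (R ⧸ K) n) :
    Pd R (R ⧸ (J ⊔ Ideal.span {q})) (n + 1) := by
  let f : (R ⧸ K) →ₗ[R] (R ⧸ J) := Submodule.mapQ K J (LinearMap.mulLeft R q)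
    (fun a ha => (hK a).1 ha)
  let g : (R ⧸ J) →ₗ[R] (R ⧸ (J ⊔ Ideal.span {q})) := Submodule.factor le_sup_left
  refine Pd.three f g ?_ (Submodule.factor_surjective _) ?_ hc hJ
  · rw [injective_iff_map_eq_zero]
    intro a ha
    obtain ⟨a, rfl⟩ := Submodule.Quotient.mk_surjective _ a
    have h1 : (Submodule.Quotient.mk (q * a) : R ⧸ J) = 0 := ha
    rw [Submodule.Quotient.mk_eq_zero] at h1 ⊢
    exact (hK a).2 h1
  · intro b
    obtain ⟨b, rfl⟩ := Submodule.Quotient.mk_surjective _ b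
    have h1 : g (Submodule.Quotient.mk b) = Submodule.Quotient.mk b := rfl
    rw [h1, Submodule.Quotient.mk_eq_zero]
    constructor
    · intro hb
      obtain ⟨j, hj, t, ht, rfl⟩ := Submodule.mem_sup.1 hb
      obtain ⟨a, rfl⟩ := Ideal.mem_span_singleton'.1 ht
      refine ⟨Submodule.Quotient.mk a, ?_⟩
      change (Submodule.Quotient.mk (q * a) : R ⧸ J) = _
      rw [Submodule.Quotient.eq]
      have : q * a - (j + a * q) = - j := by ring
      rw [this]
      exact neg_mem hj
    · rintro ⟨a, ha⟩
      obtain ⟨a, rfl⟩ := Submodule.Quotient.mk_surjective _ a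
      have h2 : (Submodule.Quotient.mk (q * a) : R ⧸ J) = Submodule.Quotient.mk b := ha
      rw [Submodule.Quotient.eq] at h2
      have : b = -(q * a - b) + a * q := by ring
      rw [this]
      exact add_mem (neg_mem (Submodule.mem_sup_left h2))
        (Submodule.mem_sup_right (Ideal.mem_span_singleton'.2 ⟨a, rfl⟩))

theorem Pd.regular {R : Type u} [CommRing R] (J : Ideal R) (q : R) {n : ℕ}
    (hq : ∀ a, q * a ∈ J → a ∈ J) (hJ : Pd R (R ⧸ J) n) :
    Pd R (R ⧸ (J ⊔ Ideal.span {q})) (n + 1) :=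
  Pd.colon J J q (fun a => ⟨fun h => J.mul_mem_left q h, hq a⟩) (hJ.mono n.le_succ) hJ

theorem Pd.bot {R : Type u} [CommRing R] {n : ℕ} : Pd R (R ⧸ (⊥ : Ideal R)) n :=
  (Pd.of_projective (A := R)).congr (Submodule.quotEquivOfEqBot ⊥ rfl).symm
end

section
open MvPolynomial

/-- linear forms -/
abbrev LinF (σ : Type) (k : Type u) [Field k] : Submodule k (MvPolynomial σ k) :=
  homogeneousSubmodule σ k 1

/-- quadrics -/
abbrev QuadF (σ : Type) (k : Type u) [Field k] : Submodule k (MvPolynomial σ k) :=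
  homogeneousSubmodule σ k 2

section
variable {k : Type u} [Field k] {σ τ ρ ι : Type}

theorem X_mem_LinF (i : σ) : (X i : MvPolynomial σ k) ∈ LinF σ k := isHomogeneous_X _ _

theorem LinF_eq_span : LinF σ k = Submodule.span k (Set.range X) := homogeneousSubmodule_one_eq_span_X

theorem QuadF_eq : QuadF σ k = LinF σ k * LinF σ k := by
  rw [← pow_two, homogeneousSubmodule_one_pow]

/-- A basis of linear forms gives new coordinates. -/
theorem exists_coord_of_basis (b : Module.Basis ι k (LinF σ k)) :
    ∃ e : MvPolynomial ι k ≃ₐ[k] MvPolynomial σ k, ∀ i, e (X i) = (b i : MvPolynomial σ k) := by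
  let A : MvPolynomial ι k →ₐ[k] MvPolynomial σ k := aeval (fun i => (b i : MvPolynomial σ k))
  let g : LinF σ k →ₗ[k] MvPolynomial ι k := b.constr k (fun i => X i)
  let B : MvPolynomial σ k →ₐ[k] MvPolynomial ι k := aeval (fun i => g ⟨X i, X_mem_LinF i⟩)
  have hBg : ∀ (p : MvPolynomial σ k) (hp : p ∈ LinF σ k), B p = g ⟨p, hp⟩ := by
    intro p hp
    have hp' := hp
    rw [LinF_eq_span] at hp'
    induction hp' using Submodule.span_induction with
    | mem x h =>
      obtain ⟨i, rfl⟩ := h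
      simp [B]
    | zero => rw [map_zero]; exact (map_zero g).symm
    | add x y hx hy h1 h2 =>
      rw [← LinF_eq_span] at hx hy
      rw [map_add, h1 hx, h2 hy, ← map_add]; rfl
    | smul a x hx h =>
      rw [← LinF_eq_span] at hx
      rw [map_smul, h hx, ← map_smul]; rfl
  have hAg : ∀ v : LinF σ k, A (g v) = v := by
    intro v
    have : A.toLinearMap ∘ₗ g = (LinF σ k).subtype := b.ext fun i => by simp [g, A]
    exact LinearMap.congr_fun this v
  refine ⟨AlgEquiv.ofAlgHom A B ?_ ?_, fun i => by simp [A]⟩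
  · ext i : 1
    simp only [AlgHom.comp_apply, AlgHom.id_apply]
    rw [show B (X i) = g ⟨X i, X_mem_LinF i⟩ by simp [B], hAg]
  · ext i : 1
    simp only [AlgHom.comp_apply, AlgHom.id_apply]
    rw [show A (X i) = b i by simp [A], hBg _ (b i).2]
    simp [g]

instance [Finite σ] (n : ℕ) : Module.Finite k (homogeneousSubmodule σ k n) :=
  Module.Finite.iff_fg.2 (homogeneousSubmodule_fg _ _ n)

theorem finrank_LinF [Fintype σ] : Module.finrank k (LinF σ k) = Fintype.card σ := by
  have hli : LinearIndependent k (X : σ → MvPolynomial σ k) := linearIndependent_X σ k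
  have h : LinF σ k = Submodule.span k (Set.range X) := LinF_eq_span
  rw [h, finrank_span_eq_card hli]

/-- Linearly independent linear forms extend to coordinates. -/
theorem exists_coord [Finite σ] [Finite τ] (u : τ → MvPolynomial σ k) (hu : ∀ i, u i ∈ LinF σ k)
    (hli : LinearIndependent k u) : ∃ (m : ℕ) (e : MvPolynomial (Fin m ⊕ τ) k ≃ₐ[k] MvPolynomial σ k),
      Nat.card σ = m + Nat.card τ ∧ (∀ i, e (X (Sum.inr i)) = u i) ∧
      (∀ i, e (X i) ∈ LinF σ k) := by
  have := Fintype.ofFinite σ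
  have := Fintype.ofFinite τ
  let v : τ → LinF σ k := fun i => ⟨u i, hu i⟩
  have hv : LinearIndependent k v := LinearIndependent.of_comp (LinF σ k).subtype hli
  let b := Module.Basis.sumExtend hv
  have hfin : Finite (τ ⊕ Module.Basis.sumExtendIndex hv) := Module.Finite.finite_basis b
  have hfin2 : Finite (Module.Basis.sumExtendIndex hv) :=
    Finite.of_injective (Sum.inr : _ → τ ⊕ Module.Basis.sumExtendIndex hv) Sum.inr_injective
  have := Fintype.ofFinite (Module.Basis.sumExtendIndex hv)
  let m := Fintype.card (Module.Basis.sumExtendIndex hv)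
  let b' : Module.Basis (Fin m ⊕ τ) k (LinF σ k) := b.reindex
    ((Equiv.sumComm _ _).trans (Equiv.sumCongr (Fintype.equivFin _) (Equiv.refl _)))
  obtain ⟨e, he⟩ := exists_coord_of_basis b'
  refine ⟨m, e, ?_, fun i => ?_, fun i => ?_⟩
  · have h1 := Module.finrank_eq_card_basis b'
    rw [finrank_LinF] at h1
    rw [Nat.card_eq_fintype_card, Nat.card_eq_fintype_card, h1, Fintype.card_sum, Fintype.card_fin]
  · rw [he]
    have : b' (Sum.inr i) = v i := by
      simp only [b', b, Module.Basis.reindex_apply]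
      simp [Module.Basis.sumExtend]
      rfl
    rw [this]
  · rw [he]; exact (b' i).2

theorem coord_hom (e : MvPolynomial ι k →ₐ[k] MvPolynomial σ k) (h : ∀ i, e (X i) ∈ LinF σ k)
    {p : MvPolynomial ι k} {n : ℕ} (hp : p.IsHomogeneous n) : (e p).IsHomogeneous n := by
  have : e = aeval (fun i => e (X i)) := by ext; simp
  rw [this, ← one_mul n]
  exact hp.aeval _ h

/-- Extension of ideals from a smaller polynomial ring. -/
theorem pd_ext {D : ℕ} (J : Ideal (MvPolynomial τ k)) (hJ : PdI J D)
    (e : MvPolynomial (ρ ⊕ τ) k ≃ₐ[k] MvPolynomial σ k)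
    (φ : MvPolynomial τ k →ₐ[k] MvPolynomial σ k) (hφ : ∀ i, φ (X i) = e (X (Sum.inr i))) :
    PdI (J.map φ) D := by
  have h1 := Pd.map_ideal (S := MvPolynomial ρ (MvPolynomial τ k)) J hJ
  have h2 := Pd.equiv_ideal ((sumAlgEquiv k ρ τ).symm.trans e).toRingEquiv _ h1
  refine h2.congr_ideal ?_
  rw [Ideal.map_map]
  change _ = J.map (φ : MvPolynomial τ k →+* MvPolynomial σ k)
  congr 1
  apply MvPolynomial.ringHom_ext
  · intro a
    change e ((sumAlgEquiv k ρ τ).symm (C (C a))) = φ (C a)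
    simp
    exact e.commutes a
  · intro i
    change e ((sumAlgEquiv k ρ τ).symm (C (X i))) = φ (X i)
    simp [hφ]

/-- basis of a subspace of linear forms as a family indexed by `Fin D` -/
theorem exists_fin_basis [Finite σ] (U : Submodule k (MvPolynomial σ k)) (hU : U ≤ LinF σ k) :
    ∃ u : Fin (Module.finrank k U) → MvPolynomial σ k, LinearIndependent k u ∧
      Submodule.span k (Set.range u) = U ∧ ∀ i, u i ∈ U := by
  have : Module.Finite k U := Submodule.finiteDimensional_of_le hU
  let b := Module.finBasis k U
  refine ⟨fun i => b i, ?_, ?_, fun i => (b i).2⟩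
  · exact b.linearIndependent.map' U.subtype (Submodule.ker_subtype U)
  · have : Set.range (fun i => (b i : MvPolynomial σ k)) = U.subtype '' Set.range b := by
      rw [← Set.range_comp]; rfl
    rw [this, Submodule.span_image, b.span_eq, Submodule.map_subtype_top]

/-- VARS -/
theorem pd_vars [Finite σ] (U : Submodule k (MvPolynomial σ k)) (hU : U ≤ LinF σ k) {D : ℕ}
    (hD : Module.finrank k U ≤ D) (s : Set (MvPolynomial σ k))
    (hs : s ⊆ Algebra.adjoin k (U : Set (MvPolynomial σ k))) :
    PdI (Ideal.span s) D := by
  obtain ⟨u, hli, hsp, hmem⟩ := exists_fin_basis U hU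
  obtain ⟨m, e, -, he, -⟩ := exists_coord u (fun i => hU (hmem i)) hli
  let φ : MvPolynomial (Fin (Module.finrank k U)) k →ₐ[k] MvPolynomial σ k := aeval u
  have hφ : Algebra.adjoin k (U : Set (MvPolynomial σ k)) ≤ φ.range := by
    refine Algebra.adjoin_le ?_
    intro x hx
    rw [← hsp] at hx
    have : Submodule.span k (Set.range u) ≤ Subalgebra.toSubmodule φ.range := by
      rw [Submodule.span_le]
      rintro _ ⟨i, rfl⟩
      exact ⟨X i, by simp [φ]⟩
    exact this hx
  have h := pd_ext (Ideal.span (φ ⁻¹' s)) (syzygy k _ (D := D) (by simpa using hD) _) e φ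
    (fun i => by rw [he]; simp [φ])
  refine h.congr_ideal ?_
  rw [Ideal.map_span, Set.image_preimage_eq_of_subset]
  intro x hx
  exact hφ (hs hx)

end
end

section
open MvPolynomial

theorem mccoy_aux {R : Type u} [CommRing R] {ρ : Type} (mo : MonomialOrder ρ)
    (E : Ideal R) (f : MvPolynomial ρ R) : ∀ g : MvPolynomial ρ R, g ≠ 0 → (∀ m, coeff m g ∈ E) →
    f * g = 0 → ∃ b ∈ E, b ≠ 0 ∧ ∀ m, coeff m f * b = 0 := by
  classical
  intro g
  induction hd : mo.toSyn (mo.degree g) using WellFoundedLT.induction generalizing g with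
  | ind d ih =>
  subst hd
  intro hg hE hfg
  by_cases hall : ∀ m, C (coeff m f) * g = 0
  · refine ⟨mo.leadingCoeff g, hE _, mo.leadingCoeff_ne_zero_iff.2 hg, fun m => ?_⟩
    have := congrArg (coeff (mo.degree g)) (hall m)
    rw [coeff_C_mul, coeff_zero] at this
    exact this
  · push Not at hall
    obtain ⟨m0, hm0⟩ := hall
    let s := f.support.filter (fun m => C (coeff m f) * g ≠ 0)
    have hs : s.Nonempty := ⟨m0, by
      simp only [s, Finset.mem_filter, mem_support_iff]
      exact ⟨fun h => hm0 (by simp [h]), hm0⟩⟩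
    obtain ⟨m, hms, hmax⟩ := s.exists_max_image mo.toSyn hs
    have hm : C (coeff m f) * g ≠ 0 := (Finset.mem_filter.1 hms).2
    have hgt : ∀ i, mo.toSyn m < mo.toSyn i → C (coeff i f) * g = 0 := by
      intro i hi
      by_contra hne
      have : i ∈ s := by
        simp only [s, Finset.mem_filter, mem_support_iff]
        exact ⟨fun h => hne (by simp [h]), hne⟩
      exact absurd (hmax i this) (not_le.2 hi)
    have hz : coeff m f * mo.leadingCoeff g = 0 := by
      have h1 := congrArg (coeff (m + mo.degree g)) hfg
      rw [coeff_mul, coeff_zero, Finset.sum_eq_single (m, mo.degree g)] at h1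
      · exact h1
      · rintro ⟨i, j⟩ hij hne
        rw [Finset.HasAntidiagonal.mem_antidiagonal] at hij
        dsimp only at hij ⊢
        rcases lt_trichotomy (mo.toSyn m) (mo.toSyn i) with h | h | h
        · have := congrArg (coeff j) (hgt i h)
          rwa [coeff_C_mul, coeff_zero] at this
        · exfalso
          have him : m = i := mo.toSyn.injective h
          subst him
          exact hne (by rw [add_left_cancel hij])
        · have : mo.toSyn (mo.degree g) < mo.toSyn j := by
            have h2 := congrArg mo.toSyn hij
            rw [map_add, map_add] at h2
            by_contra hle
            push Not at hle
            have := add_lt_add_of_lt_of_le h hle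
            rw [h2] at this
            exact lt_irrefl _ this
          rw [mo.coeff_eq_zero_of_lt this, mul_zero]
      · intro h
        exact (h (by rw [Finset.HasAntidiagonal.mem_antidiagonal])).elim
    refine ih (mo.toSyn (mo.degree (C (coeff m f) * g))) ?_ _ rfl hm ?_ ?_
    · refine lt_of_le_of_ne ?_ ?_
      · rw [mo.degree_le_iff]
        intro c hc
        rw [mem_support_iff, coeff_C_mul] at hc
        exact mo.le_degree (mem_support_iff.2 (right_ne_zero_of_mul hc))
      · intro h
        have h2 := mo.toSyn.injective h
        have h3 := mo.leadingCoeff_ne_zero_iff.2 hm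
        rw [MonomialOrder.leadingCoeff, h2, coeff_C_mul] at h3
        exact h3 hz
    · intro c
      rw [coeff_C_mul]
      exact E.mul_mem_left _ (hE c)
    · rw [mul_left_comm, hfg, mul_zero]

/-- The McCoy theorem modulo an ideal. -/
theorem mccoy {R : Type u} [CommRing R] {t : ℕ} (J E : Ideal R) (f g : MvPolynomial (Fin t) R)
    (hg : g ∉ J.map (C : R →+* MvPolynomial (Fin t) R)) (hE : ∀ m, coeff m g ∈ E)
    (hfg : f * g ∈ J.map (C : R →+* MvPolynomial (Fin t) R)) :
    ∃ b ∈ E, b ∉ J ∧ ∀ m, coeff m f * b ∈ J := by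
  have hmem : ∀ p : MvPolynomial (Fin t) R, p ∈ J.map (C : R →+* MvPolynomial (Fin t) R) ↔
      map (Ideal.Quotient.mk J) p = 0 := by
    intro p
    rw [mem_map_C_iff, MvPolynomial.ext_iff]
    refine forall_congr' fun m => ?_
    rw [coeff_map, coeff_zero, Ideal.Quotient.eq_zero_iff_mem]
  rw [hmem] at hg hfg
  rw [map_mul] at hfg
  obtain ⟨b, hbE, hb0, hb⟩ := mccoy_aux MonomialOrder.degLex (E.map (Ideal.Quotient.mk J))
    (map (Ideal.Quotient.mk J) f) (map (Ideal.Quotient.mk J) g) hg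
    (fun m => by rw [coeff_map]; exact Ideal.mem_map_of_mem _ (hE m)) hfg
  obtain ⟨b, hb1, rfl⟩ := (Ideal.mem_map_iff_of_surjective _ Ideal.Quotient.mk_surjective).1 hbE
  refine ⟨b, hb1, fun h => hb0 (Ideal.Quotient.eq_zero_iff_mem.2 h), fun m => ?_⟩
  have := hb m
  rwa [coeff_map, ← map_mul, Ideal.Quotient.eq_zero_iff_mem] at this

section
variable {k : Type u} [Field k] {σ : Type}

/-- tower coordinates relative to a space of linear forms -/
theorem exists_tower [Finite σ] (U : Submodule k (MvPolynomial σ k)) (hU : U ≤ LinF σ k) :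
    ∃ (t D : ℕ) (Φ : MvPolynomial (Fin t) (MvPolynomial (Fin D) k) ≃ₐ[k] MvPolynomial σ k),
      D = Module.finrank k U ∧ Nat.card σ = t + D ∧
      (∀ j, Φ (X j) ∈ LinF σ k) ∧ (∀ i, Φ (C (X i)) ∈ U) ∧
      Submodule.span k (Set.range fun i => Φ (C (X i))) = U ∧
      Submodule.span k (Set.range fun j => Φ (X j)) ⊔ U = LinF σ k := by
  obtain ⟨u, hli, hsp, hmem⟩ := exists_fin_basis U hU
  obtain ⟨m, e, hc, he, heL⟩ := exists_coord u (fun i => hU (hmem i)) hli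
  let Φ := (sumAlgEquiv k (Fin m) (Fin (Module.finrank k U))).symm.trans e
  have h1 : ∀ j, Φ (X j) = e (X (Sum.inl j)) := fun j => by simp [Φ]
  have h2 : ∀ i, Φ (C (X i)) = u i := fun i => by simp [Φ, he]
  refine ⟨m, _, Φ, rfl, by simpa using hc, fun j => by rw [h1]; exact heL _,
    fun i => by rw [h2]; exact hmem i, by simp only [h2, hsp], ?_⟩
  apply le_antisymm
  · refine sup_le (Submodule.span_le.2 ?_) hU
    rintro _ ⟨j, rfl⟩
    dsimp only
    rw [h1]; exact heL _
  · intro p hp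
    have hq : e.symm p ∈ LinF (Fin m ⊕ Fin (Module.finrank k U)) k := by
      have hspan : LinF σ k = (LinF (Fin m ⊕ Fin (Module.finrank k U)) k).map e.toLinearMap := by
        have : Module.Finite k (LinF σ k) := inferInstance
        symm
        apply Submodule.eq_of_le_of_finrank_eq
        · rintro _ ⟨x, hx, rfl⟩
          exact coord_hom e.toAlgHom heL hx
        · have := Fintype.ofFinite σ
          have h3 := (LinF (Fin m ⊕ Fin (Module.finrank k U)) k).equivMapOfInjective
            e.toLinearMap e.injective
          rw [← h3.finrank_eq, finrank_LinF, finrank_LinF, Fintype.card_sum, Fintype.card_fin,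
            Fintype.card_fin, ← Nat.card_eq_fintype_card (α := σ), hc]
          simp
      rw [hspan] at hp
      obtain ⟨x, hx, rfl⟩ := hp
      simpa using hx
    rw [LinF_eq_span] at hq
    rw [← e.apply_symm_apply p]
    have : Submodule.span k (Set.range X) ≤
        (Submodule.span k (Set.range fun j => Φ (X j)) ⊔ U).comap e.toLinearMap := by
      rw [Submodule.span_le]
      rintro _ ⟨i | i, rfl⟩
      · refine Submodule.mem_sup_left (Submodule.subset_span ⟨i, ?_⟩)
        exact h1 i
      · refine Submodule.mem_sup_right ?_
        change e (X (Sum.inr i)) ∈ U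
        rw [he]; exact hmem i
    exact this hq

/-- product of a spanned submodule with another -/
theorem mem_span_mul {A : Type u} [CommRing A] [Algebra k A] {t : ℕ} (z : Fin t → A)
    (U : Submodule k A) {p : A} (hp : p ∈ Submodule.span k (Set.range z) * U) :
    ∃ l : Fin t → A, (∀ j, l j ∈ U) ∧ p = ∑ j, z j * l j := by
  induction hp using Submodule.mul_induction_on' with
  | mem_mul_mem a ha b hb =>
    obtain ⟨c, rfl⟩ := (Submodule.mem_span_range_iff_exists_fun k).1 ha
    refine ⟨fun j => c j • b, fun j => U.smul_mem _ hb, ?_⟩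
    rw [Finset.sum_mul]
    refine Finset.sum_congr rfl fun j _ => ?_
    rw [smul_mul_assoc, mul_smul_comm]
  | add x hx y hy h1 h2 =>
    obtain ⟨l, hl, rfl⟩ := h1
    obtain ⟨l', hl', rfl⟩ := h2
    refine ⟨fun j => l j + l' j, fun j => U.add_mem (hl j) (hl' j), ?_⟩
    simp only [mul_add, Finset.sum_add_distrib]

end
end

section
open MvPolynomial

section
variable {k : Type u} [Field k] {σ : Type}

/-- decomposition of quadrics in tower coordinates -/
theorem tower_quad {t D : ℕ}
    (Φ : MvPolynomial (Fin t) (MvPolynomial (Fin D) k) ≃ₐ[k] MvPolynomial σ k)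
    (U : Submodule k (MvPolynomial σ k))
    (hU : Submodule.span k (Set.range fun i => Φ (C (X i))) = U)
    (hL : Submodule.span k (Set.range fun j => Φ (X j)) ⊔ U = LinF σ k)
    {q : MvPolynomial σ k} (hq : q ∈ QuadF σ k) :
    ∃ (q2 : MvPolynomial (Fin t) k) (l : Fin t → MvPolynomial (Fin D) k)
      (q0 : MvPolynomial (Fin D) k), q2 ∈ QuadF (Fin t) k ∧ (∀ j, l j ∈ LinF (Fin D) k) ∧
      q0 ∈ QuadF (Fin D) k ∧
      Φ.symm q = map (algebraMap k (MvPolynomial (Fin D) k)) q2 + ∑ j, X j * C (l j) + C q0 := by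
  let α : MvPolynomial (Fin t) k →ₐ[k] MvPolynomial σ k :=
    Φ.toAlgHom.comp (mapAlgHom (Algebra.ofId k (MvPolynomial (Fin D) k)))
  let β : MvPolynomial (Fin D) k →ₐ[k] MvPolynomial σ k :=
    Φ.toAlgHom.comp (IsScalarTower.toAlgHom k (MvPolynomial (Fin D) k) _)
  have hβ : ∀ p, β p = Φ (C p) := fun p => rfl
  have hα : ∀ p, α p = Φ (map (algebraMap k (MvPolynomial (Fin D) k)) p) := fun p => rfl
  have hZ : Submodule.span k (Set.range fun j => Φ (X j)) = (LinF (Fin t) k).map α.toLinearMap := by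
    rw [LinF_eq_span, Submodule.map_span, ← Set.range_comp]
    congr 2
    ext j
    simp [hα]
  have hU' : U = (LinF (Fin D) k).map β.toLinearMap := by
    rw [← hU, LinF_eq_span, Submodule.map_span, ← Set.range_comp]
    rfl
  rw [QuadF_eq, ← hL, Submodule.sup_mul, Submodule.mul_sup, Submodule.mul_sup] at hq
  obtain ⟨a, ha, b, hb, rfl⟩ := Submodule.mem_sup.1 hq
  obtain ⟨a1, ha1, a2, ha2, rfl⟩ := Submodule.mem_sup.1 ha
  obtain ⟨b1, hb1, b2, hb2, rfl⟩ := Submodule.mem_sup.1 hb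
  rw [hZ, ← Submodule.map_mul, ← QuadF_eq] at ha1
  rw [hU', ← Submodule.map_mul, ← QuadF_eq] at hb2
  rw [mul_comm] at hb1
  obtain ⟨l1, hl1, rfl⟩ := mem_span_mul _ _ ha2
  obtain ⟨l2, hl2, rfl⟩ := mem_span_mul _ _ hb1
  obtain ⟨q2, hq2, rfl⟩ := ha1
  obtain ⟨q0, hq0, rfl⟩ := hb2
  rw [hU'] at hl1 hl2
  choose m1 hm1 hm1' using hl1
  choose m2 hm2 hm2' using hl2
  refine ⟨q2, fun j => m1 j + m2 j, q0, hq2, fun j => add_mem (hm1 j) (hm2 j), hq0, ?_⟩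
  rw [AlgEquiv.symm_apply_eq]
  simp only [map_add, map_sum, map_mul, mul_add, Finset.sum_add_distrib, ← hm1', ← hm2']
  simp only [AlgHom.toLinearMap_apply, hα, hβ]
  ring

theorem span_eq_tower {t D : ℕ}
    (Φ : MvPolynomial (Fin t) (MvPolynomial (Fin D) k) ≃ₐ[k] MvPolynomial σ k)
    (U : Submodule k (MvPolynomial σ k))
    (hU : Submodule.span k (Set.range fun i => Φ (C (X i))) = U)
    (s : Set (MvPolynomial σ k))
    (hs : s ⊆ Algebra.adjoin k (U : Set (MvPolynomial σ k))) :
    ∃ J : Ideal (MvPolynomial (Fin D) k),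
      (∀ p, p ∈ Ideal.span s ↔ Φ.symm p ∈ J.map (C : _ →+* MvPolynomial (Fin t) (MvPolynomial (Fin D) k))) ∧
      (∀ a, a ∈ J ↔ Φ (C a) ∈ Ideal.span s) := by
  let β : MvPolynomial (Fin D) k →ₐ[k] MvPolynomial σ k :=
    Φ.toAlgHom.comp (IsScalarTower.toAlgHom k (MvPolynomial (Fin D) k) _)
  have hβ : ∀ p, β p = Φ (C p) := fun p => rfl
  have hr : Algebra.adjoin k (U : Set (MvPolynomial σ k)) ≤ β.range := by
    refine Algebra.adjoin_le ?_
    intro x hx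
    rw [← hU] at hx
    have : Submodule.span k (Set.range fun i => Φ (C (X i))) ≤ Subalgebra.toSubmodule β.range := by
      rw [Submodule.span_le]
      rintro _ ⟨i, rfl⟩
      exact ⟨X i, rfl⟩
    exact this hx
  have h1 : ∀ p, p ∈ Ideal.span s ↔ Φ.symm p ∈ (Ideal.span (β ⁻¹' s)).map
      (C : _ →+* MvPolynomial (Fin t) (MvPolynomial (Fin D) k)) := by
    intro p
    constructor
    · intro hp
      have : Ideal.span s ≤ ((Ideal.span (β ⁻¹' s)).map
          (C : _ →+* MvPolynomial (Fin t) (MvPolynomial (Fin D) k))).comap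
            (Φ.symm : MvPolynomial σ k →+* _) := by
        rw [Ideal.span_le]
        intro x hx
        obtain ⟨a, rfl⟩ := hr (hs hx)
        change Φ.symm (β a) ∈ Ideal.map _ _
        rw [hβ, AlgEquiv.symm_apply_apply]
        exact Ideal.mem_map_of_mem _ (Ideal.subset_span hx)
      exact this hp
    · intro hp
      have : (Ideal.span (β ⁻¹' s)).map
          (C : _ →+* MvPolynomial (Fin t) (MvPolynomial (Fin D) k)) ≤ (Ideal.span s).comap
            (Φ : _ →+* MvPolynomial σ k) := by
        rw [Ideal.map_le_iff_le_comap, Ideal.span_le]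
        intro x hx
        exact Ideal.subset_span hx
      have h3 : Φ (Φ.symm p) ∈ Ideal.span s := this hp
      rwa [AlgEquiv.apply_symm_apply] at h3
  refine ⟨_, h1, fun a => ?_⟩
  rw [h1, AlgEquiv.symm_apply_apply, mem_map_C_iff]
  constructor
  · intro h m
    rw [coeff_C]
    split_ifs
    · exact h
    · exact zero_mem _
  · intro h
    simpa using h 0

/-- T4 -/
theorem pd_pure_quad [Finite σ] (U : Submodule k (MvPolynomial σ k)) (hU : U ≤ LinF σ k) {D : ℕ}
    (hD : Module.finrank k U ≤ D) (s : Set (MvPolynomial σ k))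
    (hs : s ⊆ Algebra.adjoin k (U : Set (MvPolynomial σ k)))
    (q : MvPolynomial σ k) (hq : q ∈ QuadF σ k) (hqU : q ∉ Ideal.span (U : Set (MvPolynomial σ k))) :
    PdI (Ideal.span s ⊔ Ideal.span {q}) (D + 1) := by
  refine Pd.regular _ _ ?_ (pd_vars U hU hD s hs)
  intro a ha
  obtain ⟨t, D', Φ, -, -, hzL, huU, husp, hzsp⟩ := exists_tower U hU
  obtain ⟨J, hJ1, hJ2⟩ := span_eq_tower Φ U husp s hs
  by_contra hna
  rw [hJ1] at ha hna
  rw [map_mul] at ha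
  obtain ⟨b, -, hb, hbm⟩ := mccoy J ⊤ _ _ hna (fun m => trivial) ha
  obtain ⟨q2, l, q0, hq2, hl, hq0, hdec⟩ := tower_quad Φ U husp hzsp hq
  have hlin : ∀ p ∈ LinF (Fin D') k, Φ (C p) ∈ U := by
    intro p hp
    rw [LinF_eq_span] at hp
    have : Submodule.span k (Set.range X) ≤ U.comap (Φ.toAlgHom.comp
      (IsScalarTower.toAlgHom k (MvPolynomial (Fin D') k) _)).toLinearMap := by
      rw [Submodule.span_le]
      rintro _ ⟨i, rfl⟩
      exact huU i
    exact this hp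
  have hquad : ∀ p ∈ QuadF (Fin D') k, Φ (C p) ∈ Ideal.span (U : Set (MvPolynomial σ k)) := by
    intro p hp
    rw [QuadF_eq] at hp
    induction hp using Submodule.mul_induction_on' with
    | mem_mul_mem a ha b hb =>
      rw [C_mul, map_mul]
      exact Ideal.mul_mem_left _ _ (Ideal.subset_span (hlin _ hb))
    | add x hx y hy h1 h2 => rw [C_add, map_add]; exact add_mem h1 h2
  have hq2' : q2 ≠ 0 := by
    rintro rfl
    apply hqU
    rw [← Φ.apply_symm_apply q, hdec, map_zero, zero_add, map_add, map_sum]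
    refine add_mem (sum_mem fun j _ => ?_) ?_
    · rw [map_mul]
      exact Ideal.mul_mem_left _ _ (Ideal.subset_span (hlin _ (hl j)))
    · exact hquad _ hq0
  obtain ⟨m, hm⟩ := MvPolynomial.ne_zero_iff.1 hq2'
  have hdeg : m.degree = 2 := by
    by_contra h
    exact hm (IsHomogeneous.coeff_eq_zero hq2 h)
  apply hb
  have h1 := hbm m
  have h2 : coeff m (Φ.symm q) = C (coeff m q2) := by
    rw [hdec, coeff_add, coeff_add, coeff_map, coeff_sum, coeff_C, Finset.sum_eq_zero, add_zero,
      if_neg, add_zero]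
    · rfl
    · rintro rfl
      simp at hdeg
    · intro j _
      rw [mul_comm, coeff_C_mul, coeff_X, if_neg, mul_zero]
      rintro rfl
      simp at hdeg
  rw [h2] at h1
  have h3 := J.mul_mem_left (C (coeff m q2)⁻¹) h1
  rwa [← mul_assoc, ← C_mul, inv_mul_cancel₀ hm, C_1, one_mul] at h3

end
end

section
open MvPolynomial

section
variable {k K : Type u} [Field k] [Field K] [Algebra k K] {σ : Type}

attribute [local instance] MvPolynomial.algebraMvPolynomial

/-- coefficientwise application of a functional -/
noncomputable def coeffwise (l : K →ₗ[k] k) : MvPolynomial σ K →ₗ[MvPolynomial σ k] MvPolynomial σ k where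
  toFun p := ∑ d ∈ p.support, monomial d (l (coeff d p))
  map_add' p q := by
    classical
    have h : ∀ (p : MvPolynomial σ K) d,
        coeff d (∑ d ∈ p.support, monomial d (l (coeff d p))) = l (coeff d p) := by
      intro p d
      rw [coeff_sum]
      simp only [coeff_monomial]
      rw [Finset.sum_ite_eq']
      split_ifs with h
      · rfl
      · rw [notMem_support_iff.1 h, map_zero]
    ext d
    rw [coeff_add, h, h, h, coeff_add, map_add]
  map_smul' f p := by
    classical
    have h : ∀ (p : MvPolynomial σ K) d,
        coeff d (∑ d ∈ p.support, monomial d (l (coeff d p))) = l (coeff d p) := by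
      intro p d
      rw [coeff_sum]
      simp only [coeff_monomial]
      rw [Finset.sum_ite_eq']
      split_ifs with h
      · rfl
      · rw [notMem_support_iff.1 h, map_zero]
    ext d
    rw [h, RingHom.id_apply, smul_eq_mul, Algebra.smul_def, coeff_mul, coeff_mul, map_sum]
    refine Finset.sum_congr rfl fun x _ => ?_
    rw [h]
    change l (coeff x.1 (map (algebraMap k K) f) * _) = _
    rw [coeff_map, ← Algebra.smul_def, map_smul, smul_eq_mul]

theorem coeff_coeffwise (l : K →ₗ[k] k) (p : MvPolynomial σ K) (d : σ →₀ ℕ) :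
    coeff d (coeffwise l p) = l (coeff d p) := by
  classical
  change coeff d (∑ d ∈ p.support, monomial d (l (coeff d p))) = _
  rw [coeff_sum]
  simp only [coeff_monomial]
  rw [Finset.sum_ite_eq']
  split_ifs with h
  · rfl
  · rw [notMem_support_iff.1 h, map_zero]

theorem coeffwise_mul (l : K →ₗ[k] k) (f : MvPolynomial σ k) (p : MvPolynomial σ K) :
    coeffwise l (map (algebraMap k K) f * p) = f * coeffwise l p := by
  have : map (algebraMap k K) f * p = f • p := (Algebra.smul_def f p).symm
  rw [this, map_smul, smul_eq_mul]

theorem pd_descend (I : Ideal (MvPolynomial σ k)) {n : ℕ}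
    (h : PdI (I.map (map (algebraMap k K))) n) : PdI I n := by
  obtain ⟨l, hl⟩ : ∃ l : K →ₗ[k] k, l 1 = 1 := by
    obtain ⟨l, hl⟩ := (Algebra.linearMap k K).exists_leftInverse_of_injective
      (LinearMap.ker_eq_bot.2 (algebraMap k K).injective)
    exact ⟨l, by simpa using LinearMap.congr_fun hl 1⟩
  have hfree : Module.Free (MvPolynomial σ k) (MvPolynomial σ K) :=
    Module.Free.of_equiv (Algebra.IsPushout.equiv k (MvPolynomial σ k) K (MvPolynomial σ K)).toLinearEquiv
  have h1 : Pd (MvPolynomial σ k) (MvPolynomial σ K ⧸ (I.map (map (σ := σ) (algebraMap k K)))) n :=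
    Pd.restrict h
  let J : Submodule (MvPolynomial σ k) (MvPolynomial σ K) :=
    (I.map (map (σ := σ) (algebraMap k K))).restrictScalars (MvPolynomial σ k)
  have hIJ : I ≤ J.comap (Algebra.linearMap (MvPolynomial σ k) (MvPolynomial σ K)) := by
    intro x hx
    exact Ideal.mem_map_of_mem _ hx
  have hJI : J ≤ Submodule.comap (coeffwise l) I := by
    intro x hx
    have hx' : x ∈ I.map (map (σ := σ) (algebraMap k K)) := hx
    have hx'' : x ∈ Submodule.span (MvPolynomial σ K) ((map (σ := σ) (algebraMap k K)) '' I) := hx'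
    change coeffwise l x ∈ I
    clear hx hx'
    induction hx'' using Submodule.span_induction with
    | mem x h =>
      obtain ⟨f, hf, rfl⟩ := h
      rw [← mul_one (map (algebraMap k K) f), coeffwise_mul]
      exact I.mul_mem_right _ hf
    | zero => rw [map_zero]; exact zero_mem _
    | add x y _ _ h1 h2 => rw [map_add]; exact add_mem h1 h2
    | smul a x hx h =>
      revert a
      refine fun a => ?_
      have hx2 : x ∈ Submodule.span (MvPolynomial σ K) ((map (σ := σ) (algebraMap k K)) '' I) := hx
      clear h
      revert a
      induction hx2 using Submodule.span_induction with
      | mem x h =>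
        intro a
        obtain ⟨f, hf, rfl⟩ := h
        rw [smul_eq_mul, mul_comm, coeffwise_mul]
        exact I.mul_mem_right _ hf
      | zero => intro a; rw [smul_zero, map_zero]; exact zero_mem _
      | add x y hx' hy' h1 h2 => intro a; rw [smul_add, map_add]; exact add_mem (h1 hx' a) (h2 hy' a)
      | smul b x hx' h => intro a; rw [smul_smul]; exact h hx' _
  refine Pd.retract (B := MvPolynomial σ K ⧸ (I.map (map (σ := σ) (algebraMap k K))))
    (Submodule.mapQ I J _ hIJ) (Submodule.mapQ J I _ hJI) ?_ h1
  intro a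
  obtain ⟨a, rfl⟩ := Submodule.Quotient.mk_surjective _ a
  change Submodule.Quotient.mk (coeffwise l (map (algebraMap k K) a)) = _
  congr 1
  rw [← mul_one (map (algebraMap k K) a), coeffwise_mul]
  have : coeffwise l (1 : MvPolynomial σ K) = 1 := by
    classical
    ext d
    rw [coeff_coeffwise, coeff_one, coeff_one]
    split_ifs
    · exact hl
    · exact map_zero l
  rw [this, mul_one]

theorem linearIndependent_map {ι : Type} (f : ι → MvPolynomial σ k) (hf : LinearIndependent k f) :
    LinearIndependent K (fun i => map (algebraMap k K) (f i)) := by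
  rw [linearIndependent_iff'] at hf ⊢
  intro s c hc i hi
  rw [← Module.forall_dual_apply_eq_zero_iff k]
  intro l
  refine hf s (fun i => l (c i)) ?_ i hi
  have := congrArg (coeffwise l) hc
  rw [map_sum, map_zero] at this
  rw [← this]
  refine Finset.sum_congr rfl fun j _ => ?_
  ext d
  rw [coeff_coeffwise, coeff_smul, coeff_smul, coeff_map, smul_eq_mul, smul_eq_mul, mul_comm (c j),
    ← Algebra.smul_def, map_smul, smul_eq_mul, mul_comm]

end
end

section
open MvPolynomial

section
variable {k : Type*} {Ω : Type*} [Field k] [Field Ω] [Algebra k Ω]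

/-- transcendence rank of a set -/
noncomputable def rk (k : Type*) {Ω : Type*} [Field k] [Field Ω] [Algebra k Ω] (s : Set Ω) : ℕ∞ :=
  (AlgebraicIndependent.matroid k Ω).eRk s

/-- algebraic over the algebra generated by s -/
def AlgOver (k : Type*) {Ω : Type*} [Field k] [Field Ω] [Algebra k Ω] (s : Set Ω) (a : Ω) : Prop :=
  a ∈ (AlgebraicIndependent.matroid k Ω).closure s

theorem algOver_iff (s : Set Ω) (a : Ω) : AlgOver k s a ↔ IsAlgebraic (Algebra.adjoin k s) a := by
  unfold AlgOver
  rw [AlgebraicIndependent.matroid_closure_eq]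
  exact Subalgebra.mem_algebraicClosure _ _

theorem rk_mono {s t : Set Ω} (h : s ⊆ t) : rk k s ≤ rk k t := Matroid.eRk_mono _ h
theorem rk_union_le (s t : Set Ω) : rk k (s ∪ t) ≤ rk k s + rk k t :=
  Matroid.eRk_union_le_eRk_add_eRk _ _ _
theorem rk_le_encard (s : Set Ω) : rk k s ≤ s.encard := Matroid.eRk_le_encard _ _
theorem rk_union_le_encard (s t : Set Ω) : rk k (s ∪ t) ≤ rk k s + t.encard :=
  (rk_union_le s t).trans (by gcongr; exact rk_le_encard t)

theorem rk_le_of_algOver {s t : Set Ω} (h : ∀ a ∈ t, AlgOver k s a) : rk k t ≤ rk k s := by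
  unfold rk
  rw [← Matroid.eRk_closure_eq _ s]
  exact Matroid.eRk_mono _ h

theorem AlgOver.of_mem {s : Set Ω} {a : Ω} (h : a ∈ s) : AlgOver k s a :=
  Matroid.subset_closure _ s (by simp) h

theorem AlgOver.mono {s t : Set Ω} (h : s ⊆ t) {a : Ω} (ha : AlgOver k s a) : AlgOver k t a :=
  Matroid.closure_subset_closure _ h ha

theorem AlgOver.of_adjoin {s : Set Ω} {a : Ω} (h : a ∈ Algebra.adjoin k s) : AlgOver k s a := by
  rw [algOver_iff]
  exact isAlgebraic_algebraMap (⟨a, h⟩ : Algebra.adjoin k s)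

theorem AlgOver.trans {s t : Set Ω} (h : ∀ a ∈ t, AlgOver k s a) {b : Ω} (hb : AlgOver k t b) :
    AlgOver k s b :=
  Matroid.closure_subset_closure_of_subset_closure h hb

theorem AlgOver.of_field {s : Set Ω} {a : Ω} (h : a ∈ IntermediateField.adjoin k s) :
    AlgOver k s a := by
  rw [algOver_iff]
  rw [IntermediateField.mem_adjoin_iff_div] at h
  obtain ⟨r, hr, q, hq, rfl⟩ := h
  have h1 : IsAlgebraic (Algebra.adjoin k s) r := isAlgebraic_algebraMap (⟨r, hr⟩ : Algebra.adjoin k s)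
  have h2 : IsAlgebraic (Algebra.adjoin k s) q := isAlgebraic_algebraMap (⟨q, hq⟩ : Algebra.adjoin k s)
  rw [div_eq_mul_inv]
  exact h1.mul h2.inv

theorem rk_field_adjoin (s : Set Ω) : rk k (IntermediateField.adjoin k s : Set Ω) = rk k s :=
  le_antisymm (rk_le_of_algOver fun _ h => AlgOver.of_field h)
    (rk_mono (IntermediateField.subset_adjoin k s))

theorem rk_insert_of_not {s : Set Ω} {a : Ω} (h : ¬ AlgOver k s a) :
    rk k (insert a s) = rk k s + 1 :=
  Matroid.eRk_insert_eq_add_one ⟨by simp, h⟩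

theorem rk_insert_of_alg {s : Set Ω} {a : Ω} (h : AlgOver k s a) :
    rk k (insert a s) = rk k s := by
  refine le_antisymm (rk_le_of_algOver ?_) (rk_mono (Set.subset_insert _ _))
  rintro b (rfl | hb)
  exacts [h, .of_mem hb]

theorem algOver_field (F : IntermediateField k Ω) (s : Set Ω) (a : Ω) :
    AlgOver k ((F : Set Ω) ∪ s) a ↔ AlgOver F s a := by
  rw [algOver_iff, algOver_iff]
  have h : (Algebra.adjoin F s).restrictScalars k = Algebra.adjoin k ((F : Set Ω) ∪ s) := by
    apply le_antisymm
    · intro x hx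
      rw [Subalgebra.mem_restrictScalars] at hx
      induction hx using Algebra.adjoin_induction with
      | mem x hx => exact Algebra.subset_adjoin (Or.inr hx)
      | algebraMap r => exact Algebra.subset_adjoin (Or.inl r.2)
      | add x y _ _ hx hy => exact add_mem hx hy
      | mul x y _ _ hx hy => exact mul_mem hx hy
    · refine Algebra.adjoin_le ?_
      rintro x (hx | hx)
      · rw [SetLike.mem_coe, Subalgebra.mem_restrictScalars]
        exact (Algebra.adjoin F s).algebraMap_mem (⟨x, hx⟩ : F)
      · rw [SetLike.mem_coe, Subalgebra.mem_restrictScalars]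
        exact Algebra.subset_adjoin hx
  rw [← h]
  exact Iff.rfl

theorem rk_tower (F : IntermediateField k Ω) (s : Set Ω) (hs : s.Finite) :
    rk k ((F : Set Ω) ∪ s) = rk k (F : Set Ω) + rk F s := by
  induction s, hs using Set.Finite.induction_on with
  | empty => simp [rk]
  | @insert a s ha hs ih =>
    rw [Set.union_insert]
    by_cases h : AlgOver F s a
    · rw [rk_insert_of_alg h, rk_insert_of_alg ((algOver_field F s a).2 h), ih]
    · rw [rk_insert_of_not h, rk_insert_of_not (fun h' => h ((algOver_field F s a).1 h')), ih, add_assoc]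

theorem rk_union_field (s t : Set Ω) (ht : t.Finite) :
    rk k (s ∪ t) = rk k s + rk (IntermediateField.adjoin k s) t := by
  rw [← rk_field_adjoin s, ← rk_tower _ _ ht]
  apply le_antisymm
  · exact rk_mono (Set.union_subset_union_left _ (IntermediateField.subset_adjoin k s))
  · refine rk_le_of_algOver ?_
    rintro a (h | h)
    · exact (AlgOver.of_field h).mono Set.subset_union_left
    · exact .of_mem (Or.inr h)

/-- affine linear rank bound: if all coordinates of p algebraic over `s` and a subset of points -/
theorem rk_le_nat_of_finite (s : Set Ω) (hs : s.Finite) : rk k s ≤ (s.ncard : ℕ) := by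
  refine (rk_le_encard s).trans ?_
  rw [hs.cast_ncard_eq]

end
end

section
open MvPolynomial

section
variable {k : Type*} {Ω : Type*} [Field k] [Field Ω] [Algebra k Ω]

theorem exists_indep {σ : Type*} (p : σ → Ω) {m : ℕ} (h : (m : ℕ∞) ≤ rk k (Set.range p)) :
    ∃ s : Fin m → σ, AlgebraicIndependent k (p ∘ s) := by
  obtain ⟨I, hI, hi, hc⟩ := Matroid.le_eRk_iff.1 h
  have hfin : I.Finite := Set.finite_of_encard_eq_coe hc
  have hn : Nat.card I = m := by
    rw [Nat.card_coe_set_eq]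
    exact_mod_cast (hfin.cast_ncard_eq.trans hc)
  have := hfin.to_subtype
  let e : Fin m ≃ I := (Finite.equivFinOfCardEq hn).symm
  choose f hf using fun i : I => hI i.2
  refine ⟨f ∘ e, ?_⟩
  have h1 : AlgebraicIndependent k (fun i : I => (i : Ω)) := hi
  have : p ∘ f ∘ e = (fun i : I => (i : Ω)) ∘ e := by
    funext i; simp [hf]
  rw [this]
  exact h1.comp e e.injective

theorem rk_range_of_indep {ι : Type*} [Finite ι] (q : ι → Ω) (h : AlgebraicIndependent k q) :
    rk k (Set.range q) = (Nat.card ι : ℕ) := by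
  have h1 : (AlgebraicIndependent.matroid k Ω).Indep (Set.range q) :=
    AlgebraicIndependent.coe_range h
  unfold rk
  rw [h1.eRk_eq_encard]
  rw [← Set.image_univ, h.injective.encard_image, Set.encard_univ, ENat.card_eq_coe_natCard]

theorem indep_of_rk {ι : Type*} [Finite ι] (q : ι → Ω) (h : ((Nat.card ι : ℕ) : ℕ∞) ≤ rk k (Set.range q)) :
    AlgebraicIndependent k q := by
  obtain ⟨s, hs⟩ := exists_indep q h
  have hi : Function.Injective s := (hs.injective).of_comp
  have : Fintype ι := Fintype.ofFinite ι
  have hb : Function.Bijective s := (Fintype.bijective_iff_injective_and_card s).2 ⟨hi, by simp⟩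
  let e := Equiv.ofBijective s hb
  have : q = (q ∘ s) ∘ e.symm := by
    funext i
    simp only [Function.comp]
    congr 1
    exact (e.apply_symm_apply i).symm
  rw [this]
  exact hs.comp _ e.symm.injective

theorem rk_lt_of_rel {ι : Type*} [Finite ι] (q : ι → Ω) (F : MvPolynomial ι k) (hF : F ≠ 0)
    (h : aeval q F = 0) : rk k (Set.range q) + 1 ≤ (Nat.card ι : ℕ) := by
  by_contra hc
  rw [ENat.add_one_le_iff] at hc
  · push Not at hc
    have := indep_of_rk q hc
    exact hF ((algebraicIndependent_iff.1 this) F h)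
  · have := rk_le_encard (k := k) (Set.range q)
    exact ne_top_of_le_ne_top (by simpa using Set.finite_range q) this

theorem drop {B : Type*} [CommRing B] [IsDomain B] [Algebra k B] (φ : B →ₐ[k] Ω) {ι : Type*}
    (y : ι → B) (hy : AlgebraicIndependent k (φ ∘ y)) (b : B) (hb : b ≠ 0) (hφ : φ b = 0) :
    AlgebraicIndependent k (fun o : Option ι => o.elim b y) := by
  have h0 : AlgebraicIndependent k y := AlgebraicIndependent.of_comp φ hy
  rw [h0.option_iff_transcendental]
  intro halg
  obtain ⟨q, hq0, hq⟩ := halg.exists_nonzero_coeff_and_aeval_eq_zero (mem_nonZeroDivisors_of_ne_zero hb)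
  apply hq0
  have h1 : φ (q.coeff 0 : B) = 0 := by
    have := congrArg φ hq
    rw [map_zero] at this
    rw [← this, Polynomial.aeval_eq_sum_range, map_sum, Finset.sum_range_succ', Finset.sum_eq_zero]
    · simp [Subalgebra.smul_def]
    · intro i _
      simp [Subalgebra.smul_def, hφ]
  obtain ⟨F, hF⟩ : ∃ F : MvPolynomial ι k, aeval y F = (q.coeff 0 : B) := by
    exact (Algebra.adjoin_range_eq_range_aeval k y).le (q.coeff 0).2
  rw [← hF] at h1
  have h2 : aeval (φ ∘ y) F = 0 := by
    rw [← h1, ← AlgHom.comp_apply, comp_aeval]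
    rfl
  have h3 := (algebraicIndependent_iff.1 hy) F h2
  rw [h3, map_zero] at hF
  exact Subtype.ext hF.symm

/-- A hypersurface is determined by an irreducible equation. -/
theorem principal_of_rk {σ : Type*} [Finite σ] (p : σ → Ω) (h g : MvPolynomial σ k) (hh : Prime h)
    (hp : aeval p h = 0) (hg : aeval p g = 0) {m : ℕ} (hm : Nat.card σ ≤ m + 1)
    (hr : (m : ℕ∞) ≤ rk k (Set.range p)) : h ∣ g := by
  by_contra hd
  let J := Ideal.span {h}
  have hJ : J.IsPrime := (Ideal.span_singleton_prime hh.ne_zero).2 hh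
  let B := MvPolynomial σ k ⧸ J
  let φ : B →ₐ[k] Ω := Ideal.Quotient.liftₐ J (aeval p) (by
    intro a ha
    obtain ⟨c, rfl⟩ := Ideal.mem_span_singleton.1 ha
    rw [map_mul, hp, zero_mul])
  let Q := FractionRing B
  let x : σ → B := fun i => Ideal.Quotient.mk J (X i)
  let ι : B →ₐ[k] Q := IsScalarTower.toAlgHom k B Q
  have hι : Function.Injective ι := IsFractionRing.injective B Q
  obtain ⟨s, hs⟩ := exists_indep p hr
  let b : B := Ideal.Quotient.mk J g
  have hx : ∀ f : MvPolynomial σ k, aeval x f = Ideal.Quotient.mk J f := fun f => by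
    have : aeval x = Ideal.Quotient.mkₐ k J := by
      apply MvPolynomial.algHom_ext
      intro i
      rw [aeval_X]; rfl
    rw [this]; rfl
  have hb : b ≠ 0 := fun h0 => hd (Ideal.mem_span_singleton.1 (Ideal.Quotient.eq_zero_iff_mem.1 h0))
  have hφb : φ b = 0 := hg
  have hind := drop φ (x ∘ s) (by convert hs using 1; funext i; exact aeval_X p (s i)) b hb hφb
  have hind' := hind.map' (f := ι) hι
  have h1 := rk_range_of_indep _ hind'
  have h2 := rk_lt_of_rel (ι ∘ x) h hh.ne_zero (by
    have : aeval (ι ∘ x) h = ι (aeval x h) := by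
      rw [← AlgHom.comp_apply, comp_aeval]; rfl
    rw [this, hx, Ideal.Quotient.eq_zero_iff_mem.2 (Ideal.mem_span_singleton_self h), map_zero])
  have h3 : rk k (Set.range (ι ∘ fun o : Option (Fin m) => o.elim b (x ∘ s))) ≤ rk k (Set.range (ι ∘ x)) := by
    apply rk_le_of_algOver
    rintro _ ⟨o, rfl⟩
    cases o with
    | some i => exact .of_mem ⟨s i, rfl⟩
    | none =>
      apply AlgOver.of_adjoin
      rw [Algebra.adjoin_range_eq_range_aeval]
      refine ⟨g, ?_⟩
      have : aeval (ι ∘ x) g = ι (aeval x g) := by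
        rw [← AlgHom.comp_apply, comp_aeval]; rfl
      exact this.trans (by rw [hx]; rfl)
  rw [h1] at h3
  have h4 : ((Nat.card (Option (Fin m)) : ℕ) : ℕ∞) + 1 ≤ (Nat.card σ : ℕ) := le_trans (by gcongr) h2
  simp at h4
  norm_cast at h4
  omega

theorem rk_add_one_le_finrank (s : Set Ω) (hs : s.Finite) :
    rk k s + 1 ≤ (Module.finrank k (Submodule.span k (insert 1 s)) : ℕ) := by
  have h1 : LinearIndepOn k id ({1} : Set Ω) := by
    simp
  obtain ⟨t, ht, h1t, hsp, hli⟩ := exists_linearIndepOn_id_extension h1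
    (show ({1} : Set Ω) ⊆ insert 1 s by simp)
  have htf : t.Finite := (hs.insert 1).subset ht
  have hspan : Submodule.span k (insert 1 s) = Submodule.span k t :=
    le_antisymm (Submodule.span_le.2 hsp) (Submodule.span_mono ht)
  rw [hspan]
  have : Fintype t := htf.fintype
  have hc : Module.finrank k (Submodule.span k t) = t.ncard := by
    have := finrank_span_set_eq_card hli
    rw [this, Set.ncard_eq_toFinset_card']
  have h1t' : (1 : Ω) ∈ t := h1t rfl
  have h2 : rk k s ≤ rk k (t \ {1}) := by
    apply rk_le_of_algOver
    intro a ha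
    apply AlgOver.of_adjoin
    have h3 : a ∈ Submodule.span k t := hsp (Or.inr ha)
    have h4 : Submodule.span k t ≤ Subalgebra.toSubmodule (Algebra.adjoin k (t \ {1})) := by
      refine Submodule.span_le.2 fun b hb => ?_
      by_cases hb1 : b = 1
      · subst hb1; exact one_mem (Algebra.adjoin k (t \ {1}))
      · exact Algebra.subset_adjoin ⟨hb, hb1⟩
    exact h4 h3
  rw [hc]
  have h5 := rk_le_nat_of_finite (k := k) (t \ {1}) (htf.sdiff)
  rw [Set.ncard_sdiff_singleton_of_mem h1t'] at h5
  have h6 : 0 < t.ncard := (Set.ncard_pos htf).2 ⟨1, h1t'⟩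
  calc rk k s + 1 ≤ ((t.ncard - 1 : ℕ) : ℕ∞) + 1 := by gcongr; exact h2.trans h5
    _ = (t.ncard : ℕ) := by norm_cast; omega

theorem rk_le_finrank (s : Set Ω) (hs : s.Finite) :
    rk k s ≤ (Module.finrank k (Submodule.span k s) : ℕ) := by
  have h := rk_add_one_le_finrank (k := k) s hs
  have h2 : Module.finrank k (Submodule.span k (insert 1 s)) ≤ Module.finrank k (Submodule.span k s) + 1 := by
    rw [Submodule.span_insert, add_comm]
    have : Module.Finite k (Submodule.span k s) := Module.Finite.span_of_finite k hs
    refine (Submodule.finrank_add_le_finrank_add_finrank _ _).trans ?_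
    gcongr
    exact (finrank_span_le_card {(1 : Ω)}).trans (by simp)
  have h3 : rk k s + 1 ≤ (Module.finrank k (Submodule.span k s) : ℕ) + 1 :=
    h.trans (by exact_mod_cast h2)
  exact (ENat.add_le_add_iff_right (by simp)).1 h3

/-- linear relations bound the rank -/
theorem rk_le_of_linear {σ : Type*} [Finite σ] (p : σ → Ω) {D : ℕ} (u : Fin D → σ → k)
    (hu : LinearIndependent k u) (h : ∀ i, ∑ᶠ j, u i j • p j = 0) :
    rk k (Set.range p) + D ≤ (Nat.card σ : ℕ) := by
  have := Fintype.ofFinite σ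
  let L : (σ → k) →ₗ[k] Ω := Fintype.linearCombination k p
  have hr : LinearMap.range L = Submodule.span k (Set.range p) := Fintype.range_linearCombination k p
  have h1 := L.finrank_range_add_finrank_ker
  rw [hr, Module.finrank_pi] at h1
  have h2 : D ≤ Module.finrank k (LinearMap.ker L) := by
    have h3 : ∀ i, u i ∈ LinearMap.ker L := fun i => by
      rw [LinearMap.mem_ker]
      have := h i
      rw [finsum_eq_sum_of_fintype] at this
      exact this
    have hli : LinearIndependent k (fun i => (⟨u i, h3 i⟩ : LinearMap.ker L)) :=
      LinearIndependent.of_comp (LinearMap.ker L).subtype hu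
    simpa using hli.fintype_card_le_finrank
  have h4 := rk_le_finrank (k := k) (Set.range p) (Set.finite_range p)
  calc rk k (Set.range p) + D ≤ ((Module.finrank k (Submodule.span k (Set.range p)) : ℕ) : ℕ∞) + D := by gcongr
    _ ≤ _ := by rw [Nat.card_eq_fintype_card]; norm_cast; omega

theorem spec [IsAlgClosed k] (T : Set Ω) (hT : T.Finite) : Nonempty (Algebra.adjoin k T →ₐ[k] k) := by
  let R := Algebra.adjoin k T
  have hft : Algebra.FiniteType k R := by
    have := hT.fintype
    exact (Subalgebra.fg_iff_finiteType _).1 ⟨hT.toFinset, by simp [R]⟩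
  obtain ⟨m, hm⟩ := Ideal.exists_maximal R
  let _ : Field (R ⧸ m) := Ideal.Quotient.field m
  have hf : Module.Finite k (R ⧸ m) := finite_of_finite_type_of_isJacobsonRing k (R ⧸ m)
  have hb := IsAlgClosed.algebraMap_bijective_of_isIntegral (k := k) (K := R ⧸ m)
  let e : k ≃ₐ[k] (R ⧸ m) := AlgEquiv.ofBijective (Algebra.ofId k (R ⧸ m)) hb
  exact ⟨e.symm.toAlgHom.comp (Ideal.Quotient.mkₐ k m)⟩

end
end

section
open MvPolynomial

section
open TensorProduct

theorem kaehler_finrank {k L ι : Type*} [Field k] [Field L] [Algebra k L] (v : ι → L)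
    (hv : AlgebraicIndependent k v)
    [Algebra.IsSeparable (IntermediateField.adjoin k (Set.range v)) L] :
    ∃ b : Module.Basis ι L (KaehlerDifferential k L), True := by
  let A := MvPolynomial ι k
  let E := IntermediateField.adjoin k (Set.range v)
  let v' : ι → E := fun i => ⟨v i, IntermediateField.subset_adjoin _ _ ⟨i, rfl⟩⟩
  let i1 : Algebra A E := (aeval v' : A →ₐ[k] E).toRingHom.toAlgebra
  let i2 : Algebra A L := (aeval v : A →ₐ[k] L).toRingHom.toAlgebra
  have hval : ∀ a : A, ((aeval v' a : E) : L) = aeval v a := fun a => by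
    have : (E.val.comp (aeval v') : A →ₐ[k] L) = aeval v := by
      apply MvPolynomial.algHom_ext; intro i; simp [v']
    rw [← this]; rfl
  have : IsScalarTower A E L := IsScalarTower.of_algebraMap_eq (fun a => (hval a).symm)
  have : IsScalarTower k A L := IsScalarTower.of_algebraMap_eq (fun a => ((aeval v : A →ₐ[k] L).commutes a).symm)
  have : FaithfulSMul A E := (faithfulSMul_iff_algebraMap_injective A E).2 (fun a b h => by
    apply hv
    rw [← hval, ← hval]
    exact congrArg _ h)
  have : IsFractionRing A E := IsFractionRing.of_field _ _ (fun z => by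
    obtain ⟨r, s, h⟩ := (IntermediateField.mem_adjoin_range_iff k v z.1).1 z.2
    refine ⟨r, s, Subtype.ext ?_⟩
    rw [h, ← hval, ← hval]
    rfl)
  have : Algebra.FormallyEtale A E := .of_isLocalization (nonZeroDivisors A)
  have : Algebra.FormallyEtale E L := Algebra.FormallyEtale.of_isSeparable _ L
  have : Algebra.FormallyEtale A L := .comp A E L
  let e := KaehlerDifferential.tensorKaehlerEquivOfFormallyEtale k A L
  exact ⟨((KaehlerDifferential.mvPolynomialBasis k ι).baseChange L).map e, trivial⟩

end

section
variable {k : Type*} {Ω : Type*} [Field k] [Field Ω] [Algebra k Ω]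

theorem span_D_top {k L σ : Type*} [Field k] [Field L] [Algebra k L] (p : σ → L)
    (hp : IntermediateField.adjoin k (Set.range p) = ⊤) :
    Submodule.span L (Set.range fun i => KaehlerDifferential.D k L (p i)) = ⊤ := by
  rw [eq_top_iff, ← KaehlerDifferential.span_range_derivation, Submodule.span_le]
  rintro _ ⟨x, rfl⟩
  have hx : x ∈ IntermediateField.adjoin k (Set.range p) := hp ▸ IntermediateField.mem_top
  induction hx using IntermediateField.adjoin_induction with
  | mem x hx => obtain ⟨i, rfl⟩ := hx; exact Submodule.subset_span ⟨i, rfl⟩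
  | algebraMap x => simp
  | add x y _ _ hx hy => rw [map_add]; exact add_mem hx hy
  | inv x _ hx =>
    rw [Derivation.leibniz_inv]
    exact Submodule.smul_mem _ _ hx
  | mul x y _ _ hx hy =>
    rw [Derivation.leibniz]
    exact add_mem (Submodule.smul_mem _ _ hy) (Submodule.smul_mem _ _ hx)

theorem D_aeval {k L σ : Type*} [Field k] [Field L] [Algebra k L] [Fintype σ] (p : σ → L) (f : MvPolynomial σ k) :
    KaehlerDifferential.D k L (aeval p f) =
      ∑ j, aeval p (pderiv j f) • KaehlerDifferential.D k L (p j) := by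
  classical
  induction f using MvPolynomial.induction_on with
  | C a => simp
  | add f g hf hg => simp only [map_add, hf, hg, add_smul, Finset.sum_add_distrib]
  | mul_X f i hf =>
    simp only [map_mul, aeval_X, Derivation.leibniz, hf, map_add, smul_eq_mul, add_smul, Finset.sum_add_distrib,
      Finset.smul_sum, mul_smul]
    congr 1
    rw [Finset.sum_eq_single i]
    · simp
    · intro j _ hj
      simp [pderiv_X, Pi.single_apply, hj]
    · simp

/-- Jacobian criterion -/
theorem jacobian [PerfectField k] {σ : Type*} [Finite σ] (p : σ → Ω) {m c : ℕ}
    (hm : (m : ℕ∞) ≤ rk k (Set.range p)) (hc : Nat.card σ ≤ m + c)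
    (f : Fin (c + 1) → MvPolynomial σ k) (hf : ∀ i, aeval p (f i) = 0) :
    ∃ a : Fin (c + 1) → Ω, (∃ i, a i ≠ 0) ∧ ∀ j, ∑ i, a i * aeval p (pderiv j (f i)) = 0 := by
  have := Fintype.ofFinite σ
  let L := IntermediateField.adjoin k (Set.range p)
  let p' : σ → L := fun i => ⟨p i, IntermediateField.subset_adjoin _ _ ⟨i, rfl⟩⟩
  have hval : ∀ a, ((aeval p' a : L) : Ω) = aeval p a := fun a => by
    have : (L.val.comp (aeval p') : _ →ₐ[k] Ω) = aeval p := by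
      apply MvPolynomial.algHom_ext; intro i; simp [p']
    rw [← this]; rfl
  have hp' : IntermediateField.adjoin k (Set.range p') = ⊤ := by
    apply IntermediateField.map_injective L.val
    rw [IntermediateField.adjoin_map, ← AlgHom.fieldRange_eq_map, IntermediateField.fieldRange_val,
      ← Set.range_comp]
    rfl
  have hfg : Algebra.EssFiniteType k L :=
    IntermediateField.essFiniteType_iff.2 (IntermediateField.fg_adjoin_of_finite (Set.finite_range p))
  obtain ⟨s, hs, hsep⟩ := exists_isTranscendenceBasis_and_isSeparable_of_perfectField k L
  have hsep' : Algebra.IsSeparable (IntermediateField.adjoin k (Set.range ((↑) : s → L))) L := by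
    convert! hsep <;> simp
  obtain ⟨b, -⟩ := kaehler_finrank _ hs.1
  have hfr : Module.finrank L (KaehlerDifferential k L) = Nat.card s := Module.finrank_eq_nat_card_basis b
  have hms : m ≤ Nat.card s := by
    obtain ⟨t, ht⟩ := exists_indep p hm
    have ht' : AlgebraicIndependent k (p' ∘ t) := AlgebraicIndependent.of_comp L.val ht
    have h1 := rk_range_of_indep _ ht'
    have h2 := rk_range_of_indep _ hs.1
    have h3 : rk k (Set.range (p' ∘ t)) ≤ rk k (Set.range ((↑) : s → L)) := by
      apply rk_le_of_algOver
      intro a _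
      rw [algOver_iff]
      exact hs.isAlgebraic.isAlgebraic a
    rw [h1, h2] at h3
    simpa using h3
  let T : (σ → L) →ₗ[L] KaehlerDifferential k L :=
    Fintype.linearCombination L (fun i => KaehlerDifferential.D k L (p' i))
  have hT : LinearMap.range T = ⊤ := (Fintype.range_linearCombination L _).trans (span_D_top p' hp')
  have hk := T.finrank_range_add_finrank_ker
  rw [hT, finrank_top, Module.finrank_pi, hfr, ← Nat.card_eq_fintype_card] at hk
  let w : Fin (c + 1) → LinearMap.ker T := fun i => ⟨fun j => aeval p' (pderiv j (f i)), by
    rw [LinearMap.mem_ker]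
    have h0 : aeval p' (f i) = 0 := Subtype.ext ((hval _).trans (hf i))
    have := D_aeval p' (f i)
    rw [h0, map_zero] at this
    exact this.symm⟩
  have hdep : ¬ LinearIndependent L w := fun h => by
    have := h.fintype_card_le_finrank
    simp only [Fintype.card_fin] at this
    omega
  rw [Fintype.not_linearIndependent_iff] at hdep
  obtain ⟨a, ha, i, hi⟩ := hdep
  refine ⟨fun i => a i, ⟨i, by simpa using hi⟩, fun j => ?_⟩
  have h0 : ((∑ i, a i • w i : LinearMap.ker T) : σ → L) = 0 := by rw [ha]; rfl
  rw [Submodule.coe_sum] at h0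
  have h1 := congrFun h0 j
  have h2 : ∑ i, a i * aeval p' (pderiv j (f i)) = 0 := by
    rw [Finset.sum_apply] at h1
    exact h1
  have h3 := congrArg (fun x : L => (x : Ω)) h2
  simpa [hval] using h3

end
end

section
open MvPolynomial

section
variable {k : Type u} {Ω : Type u} [Field k] [Field Ω] [Algebra k Ω] {σ : Type}

theorem rk_add_finrank_le [Finite σ] (p : σ → Ω) (U : Submodule k (MvPolynomial σ k)) (hU : U ≤ LinF σ k)
    (h : ∀ l ∈ U, aeval p l = 0) :
    rk k (Set.range p) + (Module.finrank k U : ℕ) ≤ (Nat.card σ : ℕ) := by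
  have := Fintype.ofFinite σ
  let T : LinF σ k →ₗ[k] Ω := (aeval p : MvPolynomial σ k →ₐ[k] Ω).toLinearMap.comp (LinF σ k).subtype
  have h1 := T.finrank_range_add_finrank_ker
  rw [finrank_LinF] at h1
  have h2 : Module.finrank k U ≤ Module.finrank k (LinearMap.ker T) := by
    let g : U →ₗ[k] LinearMap.ker T :=
      LinearMap.codRestrict _ (Submodule.inclusion hU) (fun x => LinearMap.mem_ker.2 (h x x.2))
    refine LinearMap.finrank_le_finrank_of_injective (f := g) ?_
    intro x y hxy
    have := congrArg (fun z : LinearMap.ker T => ((z : LinF σ k) : MvPolynomial σ k)) hxy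
    exact Subtype.ext this
  have h3 : Submodule.span k (Set.range p) ≤ LinearMap.range T := by
    rw [Submodule.span_le]
    rintro _ ⟨i, rfl⟩
    exact ⟨⟨X i, X_mem_LinF i⟩, by simp [T]⟩
  have h4 := rk_le_finrank (k := k) (Set.range p) (Set.finite_range p)
  have h5 := Submodule.finrank_mono h3
  calc rk k (Set.range p) + (Module.finrank k U : ℕ)
      ≤ ((Module.finrank k (LinearMap.range T) : ℕ) : ℕ∞) + (Module.finrank k (LinearMap.ker T) : ℕ) := by
        gcongr; exact h4.trans (by exact_mod_cast h5)
    _ ≤ _ := by rw [Nat.card_eq_fintype_card]; exact_mod_cast h1.le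

theorem lin_eval_add {l : MvPolynomial σ k} (hl : l ∈ LinF σ k) (x y : σ → k) :
    eval (x + y) l = eval x l + eval y l := by
  rw [LinF_eq_span] at hl
  induction hl using Submodule.span_induction with
  | mem l hl => obtain ⟨i, rfl⟩ := hl; simp
  | zero => simp
  | add a b _ _ ha hb => rw [map_add, ha, hb, map_add, map_add]; ring
  | smul c a _ ha => simp only [smul_eval, ha]; ring

theorem lin_pderiv [Fintype σ] {l : MvPolynomial σ k} (hl : l ∈ LinF σ k) (x w : σ → k) :
    ∑ j, x j * eval w (pderiv j l) = eval x l := by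
  classical
  rw [LinF_eq_span] at hl
  induction hl using Submodule.span_induction with
  | mem l hl => obtain ⟨i, rfl⟩ := hl; simp [pderiv_X, Pi.single_apply, Finset.sum_ite_eq]
  | zero => simp
  | add a b _ _ ha hb => simp only [map_add, mul_add, Finset.sum_add_distrib, ha, hb]
  | smul c a _ ha =>
    simp only [Derivation.map_smul, smul_eval]
    rw [← ha, Finset.mul_sum]
    exact Finset.sum_congr rfl fun _ _ => by ring

theorem quad_eval_add [Fintype σ] {q : MvPolynomial σ k} (hq : q ∈ QuadF σ k) (x w : σ → k) :
    eval (x + w) q = eval x q + eval w q + ∑ j, x j * eval w (pderiv j q) := by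
  rw [QuadF_eq] at hq
  induction hq using Submodule.mul_induction_on' with
  | mem_mul_mem l hl m hm =>
    simp only [map_mul, Derivation.leibniz, smul_eq_mul, map_add, mul_add, Finset.sum_add_distrib]
    rw [lin_eval_add hl, lin_eval_add hm]
    have h1 : ∑ j, x j * (eval w l * eval w (pderiv j m)) = eval w l * eval x m := by
      rw [← lin_pderiv hm x w, Finset.mul_sum]
      exact Finset.sum_congr rfl fun _ _ => by ring
    have h2 : ∑ j, x j * (eval w m * eval w (pderiv j l)) = eval w m * eval x l := by
      rw [← lin_pderiv hl x w, Finset.mul_sum]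
      exact Finset.sum_congr rfl fun _ _ => by ring
    rw [h1, h2]; ring
  | add a _ b _ ha hb => simp only [map_add, mul_add, Finset.sum_add_distrib, ha, hb]; ring

theorem hom_eval_smul {q : MvPolynomial σ k} {n : ℕ} (hq : q.IsHomogeneous n) (c : k) (w : σ → k) :
    eval (c • w) q = c ^ n * eval w q := by
  have : (c • w) = fun i => c * w i := rfl
  rw [this, eval_eq, eval_eq, Finset.mul_sum]
  refine Finset.sum_congr rfl fun d hd => ?_
  have hdeg := hq (mem_support_iff.1 hd)
  simp only [mul_pow, Finset.prod_mul_distrib]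
  rw [Finset.prod_pow_eq_pow_sum]
  have : ∑ i ∈ d.support, d i = n := by rw [← hdeg, Finsupp.weight_apply]; simp [Finsupp.sum]
  rw [this]; ring

theorem pderiv_quad_mem {q : MvPolynomial σ k} (hq : q ∈ QuadF σ k) (j : σ) :
    pderiv j q ∈ LinF σ k := by
  exact IsHomogeneous.pderiv (n := 2) hq

/-- the radical argument -/
theorem minvars [Finite σ] [IsAlgClosed k] (q : MvPolynomial σ k) (hq : q ∈ QuadF σ k) (p : σ → Ω)
    (h0 : aeval p q = 0) (h1 : ∀ j, aeval p (pderiv j q) = 0) :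
    ∃ U : Submodule k (MvPolynomial σ k), U ≤ LinF σ k ∧ q ∈ Algebra.adjoin k (U : Set (MvPolynomial σ k))
      ∧ ∀ l ∈ U, aeval p l = 0 := by
  have := Fintype.ofFinite σ
  let W : Submodule k (σ → k) :=
    { carrier := {w | eval w q = 0 ∧ ∀ j, eval w (pderiv j q) = 0}
      zero_mem' := by
        refine ⟨?_, fun j => ?_⟩
        · have := hom_eval_smul (n := 2) hq 0 0
          simpa using this
        · have := hom_eval_smul (n := 1) (pderiv_quad_mem hq j) 0 0
          simpa using this
      add_mem' := by
        rintro a b ⟨ha, ha'⟩ ⟨hb, hb'⟩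
        refine ⟨?_, fun j => ?_⟩
        · rw [quad_eval_add hq, ha, hb]; simp [hb']
        · rw [lin_eval_add (pderiv_quad_mem hq j), ha', hb', add_zero]
      smul_mem' := by
        rintro c a ⟨ha, ha'⟩
        refine ⟨?_, fun j => ?_⟩
        · rw [hom_eval_smul (n := 2) hq, ha, mul_zero]
        · rw [hom_eval_smul (n := 1) (pderiv_quad_mem hq j), ha', mul_zero] }
  let U : Submodule k (MvPolynomial σ k) :=
    { carrier := {l | l ∈ LinF σ k ∧ ∀ w ∈ W, eval w l = 0}
      zero_mem' := ⟨zero_mem _, by simp⟩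
      add_mem' := by
        rintro a b ⟨ha, ha'⟩ ⟨hb, hb'⟩
        exact ⟨add_mem ha hb, fun w hw => by rw [map_add, ha' w hw, hb' w hw, add_zero]⟩
      smul_mem' := by
        rintro c a ⟨ha, ha'⟩
        exact ⟨Submodule.smul_mem _ c ha, fun w hw => by rw [smul_eval, ha' w hw, mul_zero]⟩ }
  refine ⟨U, fun l hl => hl.1, ?_, ?_⟩
  · obtain ⟨W', hW'⟩ := Submodule.exists_isCompl W
    let π : (σ → k) →ₗ[k] (σ → k) := W'.subtype.comp (Submodule.projectionOnto W' W hW'.symm)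
    have hπ : ∀ x, x - π x ∈ W := fun x => by
      have := Submodule.projectionOnto_apply_eq_zero_iff hW'.symm (x := x - π x)
      rw [← this, map_sub, sub_eq_zero]
      exact (Submodule.projectionOnto_apply_left hW'.symm _).symm
    have hπ0 : ∀ x ∈ W, π x = 0 := fun x hx => by
      have := (Submodule.projectionOnto_apply_eq_zero_iff hW'.symm (x := x)).2 hx
      change ((Submodule.projectionOnto W' W hW'.symm x : W') : σ → k) = 0
      rw [this]; rfl
    classical
    let g : σ → MvPolynomial σ k := fun s => ∑ i, C (π (Pi.single i 1) s) * X i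
    have hgl : ∀ s, g s ∈ LinF σ k := fun s => by
      refine Submodule.sum_mem _ fun i _ => ?_
      rw [C_mul']
      exact Submodule.smul_mem _ _ (X_mem_LinF i)
    have hg : ∀ s x, eval x (g s) = π x s := fun s x => by
      have hx : x = ∑ i, x i • (Pi.single i 1 : σ → k) := by
        funext j; simp [Finset.sum_apply, Pi.single_apply]
      conv_rhs => rw [hx]
      simp [g, map_sum, Finset.sum_apply, mul_comm]
    have hgU : ∀ s, g s ∈ U := fun s => ⟨hgl s, fun w hw => by rw [hg, hπ0 w hw]; rfl⟩
    have hq' : q = aeval g q := by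
      apply MvPolynomial.funext
      intro x
      have h2 : eval x (aeval g q) = eval (π x) q := by
        have : ((aeval x : MvPolynomial σ k →ₐ[k] k).comp (aeval g)) = aeval (π x) := by
          apply MvPolynomial.algHom_ext; intro s
          rw [AlgHom.comp_apply, aeval_X, aeval_X, aeval_eq_eval]
          exact hg s x
        have h := DFunLike.congr_fun this q
        rw [AlgHom.comp_apply, aeval_eq_eval, aeval_eq_eval] at h
        exact h
      rw [h2]
      have h3 := quad_eval_add hq (π x) (x - π x)
      rw [(hπ x).1] at h3
      simpa [(hπ x).2] using h3
    rw [hq']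
    have : aeval g q ∈ (aeval g : MvPolynomial σ k →ₐ[k] _).range := ⟨q, rfl⟩
    rw [← Algebra.adjoin_range_eq_range_aeval] at this
    refine Algebra.adjoin_mono ?_ this
    rintro _ ⟨s, rfl⟩
    exact hgU s
  · intro l hl
    by_contra hne
    let T : Set Ω := insert (aeval p l)⁻¹ (Set.range p)
    obtain ⟨ψ⟩ := spec (k := k) T ((Set.finite_range p).insert _)
    let p' : σ → Algebra.adjoin k T := fun i => ⟨p i, Algebra.subset_adjoin (Or.inr ⟨i, rfl⟩)⟩
    have hval : ∀ a, ((aeval p' a : Algebra.adjoin k T) : Ω) = aeval p a := fun a => by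
      have : ((Algebra.adjoin k T).val.comp (aeval p') : _ →ₐ[k] Ω) = aeval p := by
        apply MvPolynomial.algHom_ext; intro i; simp [p']
      rw [← this]; rfl
    let w : σ → k := fun i => ψ (p' i)
    have hw : ∀ a, eval w a = ψ (aeval p' a) := fun a => by
      have : (ψ.comp (aeval p') : _ →ₐ[k] k) = aeval w := by
        apply MvPolynomial.algHom_ext; intro i; simp [w]
      rw [← AlgHom.comp_apply, this]; simp [aeval_eq_eval]
    have hz : ∀ a, aeval p a = 0 → eval w a = 0 := fun a ha => by
      have : aeval p' a = 0 := Subtype.ext ((hval a).trans ha)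
      rw [hw, this, map_zero]
    have hwW : w ∈ W := ⟨hz _ h0, fun j => hz _ (h1 j)⟩
    have h2 := hl.2 w hwW
    let r : Algebra.adjoin k T := ⟨(aeval p l)⁻¹, Algebra.subset_adjoin (Or.inl rfl)⟩
    have h3 : aeval p' l * r = 1 := Subtype.ext (by
      change ((aeval p' l : Algebra.adjoin k T) : Ω) * (aeval p l)⁻¹ = 1
      rw [hval, mul_inv_cancel₀ hne])
    have h4 := congrArg ψ h3
    rw [map_mul, ← hw, h2, zero_mul, map_one] at h4
    exact zero_ne_one h4

end
end

section
open MvPolynomial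

section
variable {k : Type u} {L : Type u} [Field k] [Field L] [Algebra k L] {σ : Type}

theorem lift_coeffs {σ : Type} (B : Subalgebra k L) (g : MvPolynomial σ L) (h : (g.coeffs : Set L) ⊆ B) :
    ∃ g' : MvPolynomial σ B, map (algebraMap B L) g' = g := by
  have := (mem_range_map_iff_coeffs_subset (f := algebraMap B L) (x := g)).2 (by
    intro x hx
    exact ⟨⟨x, h hx⟩, rfl⟩)
  exact this

theorem hom_of_map_inj {A B : Type*} [CommRing A] [CommRing B] (f : A →+* B) (hf : Function.Injective f)
    {σ : Type} {n : ℕ} (g : MvPolynomial σ A) (h : (map f g).IsHomogeneous n) : g.IsHomogeneous n := by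
  intro d hd
  apply h
  rw [coeff_map]
  exact fun h0 => hd (hf (h0.trans (map_zero f).symm))

theorem spec_form [IsAlgClosed k] {ι κ : Type} [Fintype ι] [Finite κ] [Finite σ] (f : ι → MvPolynomial σ k)
    (cc : ι → L) (UL : Submodule L (MvPolynomial σ L)) (hUL : UL ≤ LinF σ L)
    (hq : ∑ i, C (cc i) * map (algebraMap k L) (f i) ∈ Algebra.adjoin L (UL : Set (MvPolynomial σ L)))
    (g : κ → MvPolynomial σ k) (hg : ∀ i, map (algebraMap k L) (g i) ∈ Ideal.span (UL : Set (MvPolynomial σ L)))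
    (T0 : Set L) (hT0 : T0.Finite) :
    ∃ (B : Subalgebra k L) (ψ : B →ₐ[k] k) (b : ι → B), T0 ⊆ B ∧ (∀ i, (b i : L) = cc i) ∧
      ∃ U : Submodule k (MvPolynomial σ k), U ≤ LinF σ k ∧ Module.finrank k U ≤ Module.finrank L UL ∧
        ∑ i, C (ψ (b i)) * f i ∈ Algebra.adjoin k (U : Set (MvPolynomial σ k)) ∧
        ∀ i, g i ∈ Ideal.span (U : Set (MvPolynomial σ k)) := by
  classical
  obtain ⟨u, hu, hus, huU⟩ := exists_fin_basis UL hUL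
  generalize Module.finrank L UL = D at *
  have hq' : ∃ Q : MvPolynomial (Fin D) L, aeval u Q = ∑ i, C (cc i) * map (algebraMap k L) (f i) := by
    rw [← hus, Algebra.adjoin_span, Algebra.adjoin_range_eq_range_aeval] at hq
    exact hq
  obtain ⟨Q, hQ⟩ := hq'
  have hg' : ∀ i, ∃ m : Fin D → MvPolynomial σ L, ∑ j, m j * u j = map (algebraMap k L) (g i) := by
    intro i
    have h1 := hg i
    have : Ideal.span (UL : Set (MvPolynomial σ L)) = Ideal.span (Set.range u) := by
      apply le_antisymm
      · rw [Ideal.span_le, ← hus]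
        intro x hx
        exact Submodule.span_subset_span L (MvPolynomial σ L) _ hx
      · exact Ideal.span_mono (by rintro _ ⟨i, rfl⟩; exact huU i)
    rw [this, Ideal.mem_span_range_iff_exists_fun] at h1
    exact h1
  choose m hm using hg'
  have := Fintype.ofFinite κ
  let T : Set L := T0 ∪ Set.range cc ∪ (Q.coeffs : Set L) ∪ (⋃ j, ((u j).coeffs : Set L)) ∪
    ⋃ i, ⋃ j, ((m i j).coeffs : Set L)
  have hT : T.Finite := by
    refine ((((hT0.union (Set.finite_range cc)).union (Finset.finite_toSet _)).union
      (Set.finite_iUnion fun j => Finset.finite_toSet _))).union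
      (Set.finite_iUnion fun i => Set.finite_iUnion fun j => Finset.finite_toSet _)
  obtain ⟨ψ⟩ := spec (k := k) T hT
  set B := Algebra.adjoin k T
  have hTB : T ⊆ B := Algebra.subset_adjoin
  have hinj : Function.Injective (algebraMap B L) := Subtype.val_injective
  obtain ⟨Q', hQ'⟩ := lift_coeffs B Q (fun x hx => hTB (Or.inl (Or.inl (Or.inr hx))))
  have hu' : ∀ j, ∃ u' : MvPolynomial σ B, map (algebraMap B L) u' = u j := fun j =>
    lift_coeffs B (u j) (fun x hx => hTB (Or.inl (Or.inr (Set.mem_iUnion.2 ⟨j, hx⟩))))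
  choose u' hu' using hu'
  have hm' : ∀ i j, ∃ m' : MvPolynomial σ B, map (algebraMap B L) m' = m i j := fun i j =>
    lift_coeffs B (m i j) (fun x hx => hTB (Or.inr (Set.mem_iUnion.2 ⟨i, Set.mem_iUnion.2 ⟨j, hx⟩⟩)))
  choose m' hm' using hm'
  let b : ι → B := fun i => ⟨cc i, hTB (Or.inl (Or.inl (Or.inl (Or.inr ⟨i, rfl⟩))))⟩
  have hmapinj := map_injective (σ := σ) (algebraMap B L) hinj
  let v : Fin D → MvPolynomial σ k := fun j => map (ψ : B →+* k) (u' j)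
  have hv : ∀ j, v j ∈ LinF σ k := fun j => by
    have : (u' j).IsHomogeneous 1 := hom_of_map_inj _ hinj _ (by rw [hu']; exact hUL (huU j))
    exact this.map _
  have hkB : ∀ a : MvPolynomial σ k, map (algebraMap k L) a = map (algebraMap B L) (map (algebraMap k B) a) := by
    intro a; rw [map_map]; rfl
  have hkk : ∀ a : MvPolynomial σ k, map (ψ : B →+* k) (map (algebraMap k B) a) = a := by
    intro a; rw [map_map, AlgHom.comp_algebraMap]; exact map_id a
  refine ⟨B, ψ, b, fun x hx => hTB (Or.inl (Or.inl (Or.inl (Or.inl hx)))), fun i => rfl,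
    Submodule.span k (Set.range v), ?_, ?_, ?_, ?_⟩
  · rw [Submodule.span_le]; rintro _ ⟨j, rfl⟩; exact hv j
  · exact (finrank_range_le_card v).trans (by simp)
  · have h1 : eval₂ C u' Q' = ∑ i, C (b i) * map (algebraMap k B) (f i) := by
      apply hmapinj
      rw [map_sum]
      simp only [map_mul, map_C, ← hkB]
      have : map (algebraMap B L) (eval₂ C u' Q') = aeval u Q := by
        rw [map_eval₂, hQ']
        have hh : (⇑(map (algebraMap B L)) ∘ u') = u := funext hu'
        rw [hh]; rfl
      rw [this, hQ]; rfl
    have h2 := congrArg (map (ψ : B →+* k)) h1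
    rw [map_sum] at h2
    simp only [map_mul, map_C, hkk] at h2
    have h3 : map (ψ : B →+* k) (eval₂ C u' Q') = aeval v (map (ψ : B →+* k) Q') := by
      rw [map_eval₂]; rfl
    rw [h3] at h2
    change ∑ i, C ((ψ : B →+* k) (b i)) * f i ∈ _
    rw [← h2, Algebra.adjoin_span, Algebra.adjoin_range_eq_range_aeval]
    exact ⟨_, rfl⟩
  · intro i
    have h1 : ∑ j, m' i j * u' j = map (algebraMap k B) (g i) := by
      apply hmapinj
      rw [← hkB, ← hm i, map_sum]
      exact Finset.sum_congr rfl fun j _ => by rw [map_mul, hm', hu']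
    have h2 := congrArg (map (ψ : B →+* k)) h1
    rw [hkk, map_sum] at h2
    rw [← h2]
    refine Ideal.sum_mem _ fun j _ => ?_
    rw [map_mul]
    exact Ideal.mul_mem_left _ _ (Ideal.subset_span (Submodule.subset_span ⟨j, rfl⟩))

end
end

section
open MvPolynomial

section
variable {k : Type u} {Ω : Type u} [Field k] [Field Ω] [Algebra k Ω] {σ : Type}

theorem AlgOver.of_span {s : Set Ω} {a : Ω} (h : a ∈ Submodule.span k s) : AlgOver k s a :=
  AlgOver.of_adjoin (Algebra.span_le_adjoin k s h)

theorem mem_span_of_rk [Finite σ] (p : σ → Ω) (U : Submodule k (MvPolynomial σ k)) (hU : U ≤ LinF σ k)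
    (h : ∀ l ∈ U, aeval p l = 0) (hr : ((Nat.card σ : ℕ) : ℕ∞) ≤ rk k (Set.range p) + (Module.finrank k U : ℕ))
    (g : MvPolynomial σ k) (hg : aeval p g = 0) : g ∈ Ideal.span (U : Set (MvPolynomial σ k)) := by
  have := Fintype.ofFinite σ
  obtain ⟨u, hu, hus, huU⟩ := exists_fin_basis U hU
  generalize Module.finrank k U = D at *
  obtain ⟨m, e, hc, he, hl⟩ := exists_coord u (fun i => hU (huU i)) hu
  let z : Fin m → Ω := fun j => aeval p (e (X (Sum.inl j)))
  let w : Fin m ⊕ Fin D → Ω := fun i => aeval p (e (X i))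
  have hw : ∀ G, aeval w G = aeval p (e G) := by
    intro G
    have : (aeval w : _ →ₐ[k] Ω) = (aeval p).comp (e : _ →ₐ[k] MvPolynomial σ k) := by
      apply MvPolynomial.algHom_ext; intro i; simp [w]
    rw [this]; rfl
  have hw0 : ∀ i, w (Sum.inr i) = 0 := fun i => by
    change aeval p (e _) = 0
    rw [he]; exact h _ (huU i)
  let π : MvPolynomial (Fin m ⊕ Fin D) k →ₐ[k] MvPolynomial (Fin m) k := aeval (Sum.elim X 0)
  have hπ : ∀ G, aeval z (π G) = aeval w G := by
    intro G
    have : (aeval z : _ →ₐ[k] Ω).comp π = aeval w := by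
      apply MvPolynomial.algHom_ext
      rintro (i | i)
      · simp [π, z, w]
      · simp [π, hw0]
    rw [← this]; rfl
  have hz : AlgebraicIndependent k z := by
    apply indep_of_rk
    have h1 : rk k (Set.range p) ≤ rk k (Set.range z) := by
      apply rk_le_of_algOver
      rintro _ ⟨i, rfl⟩
      apply AlgOver.of_adjoin
      rw [Algebra.adjoin_range_eq_range_aeval]
      refine ⟨π (e.symm (X i)), ?_⟩
      change aeval z _ = _
      rw [hπ, hw]; simp
    have hcc : Nat.card σ = m + D := by simpa using hc
    rw [hcc] at hr
    have h2 := hr.trans (add_le_add_left h1 _)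
    push_cast at h2
    simpa using (ENat.add_le_add_iff_right (ENat.natCast_ne_top D)).1 h2
  have h0 : π (e.symm g) = 0 := by
    apply hz
    rw [map_zero, hπ, hw]; simpa using hg
  let I := Ideal.span (U : Set (MvPolynomial σ k))
  have hh : (Ideal.Quotient.mkₐ k I).comp (e : MvPolynomial (Fin m ⊕ Fin D) k →ₐ[k] MvPolynomial σ k) =
      ((Ideal.Quotient.mkₐ k I).comp (e : MvPolynomial (Fin m ⊕ Fin D) k →ₐ[k] MvPolynomial σ k)).comp
        ((rename Sum.inl).comp π) := by
    apply MvPolynomial.algHom_ext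
    rintro (i | i)
    · simp [π]
    · have : e (X (Sum.inr i)) ∈ I := by rw [he]; exact Ideal.subset_span (huU i)
      have := Ideal.Quotient.eq_zero_iff_mem.2 this
      simp [π, this]
  have h1 := DFunLike.congr_fun hh (e.symm g)
  simp only [AlgHom.comp_apply, h0, map_zero] at h1
  have h2 : Ideal.Quotient.mk I g = 0 := by simpa using h1
  exact Ideal.Quotient.eq_zero_iff_mem.1 h2

theorem exists_li_fin {M : Type*} [AddCommGroup M] [Module k M] (V : Submodule k M) {m : ℕ}
    (h : m ≤ Module.finrank k V) : ∃ f : Fin m → M, LinearIndependent k f ∧ ∀ i, f i ∈ V := by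
  obtain ⟨f, hf⟩ := exists_linearIndependent_of_le_finrank h
  exact ⟨fun i => f i, hf.map' V.subtype (Submodule.ker_subtype V), fun i => (f i).2⟩

theorem quad_const_zero {q : MvPolynomial σ k} (hq : q ∈ QuadF σ k) (U : Submodule k (MvPolynomial σ k))
    (hU : ∀ l ∈ U, l = 0) (h : q ∈ Algebra.adjoin k (U : Set (MvPolynomial σ k))) : q = 0 := by
  have : (U : Set (MvPolynomial σ k)) ⊆ {0} := fun l hl => hU l hl
  have h1 := Algebra.adjoin_mono this h
  rw [Algebra.adjoin_singleton_zero] at h1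
  obtain ⟨a, rfl⟩ := h1
  change C a ∈ _ at hq
  by_contra hne
  have h2 : (C a : MvPolynomial σ k).IsHomogeneous 2 := hq
  have := (isHomogeneous_C σ a).inj_right h2 hne
  omega

theorem algOver_empty {x : Ω} (hx : IsAlgebraic k x) : AlgOver k ∅ x := by
  rw [algOver_iff]
  exact IsAlgebraic.extendScalars (FaithfulSMul.algebraMap_injective k (Algebra.adjoin k (∅ : Set Ω))) hx

theorem algClosed_aux (F E : Type u) [Field F] [Field E] [Algebra F E] [IsAlgClosed E] :
    IsAlgClosed (algebraicClosure F E) :=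
  (IsAlgClosed.algebraicClosure_eq_bot_iff (algebraicClosure F E) E).mp (algebraicClosure.algebraicClosure_eq_bot F E)

theorem exists_algClosed_over [IsAlgClosed Ω] (F : IntermediateField k Ω) :
    ∃ L : IntermediateField k Ω, IsAlgClosed L ∧ F ≤ L ∧ ∀ x ∈ L, IsAlgebraic F x := by
  refine ⟨(algebraicClosure F Ω).restrictScalars k, ?_, ?_, ?_⟩
  · exact algClosed_aux F Ω
  · intro x hx
    exact mem_algebraicClosure_iff.2 (isAlgebraic_algebraMap (⟨x, hx⟩ : F))
  · intro x hx
    exact mem_algebraicClosure_iff.1 hx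

theorem jac_main [Finite σ] [IsAlgClosed k] [IsAlgClosed Ω] (p : σ → Ω) (c : ℕ)
    (hr : ((Nat.card σ : ℕ) : ℕ∞) ≤ rk k (Set.range p) + c)
    (hL : ∀ l ∈ LinF σ k, aeval p l = 0 → l = 0) (V : Submodule k (MvPolynomial σ k)) (hV : V ≤ QuadF σ k)
    (hVp : ∀ v ∈ V, aeval p v = 0) (hc : c + 1 ≤ Module.finrank k V) :
    ∃ (D : ℕ) (f1 f2 : MvPolynomial σ k) (U1 U2 : Submodule k (MvPolynomial σ k)), D ≤ 2 * c ∧ f1 ∈ V ∧ f2 ∈ V ∧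
      LinearIndependent k ![f1, f2] ∧ U1 ≤ LinF σ k ∧ U2 ≤ LinF σ k ∧ Module.finrank k U1 ≤ D ∧
      Module.finrank k U2 ≤ D ∧ f1 ∈ Algebra.adjoin k (U1 : Set (MvPolynomial σ k)) ∧
      f2 ∈ Algebra.adjoin k (U2 : Set (MvPolynomial σ k)) ∧
      (D = 2 * c → ∀ v ∈ V, v ∈ Ideal.span (U1 : Set (MvPolynomial σ k))) := by
  classical
  obtain ⟨f, hf, hfV⟩ := exists_li_fin V hc
  have hm : ((Nat.card σ - c : ℕ) : ℕ∞) ≤ rk k (Set.range p) := by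
    rw [ENat.natCast_sub]; exact tsub_le_iff_right.2 hr
  obtain ⟨a, ⟨i0, hi0⟩, ha⟩ := jacobian p hm (by omega : Nat.card σ ≤ (Nat.card σ - c) + c) f
    (fun i => hVp _ (hfV i))
  let cc : Fin (c + 1) → Ω := fun i => a i / a i0
  have hcc0 : cc i0 = 1 := div_self hi0
  have hcc : ∀ j, ∑ i, cc i * aeval p (pderiv j (f i)) = 0 := fun j => by
    have := ha j
    have h2 : ∑ i, cc i * aeval p (pderiv j (f i)) = (∑ i, a i * aeval p (pderiv j (f i))) / a i0 := by
      rw [Finset.sum_div]; exact Finset.sum_congr rfl fun i _ => by simp only [cc]; ring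
    rw [h2, this, zero_div]
  have hcomb : ∀ d : Fin (c + 1) → k, ∑ i, C (d i) * f i ∈ V := fun d =>
    Submodule.sum_mem _ fun i _ => by rw [C_mul']; exact V.smul_mem _ (hfV i)
  -- not all in k
  have hnk : ∃ i1, cc i1 ∉ Set.range (algebraMap k Ω) := by
    by_contra hcon
    push Not at hcon
    choose d hd using hcon
    have hqV := hcomb d
    obtain ⟨U, hU, hq, hU0⟩ := minvars (∑ i, C (d i) * f i) (hV hqV) p (hVp _ hqV) (fun j => by
      rw [map_sum, map_sum, ← hcc j]
      refine Finset.sum_congr rfl fun i _ => ?_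
      rw [pderiv_C_mul, map_mul, aeval_C, hd])
    have := quad_const_zero (hV hqV) U (fun l hl => hL l (hU hl) (hU0 l hl)) hq
    simp only [C_mul'] at this
    have h0 := Fintype.linearIndependent_iff.1 hf d this i0
    have := hd i0
    rw [h0, hcc0, map_zero] at this
    exact zero_ne_one this
  obtain ⟨i1, hi1⟩ := hnk
  let s := Set.range cc
  obtain ⟨L, hLac, hFL, hLalg⟩ := exists_algClosed_over (IntermediateField.adjoin k s)
  have hsL : ∀ i, cc i ∈ L := fun i => hFL (IntermediateField.subset_adjoin k s ⟨i, rfl⟩)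
  let cL : Fin (c + 1) → L := fun i => ⟨cc i, hsL i⟩
  have hrkL : rk k (L : Set Ω) ≤ c := by
    have h1 : rk k (L : Set Ω) ≤ rk k s := by
      apply rk_le_of_algOver
      intro x hx
      have h2 := (algOver_field _ _ _).2 (algOver_empty (hLalg x hx))
      refine AlgOver.trans ?_ h2
      rintro y (hy | hy)
      · exact AlgOver.of_field hy
      · exact hy.elim
    refine h1.trans ?_
    let s' := cc '' {i | i ≠ i0}
    have h2 : rk k s ≤ rk k s' := by
      apply rk_le_of_algOver
      rintro _ ⟨i, rfl⟩
      by_cases h : i = i0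
      · subst h; rw [hcc0]; exact AlgOver.of_adjoin (one_mem _)
      · exact AlgOver.of_mem ⟨i, h, rfl⟩
    refine h2.trans ((rk_le_encard s').trans ?_)
    refine (Set.encard_image_le _ _).trans ?_
    have : {i : Fin (c + 1) | i ≠ i0} = ((Finset.univ.erase i0 : Finset (Fin (c + 1))) : Set (Fin (c+1))) := by
      ext; simp
    rw [this, Set.encard_coe_eq_coe_finsetCard]
    simp
  have hmapV : ∀ g : MvPolynomial σ k, aeval p (map (algebraMap k L) g) = aeval p g := fun g =>
    aeval_map_algebraMap L p g
  let q : MvPolynomial σ L := ∑ i, C (cL i) * map (algebraMap k L) (f i)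
  have hq : q ∈ QuadF σ L := Submodule.sum_mem _ fun i _ => by
    rw [C_mul']
    exact Submodule.smul_mem _ _ (IsHomogeneous.map (hV (hfV i)) _)
  obtain ⟨UL, hUL, hqU, hU0⟩ := minvars q hq p
    (by
      rw [map_sum]
      refine Finset.sum_eq_zero fun i _ => ?_
      rw [map_mul, hmapV, hVp _ (hfV i), mul_zero])
    (fun j => by
      rw [map_sum, map_sum, ← hcc j]
      refine Finset.sum_congr rfl fun i _ => ?_
      rw [pderiv_C_mul, map_mul, aeval_C, pderiv_map, hmapV]
      rfl)
  have hLR := rk_add_finrank_le p UL hUL hU0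
  have hrp : ((Nat.card σ : ℕ) : ℕ∞) ≤ c + rk L (Set.range p) + c := by
    refine hr.trans ?_
    gcongr
    calc rk k (Set.range p) ≤ rk k ((L : Set Ω) ∪ Set.range p) := rk_mono Set.subset_union_right
      _ = _ := rk_tower L _ (Set.finite_range p)
      _ ≤ _ := by gcongr
  obtain ⟨r, hrr⟩ : ∃ r : ℕ, rk L (Set.range p) = r := by
    have := rk_le_nat_of_finite (k := L) (Set.range p) (Set.finite_range p)
    exact ENat.ne_top_iff_exists.1 (ne_top_of_le_ne_top (ENat.natCast_ne_top _) this) |>.imp fun _ h => h.symm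
  rw [hrr] at hLR hrp
  have hLR' : r + Module.finrank L UL ≤ Nat.card σ := by exact_mod_cast hLR
  have hrp' : Nat.card σ ≤ c + r + c := by exact_mod_cast hrp
  obtain ⟨m, g, hg, hgV⟩ : ∃ (m : ℕ) (g : Fin m → MvPolynomial σ k),
      (∀ i, map (algebraMap k L) (g i) ∈ Ideal.span (UL : Set (MvPolynomial σ L))) ∧
      (Module.finrank L UL = 2 * c → V ≤ Submodule.span k (Set.range g)) := by
    by_cases hD : Module.finrank L UL = 2 * c
    · have : Module.Finite k V := Submodule.finiteDimensional_of_le hV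
      refine ⟨_, fun i => (Module.finBasis k V i : MvPolynomial σ k), fun i => ?_, fun _ => ?_⟩
      · apply mem_span_of_rk p UL hUL hU0
        · rw [hrr]; exact_mod_cast (by omega)
        · rw [hmapV]; exact hVp _ (Subtype.property _)
      · intro v hv
        have := (Module.finBasis k V).mem_span (⟨v, hv⟩ : V)
        have h2 := Submodule.mem_map_of_mem (f := V.subtype) this
        rw [Submodule.map_span, ← Set.range_comp] at h2
        exact h2
    · exact ⟨0, Fin.elim0, fun i => i.elim0, fun h => (hD h).elim⟩
  obtain ⟨B1, ψ1, b1, -, hb1, U1, hU1, hd1, hf1, hg1⟩ := spec_form f cL UL hUL hqU g hg ∅ Set.finite_empty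
  obtain ⟨B2, ψ2, b2, hT2, hb2, U2, hU2, hd2, hf2, -⟩ := spec_form f cL UL hUL hqU g hg
    {(cL i1 - algebraMap k L (ψ1 (b1 i1)))⁻¹} (Set.finite_singleton _)
  have hone1 : ψ1 (b1 i0) = 1 := by
    have : b1 i0 = 1 := Subtype.ext ((hb1 i0).trans (Subtype.ext hcc0))
    rw [this, map_one]
  have hone2 : ψ2 (b2 i0) = 1 := by
    have : b2 i0 = 1 := Subtype.ext ((hb2 i0).trans (Subtype.ext hcc0))
    rw [this, map_one]
  have hne : ψ2 (b2 i1) ≠ ψ1 (b1 i1) := by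
    intro heq
    let w : B2 := ⟨_, hT2 rfl⟩
    have hne0 : cL i1 - algebraMap k L (ψ1 (b1 i1)) ≠ 0 := by
      intro h0
      apply hi1
      refine ⟨ψ1 (b1 i1), ?_⟩
      have := sub_eq_zero.1 h0
      exact (congrArg (fun x : L => (x : Ω)) this).symm
    have h1 : (b2 i1 - algebraMap k B2 (ψ1 (b1 i1))) * w = 1 := by
      apply Subtype.ext
      change ((b2 i1 : L) - algebraMap k L (ψ1 (b1 i1))) * _ = 1
      rw [hb2]
      exact mul_inv_cancel₀ hne0
    have h2 := congrArg ψ2 h1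
    rw [map_mul, map_sub, AlgHom.commutes, heq, map_one] at h2
    simp at h2
  refine ⟨Module.finrank L UL, _, _, U1, U2, by omega, hcomb _, hcomb _, ?_, hU1, hU2, hd1, hd2, hf1, hf2, ?_⟩
  · rw [LinearIndependent.pair_iff]
    intro x y hxy
    have h1 : ∑ i, (x * ψ1 (b1 i) + y * ψ2 (b2 i)) • f i = 0 := by
      rw [← hxy, Finset.smul_sum, Finset.smul_sum, ← Finset.sum_add_distrib]
      refine Finset.sum_congr rfl fun i _ => ?_
      rw [C_mul', C_mul', smul_smul, smul_smul, add_smul]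
    have h2 := Fintype.linearIndependent_iff.1 hf _ h1
    have h3 := h2 i0
    have h4 := h2 i1
    rw [hone1, hone2] at h3
    have h5 : y = -x := by linear_combination h3
    rw [h5] at h4
    have h6 : x * (ψ1 (b1 i1) - ψ2 (b2 i1)) = 0 := by linear_combination h4
    have hx : x = 0 := (mul_eq_zero.1 h6).resolve_right (fun h => hne (sub_eq_zero.1 h).symm)
    exact ⟨hx, by rw [h5, hx, neg_zero]⟩
  · intro hD v hv
    have := hgV hD hv
    have h2 : Submodule.span k (Set.range g) ≤ (Ideal.span (U1 : Set (MvPolynomial σ k))).restrictScalars k := by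
      rw [Submodule.span_le]; rintro _ ⟨i, rfl⟩; exact hg1 i
    exact h2 this

end
end

section
open MvPolynomial

section
variable {k : Type u} {Ω : Type u} [Field k] [Field Ω] [Algebra k Ω] {σ : Type}

/-- affine quadric with given parts -/
noncomputable def aq {K : Type u} [Field K] {t : ℕ} (q2 : MvPolynomial (Fin t) K) (l : Fin t → K) (c : K) :
    MvPolynomial (Fin t) K := q2 + ∑ j, C (l j) * X j + C c

theorem aq_zero {K : Type u} [Field K] {t : ℕ} {q2 : MvPolynomial (Fin t) K} (hq : q2 ∈ QuadF (Fin t) K)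
    {l : Fin t → K} {c : K} (h : aq q2 l c = 0) : q2 = 0 ∧ (∀ j, l j = 0) ∧ c = 0 := by
  classical
  have hl : (∑ j, C (l j) * X j : MvPolynomial (Fin t) K).IsHomogeneous 1 := by
    refine Submodule.sum_mem (homogeneousSubmodule (Fin t) K 1) fun j _ => ?_
    rw [C_mul']
    exact Submodule.smul_mem _ _ (X_mem_LinF j)
  have hc : (C c : MvPolynomial (Fin t) K).IsHomogeneous 0 := isHomogeneous_C _ _
  have hq' : q2.IsHomogeneous 2 := hq
  have e2 := congrArg (homogeneousComponent 2) h
  have e1 := congrArg (homogeneousComponent 1) h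
  have e0 := congrArg (homogeneousComponent 0) h
  simp only [aq, map_add, map_zero] at e2 e1 e0
  rw [homogeneousComponent_of_mem hq', homogeneousComponent_of_mem hl, homogeneousComponent_of_mem hc] at e2 e1 e0
  simp at e2 e1 e0
  refine ⟨e2, fun j => ?_, e0⟩
  have := congrArg (coeff (Finsupp.single j 1)) e1
  simpa [coeff_sum, coeff_C_mul, coeff_X, Finsupp.single_left_inj] using this

theorem aq_deg {K : Type u} [Field K] {t : ℕ} {q2 : MvPolynomial (Fin t) K} (hq : q2 ∈ QuadF (Fin t) K)
    (l : Fin t → K) (c : K) : (aq q2 l c).totalDegree ≤ 2 := by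
  unfold aq
  have hl : (∑ j, C (l j) * X j : MvPolynomial (Fin t) K).IsHomogeneous 1 := by
    refine Submodule.sum_mem (homogeneousSubmodule (Fin t) K 1) fun j _ => ?_
    rw [C_mul']
    exact Submodule.smul_mem _ _ (X_mem_LinF j)
  have hq' : q2.IsHomogeneous 2 := hq
  refine (totalDegree_add _ _).trans (max_le ((totalDegree_add _ _).trans (max_le hq'.totalDegree_le ?_)) ?_)
  · exact hl.totalDegree_le.trans (by norm_num)
  · simp

theorem aq_sub {K : Type u} [Field K] {t : ℕ} (q2 q2' : MvPolynomial (Fin t) K)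
    (l l' : Fin t → K) (c c' κ : K) : aq q2' l' c' - C κ * aq q2 l c =
      aq (q2' - κ • q2) (fun j => l' j - κ * l j) (c' - κ * c) := by
  unfold aq
  simp only [C_sub, C_mul, sub_mul, Finset.sum_sub_distrib, mul_add, Finset.mul_sum, smul_eq_C_mul, mul_assoc]
  ring

theorem tower_point [Finite σ] (p : σ → Ω) (U : Submodule k (MvPolynomial σ k)) (hU : U ≤ LinF σ k) :
    ∃ (t : ℕ) (z : Fin t → MvPolynomial σ k), (∀ j, z j ∈ LinF σ k) ∧ Nat.card σ = t + Module.finrank k U ∧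
      (∀ ℓ ∈ LinF (Fin t) k, aeval z ℓ ∈ U → ℓ = 0) ∧
      rk k (Set.range p) ≤ rk k (aeval p '' (U : Set (MvPolynomial σ k))) +
        rk (IntermediateField.adjoin k (aeval p '' (U : Set (MvPolynomial σ k)))) (Set.range fun j => aeval p (z j)) ∧
      ∀ v ∈ QuadF σ k, ∃ (q2 : MvPolynomial (Fin t) k) (l : Fin t → MvPolynomial σ k) (q0 : MvPolynomial σ k),
        q2 ∈ QuadF (Fin t) k ∧ (∀ j, l j ∈ U) ∧ q0 ∈ Algebra.adjoin k (U : Set (MvPolynomial σ k)) ∧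
        v = aeval z q2 + ∑ j, z j * l j + q0 := by
  obtain ⟨t, D, Φ, hD, hN, hz, hu, husp, hzsp⟩ := exists_tower U hU
  have hlinU : ∀ l ∈ LinF (Fin D) k, Φ (C l) ∈ U := by
    intro l hl
    rw [LinF_eq_span] at hl
    induction hl using Submodule.span_induction with
    | mem l hl => obtain ⟨i, rfl⟩ := hl; exact hu i
    | zero => simp
    | add a b _ _ ha hb => rw [C_add, map_add]; exact add_mem ha hb
    | smul c a _ ha =>
      have : Φ (C (c • a)) = c • Φ (C a) := by
        rw [← map_smul]; congr 1
        exact map_smul (IsScalarTower.toAlgHom k (MvPolynomial (Fin D) k) (MvPolynomial (Fin t) (MvPolynomial (Fin D) k))) c a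
      rw [this]; exact U.smul_mem _ ha
  have hmap : ∀ q : MvPolynomial (Fin t) k, aeval (fun j => Φ (X j)) q = Φ (map (algebraMap k _) q) := by
    intro q
    have : (aeval (fun j => Φ (X j)) : MvPolynomial (Fin t) k →ₐ[k] _) =
        (Φ : _ →ₐ[k] MvPolynomial σ k).comp (mapAlgHom (Algebra.ofId k (MvPolynomial (Fin D) k))) := by
      apply MvPolynomial.algHom_ext; intro i; simp
    rw [this]; rfl
  have hadj : ∀ q : MvPolynomial (Fin D) k, Φ (C q) ∈ Algebra.adjoin k (U : Set (MvPolynomial σ k)) := by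
    intro q
    have : Φ (C q) = aeval (fun i => Φ (C (X i))) q := by
      have : (Φ.toAlgHom.comp (IsScalarTower.toAlgHom k (MvPolynomial (Fin D) k) _)) =
         aeval (fun i => Φ (C (X i))) := by
        apply MvPolynomial.algHom_ext; intro i; simp [algebraMap_eq]
      rw [← this]; rfl
    rw [this, ← husp, Algebra.adjoin_span, Algebra.adjoin_range_eq_range_aeval]
    exact ⟨_, rfl⟩
  refine ⟨t, fun j => Φ (X j), hz, by rw [hN, hD], ?_, ?_, ?_⟩
  · intro ℓ hℓ h
    rw [hmap, ← husp] at h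
    have h1 : ∀ y ∈ Submodule.span k (Set.range fun i => Φ (C (X i))), ∃ a, y = Φ (C a) := by
      intro y hy
      induction hy using Submodule.span_induction with
      | mem l hl => obtain ⟨i, rfl⟩ := hl; exact ⟨_, rfl⟩
      | zero => exact ⟨0, by simp⟩
      | add a b _ _ ha hb =>
        obtain ⟨a, rfl⟩ := ha; obtain ⟨b, rfl⟩ := hb; exact ⟨a + b, by simp⟩
      | smul c a _ ha =>
        obtain ⟨a, rfl⟩ := ha
        refine ⟨c • a, ?_⟩
        rw [← map_smul]; congr 1
        exact (map_smul (IsScalarTower.toAlgHom k (MvPolynomial (Fin D) k) (MvPolynomial (Fin t) (MvPolynomial (Fin D) k))) c a).symm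
    obtain ⟨a, ha⟩ := h1 _ h
    have h2 := Φ.injective ha
    have h3 : (map (algebraMap k (MvPolynomial (Fin D) k)) ℓ).IsHomogeneous 1 := IsHomogeneous.map hℓ _
    by_contra hne
    have hne' : map (algebraMap k (MvPolynomial (Fin D) k)) ℓ ≠ 0 := fun h0 => hne
      (map_injective _ (FaithfulSMul.algebraMap_injective k _) (by rw [h0, map_zero]))
    rw [h2] at h3 hne'
    have := (isHomogeneous_C _ a).inj_right h3 hne'
    omega
  · set s := aeval p '' (U : Set (MvPolynomial σ k))
    rw [← rk_union_field s _ (Set.finite_range _)]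
    apply rk_le_of_algOver
    rintro _ ⟨i, rfl⟩
    have h1 : (X i : MvPolynomial σ k) ∈ LinF σ k := X_mem_LinF i
    rw [← hzsp, Submodule.mem_sup] at h1
    obtain ⟨a, ha, b, hb, hab⟩ := h1
    have : p i = aeval p a + aeval p b := by rw [← map_add, hab, aeval_X]
    rw [this]
    apply AlgOver.of_span
    refine add_mem ?_ (Submodule.subset_span (Or.inl ⟨b, hb, rfl⟩))
    have h2 := Submodule.mem_map_of_mem (f := (aeval p : _ →ₐ[k] Ω).toLinearMap) ha
    rw [Submodule.map_span] at h2
    refine Submodule.span_mono ?_ h2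
    rintro _ ⟨_, ⟨j, rfl⟩, rfl⟩
    exact Or.inr ⟨j, rfl⟩
  · intro v hv
    obtain ⟨q2, l, q0, hq2, hl, hq0, heq⟩ := tower_quad Φ U husp hzsp hv
    refine ⟨q2, fun j => Φ (C (l j)), Φ (C q0), hq2, fun j => hlinU _ (hl j), hadj _, ?_⟩
    have := congrArg Φ heq
    rw [AlgEquiv.apply_symm_apply] at this
    rw [hmap, this]
    simp

theorem eval_aq {K : IntermediateField k Ω} {t : ℕ} (p : σ → Ω) (z l : Fin t → MvPolynomial σ k)
    (q2 : MvPolynomial (Fin t) k) (q0 : MvPolynomial σ k) (l' : Fin t → K) (c' : K)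
    (hl : ∀ j, aeval p (l j) = l' j) (hc : aeval p q0 = c') :
    aeval p (aeval z q2 + ∑ j, z j * l j + q0) = aeval (fun j => aeval p (z j)) (aq (map (algebraMap k K) q2) l' c') := by
  unfold aq
  simp only [map_add, map_sum, map_mul, aeval_C, aeval_X, hl, hc]
  rw [aeval_map_algebraMap]
  congr 2
  · have : (aeval p : _ →ₐ[k] Ω).comp (aeval z) = aeval (fun j => aeval p (z j)) := by
      apply MvPolynomial.algHom_ext; intro i; simp
    rw [← this]; rfl
  · exact Finset.sum_congr rfl fun j _ => mul_comm _ _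

end
end

section
open MvPolynomial

section
variable {k : Type u} {Ω : Type u} [Field k] [Field Ω] [Algebra k Ω] {σ : Type}

theorem isUnit_of_deg0 {F : MvPolynomial σ k} (h0 : F ≠ 0) (h : F.totalDegree = 0) : IsUnit F := by
  rw [totalDegree_eq_zero_iff_eq_C] at h
  rw [h] at h0 ⊢
  have : F.coeff 0 ≠ 0 := fun h => h0 (by rw [h, C_0])
  exact (IsUnit.mk0 _ this).map C

theorem ne_zero_of_deg {F : MvPolynomial σ k} {n : ℕ} (h : F.totalDegree = n + 1) : F ≠ 0 := by
  rintro rfl; simp at h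

theorem irr_deg1 {F : MvPolynomial σ k} (h : F.totalDegree = 1) : Irreducible F := by
  have h0 := ne_zero_of_deg h
  refine ⟨fun hu => ?_, fun a b hab => ?_⟩
  · rw [isUnit_iff_totalDegree_of_isReduced] at hu; omega
  · have ha : a ≠ 0 := by rintro rfl; simp at hab; exact h0 hab
    have hb : b ≠ 0 := by rintro rfl; simp at hab; exact h0 hab
    rw [hab, totalDegree_mul_of_isDomain ha hb] at h
    rcases Nat.eq_zero_or_pos a.totalDegree with h1 | h1
    · exact Or.inl (isUnit_of_deg0 ha h1)
    · exact Or.inr (isUnit_of_deg0 hb (by omega))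

theorem dvd_prop {F G : MvPolynomial σ k} (h0 : F ≠ 0) (h : F ∣ G) (hd : G.totalDegree ≤ F.totalDegree) :
    ∃ κ : k, G = C κ * F := by
  obtain ⟨Q, rfl⟩ := h
  by_cases hQ : Q = 0
  · exact ⟨0, by simp [hQ]⟩
  · rw [totalDegree_mul_of_isDomain h0 hQ] at hd
    have : Q.totalDegree = 0 := by omega
    rw [totalDegree_eq_zero_iff_eq_C] at this
    exact ⟨Q.coeff 0, by rw [← this, mul_comm]⟩

theorem deg1_split {F : MvPolynomial σ k} (h : F.totalDegree ≤ 1) : ∃ l ∈ LinF σ k, ∃ e : k, F = l + C e := by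
  refine ⟨homogeneousComponent 1 F, homogeneousComponent_mem _ _, F.coeff 0, ?_⟩
  have h1 := sum_homogeneousComponent F
  have h2 : ∑ i ∈ Finset.range 2, homogeneousComponent i F = F := by
    conv_rhs => rw [← h1]
    symm
    apply Finset.sum_subset
    · intro x; simp; omega
    · intro x _ hx
      apply homogeneousComponent_eq_zero
      simp at hx; omega
  rw [Finset.sum_range_succ, Finset.sum_range_one, homogeneousComponent_zero] at h2
  rw [add_comm]; exact h2.symm

theorem lin_deg {l : MvPolynomial σ k} (hl : l ∈ LinF σ k) (h : l ≠ 0) : l.totalDegree = 1 :=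
  IsHomogeneous.totalDegree hl h

theorem lin_prime {l : MvPolynomial σ k} (hl : l ∈ LinF σ k) (h : l ≠ 0) : Prime l :=
  (irr_deg1 (lin_deg hl h)).prime

/-- factors of a quadric over an algebraically closed field -/
theorem factor_descend {L : Type u} [Field L] [Algebra k L] [IsAlgClosed k] (q : MvPolynomial σ k) (hq0 : q ≠ 0)
    (a b : MvPolynomial σ L) (ha : a ∈ LinF σ L) (hb : b ∈ LinF σ L) (h : map (algebraMap k L) q = a * b) :
    ∃ l ∈ LinF σ k, l ≠ 0 ∧ ∃ κ : L, κ ≠ 0 ∧ a = C κ * map (algebraMap k L) l := by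
  have hinjL := map_injective (σ := σ) (algebraMap k L) (algebraMap k L).injective
  have hab0 : a * b ≠ 0 := by rw [← h]; exact fun h0 => hq0 (hinjL (h0.trans (map_zero _).symm))
  obtain ⟨ha0, hb0⟩ := mul_ne_zero_iff.1 hab0
  let T : Set L := (a.coeffs : Set L) ∪ (b.coeffs : Set L)
  obtain ⟨ψ⟩ := spec (k := k) T ((Finset.finite_toSet _).union (Finset.finite_toSet _))
  set B := Algebra.adjoin k T
  have hTB : T ⊆ B := Algebra.subset_adjoin
  have hinj : Function.Injective (algebraMap B L) := Subtype.val_injective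
  obtain ⟨a', ha'⟩ := lift_coeffs B a (fun x hx => hTB (Or.inl hx))
  obtain ⟨b', hb'⟩ := lift_coeffs B b (fun x hx => hTB (Or.inr hx))
  have hkB : ∀ a : MvPolynomial σ k, map (algebraMap k L) a = map (algebraMap B L) (map (algebraMap k B) a) := by
    intro a; rw [map_map]; rfl
  have hkk : ∀ a : MvPolynomial σ k, map (ψ : B →+* k) (map (algebraMap k B) a) = a := by
    intro a; rw [map_map, AlgHom.comp_algebraMap]; exact map_id a
  have h1 : map (algebraMap k B) q = a' * b' := by
    apply map_injective (σ := σ) (algebraMap B L) hinj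
    rw [← hkB, h, map_mul, ha', hb']
  have h2 := congrArg (map (ψ : B →+* k)) h1
  rw [hkk, map_mul] at h2
  set m1 := map (ψ : B →+* k) a'
  set m2 := map (ψ : B →+* k) b'
  have hm1 : m1 ∈ LinF σ k := (hom_of_map_inj _ hinj a' (by rw [ha']; exact ha)).map _
  have hm2 : m2 ∈ LinF σ k := (hom_of_map_inj _ hinj b' (by rw [hb']; exact hb)).map _
  have hm0 : m1 * m2 ≠ 0 := by rw [← h2]; exact hq0
  obtain ⟨hm10, hm20⟩ := mul_ne_zero_iff.1 hm0
  have hM : ∀ m ∈ LinF σ k, map (algebraMap k L) m ∈ LinF σ L := fun m hm => IsHomogeneous.map hm _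
  have hM0 : ∀ m : MvPolynomial σ k, m ≠ 0 → map (algebraMap k L) m ≠ 0 := fun m hm h0 =>
    hm (hinjL (h0.trans (map_zero _).symm))
  have hprod : a * b = map (algebraMap k L) m1 * map (algebraMap k L) m2 := by rw [← h, h2, map_mul]
  have hpr := lin_prime (hM m1 hm1) (hM0 m1 hm10)
  have hdvd : map (algebraMap k L) m1 ∣ a * b := ⟨_, hprod⟩
  rcases hpr.dvd_or_dvd hdvd with hd | hd
  · obtain ⟨κ, hκ⟩ := dvd_prop (hM0 m1 hm10) hd (by rw [lin_deg ha ha0, lin_deg (hM m1 hm1) (hM0 m1 hm10)])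
    exact ⟨m1, hm1, hm10, κ, by rintro rfl; simp at hκ; exact ha0 hκ, hκ⟩
  · obtain ⟨κ, hκ⟩ := dvd_prop (hM0 m1 hm10) hd (by rw [lin_deg hb hb0, lin_deg (hM m1 hm1) (hM0 m1 hm10)])
    have hκ0 : κ ≠ 0 := by rintro rfl; simp at hκ; exact hb0 hκ
    refine ⟨m2, hm2, hm20, κ⁻¹, inv_ne_zero hκ0, ?_⟩
    have h3 : (C κ * a) * map (algebraMap k L) m1 = map (algebraMap k L) m2 * map (algebraMap k L) m1 := by
      rw [mul_comm (map (algebraMap k L) m2), ← hprod, hκ]; ring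
    have h4 := mul_right_cancel₀ (hM0 m1 hm10) h3
    rw [← h4, ← mul_assoc, ← C_mul, inv_mul_cancel₀ hκ0, C_1, one_mul]

theorem aq_comp2 {K : Type u} [Field K] {t : ℕ} {q2 : MvPolynomial (Fin t) K} (hq : q2 ∈ QuadF (Fin t) K)
    (l : Fin t → K) (c : K) : homogeneousComponent 2 (aq q2 l c) = q2 := by
  have hl : (∑ j, C (l j) * X j : MvPolynomial (Fin t) K).IsHomogeneous 1 := by
    refine Submodule.sum_mem (homogeneousSubmodule (Fin t) K 1) fun j _ => ?_
    rw [C_mul']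
    exact Submodule.smul_mem _ _ (X_mem_LinF j)
  have hc : (C c : MvPolynomial (Fin t) K).IsHomogeneous 0 := isHomogeneous_C _ _
  have hq' : q2.IsHomogeneous 2 := hq
  unfold aq
  rw [map_add, map_add, homogeneousComponent_of_mem hq', homogeneousComponent_of_mem hl, homogeneousComponent_of_mem hc]
  simp

theorem step1 [Finite σ] (p : σ → Ω) {c : ℕ} (hr : ((Nat.card σ : ℕ) : ℕ∞) ≤ rk k (Set.range p) + c)
    (hL : ∀ l ∈ LinF σ k, aeval p l = 0 → l = 0) (U : Submodule k (MvPolynomial σ k)) (hU : U ≤ LinF σ k)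
    (h1 : rk k (aeval p '' (U : Set (MvPolynomial σ k))) + c ≤ (Module.finrank k U : ℕ))
    (v : MvPolynomial σ k) (hv : v ∈ QuadF σ k) (hvp : aeval p v = 0) :
    v ∈ Algebra.adjoin k (U : Set (MvPolynomial σ k)) := by
  obtain ⟨t, z, hz, hN, -, hrk, hq⟩ := tower_point p U hU
  obtain ⟨q2, l, q0, hq2, hl, hq0, hveq⟩ := hq v hv
  set K := IntermediateField.adjoin k (aeval p '' (U : Set (MvPolynomial σ k)))
  have hindep : AlgebraicIndependent K (fun j => aeval p (z j)) := by
    apply indep_of_rk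
    rw [hN] at hr
    have h2 := hr.trans (add_le_add_left hrk _)
    generalize rk K (Set.range fun j => aeval p (z j)) = b at *
    generalize rk k (aeval p '' (U : Set (MvPolynomial σ k))) = a at *
    have h3 : ((t : ℕ) : ℕ∞) + (Module.finrank k U : ℕ) ≤ b + (Module.finrank k U : ℕ) := by
      calc ((t : ℕ) : ℕ∞) + (Module.finrank k U : ℕ) ≤ a + b + c := by exact_mod_cast h2
        _ = b + (a + c) := by ring
        _ ≤ _ := by gcongr
    simpa using (ENat.add_le_add_iff_right (ENat.natCast_ne_top _)).1 h3
  have hUK : ∀ u ∈ U, aeval p u ∈ K := fun u hu => IntermediateField.subset_adjoin _ _ ⟨u, hu, rfl⟩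
  have hAK : aeval p q0 ∈ K := by
    have : Algebra.adjoin k (U : Set (MvPolynomial σ k)) ≤ K.toSubalgebra.comap (aeval p) := Algebra.adjoin_le hUK
    exact this hq0
  have he := eval_aq (K := K) p z l q2 q0 (fun j => ⟨_, hUK _ (hl j)⟩) ⟨_, hAK⟩ (fun j => rfl) rfl
  rw [← hveq, hvp] at he
  have h0 := hindep (he.symm.trans (map_zero _).symm)
  obtain ⟨e2, e1, -⟩ := aq_zero (IsHomogeneous.map hq2 _) h0
  have e2' : q2 = 0 := map_injective _ (algebraMap k K).injective (e2.trans (map_zero _).symm)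
  have e1' : ∀ j, l j = 0 := fun j => hL _ (hU (hl j)) (congrArg Subtype.val (e1 j))
  rw [hveq, e2']
  simp [e1', hq0]

end
end

section
open MvPolynomial

section
variable {k : Type u} {Ω : Type u} [Field k] [Field Ω] [Algebra k Ω] {σ : Type}

theorem alg_mem_range [IsAlgClosed k] {K : Type u} [Field K] [Algebra k K] {x : K} (h : IsIntegral k x) :
    x ∈ Set.range (algebraMap k K) :=
  minpoly.mem_range_of_degree_eq_one k x (IsAlgClosed.degree_eq_one_of_irreducible k (minpoly.irreducible h))

theorem pencil [IsAlgClosed k] (Y Λ E : Submodule k Ω) [Module.Finite k Λ] [Module.Finite k E]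
    (h : Y ≤ Λ ⊔ E) (κ : Ω) (hκ : ∀ x ∈ Λ, κ * x ∈ Λ ⊔ E) (hk : κ ∉ Set.range (algebraMap k Ω)) :
    rk k (Y : Set Ω) ≤ (Module.finrank k E + 1 : ℕ) := by
  obtain ⟨m, e, hm, he⟩ : ∃ (m : ℕ) (e : Fin m → Ω), m = Module.finrank k E ∧ Submodule.span k (Set.range e) = E := by
    let b := Module.finBasis k E
    refine ⟨_, fun i => b i, rfl, ?_⟩
    have := congrArg (Submodule.map E.subtype) b.span_eq
    rw [Submodule.map_span, Submodule.map_top, Submodule.range_subtype, ← Set.range_comp] at this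
    exact this
  let F := IntermediateField.adjoin k (insert κ (E : Set Ω))
  let κ' : F := ⟨κ, IntermediateField.subset_adjoin _ _ (Set.mem_insert _ _)⟩
  let R : Submodule F Ω := LinearMap.range (Algebra.linearMap F Ω)
  have hER : ∀ x ∈ E, x ∈ R := fun x hx =>
    ⟨⟨x, IntermediateField.subset_adjoin _ _ (Set.mem_insert_of_mem _ hx)⟩, rfl⟩
  have hΛ : ∀ x ∈ Λ, x ∈ R := by
    by_contra hc
    push Not at hc
    obtain ⟨x, hx, hxR⟩ := hc
    apply hk
    let π : Ω →ₗ[k] (Ω ⧸ R) := (R.mkQ).restrictScalars k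
    have hIntegral : IsIntegral k κ' := by
      apply isIntegral_of_smul_mem_submodule (M := Ω ⧸ R) (Λ.map π)
      · intro h0
        have : π x ∈ Λ.map π := Submodule.mem_map_of_mem hx
        rw [h0, Submodule.mem_bot] at this
        exact hxR ((Submodule.Quotient.mk_eq_zero R).1 this)
      · exact (Module.Finite.iff_fg.1 inferInstance)
      · rintro _ ⟨y, hy, rfl⟩
        obtain ⟨a, ha, b, hb, hab⟩ := Submodule.mem_sup.1 (hκ y hy)
        have : κ' • π y = π a := by
          have h1 : κ' • π y = π (κ * y) := (R.mkQ.map_smul κ' y).symm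
          rw [h1, ← hab, map_add]
          have : π b = 0 := (Submodule.Quotient.mk_eq_zero R).2 (hER b hb)
          rw [this, add_zero]
        rw [this]
        exact Submodule.mem_map_of_mem ha
    obtain ⟨c, hc⟩ := alg_mem_range hIntegral
    exact ⟨c, congrArg Subtype.val hc⟩
  have hYF : ∀ y ∈ Y, y ∈ F := by
    intro y hy
    obtain ⟨a, ha, b, hb, rfl⟩ := Submodule.mem_sup.1 (h hy)
    have : a + b ∈ R := add_mem (hΛ a ha) (hER b hb)
    obtain ⟨c, hc⟩ := this
    rw [← hc]
    exact c.2
  have h1 : rk k (Y : Set Ω) ≤ rk k (insert κ (E : Set Ω)) :=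
    rk_le_of_algOver fun y hy => AlgOver.of_field (hYF y hy)
  have h2 : rk k (insert κ (E : Set Ω)) ≤ rk k ((Set.range e) ∪ {κ}) := by
    apply rk_le_of_algOver
    rintro a (rfl | ha)
    · exact AlgOver.of_mem (Or.inr rfl)
    · exact (AlgOver.of_span (by rw [he]; exact ha)).mono Set.subset_union_left
  refine h1.trans (h2.trans ((rk_union_le_encard _ _).trans ?_))
  rw [Set.encard_singleton]
  push_cast
  gcongr
  rw [← hm]
  refine (rk_le_encard _).trans ?_
  rw [← Set.image_univ]
  refine (Set.encard_image_le _ _).trans ?_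
  simp [Set.encard_univ]

end
end

section
open MvPolynomial

section
variable {k : Type u} {Ω : Type u} [Field k] [Field Ω] [Algebra k Ω] {σ : Type}

theorem aeval_lin_mem {t : ℕ} (z : Fin t → MvPolynomial σ k) (W : Submodule k (MvPolynomial σ k)) (hz : ∀ j, z j ∈ W)
    (ℓ : MvPolynomial (Fin t) k) (hℓ : ℓ ∈ LinF (Fin t) k) : aeval z ℓ ∈ W := by
  rw [LinF_eq_span] at hℓ
  have h := Submodule.mem_map_of_mem (f := (aeval z : _ →ₐ[k] MvPolynomial σ k).toLinearMap) hℓ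
  rw [Submodule.map_span] at h
  refine (Submodule.span_le.2 ?_) h
  rintro _ ⟨_, ⟨j, rfl⟩, rfl⟩
  simpa using hz j

theorem finrank_sup_singleton {M : Type*} [AddCommGroup M] [Module k M] (U : Submodule k M) [Module.Finite k U] (x : M) (hx : x ∉ U) :
    Module.finrank k ↥(U ⊔ Submodule.span k {x}) = Module.finrank k U + 1 := by
  have h := Submodule.finrank_sup_add_finrank_inf_eq U (Submodule.span k {x})
  have h0 : x ≠ 0 := by rintro rfl; exact hx U.zero_mem
  have h1 : U ⊓ Submodule.span k {x} = ⊥ := by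
    rw [eq_bot_iff]
    rintro y ⟨hy, hy'⟩
    obtain ⟨c, rfl⟩ := Submodule.mem_span_singleton.1 hy'
    by_cases hc : c = 0
    · simp [hc]
    · exact (hx (by simpa [smul_smul, hc] using U.smul_mem c⁻¹ hy)).elim
  rw [h1, finrank_bot, finrank_span_singleton h0] at h
  omega

theorem step2_red [IsAlgClosed k] [Finite σ] (p : σ → Ω) {c : ℕ} (hr : ((Nat.card σ : ℕ) : ℕ∞) ≤ rk k (Set.range p) + (c + 1 : ℕ))
    (hL : ∀ l ∈ LinF σ k, aeval p l = 0 → l = 0) 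
    (U : Submodule k (MvPolynomial σ k)) (hU : U ≤ LinF σ k)
    (h1 : rk k (aeval p '' (U : Set (MvPolynomial σ k))) + c ≤ (Module.finrank k U : ℕ))
    {t : ℕ} (z : Fin t → MvPolynomial σ k) (hz : ∀ j, z j ∈ LinF σ k)
    (hzU : ∀ ℓ ∈ LinF (Fin t) k, aeval z ℓ ∈ U → ℓ = 0)
    (K : IntermediateField k Ω) (hK : K = IntermediateField.adjoin k (aeval p '' (U : Set (MvPolynomial σ k))))
    (q2 : MvPolynomial (Fin t) k) (hq2 : q2 ∈ QuadF (Fin t) k) (h0 : q2 ≠ 0) (l : Fin t → K) (e : K)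
    (a b : MvPolynomial (Fin t) K) (ha : ¬ IsUnit a) (hb : ¬ IsUnit b) (hab : aq (map (algebraMap k K) q2) l e = a * b)
    (ha0 : aeval (fun j => aeval p (z j)) a = 0) :
    ∃ U' : Submodule k (MvPolynomial σ k), U ≤ U' ∧ U' ≤ LinF σ k ∧ Module.finrank k U' ≤ Module.finrank k U + (c + 1) ∧
      ∀ v ∈ QuadF σ k, aeval p v = 0 → v ∈ Algebra.adjoin k (U' : Set (MvPolynomial σ k)) := by
  have hq2' : map (algebraMap k K) q2 ∈ QuadF (Fin t) K := IsHomogeneous.map hq2 _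
  have hc2 := aq_comp2 hq2' l e
  have hd := aq_deg hq2' l e
  have hm0 : map (algebraMap k K) q2 ≠ 0 := fun h => h0 (map_injective _ (algebraMap k K).injective (h.trans (map_zero _).symm))
  have hF0 : aq (map (algebraMap k K) q2) l e ≠ 0 := fun h => hm0 (by rw [← hc2, h, map_zero])
  rw [hab] at hF0 hd hc2
  obtain ⟨han, hbn⟩ := mul_ne_zero_iff.1 hF0
  rw [totalDegree_mul_of_isDomain han hbn] at hd
  have hda : a.totalDegree ≠ 0 := fun h => ha (isUnit_of_deg0 han h)
  have hdb : b.totalDegree ≠ 0 := fun h => hb (isUnit_of_deg0 hbn h)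
  obtain ⟨l1, hl1, e1, rfl⟩ := deg1_split (F := a) (by omega)
  obtain ⟨l2, hl2, e2, rfl⟩ := deg1_split (F := b) (by omega)
  have hprod : map (algebraMap k K) q2 = l1 * l2 := by
    rw [← hc2]
    have : (l1 + C e1) * (l2 + C e2) = l1 * l2 + (C e2 * l1 + C e1 * l2) + C (e1 * e2) := by
      rw [C_mul]; ring
    rw [this, map_add, map_add]
    have g1 : (l1 * l2).IsHomogeneous 2 := IsHomogeneous.mul hl1 hl2
    have g2 : (C e2 * l1 + C e1 * l2).IsHomogeneous 1 := by
      rw [C_mul', C_mul']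
      exact add_mem (Submodule.smul_mem (LinF (Fin t) K) _ hl1) (Submodule.smul_mem (LinF (Fin t) K) _ hl2)
    rw [homogeneousComponent_of_mem g1, homogeneousComponent_of_mem g2, homogeneousComponent_of_mem (isHomogeneous_C _ (e1*e2))]
    simp
  obtain ⟨ℓ, hℓ, hℓ0, κ, hκ0, hκ⟩ := factor_descend q2 h0 l1 l2 hl1 hl2 hprod
  have hmem : aeval p (aeval z ℓ) ∈ K := by
    have h2 : aeval p (aeval z ℓ) = aeval (fun j => aeval p (z j)) (map (algebraMap k K) ℓ) := by
      rw [aeval_map_algebraMap]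
      have : (aeval p : _ →ₐ[k] Ω).comp (aeval z) = aeval (fun j => aeval p (z j)) := by
        apply MvPolynomial.algHom_ext; intro i; simp
      rw [← this]; rfl
    rw [hκ, map_add, map_mul, aeval_C, aeval_C, ← h2] at ha0
    have h3 : aeval p (aeval z ℓ) = ((-e1 / κ : K) : Ω) := by
      have hk' : (κ : Ω) ≠ 0 := fun h => hκ0 (Subtype.ext h)
      push_cast
      rw [eq_div_iff hk', eq_neg_iff_add_eq_zero, mul_comm]
      exact ha0
    rw [h3]; exact (-e1/κ : K).2
  have hfin : Module.Finite k U := Submodule.finiteDimensional_of_le hU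
  have hnot : aeval z ℓ ∉ U := fun h => hℓ0 (hzU _ hℓ h)
  have hfr := finrank_sup_singleton U _ hnot
  have hU' : U ⊔ Submodule.span k {aeval z ℓ} ≤ LinF σ k := sup_le hU (by
      rw [Submodule.span_singleton_le_iff_mem]; exact aeval_lin_mem z _ hz ℓ hℓ)
  refine ⟨U ⊔ Submodule.span k {aeval z ℓ}, le_sup_left, hU', by omega, ?_⟩
  · intro v hv hvp
    apply step1 p hr hL _ hU' _ v hv hvp
    rw [hfr]
    have h4 : rk k (aeval p '' ((U ⊔ Submodule.span k {aeval z ℓ} : Submodule k (MvPolynomial σ k)) : Set (MvPolynomial σ k))) ≤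
        rk k (aeval p '' (U : Set (MvPolynomial σ k))) := by
      apply rk_le_of_algOver
      rintro _ ⟨y, hy, rfl⟩
      apply AlgOver.of_field
      obtain ⟨y1, hy1, y2, hy2, rfl⟩ := Submodule.mem_sup.1 hy
      obtain ⟨d, rfl⟩ := Submodule.mem_span_singleton.1 hy2
      rw [map_add, map_smul]
      refine add_mem (IntermediateField.subset_adjoin _ _ ⟨_, hy1, rfl⟩) ?_
      rw [← hK]
      exact K.smul_mem hmem
    push_cast
    rw [← add_assoc]
    gcongr
    exact (add_le_add_left h4 _).trans h1

end
end

section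
open MvPolynomial

section
variable {k : Type u} {Ω : Type u} [Field k] [Field Ω] [Algebra k Ω] {σ : Type}

theorem step2_pencil [IsAlgClosed k] [Finite σ] (p : σ → Ω) {c : ℕ}
    (hL : ∀ l ∈ LinF σ k, aeval p l = 0 → l = 0) 
    (U : Submodule k (MvPolynomial σ k)) (hU : U ≤ LinF σ k)
    (h1 : ((Module.finrank k U : ℕ) : ℕ∞) ≤ rk k (aeval p '' (U : Set (MvPolynomial σ k))) + c)
    {t : ℕ} (z : Fin t → MvPolynomial σ k) (hz : ∀ j, z j ∈ LinF σ k)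
    (lf lg : Fin t → MvPolynomial σ k) (hlf : ∀ j, lf j ∈ U) (hlg : ∀ j, lg j ∈ U)
    (κ : Ω) (hκ : κ ∉ Set.range (algebraMap k Ω)) (hg : ∀ j, aeval p (lg j) = κ * aeval p (lf j)) :
    ∃ W : Submodule k (MvPolynomial σ k), W ≤ LinF σ k ∧ Module.finrank k W ≤ c + 1 ∧
      ∀ (lv : Fin t → MvPolynomial σ k) (κ' : Ω), (∀ j, lv j ∈ U) → (∀ j, aeval p (lv j) = κ' * aeval p (lf j)) →
      ∑ j, z j * lv j ∈ Algebra.adjoin k ((U ⊔ W : Submodule k (MvPolynomial σ k)) : Set (MvPolynomial σ k)) := by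
  have hfin : Module.Finite k U := Submodule.finiteDimensional_of_le hU
  let Λ := Submodule.span k (Set.range lf)
  have hΛU : Λ ≤ U := Submodule.span_le.2 (by rintro _ ⟨j, rfl⟩; exact hlf j)
  obtain ⟨b, hbli, hbsp, hbΛ⟩ := exists_fin_basis Λ (hΛU.trans hU)
  have hfinΛ : Module.Finite k Λ := Submodule.finiteDimensional_of_le hΛU
  -- dimension bound
  have hdim : Module.finrank k Λ ≤ c + 1 := by
    let φ : MvPolynomial σ k →ₗ[k] Ω := (aeval p : _ →ₐ[k] Ω).toLinearMap
    obtain ⟨E, hE⟩ := Submodule.exists_isCompl (Λ.comap U.subtype)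
    let E' := E.map U.subtype
    have hsup : U ≤ Λ ⊔ E' := by
      intro u hu
      have : (⟨u, hu⟩ : U) ∈ Λ.comap U.subtype ⊔ E := by rw [hE.sup_eq_top]; trivial
      obtain ⟨a, ha, b, hb, hab⟩ := Submodule.mem_sup.1 this
      have := congrArg Subtype.val hab
      change (a : MvPolynomial σ k) + b = u at this
      rw [← this]
      exact Submodule.add_mem_sup ha ⟨b, hb, rfl⟩
    have hdimE : Module.finrank k Λ + Module.finrank k E' = Module.finrank k U := by
      have h2 := Submodule.finrank_add_eq_of_isCompl hE
      have h3 : Module.finrank k (Λ.comap U.subtype) = Module.finrank k Λ :=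
        (Submodule.comapSubtypeEquivOfLe hΛU).finrank_eq
      have h4 : Module.finrank k E' = Module.finrank k E := (Submodule.equivMapOfInjective U.subtype U.injective_subtype E).finrank_eq.symm
      omega
    have hp := pencil (k := k) (U.map φ) (Λ.map φ) (E'.map φ) (by rw [← Submodule.map_sup]; exact Submodule.map_mono hsup) κ
      (by
        rw [← Submodule.map_sup]
        rintro _ ⟨x, hx, rfl⟩
        have hx' : x ∈ Submodule.span k (Set.range lf) := hx
        clear hx
        induction hx' using Submodule.span_induction with
        | mem x hx => 
          obtain ⟨j, rfl⟩ := hx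
          exact ⟨lg j, hsup (hlg j), hg j⟩
        | zero => simp
        | add x y _ _ hx hy => rw [map_add, mul_add]; exact add_mem hx hy
        | smul a x _ hx => rw [map_smul, mul_smul_comm]; exact Submodule.smul_mem _ _ hx) hκ
    have h5 : Module.finrank k (E'.map φ) ≤ Module.finrank k E' := Submodule.finrank_map_le _ _
    have h6 : ((Module.finrank k U : ℕ) : ℕ∞) ≤ (Module.finrank k (E'.map φ) + 1 : ℕ) + c := h1.trans (add_le_add_left hp _)
    have h7 : Module.finrank k U ≤ (Module.finrank k (E'.map φ) + 1) + c := by exact_mod_cast h6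
    omega
  have hA : ∀ i, ∃ a : Fin t → k, ∑ j, a j • lf j = b i := fun i =>
    (Submodule.mem_span_range_iff_exists_fun k).1 (hbΛ i)
  choose a ha using hA
  have hC : ∀ j, ∃ d : Fin (Module.finrank k Λ) → k, ∑ i, d i • b i = lf j := fun j =>
    (Submodule.mem_span_range_iff_exists_fun k).1 (by rw [hbsp]; exact Submodule.subset_span ⟨j, rfl⟩)
  choose d hd using hC
  let z' : Fin (Module.finrank k Λ) → MvPolynomial σ k := fun i => ∑ j, d j i • z j
  refine ⟨Submodule.span k (Set.range z'), ?_, ?_, ?_⟩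
  · rw [Submodule.span_le]
    rintro _ ⟨i, rfl⟩
    exact Submodule.sum_mem _ fun j _ => Submodule.smul_mem _ _ (hz j)
  · exact (finrank_range_le_card z').trans (by simpa using hdim)
  · intro lv κ' hlv hv
    have hT : ∀ j, lv j = ∑ i, d j i • ∑ j', a i j' • lv j' := by
      intro j
      rw [← sub_eq_zero]
      apply hL
      · exact sub_mem (hU (hlv j)) (Submodule.sum_mem _ fun i _ => Submodule.smul_mem _ _ 
          (Submodule.sum_mem _ fun j' _ => Submodule.smul_mem _ _ (hU (hlv j'))))
      · have h8 := congrArg (aeval p) (hd j)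
        simp only [← ha, map_sum, map_smul] at h8
        simp only [map_sub, map_sum, map_smul, hv]
        rw [← h8, sub_eq_zero, Finset.mul_sum]
        refine Finset.sum_congr rfl fun i _ => ?_
        rw [mul_smul_comm, Finset.mul_sum]
        simp only [mul_smul_comm]
    have : ∑ j, z j * lv j = ∑ i, z' i * ∑ j', a i j' • lv j' := by
      calc ∑ j, z j * lv j = ∑ j, z j * ∑ i, d j i • (fun i => ∑ j', a i j' • lv j') i :=
            Finset.sum_congr rfl fun j _ => congrArg (z j * ·) (hT j)
        _ = ∑ i, z' i * (fun i => ∑ j', a i j' • lv j') i := by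
          generalize (fun i => ∑ j', a i j' • lv j') = y
          simp only [z', Finset.sum_mul, Finset.mul_sum, mul_smul_comm, smul_mul_assoc]
          rw [Finset.sum_comm]
    rw [this]
    refine Subalgebra.sum_mem _ fun i _ => Subalgebra.mul_mem _ ?_ (Subalgebra.sum_mem _ fun j _ => Subalgebra.smul_mem _ ?_ _)
    · exact Algebra.subset_adjoin (Submodule.mem_sup_right (Submodule.subset_span ⟨i, rfl⟩))
    · exact Algebra.subset_adjoin (Submodule.mem_sup_left (hlv j))

set_option maxHeartbeats 1000000 in
theorem step2 [IsAlgClosed k] [Finite σ] (p : σ → Ω) {c : ℕ} (hr : ((Nat.card σ : ℕ) : ℕ∞) ≤ rk k (Set.range p) + (c + 1 : ℕ))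
    (hL : ∀ l ∈ LinF σ k, aeval p l = 0 → l = 0) 
    (V : Submodule k (MvPolynomial σ k)) (hV : V ≤ QuadF σ k) (hVp : ∀ v ∈ V, aeval p v = 0)
    (U : Submodule k (MvPolynomial σ k)) (hU : U ≤ LinF σ k)
    (h1 : rk k (aeval p '' (U : Set (MvPolynomial σ k))) + c ≤ (Module.finrank k U : ℕ)) :
    (∃ U' : Submodule k (MvPolynomial σ k), U ≤ U' ∧ U' ≤ LinF σ k ∧ Module.finrank k U' ≤ Module.finrank k U + (c + 1) ∧
      ∀ v ∈ V, v ∈ Algebra.adjoin k (U' : Set (MvPolynomial σ k))) ∨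
    (∃ f ∈ V, ∀ v ∈ V, ∃ κ : k, v - κ • f ∈ Algebra.adjoin k (U : Set (MvPolynomial σ k))) := by
  by_cases h1' : rk k (aeval p '' (U : Set (MvPolynomial σ k))) + (c + 1 : ℕ) ≤ (Module.finrank k U : ℕ)
  · exact Or.inl ⟨U, le_rfl, hU, by omega, fun v hv => step1 p hr hL U hU h1' v (hV hv) (hVp v hv)⟩
  have h1'' : ((Module.finrank k U : ℕ) : ℕ∞) ≤ rk k (aeval p '' (U : Set (MvPolynomial σ k))) + c := by
    push Not at h1'
    have := Order.lt_add_one_iff_of_not_isMax (x := ((Module.finrank k U : ℕ) : ℕ∞)) (y := rk k (aeval p '' (U : Set (MvPolynomial σ k))) + c)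
      (by
        rw [isMax_iff_eq_top]
        exact ne_top_of_le_ne_top (ENat.natCast_ne_top _) h1)
    rw [← this, add_assoc]; exact_mod_cast h1'
  obtain ⟨t, z, hz, hN, hzU, hrk, hq⟩ := tower_point p U hU
  choose! q2 l q0 hq2 hl hq0 hveq using hq
  obtain ⟨K, hKdef⟩ : ∃ K, K = IntermediateField.adjoin k (aeval p '' (U : Set (MvPolynomial σ k))) := ⟨_, rfl⟩
  rw [← hKdef] at hrk
  have hUK : ∀ u ∈ U, aeval p u ∈ K := fun u hu => by rw [hKdef]; exact IntermediateField.subset_adjoin _ _ ⟨u, hu, rfl⟩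
  have hAK : ∀ u ∈ Algebra.adjoin k (U : Set (MvPolynomial σ k)), aeval p u ∈ K := by
    have : Algebra.adjoin k (U : Set (MvPolynomial σ k)) ≤ K.toSubalgebra.comap (aeval p) := Algebra.adjoin_le hUK
    exact fun u hu => this hu
  classical
  obtain ⟨bar, hbar⟩ : ∃ bar : MvPolynomial σ k → K, ∀ u, aeval p u ∈ K → aeval p u = bar u :=
    ⟨fun u => if h : aeval p u ∈ K then ⟨_, h⟩ else 0, fun u hu => by simp [hu]⟩
  obtain ⟨tl, htl⟩ : ∃ tl : MvPolynomial σ k → MvPolynomial (Fin t) K, ∀ v, tl v = aq (map (algebraMap k K) (q2 v)) (fun j => bar (l v j)) (bar (q0 v)) :=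
    ⟨_, fun v => rfl⟩
  have hr' : ((t - 1 : ℕ) : ℕ∞) ≤ rk K (Set.range fun j => aeval p (z j)) := by
    rw [hN] at hr
    have h2 := hr.trans (add_le_add_left hrk _)
    generalize rk K (Set.range fun j => aeval p (z j)) = b at *
    generalize rk k (aeval p '' (U : Set (MvPolynomial σ k))) = a at *
    have h3 : ((t : ℕ) : ℕ∞) + (Module.finrank k U : ℕ) ≤ (b + 1) + (Module.finrank k U : ℕ) := by
      calc ((t : ℕ) : ℕ∞) + (Module.finrank k U : ℕ) ≤ a + b + (c + 1) := by exact_mod_cast h2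
        _ = b + 1 + (a + c) := by ring
        _ ≤ _ := by gcongr
    have h4 := (ENat.add_le_add_iff_right (ENat.natCast_ne_top _)).1 h3
    rw [ENat.natCast_sub]
    exact tsub_le_iff_right.2 h4
  have F1 : ∀ v ∈ V, aeval (fun j => aeval p (z j)) (tl v) = 0 := by
    intro v hv
    have he := eval_aq (K := K) p z (l v) (q2 v) (q0 v) (fun j => bar (l v j)) (bar (q0 v))
      (fun j => hbar _ (hUK _ (hl v (hV hv) j))) (hbar _ (hAK _ (hq0 v (hV hv))))
    rw [← hveq v (hV hv), hVp v hv] at he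
    rw [htl, ← he]
  have F2 : ∀ v ∈ V, ∀ f ∈ V, ∀ κ : K, tl v = C κ * tl f → map (algebraMap k K) (q2 v) = κ • map (algebraMap k K) (q2 f) ∧
      ∀ j, aeval p (l v j) = κ * aeval p (l f j) := by
    intro v hv f hf κ h
    rw [htl, htl, ← sub_eq_zero, aq_sub] at h
    obtain ⟨e2, e1, -⟩ := aq_zero (sub_mem (IsHomogeneous.map (hq2 v (hV hv)) _ : _ ∈ QuadF (Fin t) K)
      (Submodule.smul_mem (QuadF (Fin t) K) κ (IsHomogeneous.map (hq2 f (hV hf)) _))) h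
    refine ⟨sub_eq_zero.1 e2, fun j => ?_⟩
    rw [hbar _ (hUK _ (hl v (hV hv) j)), hbar _ (hUK _ (hl f (hV hf) j)), sub_eq_zero.1 (e1 j)]
    rfl
  have F3 : ∀ v ∈ V, ∀ f ∈ V, ∀ κ : k, tl v = C (algebraMap k K κ) * tl f → 
      v - κ • f ∈ Algebra.adjoin k (U : Set (MvPolynomial σ k)) := by
    intro v hv f hf κ h
    obtain ⟨g2, g1⟩ := F2 v hv f hf _ h
    have e2 : q2 v = κ • q2 f := by
      apply map_injective _ (algebraMap k K).injective
      rw [g2, smul_eq_C_mul, smul_eq_C_mul, map_mul, map_C]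
    have e1 : ∀ j, l v j = κ • l f j := by
      intro j
      rw [← sub_eq_zero]
      apply hL
      · exact sub_mem (hU (hl v (hV hv) j)) (Submodule.smul_mem _ _ (hU (hl f (hV hf) j)))
      · rw [map_sub, map_smul, g1 j, Algebra.smul_def, sub_eq_zero]; rfl
    have : v - κ • f = q0 v - κ • q0 f := by
      have a1 := hveq v (hV hv)
      have a2 := hveq f (hV hf)
      rw [e2, map_smul] at a1
      simp only [e1, mul_smul_comm, ← Finset.smul_sum] at a1
      calc v - κ • f = (κ • (aeval z) (q2 f) + κ • ∑ i, z i * l f i + q0 v) - κ • (aeval z (q2 f) + ∑ j, z j * l f j + q0 f) := by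
            rw [← a1, ← a2]
        _ = _ := by simp only [smul_add]; ring
    rw [this]
    exact Subalgebra.sub_mem _ (hq0 v (hV hv)) (Subalgebra.smul_mem _ (hq0 f (hV hf)) _)
  have hprin : ∀ f ∈ V, Irreducible (tl f) → (∀ v ∈ V, (tl v).totalDegree ≤ (tl f).totalDegree) → 
      ∀ v ∈ V, ∃ κ, tl v = C κ * tl f := by
    intro f hf hirr hdeg v hv
    refine dvd_prop hirr.ne_zero ?_ (hdeg v hv)
    exact principal_of_rk (k := K) (fun j => aeval p (z j)) (tl f) (tl v) hirr.prime (F1 f hf) (F1 v hv) (m := t - 1)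
      (by simp; omega) hr'
  have hmapinj : Function.Injective (map (σ := Fin t) (algebraMap k K)) := map_injective _ (algebraMap k K).injective
  by_cases hA : ∃ f ∈ V, q2 f ≠ 0
  · obtain ⟨f, hf, hf0⟩ := hA
    have hm0 : map (algebraMap k K) (q2 f) ≠ 0 := fun h => hf0 (hmapinj (h.trans (map_zero _).symm))
    have hq2' : map (algebraMap k K) (q2 f) ∈ QuadF (Fin t) K := IsHomogeneous.map (hq2 f (hV hf)) _
    have hc2 := aq_comp2 hq2' (fun j => bar (l f j)) (bar (q0 f))
    rw [← htl] at hc2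
    have hdeg : 2 ≤ (tl f).totalDegree := by
      by_contra hlt
      rw [homogeneousComponent_eq_zero _ _ (by omega)] at hc2
      exact hm0 hc2.symm
    have htf0 : tl f ≠ 0 := by intro h; rw [h] at hdeg; simp at hdeg
    by_cases hirr : Irreducible (tl f)
    · right
      refine ⟨f, hf, fun v hv => ?_⟩
      obtain ⟨κ, hκ⟩ := hprin f hf hirr (fun v hv => by
        refine le_trans ?_ hdeg
        rw [htl]; exact aq_deg (IsHomogeneous.map (hq2 v (hV hv)) _) _ _) v hv
      obtain ⟨g2, -⟩ := F2 v hv f hf κ hκ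
      obtain ⟨m, hm⟩ := ne_zero_iff.1 hf0
      have hcm := congrArg (coeff m) g2
      rw [coeff_map, coeff_smul, coeff_map, smul_eq_mul] at hcm
      have hm' : algebraMap k K (coeff m (q2 f)) ≠ 0 := by
        simpa using hm
      have hκ' : κ = algebraMap k K (coeff m (q2 v) / coeff m (q2 f)) := by
        rw [map_div₀, eq_div_iff hm', hcm]
      exact ⟨_, F3 v hv f hf _ (by rw [← hκ']; exact hκ)⟩
    · left
      have : ∃ a b, ¬ IsUnit a ∧ ¬ IsUnit b ∧ tl f = a * b := by
        rw [irreducible_iff] at hirr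
        push Not at hirr
        obtain ⟨a, b, h, h1, h2⟩ := hirr (fun hu => by
          rw [isUnit_iff_totalDegree_of_isReduced] at hu; omega)
        exact ⟨a, b, h1, h2, h⟩
      obtain ⟨a, b, ha, hb, hab⟩ := this
      have h0 := F1 f hf
      rw [hab, map_mul, mul_eq_zero] at h0
      rw [htl] at hab
      rcases h0 with h0 | h0
      · obtain ⟨U', g1, g2, g3, g4⟩ := step2_red p hr hL U hU h1 z hz hzU K hKdef (q2 f) (hq2 f (hV hf)) hf0 _ _ a b ha hb hab h0
        exact ⟨U', g1, g2, g3, fun v hv => g4 v (hV hv) (hVp v hv)⟩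
      · rw [mul_comm] at hab
        obtain ⟨U', g1, g2, g3, g4⟩ := step2_red p hr hL U hU h1 z hz hzU K hKdef (q2 f) (hq2 f (hV hf)) hf0 _ _ b a hb ha hab h0
        exact ⟨U', g1, g2, g3, fun v hv => g4 v (hV hv) (hVp v hv)⟩
  · push Not at hA
    by_cases h0 : ∀ v ∈ V, tl v = 0
    · left
      refine ⟨U, le_rfl, hU, by omega, fun v hv => ?_⟩
      have := F3 v hv v hv 0 (by simp [h0 v hv])
      simpa using this
    push Not at h0
    obtain ⟨f, hf, hf0⟩ := h0
    have hdeg : ∀ v ∈ V, (tl v).totalDegree ≤ 1 := by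
      intro v hv
      rw [htl, hA v hv, map_zero]
      unfold aq
      rw [zero_add]
      refine (totalDegree_add _ _).trans (max_le ?_ (by simp))
      refine (totalDegree_finsetSum _ _).trans (Finset.sup_le fun j _ => ?_)
      refine (totalDegree_mul _ _).trans ?_
      simp
    have hdf : (tl f).totalDegree = 1 := by
      refine le_antisymm (hdeg f hf) ?_
      by_contra hlt
      have hu := isUnit_of_deg0 hf0 (by omega)
      have := hu.map (aeval (fun j => aeval p (z j)))
      rw [F1 f hf] at this
      exact not_isUnit_zero this
    have hpr := hprin f hf (irr_deg1 hdf) (fun v hv => by rw [hdf]; exact hdeg v hv)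
    by_cases hk : ∀ v ∈ V, ∃ κ : k, tl v = C (algebraMap k K κ) * tl f
    · right
      refine ⟨f, hf, fun v hv => ?_⟩
      obtain ⟨κ, hκ⟩ := hk v hv
      exact ⟨κ, F3 v hv f hf κ hκ⟩
    left
    push Not at hk
    obtain ⟨g, hg, hgk⟩ := hk
    obtain ⟨κ, hκ⟩ := hpr g hg
    obtain ⟨W, hW, hWd, hW'⟩ := step2_pencil p hL U hU h1'' z hz (l f) (l g) (hl f (hV hf)) (hl g (hV hg)) κ
      (by
        rintro ⟨c, hc⟩
        apply hgk c
        rw [hκ]; congr 2; exact Subtype.ext hc.symm) (F2 g hg f hf κ hκ).2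
    have hfU : Module.Finite k U := Submodule.finiteDimensional_of_le hU
    have hfW : Module.Finite k W := Submodule.finiteDimensional_of_le hW
    refine ⟨U ⊔ W, le_sup_left, sup_le hU hW, (Submodule.finrank_add_le_finrank_add_finrank _ _).trans (by omega), ?_⟩
    intro v hv
    obtain ⟨κ', hκ'⟩ := hpr v hv
    rw [hveq v (hV hv), hA v hv, map_zero, zero_add]
    refine Subalgebra.add_mem _ (hW' (l v) κ' (hl v (hV hv)) (F2 v hv f hf κ' hκ').2) ?_
    have hsub : (U : Set (MvPolynomial σ k)) ⊆ ((U ⊔ W : Submodule k (MvPolynomial σ k)) : Set (MvPolynomial σ k)) :=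
      fun x hx => Submodule.mem_sup_left hx
    exact Algebra.adjoin_mono hsub (hq0 v (hV hv))

end
end

section
open MvPolynomial

section
variable {k : Type u} {Ω : Type u} [Field k] [Field Ω] [Algebra k Ω] {σ : Type}

theorem exists_compl_ge {M : Type*} [AddCommGroup M] [Module k M] (L U C : Submodule k M) (hU : U ≤ L) (hC : C ≤ L)
    (h : Disjoint U C) : ∃ C', C ≤ C' ∧ C' ≤ L ∧ Disjoint U C' ∧ U ⊔ C' = L := by
  obtain ⟨E, hE1, hE2⟩ := IsModularLattice.exists_disjoint_and_sup_eq (sup_le hU hC)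
  refine ⟨C ⊔ E, le_sup_left, ?_, ?_, ?_⟩
  · exact sup_le hC (hE2 ▸ le_sup_right)
  · exact Disjoint.disjoint_sup_right_of_disjoint_sup_left h hE1
  · rw [← sup_assoc, hE2]

theorem exists_linproj {M : Type*} [AddCommGroup M] [Module k M] (L U C : Submodule k M) (hC : C ≤ L) (hd : Disjoint U C)
    (hs : U ⊔ C = L) : ∃ g : M →ₗ[k] M, (∀ u ∈ U, g u = 0) ∧ (∀ c ∈ C, g c = c) ∧ (∀ l ∈ L, g l ∈ C) ∧ (∀ l ∈ L, l - g l ∈ U) := by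
  obtain ⟨C2, h1, -, h2, h3⟩ := exists_compl_ge ⊤ U C le_top le_top hd
  have hc : IsCompl C2 U := ⟨h2.symm, codisjoint_iff.2 (by rw [sup_comm, h3])⟩
  let g := C2.subtype ∘ₗ C2.projectionOnto U hc
  have g1 : ∀ u ∈ U, g u = 0 := fun u hu => by simp [g, Submodule.projectionOnto_apply_of_mem_right hc hu]
  have g2 : ∀ c ∈ C, g c = c := fun c hcc => by 
    simpa [g] using congrArg Subtype.val (Submodule.projectionOnto_apply_left hc ⟨c, h1 hcc⟩)
  refine ⟨g, g1, g2, ?_, ?_⟩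
  · intro l hl
    rw [← hs] at hl
    obtain ⟨a, ha, b, hb, rfl⟩ := Submodule.mem_sup.1 hl
    rw [map_add, g1 a ha, g2 b hb, zero_add]; exact hb
  · intro l hl
    rw [← hs] at hl
    obtain ⟨a, ha, b, hb, rfl⟩ := Submodule.mem_sup.1 hl
    rw [map_add, g1 a ha, g2 b hb, zero_add, add_sub_cancel_right]; exact ha

theorem exists_proj (U C : Submodule k (MvPolynomial σ k)) (hC : C ≤ LinF σ k) (hd : Disjoint U C)
    (hs : U ⊔ C = LinF σ k) : ∃ π : MvPolynomial σ k →ₐ[k] MvPolynomial σ k, (∀ u ∈ U, π u = 0) ∧ (∀ c ∈ C, π c = c) ∧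
      (∀ l ∈ LinF σ k, π l ∈ C) ∧ (∀ l ∈ LinF σ k, l - π l ∈ U) := by
  obtain ⟨g, g1, g2, g3, g4⟩ := exists_linproj (LinF σ k) U C hC hd hs
  have h : ∀ l ∈ LinF σ k, aeval (fun i => g (X i)) l = g l := by
    intro l hl
    rw [LinF_eq_span] at hl
    induction hl using Submodule.span_induction with
    | mem x hx => obtain ⟨i, rfl⟩ := hx; simp
    | zero => simp
    | add a b _ _ ha hb => rw [map_add, map_add, ha, hb]
    | smul c a _ ha => rw [map_smul, map_smul, ha]
  have hU : U ≤ LinF σ k := hs ▸ le_sup_left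
  refine ⟨aeval (fun i => g (X i)), fun u hu => ?_, fun c hc => ?_, fun l hl => ?_, fun l hl => ?_⟩
  · rw [h u (hU hu), g1 u hu]
  · rw [h c (hC hc), g2 c hc]
  · rw [h l hl]; exact g3 l hl
  · rw [h l hl]; exact g4 l hl

theorem diff_mem {π : MvPolynomial σ k →ₐ[k] MvPolynomial σ k} {L A : Submodule k (MvPolynomial σ k)}
    (h1 : ∀ l ∈ L, π l ∈ L) (h2 : ∀ l ∈ L, l - π l ∈ A) {q : MvPolynomial σ k} (hq : q ∈ L * L) : q - π q ∈ A * L := by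
  induction hq using Submodule.mul_induction_on' with
  | mem_mul_mem a ha b hb =>
    have : a * b - π (a * b) = (a - π a) * b + (b - π b) * π a := by rw [map_mul]; ring
    rw [this]
    exact add_mem (Submodule.mul_mem_mul (h2 a ha) hb) (Submodule.mul_mem_mul (h2 b hb) (h1 a ha))
  | add x hx y hy h1 h2 => 
    have : x + y - π (x + y) = (x - π x) + (y - π y) := by rw [map_add]; ring
    rw [this]; exact add_mem h1 h2

theorem ideal_kill {A B : Type*} [CommRing A] [CommRing B] (π : A →+* B) (s : Set A) (h : ∀ u ∈ s, π u = 0) (q : A) (hq : q ∈ Ideal.span s) :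
    π q = 0 := by
  have : Ideal.span s ≤ RingHom.ker π := Ideal.span_le.2 h
  exact this hq

theorem ideal_quad (U : Submodule k (MvPolynomial σ k)) (hU : U ≤ LinF σ k) {q : MvPolynomial σ k} (hq : q ∈ QuadF σ k)
    (h : q ∈ Ideal.span (U : Set (MvPolynomial σ k))) : q ∈ U * LinF σ k := by
  obtain ⟨C, -, hC, hd, hs⟩ := exists_compl_ge (LinF σ k) U ⊥ hU bot_le disjoint_bot_right
  obtain ⟨π, p1, p2, p3, p4⟩ := exists_proj U C hC hd hs
  rw [QuadF_eq] at hq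
  have := diff_mem (fun l hl => hC (p3 l hl)) p4 hq
  have h0 : π q = 0 := ideal_kill π.toRingHom _ p1 q h
  rwa [h0, sub_zero] at this

theorem quad_adjoin (U : Submodule k (MvPolynomial σ k)) (hU : U ≤ LinF σ k) {q : MvPolynomial σ k} (hq : q ∈ QuadF σ k)
    (h : q ∈ Algebra.adjoin k (U : Set (MvPolynomial σ k))) : q ∈ U * U := by
  obtain ⟨C, -, hC, hd, hs⟩ := exists_compl_ge (LinF σ k) U ⊥ hU bot_le disjoint_bot_right
  obtain ⟨π, p1, p2, p3, p4⟩ := exists_proj C U hU hd.symm (by rw [sup_comm]; exact hs)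
  have h0 : π q = q := by
    have : Algebra.adjoin k (U : Set (MvPolynomial σ k)) ≤ AlgHom.equalizer π (AlgHom.id k _) :=
      Algebra.adjoin_le (fun u hu => p2 u hu)
    exact this h
  rw [← h0]
  rw [QuadF_eq] at hq
  have h1 := Submodule.mem_map_of_mem (f := π.toLinearMap) hq
  rw [Submodule.map_mul] at h1
  refine (Submodule.mul_le.2 fun a ha b hb => Submodule.mul_mem_mul (?_ : a ∈ U) (?_ : b ∈ U)) h1
  · obtain ⟨l, hl, rfl⟩ := ha; exact p3 l hl
  · obtain ⟨l, hl, rfl⟩ := hb; exact p3 l hl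

theorem quad_both (U1 U2 : Submodule k (MvPolynomial σ k)) (hU1 : U1 ≤ LinF σ k) (hU2 : U2 ≤ LinF σ k)
    {q : MvPolynomial σ k} (hq : q ∈ QuadF σ k) (h1 : q ∈ Ideal.span (U1 : Set (MvPolynomial σ k)))
    (h2 : q ∈ Algebra.adjoin k (U2 : Set (MvPolynomial σ k))) : q ∈ (U1 ⊓ U2) * U2 := by
  have hq2 := quad_adjoin U2 hU2 hq h2
  obtain ⟨C, -, hC, hd, hs⟩ := exists_compl_ge U2 (U1 ⊓ U2) ⊥ inf_le_right bot_le disjoint_bot_right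
  have hd' : Disjoint U1 C := by
    rw [disjoint_iff] at hd ⊢
    rw [inf_assoc, inf_eq_right.2 hC] at hd; exact hd
  obtain ⟨C', hCC', hC', hd', hs'⟩ := exists_compl_ge (LinF σ k) U1 C hU1 (hC.trans hU2) hd'
  obtain ⟨π, p1, p2, p3, p4⟩ := exists_proj U1 C' hC' hd' hs'
  have g1 : ∀ l ∈ U2, π l ∈ C ∧ l - π l ∈ U1 ⊓ U2 := by
    intro l hl
    rw [← hs] at hl
    obtain ⟨a, ha, b, hb, rfl⟩ := Submodule.mem_sup.1 hl
    rw [map_add, p1 a ha.1, p2 b (hCC' hb), zero_add, add_sub_cancel_right]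
    exact ⟨hb, ha⟩
  have := diff_mem (fun l hl => hC (g1 l hl).1) (fun l hl => (g1 l hl).2) hq2
  have h0 : π q = 0 := ideal_kill π.toRingHom _ p1 q h1
  rwa [h0, sub_zero] at this

theorem mul_adjoin {A B W : Submodule k (MvPolynomial σ k)} (hA : A ≤ W) (hB : B ≤ W) {q : MvPolynomial σ k} (hq : q ∈ A * B) :
    q ∈ Algebra.adjoin k (W : Set (MvPolynomial σ k)) := by
  have : A * B ≤ Subalgebra.toSubmodule (Algebra.adjoin k (W : Set (MvPolynomial σ k))) := by
    rw [Submodule.mul_le]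
    intro a ha b hb
    exact Subalgebra.mul_mem _ (Algebra.subset_adjoin (hA ha)) (Algebra.subset_adjoin (hB hb))
  exact this hq

theorem mul_few [Finite σ] (A W : Submodule k (MvPolynomial σ k)) (hA : A ≤ LinF σ k) {q : MvPolynomial σ k} (hq : q ∈ A * W) :
    ∃ W' ≤ W, Module.finrank k W' ≤ Module.finrank k A ∧ q ∈ A * W' := by
  obtain ⟨u, hli, hsp, hmem⟩ := exists_fin_basis A hA
  rw [← hsp] at hq
  obtain ⟨l, hl, rfl⟩ := mem_span_mul u W hq
  refine ⟨Submodule.span k (Set.range l), Submodule.span_le.2 (by rintro _ ⟨j, rfl⟩; exact hl j), ?_, ?_⟩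
  · exact (finrank_range_le_card l).trans (by simp)
  · exact Submodule.sum_mem _ fun j _ => Submodule.mul_mem_mul (hmem j) (Submodule.subset_span ⟨j, rfl⟩)

/-- restriction to a subring generated by linear forms -/
theorem exists_restr [Finite σ] (p : σ → Ω) (U : Submodule k (MvPolynomial σ k)) (hU : U ≤ LinF σ k) :
    ∃ u : Fin (Module.finrank k U) → MvPolynomial σ k, Function.Injective (aeval (R := k) u) ∧ (∀ i, u i ∈ U) ∧
      (LinF (Fin (Module.finrank k U)) k).map (aeval (R := k) u).toLinearMap = U ∧
      (∀ v ∈ QuadF σ k, v ∈ Algebra.adjoin k (U : Set (MvPolynomial σ k)) → ∃ F ∈ QuadF (Fin (Module.finrank k U)) k, aeval u F = v) ∧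
      rk k (Set.range fun i => aeval p (u i)) = rk k (aeval p '' (U : Set (MvPolynomial σ k))) ∧
      ∀ F : MvPolynomial (Fin (Module.finrank k U)) k, aeval (fun i => aeval p (u i)) F = aeval p (aeval u F) := by
  obtain ⟨u, hli, hsp, hmem⟩ := exists_fin_basis U hU
  have hmap : (LinF (Fin (Module.finrank k U)) k).map (aeval (R := k) u).toLinearMap = U := by
    rw [LinF_eq_span, Submodule.map_span, ← Set.range_comp]
    refine Eq.trans ?_ hsp
    congr 2; funext i; simp
  refine ⟨u, ?_, hmem, hmap, ?_, ?_, ?_⟩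
  · obtain ⟨m, e, -, he, -⟩ := exists_coord u (fun i => hU (hmem i)) hli
    have : (aeval (R := k) u) = (e.toAlgHom).comp (rename Sum.inr) := by
      apply MvPolynomial.algHom_ext; intro i; simp [he]
    rw [this]
    exact e.injective.comp (rename_injective _ Sum.inr_injective)
  · intro v hv hvU
    have h1 := quad_adjoin U hU hv hvU
    rw [← hmap, ← Submodule.map_mul, ← QuadF_eq] at h1
    exact h1
  · apply le_antisymm
    · apply rk_mono
      rintro _ ⟨i, rfl⟩
      exact ⟨_, hmem i, rfl⟩
    · apply rk_le_of_algOver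
      rintro _ ⟨y, hy, rfl⟩
      apply AlgOver.of_span
      rw [SetLike.mem_coe, ← hsp] at hy
      have h2 := Submodule.mem_map_of_mem (f := (aeval p : _ →ₐ[k] Ω).toLinearMap) hy
      rw [Submodule.map_span, ← Set.range_comp] at h2
      exact h2
  · intro F
    have : (aeval p : _ →ₐ[k] Ω).comp (aeval u) = aeval (fun i => aeval p (u i)) := by
        apply MvPolynomial.algHom_ext; intro i; simp
    rw [← this]; rfl

theorem quad_irr (p : σ → Ω) (hL : ∀ l ∈ LinF σ k, aeval p l = 0 → l = 0) {F : MvPolynomial σ k} (hF : F ∈ QuadF σ k) (h0 : F ≠ 0)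
    (hp : aeval p F = 0) : Irreducible F := by
  have hd : F.totalDegree = 2 := IsHomogeneous.totalDegree hF h0
  refine ⟨fun hu => ?_, fun a b hab => ?_⟩
  · rw [isUnit_iff_totalDegree_of_isReduced] at hu; omega
  · by_contra hc
    push Not at hc
    have h0' := h0
    rw [hab] at h0'
    obtain ⟨han, hbn⟩ := mul_ne_zero_iff.1 h0'
    have hd' := hd
    rw [hab, totalDegree_mul_of_isDomain han hbn] at hd'
    have hda : a.totalDegree ≠ 0 := fun h => hc.1 (isUnit_of_deg0 han h)
    have hdb : b.totalDegree ≠ 0 := fun h => hc.2 (isUnit_of_deg0 hbn h)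
    obtain ⟨l1, hl1, e1, rfl⟩ := deg1_split (F := a) (by omega)
    obtain ⟨l2, hl2, e2, rfl⟩ := deg1_split (F := b) (by omega)
    have hprod : F = l1 * l2 := by
      have hF' : F.IsHomogeneous 2 := hF
      have : F = l1 * l2 + (C e2 * l1 + C e1 * l2) + C (e1 * e2) := by
        rw [C_mul, hab]; ring
      have h2 := congrArg (homogeneousComponent 2) this
      rw [map_add, map_add, homogeneousComponent_of_mem hF'] at h2
      have g1 : (l1 * l2).IsHomogeneous 2 := IsHomogeneous.mul hl1 hl2
      have g2 : (C e2 * l1 + C e1 * l2).IsHomogeneous 1 := by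
        rw [C_mul', C_mul']
        exact add_mem (Submodule.smul_mem (LinF σ k) _ hl1) (Submodule.smul_mem (LinF σ k) _ hl2)
      rw [homogeneousComponent_of_mem g1, homogeneousComponent_of_mem g2, homogeneousComponent_of_mem (isHomogeneous_C _ (e1*e2))] at h2
      simpa using h2
    rw [hprod, map_mul, mul_eq_zero] at hp
    rcases hp with hp | hp
    · rw [hL l1 hl1 hp, zero_mul] at hprod; exact h0 hprod
    · rw [hL l2 hl2 hp, mul_zero] at hprod; exact h0 hprod

/-- one relation -/
theorem rel_one [Finite σ] (p : σ → Ω) (U : Submodule k (MvPolynomial σ k)) (hU : U ≤ LinF σ k) (f : MvPolynomial σ k)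
    (hf : f ∈ QuadF σ k) (hfU : f ∈ Algebra.adjoin k (U : Set (MvPolynomial σ k))) (hfp : aeval p f = 0) (h0 : f ≠ 0) :
    rk k (aeval p '' (U : Set (MvPolynomial σ k))) + 1 ≤ (Module.finrank k U : ℕ) := by
  obtain ⟨u, hinj, hmem, hmap, hq, hrk, hev⟩ := exists_restr p U hU
  obtain ⟨F, hF, rfl⟩ := hq f hf hfU
  have := rk_lt_of_rel (k := k) (fun i => aeval p (u i)) F (by rintro rfl; simp at h0) (by rw [hev, hfp])
  rw [hrk] at this
  simpa using this

/-- two relations -/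
theorem rel_two [Finite σ] (p : σ → Ω) (hL : ∀ l ∈ LinF σ k, aeval p l = 0 → l = 0) (U : Submodule k (MvPolynomial σ k)) (hU : U ≤ LinF σ k) (f g : MvPolynomial σ k)
    (hf : f ∈ QuadF σ k) (hfU : f ∈ Algebra.adjoin k (U : Set (MvPolynomial σ k))) (hfp : aeval p f = 0)
    (hg : g ∈ QuadF σ k) (hgU : g ∈ Algebra.adjoin k (U : Set (MvPolynomial σ k))) (hgp : aeval p g = 0) 
    (hli : LinearIndependent k ![f, g]) :
    rk k (aeval p '' (U : Set (MvPolynomial σ k))) + 2 ≤ (Module.finrank k U : ℕ) := by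
  have h0 : f ≠ 0 := hli.ne_zero 0
  have h1 := rel_one p U hU f hf hfU hfp h0
  by_contra hcon
  obtain ⟨u, hinj, hmem, hmap, hq, hrk, hev⟩ := exists_restr p U hU
  obtain ⟨F, hF, rfl⟩ := hq f hf hfU
  obtain ⟨G, hG, rfl⟩ := hq g hg hgU
  have hL' : ∀ l ∈ LinF (Fin (Module.finrank k U)) k, aeval (fun i => aeval p (u i)) l = 0 → l = 0 := by
    intro l hl h
    rw [hev] at h
    have h3 : aeval u l ∈ U := hmap.le ⟨l, hl, rfl⟩
    exact hinj ((hL _ (hU h3) h).trans (map_zero _).symm)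
  have hF0 : F ≠ 0 := by rintro rfl; simp at h0
  have hirr := quad_irr (fun i => aeval p (u i)) hL' hF hF0 (by rw [hev, hfp])
  have hge : ((Module.finrank k U - 1 : ℕ) : ℕ∞) ≤ rk k (Set.range fun i => aeval p (u i)) := by
    rw [hrk]
    rw [ENat.natCast_sub]
    apply tsub_le_iff_right.2
    generalize rk k (aeval p '' (U : Set (MvPolynomial σ k))) = a at *
    have : a ≠ ⊤ := by rintro rfl; simp at h1
    lift a to ℕ using this
    norm_cast at *
    omega
  have hdvd := principal_of_rk (fun i => aeval p (u i)) F G hirr.prime (by rw [hev, hfp]) (by rw [hev, hgp]) (by simp; omega) hge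
  have hG0 : G ≠ 0 := by rintro rfl; exact hli.ne_zero 1 (by simp)
  obtain ⟨κ, hκ⟩ := dvd_prop hF0 hdvd (by rw [IsHomogeneous.totalDegree hG hG0, IsHomogeneous.totalDegree hF hF0])
  rw [LinearIndependent.pair_iff] at hli
  have := hli κ (-1) (by rw [hκ, map_mul, ← algebraMap_eq, AlgHom.commutes, Algebra.smul_def]; ring_nf; simp [neg_smul])
  simp at this

end
end

section
open MvPolynomial

section
variable {k : Type u} {Ω : Type u} [Field k] [Field Ω] [Algebra k Ω] {σ : Type}

/-- the part of `V` in a subring has codimension at most one in case (ii) -/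
theorem codim_one {M : Type*} [AddCommGroup M] [Module k M] (V A : Submodule k M) [Module.Finite k V] (f : M)
    (hf : f ∈ V) (h : ∀ v ∈ V, ∃ κ : k, v - κ • f ∈ A) : 
    V ≤ (V ⊓ A) ⊔ Submodule.span k {f} ∧ Module.finrank k V ≤ Module.finrank k ↥(V ⊓ A) + 1 := by
  have h1 : V ≤ (V ⊓ A) ⊔ Submodule.span k {f} := by
    intro v hv
    obtain ⟨κ, hκ⟩ := h v hv
    have : v = (v - κ • f) + κ • f := by abel
    rw [this]
    exact Submodule.add_mem_sup ⟨sub_mem hv (V.smul_mem _ hf), hκ⟩ (Submodule.smul_mem _ _ (Submodule.mem_span_singleton_self f))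
  refine ⟨h1, ?_⟩
  have : Module.Finite k ↥(V ⊓ A) := Submodule.finiteDimensional_of_le inf_le_left
  refine (Submodule.finrank_mono h1).trans ((Submodule.finrank_add_le_finrank_add_finrank _ _).trans ?_)
  gcongr
  exact (finrank_span_le_card {f}).trans (by simp)

theorem ht2 [Finite σ] [IsAlgClosed k] [IsAlgClosed Ω] (p : σ → Ω)
    (hr : ((Nat.card σ : ℕ) : ℕ∞) ≤ rk k (Set.range p) + 2)
    (hL : ∀ l ∈ LinF σ k, aeval p l = 0 → l = 0) (V : Submodule k (MvPolynomial σ k)) (hV : V ≤ QuadF σ k)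
    (hVp : ∀ v ∈ V, aeval p v = 0) (hc : 3 ≤ Module.finrank k V) :
    ∃ U ≤ LinF σ k, Module.finrank k U ≤ 6 ∧ ∀ v ∈ V, v ∈ Algebra.adjoin k (U : Set (MvPolynomial σ k)) := by
  obtain ⟨D, f1, f2, U1, U2, hD, hf1, hf2, hli, hU1, hU2, hd1, hd2, hfU1, -, -⟩ := jac_main p 2 (by exact_mod_cast hr) hL V hV hVp hc
  have h1 := rel_one p U1 hU1 f1 (hV hf1) hfU1 (hVp _ hf1) (hli.ne_zero 0)
  rcases step2 p (c := 1) (by exact_mod_cast hr) hL V hV hVp U1 hU1 (by exact_mod_cast h1) with ⟨U', -, h2, h3, h4⟩ | ⟨f, hf, h⟩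
  · exact ⟨U', h2, by omega, h4⟩
  · have : Module.Finite k V := Submodule.finiteDimensional_of_le hV
    obtain ⟨-, h5⟩ := codim_one V (Subalgebra.toSubmodule (Algebra.adjoin k (U1 : Set (MvPolynomial σ k)))) f hf h
    obtain ⟨g, hg, hgV⟩ := exists_li_fin (V ⊓ (Subalgebra.toSubmodule (Algebra.adjoin k (U1 : Set (MvPolynomial σ k))))) (m := 2) (by omega)
    have hg' : ![g 0, g 1] = g := by ext i; fin_cases i <;> rfl
    have h6 := rel_two p hL U1 hU1 (g 0) (g 1) (hV (hgV 0).1) (hgV 0).2 (hVp _ (hgV 0).1) (hV (hgV 1).1) (hgV 1).2 (hVp _ (hgV 1).1)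
      (by rw [hg']; exact hg)
    exact ⟨U1, hU1, by omega, fun v hv => step1 p (c := 2) (by exact_mod_cast hr) hL U1 hU1 (by exact_mod_cast h6) v (hV hv) (hVp v hv)⟩

/-- generators in few variables plus one further quadric -/
theorem pd_plus_one [Finite σ] (U : Submodule k (MvPolynomial σ k)) (hU : U ≤ LinF σ k) {D : ℕ} (hD : Module.finrank k U ≤ D)
    (hD0 : 1 ≤ D)
    (V V' : Submodule k (MvPolynomial σ k)) (hV'U : ∀ v ∈ V', v ∈ Algebra.adjoin k (U : Set (MvPolynomial σ k)))
    (f : MvPolynomial σ k) (hf : f ∈ V) (hfq : f ∈ QuadF σ k) (hV' : V' ≤ V) (hV : V ≤ V' ⊔ Submodule.span k {f}) :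
    PdI (Ideal.span (V : Set (MvPolynomial σ k))) (2 * D) := by
  have hspan : Ideal.span (V : Set (MvPolynomial σ k)) = Ideal.span (V' : Set (MvPolynomial σ k)) ⊔ Ideal.span {f} := by
    apply le_antisymm
    · rw [Ideal.span_le]
      intro v hv
      obtain ⟨a, ha, b, hb, rfl⟩ := Submodule.mem_sup.1 (hV hv)
      obtain ⟨c, rfl⟩ := Submodule.mem_span_singleton.1 hb
      refine Submodule.add_mem_sup (Ideal.subset_span ha) ?_
      rw [smul_eq_C_mul]
      exact Ideal.mul_mem_left _ _ (Ideal.mem_span_singleton_self f)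
    · refine sup_le (Ideal.span_mono hV') ?_
      rw [Ideal.span_singleton_le_iff_mem]
      exact Ideal.subset_span hf
  by_cases hfU : f ∈ Ideal.span (U : Set (MvPolynomial σ k))
  · have h1 := ideal_quad U hU hfq hfU
    obtain ⟨W, hW, hWd, hfW⟩ := mul_few U _ hU h1
    have : Module.Finite k U := Submodule.finiteDimensional_of_le hU
    have : Module.Finite k W := Submodule.finiteDimensional_of_le hW
    refine pd_vars (U ⊔ W) (sup_le hU hW) ((Submodule.finrank_add_le_finrank_add_finrank _ _).trans (by omega)) _ ?_
    intro v hv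
    obtain ⟨a, ha, b, hb, rfl⟩ := Submodule.mem_sup.1 (hV hv)
    obtain ⟨c, rfl⟩ := Submodule.mem_span_singleton.1 hb
    have hsub : (U : Set (MvPolynomial σ k)) ⊆ ((U ⊔ W : Submodule k (MvPolynomial σ k)) : Set (MvPolynomial σ k)) :=
      fun x hx => Submodule.mem_sup_left hx
    exact Subalgebra.add_mem _ (Algebra.adjoin_mono hsub (hV'U a ha))
      (Subalgebra.smul_mem _ (mul_adjoin le_sup_left le_sup_right hfW) _)
  · rw [hspan]
    exact (pd_pure_quad U hU hD _ hV'U f hfq hfU).mono (by omega)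

theorem case_d0 [Finite σ] [IsAlgClosed k] [IsAlgClosed Ω] (p : σ → Ω)
    (hr : ((Nat.card σ : ℕ) : ℕ∞) ≤ rk k (Set.range p) + 3)
    (hL : ∀ l ∈ LinF σ k, aeval p l = 0 → l = 0) (V : Submodule k (MvPolynomial σ k)) (hV : V ≤ QuadF σ k)
    (hVp : ∀ v ∈ V, aeval p v = 0) (hc : 4 ≤ Module.finrank k V) :
    PdI (Ideal.span (V : Set (MvPolynomial σ k))) 13 := by
  have hVfin : Module.Finite k V := Submodule.finiteDimensional_of_le hV
  obtain ⟨D, f1, f2, U1, U2, hD, hf1, hf2, hli, hU1, hU2, hd1, hd2, hfU1, hfU2, hDV⟩ := jac_main p 3 (by exact_mod_cast hr) hL V hV hVp hc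
  have : Module.Finite k U1 := Submodule.finiteDimensional_of_le hU1
  have : Module.Finite k U2 := Submodule.finiteDimensional_of_le hU2
  have hle := fun (A B : Submodule k (MvPolynomial σ k)) (h : A ≤ B) =>
    Algebra.adjoin_mono (R := k) (show (A : Set (MvPolynomial σ k)) ⊆ B from h)
  obtain ⟨U, hU, hUd, hU1', hU2'⟩ : ∃ U ≤ LinF σ k, Module.finrank k U ≤ 10 ∧
      f1 ∈ Algebra.adjoin k (U : Set (MvPolynomial σ k)) ∧ f2 ∈ Algebra.adjoin k (U : Set (MvPolynomial σ k)) := by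
    have hsum := Submodule.finrank_sup_add_finrank_inf_eq U1 U2
    by_cases hD5 : D ≤ 5
    · exact ⟨U1 ⊔ U2, sup_le hU1 hU2, by omega, hle _ _ le_sup_left hfU1, hle _ _ le_sup_right hfU2⟩
    · have h1 := quad_both U1 U2 hU1 hU2 (hV hf2) (hDV (by omega) f2 hf2) hfU2
      by_cases ha : Module.finrank k ↥(U1 ⊓ U2) ≤ 3
      · obtain ⟨W, hW, hWd, hfW⟩ := mul_few (U1 ⊓ U2) _ (inf_le_left.trans hU1) h1
        have : Module.Finite k W := Submodule.finiteDimensional_of_le (hW.trans hU2)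
        exact ⟨U1 ⊔ W, sup_le hU1 (hW.trans hU2), (Submodule.finrank_add_le_finrank_add_finrank _ _).trans (by omega),
          hle _ _ le_sup_left hfU1, mul_adjoin (inf_le_left.trans le_sup_left) le_sup_right hfW⟩
      · exact ⟨U1 ⊔ U2, sup_le hU1 hU2, by omega, hle _ _ le_sup_left hfU1, hle _ _ le_sup_right hfU2⟩
  have h2 := rel_two p hL U hU f1 f2 (hV hf1) hU1' (hVp _ hf1) (hV hf2) hU2' (hVp _ hf2) hli
  rcases step2 p (c := 2) (by exact_mod_cast hr) hL V hV hVp U hU (by exact_mod_cast h2) with ⟨U', -, h3, h4, h5⟩ | ⟨f, hf, h⟩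
  · exact pd_vars U' h3 (by omega) _ h5
  · obtain ⟨h6, h5⟩ := codim_one V (Subalgebra.toSubmodule (Algebra.adjoin k (U : Set (MvPolynomial σ k)))) f hf h
    by_cases h3 : rk k (aeval p '' (U : Set (MvPolynomial σ k))) + 3 ≤ (Module.finrank k U : ℕ)
    · exact pd_vars U hU (by omega) _ fun v hv => step1 p (c := 3) (by exact_mod_cast hr) hL U hU (by exact_mod_cast h3) v (hV hv) (hVp v hv)
    obtain ⟨u, hinj, hmem, hmap, hq, hrk, hev⟩ := exists_restr p U hU
    let V' := V ⊓ (Subalgebra.toSubmodule (Algebra.adjoin k (U : Set (MvPolynomial σ k))))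
    let φ := (aeval (R := k) u).toLinearMap
    let W := QuadF (Fin (Module.finrank k U)) k ⊓ V'.comap φ
    have hWmap : W.map φ = V' := by
      apply le_antisymm
      · rintro _ ⟨x, hx, rfl⟩; exact hx.2
      · intro v hv
        obtain ⟨F, hF, rfl⟩ := hq v (hV hv.1) hv.2
        exact ⟨F, ⟨hF, hv⟩, rfl⟩
    have hWd : Module.finrank k W = Module.finrank k V' := by
      rw [← hWmap]
      exact (Submodule.equivMapOfInjective φ hinj W).finrank_eq
    obtain ⟨U'', hU'', hd'', hU''V⟩ := ht2 (fun i => aeval p (u i)) (by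
        rw [hrk]
        simp only [Nat.card_eq_fintype_card, Fintype.card_fin]
        generalize rk k (aeval p '' (U : Set (MvPolynomial σ k))) = a at *
        generalize Module.finrank k U = D at *
        have : a ≠ ⊤ := by rintro rfl; simp at h2
        lift a to ℕ using this
        norm_cast at *
        omega)
      (by
        intro l hl h
        rw [hev] at h
        have h3 : aeval u l ∈ U := hmap.le ⟨l, hl, rfl⟩
        exact hinj ((hL _ (hU h3) h).trans (map_zero _).symm))
      W inf_le_left (by
        intro w hw
        rw [hev]
        exact hVp _ hw.2.1) (by rw [hWd]; change 3 ≤ Module.finrank k ↥(V ⊓ _); omega)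
    have hfin'' : Module.Finite k U'' := Submodule.finiteDimensional_of_le hU''
    refine (pd_plus_one (U''.map φ) (le_trans (Submodule.map_mono hU'') (hmap.le.trans hU)) (D := 6)
      ((Submodule.finrank_map_le _ _).trans hd'') (by norm_num) V V' ?_ f hf (hV hf) inf_le_left h6).mono (by norm_num)
    intro v hv
    rw [← hWmap] at hv
    obtain ⟨w, hw, rfl⟩ := hv
    have h8 := hU''V w hw
    have h9 : Algebra.adjoin k (U'' : Set (MvPolynomial (Fin (Module.finrank k U)) k)) ≤
      (Algebra.adjoin k ((U''.map φ : Submodule k (MvPolynomial σ k)) : Set (MvPolynomial σ k))).comap (aeval (R := k) u) :=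
      Algebra.adjoin_le fun x hx => Algebra.subset_adjoin ⟨x, hx, rfl⟩
    exact h9 h8

end
end

section
open MvPolynomial

section
variable {k : Type u} {Ω : Type u} [Field k] [Field Ω] [Algebra k Ω] {σ : Type}

theorem Pd.colon_mid {R : Type u} [CommRing R] (J K : Ideal R) (q : R) {n : ℕ}
    (hK : ∀ a, a ∈ K ↔ q * a ∈ J) (hJ : PdI (J ⊔ Ideal.span {q}) n) (hc : PdI K n) : PdI J n := by
  let f : (R ⧸ K) →ₗ[R] (R ⧸ J) := Submodule.mapQ K J (LinearMap.mulLeft R q)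
    (fun a ha => (hK a).1 ha)
  let g : (R ⧸ J) →ₗ[R] (R ⧸ (J ⊔ Ideal.span {q})) := Submodule.factor le_sup_left
  refine Pd.two f g ?_ (Submodule.factor_surjective _) ?_ hc hJ
  · rw [injective_iff_map_eq_zero]
    intro a ha
    obtain ⟨a, rfl⟩ := Submodule.Quotient.mk_surjective _ a
    have h1 : (Submodule.Quotient.mk (q * a) : R ⧸ J) = 0 := ha
    rw [Submodule.Quotient.mk_eq_zero] at h1 ⊢
    exact (hK a).2 h1
  · intro b
    obtain ⟨b, rfl⟩ := Submodule.Quotient.mk_surjective _ b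
    have h1 : g (Submodule.Quotient.mk b) = Submodule.Quotient.mk b := rfl
    rw [h1, Submodule.Quotient.mk_eq_zero]
    constructor
    · intro hb
      obtain ⟨j, hj, t, ht, rfl⟩ := Submodule.mem_sup.1 hb
      obtain ⟨a, rfl⟩ := Ideal.mem_span_singleton'.1 ht
      refine ⟨Submodule.Quotient.mk a, ?_⟩
      change (Submodule.Quotient.mk (q * a) : R ⧸ J) = _
      rw [Submodule.Quotient.eq]
      have : q * a - (j + a * q) = - j := by ring
      rw [this]
      exact neg_mem hj
    · rintro ⟨a, ha⟩
      obtain ⟨a, rfl⟩ := Submodule.Quotient.mk_surjective _ a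
      have h2 : (Submodule.Quotient.mk (q * a) : R ⧸ J) = Submodule.Quotient.mk b := ha
      rw [Submodule.Quotient.eq] at h2
      have : b = -(q * a - b) + a * q := by ring
      rw [this]
      exact add_mem (neg_mem (Submodule.mem_sup_left h2))
        (Submodule.mem_sup_right (Ideal.mem_span_singleton'.2 ⟨a, rfl⟩))

theorem mod_lin [Finite σ] (U : Submodule k (MvPolynomial σ k)) (hU : U ≤ LinF σ k) :
    ∃ (m : ℕ) (π : MvPolynomial σ k →ₐ[k] MvPolynomial (Fin m) k) (ρ : MvPolynomial (Fin m) k →ₐ[k] MvPolynomial σ k),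
      m + Module.finrank k U = Nat.card σ ∧ (∀ u ∈ U, π u = 0) ∧ (∀ a, π (ρ a) = a) ∧
      (∀ y, y - ρ (π y) ∈ Ideal.span (U : Set (MvPolynomial σ k))) ∧
      (∀ l ∈ LinF σ k, π l ∈ LinF (Fin m) k) ∧ (∀ l ∈ LinF (Fin m) k, ρ l ∈ LinF σ k) := by
  obtain ⟨u, hli, hsp, hmem⟩ := exists_fin_basis U hU
  obtain ⟨m, e, hcard, he, hel⟩ := exists_coord u (fun i => hU (hmem i)) hli
  let π : MvPolynomial σ k →ₐ[k] MvPolynomial (Fin m) k := (aeval (Sum.elim X 0)).comp e.symm.toAlgHom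
  let ρ : MvPolynomial (Fin m) k →ₐ[k] MvPolynomial σ k := e.toAlgHom.comp (rename Sum.inl)
  have hρ : ∀ l ∈ LinF (Fin m) k, ρ l ∈ LinF σ k := by
    intro l hl
    rw [LinF_eq_span] at hl
    have h2 := Submodule.mem_map_of_mem (f := ρ.toLinearMap) hl
    rw [Submodule.map_span, ← Set.range_comp] at h2
    refine Submodule.span_le.2 ?_ h2
    rintro _ ⟨i, rfl⟩
    simpa [ρ] using hel (Sum.inl i)
  have hπρ : ∀ a, π (ρ a) = a := by
    intro a
    have : π.comp ρ = AlgHom.id k _ := by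
      apply MvPolynomial.algHom_ext; intro i; simp [π, ρ]
    exact DFunLike.congr_fun this a
  have hπu : ∀ i, π (u i) = 0 := by
    intro i
    rw [← he i]; simp [π]
  have hπU : ∀ x ∈ U, π x = 0 := by
    intro x hx
    rw [← hsp] at hx
    exact (Submodule.span_le (p := LinearMap.ker π.toLinearMap)).2 (by rintro _ ⟨i, rfl⟩; exact hπu i) hx
  have hdiff : ∀ y, y - ρ (π y) ∈ Ideal.span (U : Set (MvPolynomial σ k)) := by
    intro y
    have : (Ideal.Quotient.mkₐ k (Ideal.span (U : Set (MvPolynomial σ k)))).comp ((ρ.comp π).comp e.toAlgHom) =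
      (Ideal.Quotient.mkₐ k (Ideal.span (U : Set (MvPolynomial σ k)))).comp e.toAlgHom := by
      apply MvPolynomial.algHom_ext
      rintro (i | i)
      · simp [π, ρ]
      · simp only [AlgHom.comp_apply]
        have h1 : e.toAlgHom (X (Sum.inr i)) = u i := he i
        rw [h1, hπu, map_zero, map_zero]
        exact (Ideal.Quotient.eq_zero_iff_mem.2 (Ideal.subset_span (hmem i))).symm
    have h2 := DFunLike.congr_fun this (e.symm y)
    simp only [AlgHom.comp_apply] at h2
    have h3 : e.toAlgHom (e.symm y) = y := e.apply_symm_apply y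
    rw [h3] at h2
    exact (Ideal.Quotient.eq.1 h2.symm)
  refine ⟨m, π, ρ, by simpa using hcard.symm, hπU, hπρ, hdiff, ?_, hρ⟩
  have hspan : LinF σ k ≤ Submodule.span k (Set.range fun i => e (X i)) := by
    have hr : Nat.card (Fin m ⊕ Fin (Module.finrank k U)) = Nat.card σ := by simp [hcard]
    have hli' : LinearIndependent k (fun i => e (X i : MvPolynomial (Fin m ⊕ Fin (Module.finrank k U)) k)) := by
      have h0 : LinearIndependent k (fun i => (X i : MvPolynomial (Fin m ⊕ Fin (Module.finrank k U)) k)) :=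
        (algebraicIndependent_X _ k).linearIndependent
      exact h0.map' e.toLinearMap (LinearMap.ker_eq_bot.2 e.injective)
    have hle : Submodule.span k (Set.range fun i => e (X i : MvPolynomial (Fin m ⊕ Fin (Module.finrank k U)) k)) ≤ LinF σ k := by
      rw [Submodule.span_le]; rintro _ ⟨i, rfl⟩; exact hel i
    have : Fintype σ := Fintype.ofFinite σ
    refine (Submodule.eq_of_le_of_finrank_eq hle ?_).ge
    rw [finrank_span_eq_card hli', finrank_LinF, ← Nat.card_eq_fintype_card, hr, Nat.card_eq_fintype_card]
  intro l hl
  refine (Submodule.span_le (p := (LinF (Fin m) k).comap π.toLinearMap)).2 ?_ (hspan hl)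
  rintro _ ⟨i | i, rfl⟩
  · simpa [π] using X_mem_LinF i
  · simp [π]

theorem mod_point [Finite σ] (U : Submodule k (MvPolynomial σ k)) {m : ℕ} (π : MvPolynomial σ k →ₐ[k] MvPolynomial (Fin m) k)
    (ρ : MvPolynomial (Fin m) k →ₐ[k] MvPolynomial σ k)
    (h1 : ∀ y, y - ρ (π y) ∈ Ideal.span (U : Set (MvPolynomial σ k)))
    (h2 : ∀ l ∈ LinF σ k, π l ∈ LinF (Fin m) k) (p : σ → Ω) (hp : ∀ u ∈ U, aeval p u = 0) :
    ∃ p' : Fin m → Ω, (∀ y, aeval p y = aeval p' (π y)) ∧ (∀ a, aeval p (ρ a) = aeval p' a) ∧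
      rk k (Set.range p) ≤ rk k (Set.range p') := by
  have h3 : ∀ a, aeval p (ρ a) = aeval (fun j => aeval p (ρ (X j))) a := by
    intro a
    have : (aeval p : _ →ₐ[k] Ω).comp ρ = aeval (fun j => aeval p (ρ (X j))) := by
      apply MvPolynomial.algHom_ext; intro i; simp
    exact DFunLike.congr_fun this a
  have h4 : ∀ y, aeval p y = aeval (fun j => aeval p (ρ (X j))) (π y) := by
    intro y
    rw [← h3]
    have := ideal_kill (aeval p : _ →ₐ[k] Ω).toRingHom (U : Set (MvPolynomial σ k)) hp _ (h1 y)
    rw [map_sub, sub_eq_zero] at this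
    exact this
  refine ⟨_, h4, h3, ?_⟩
  apply rk_le_of_algOver
  rintro _ ⟨i, rfl⟩
  have h5 := h4 (X i)
  rw [aeval_X] at h5
  rw [h5]
  apply AlgOver.of_span
  have h6 := h2 _ (X_mem_LinF i)
  rw [LinF_eq_span] at h6
  have h7 := Submodule.mem_map_of_mem (f := (aeval (fun j => aeval p (ρ (X j))) : _ →ₐ[k] Ω).toLinearMap) h6
  rw [Submodule.map_span, ← Set.range_comp] at h7
  have h8 : (⇑(aeval (fun j => aeval p (ρ (X j))) : _ →ₐ[k] Ω).toLinearMap ∘ X) = fun j => aeval p (ρ (X j)) := by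
    funext j; simp
  rw [h8] at h7
  exact h7

theorem mod_ker {U : Submodule k (MvPolynomial σ k)} {m : ℕ} {π : MvPolynomial σ k →ₐ[k] MvPolynomial (Fin m) k}
    {ρ : MvPolynomial (Fin m) k →ₐ[k] MvPolynomial σ k} (h0 : ∀ u ∈ U, π u = 0)
    (h1 : ∀ y, y - ρ (π y) ∈ Ideal.span (U : Set (MvPolynomial σ k))) (y : MvPolynomial σ k) :
    y ∈ Ideal.span (U : Set (MvPolynomial σ k)) ↔ π y = 0 := by
  constructor
  · exact ideal_kill π.toRingHom _ h0 y
  · intro h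
    have := h1 y
    rwa [h, map_zero, sub_zero] at this

/-- linear forms plus two further polynomials -/
theorem pd_lin_two [Finite σ] (U : Submodule k (MvPolynomial σ k)) (hU : U ≤ LinF σ k) {D : ℕ} (hD : Module.finrank k U ≤ D)
    (q1 q2 : MvPolynomial σ k) : PdI (Ideal.span (U : Set (MvPolynomial σ k)) ⊔ Ideal.span {q1} ⊔ Ideal.span {q2}) (D + 2) := by
  obtain ⟨m, π, ρ, -, h0, hπρ, h1, -, -⟩ := mod_lin U hU
  have hker := mod_ker h0 h1
  have hP : PdI (Ideal.span (U : Set (MvPolynomial σ k))) D := pd_vars U hU hD _ (Algebra.subset_adjoin)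
  have hone : ∀ q, PdI (Ideal.span (U : Set (MvPolynomial σ k)) ⊔ Ideal.span {q}) (D + 1) := by
    intro q
    by_cases hq : π q = 0
    · refine Pd.congr_ideal ?_ (hP.mono (Nat.le_succ D))
      exact (sup_eq_left.2 ((Ideal.span_singleton_le_iff_mem _).2 ((hker q).2 hq))).symm
    · refine Pd.regular _ q ?_ hP
      intro a ha
      rw [hker, map_mul] at ha
      exact (hker a).2 ((mul_eq_zero.1 ha).resolve_left hq)
  have hmem : ∀ q y : MvPolynomial σ k, y ∈ Ideal.span (U : Set (MvPolynomial σ k)) ⊔ Ideal.span {q} ↔ π q ∣ π y := by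
    intro q y
    constructor
    · intro hy
      obtain ⟨j, hj, t, ht, rfl⟩ := Submodule.mem_sup.1 hy
      obtain ⟨a, rfl⟩ := Ideal.mem_span_singleton'.1 ht
      rw [map_add, (hker j).1 hj, zero_add, map_mul]
      exact dvd_mul_left _ _
    · rintro ⟨c, hc⟩
      have : y = (y - q * ρ c) + ρ c * q := by ring
      rw [this]
      refine Submodule.add_mem_sup ((hker _).2 ?_) (Ideal.mem_span_singleton'.2 ⟨_, rfl⟩)
      rw [map_sub, map_mul, hπρ, hc, sub_self]
  by_cases hq1 : π q1 = 0
  · refine Pd.congr_ideal ?_ ((hone q2).mono (Nat.le_succ _))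
    congr 1
    exact (sup_eq_left.2 ((Ideal.span_singleton_le_iff_mem _).2 ((hker q1).2 hq1))).symm
  obtain ⟨a, b, g, hrel, hqg1, hqg2⟩ := UniqueFactorizationMonoid.exists_reduced_factors (π q1) hq1 (π q2)
  · refine Pd.colon _ (Ideal.span (U : Set (MvPolynomial σ k)) ⊔ Ideal.span {ρ a}) q2 ?_ ((hone q1).mono (Nat.le_succ _)) (hone _)
    intro y
    rw [hmem, hmem, hπρ, map_mul, ← hqg1, ← hqg2, mul_assoc]
    have hg : g ≠ 0 := by rintro rfl; simp at hqg1; exact hq1 hqg1.symm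
    rw [mul_dvd_mul_iff_left hg]
    constructor
    · exact fun h => h.mul_left _
    · exact fun h => hrel.dvd_of_dvd_mul_left h

end
end

section
open MvPolynomial

section
variable {k : Type u} {Ω : Type u} [Field k] [Field Ω] [Algebra k Ω] {σ : Type}

theorem finrank_div_le (x : MvPolynomial σ k) (hx : x ≠ 0) (V : Submodule k (MvPolynomial σ k)) [Module.Finite k V]
    (L : Submodule k (MvPolynomial σ k)) :
    Module.finrank k ↥(L ⊓ V.comap (LinearMap.mulLeft k x)) ≤ Module.finrank k V := by
  have hinj : Function.Injective (LinearMap.mulLeft k x) := fun a b h => mul_left_cancel₀ hx h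
  rw [(Submodule.equivMapOfInjective _ hinj (L ⊓ V.comap (LinearMap.mulLeft k x))).finrank_eq]
  apply Submodule.finrank_mono
  rintro _ ⟨y, hy, rfl⟩
  exact hy.2

theorem quad_mod {m : ℕ} (π : MvPolynomial σ k →ₐ[k] MvPolynomial (Fin m) k)
    (h : ∀ l ∈ LinF σ k, π l ∈ LinF (Fin m) k) {q : MvPolynomial σ k} (hq : q ∈ QuadF σ k) : π q ∈ QuadF (Fin m) k := by
  have h1 := coord_hom (k := k) π (fun i => h _ (X_mem_LinF i)) hq
  exact h1

/-- coprimality of two quadrics killed by a nondegenerate point -/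
theorem quad_coprime [Finite σ] (p : σ → Ω) (hL : ∀ l ∈ LinF σ k, aeval p l = 0 → l = 0) {F G : MvPolynomial σ k} (hF : F ∈ QuadF σ k)
    (hG : G ∈ QuadF σ k) (hp : aeval p F = 0) (hli : LinearIndependent k ![F, G]) (a b : MvPolynomial σ k)
    (hab : F * a + G * b = 0) : ∃ c, a = G * c ∧ b = - (F * c) := by
  have hF0 : F ≠ 0 := hli.ne_zero 0
  have hG0 : G ≠ 0 := hli.ne_zero 1
  have h1 : Prime F := (quad_irr p hL hF hF0 hp).prime
  have h2 : F ∣ G * b := ⟨-a, by linear_combination hab⟩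
  rcases h1.dvd_or_dvd h2 with h | ⟨c, hc⟩
  · obtain ⟨κ, hκ⟩ := dvd_prop hF0 h (by
      rw [IsHomogeneous.totalDegree hF hF0, IsHomogeneous.totalDegree hG hG0])
    exfalso
    rw [LinearIndependent.pair_iff] at hli
    have := (hli κ (-1) (by rw [hκ, smul_eq_C_mul]; simp)).2
    simp at this
  · refine ⟨-c, ?_, by rw [hc]; ring⟩
    apply mul_left_cancel₀ hF0
    linear_combination hab - G * hc

theorem case_d1 [Finite σ] [IsAlgClosed k] [IsAlgClosed Ω] (p : σ → Ω)
    (hr : ((Nat.card σ : ℕ) : ℕ∞) ≤ rk k (Set.range p) + 3)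
    (x : MvPolynomial σ k) (hx : x ∈ LinF σ k) (hx0 : x ≠ 0) (hxp : aeval p x = 0)
    (hK : ∀ l ∈ LinF σ k, aeval p l = 0 → l ∈ Submodule.span k {x}) (V : Submodule k (MvPolynomial σ k)) (hV : V ≤ QuadF σ k)
    (hVp : ∀ v ∈ V, aeval p v = 0) (hc : 4 ≤ Module.finrank k V) :
    PdI (Ideal.span (V : Set (MvPolynomial σ k))) (3 * Module.finrank k V + 1) := by
  have hVfin : Module.Finite k V := Submodule.finiteDimensional_of_le hV
  let U := Submodule.span k {x}
  have hU : U ≤ LinF σ k := by rw [Submodule.span_le]; simpa using hx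
  have hUd : Module.finrank k U = 1 := finrank_span_singleton hx0
  have hUfin : Module.Finite k U := Submodule.finiteDimensional_of_le hU
  obtain ⟨m, π, ρ, hm, h0, hπρ, h1, hπL, hρL⟩ := mod_lin U hU
  have hker := mod_ker h0 h1
  have hUI : Ideal.span (U : Set (MvPolynomial σ k)) = Ideal.span {x} := by
    apply le_antisymm
    · rw [Ideal.span_le]
      intro y hy
      obtain ⟨c, rfl⟩ := Submodule.mem_span_singleton.1 hy
      rw [smul_eq_C_mul]
      exact Ideal.mul_mem_left _ _ (Ideal.mem_span_singleton_self x)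
    · exact Ideal.span_mono (Set.singleton_subset_iff.2 (Submodule.mem_span_singleton_self (R := k) x))
  have hkerx : ∀ y, π y = 0 → ∃ y', y = x * y' := by
    intro y hy
    rw [← hker, hUI, Ideal.mem_span_singleton] at hy
    exact hy
  have hπx : π x = 0 := h0 x (Submodule.mem_span_singleton_self (R := k) x)
  have hquad : ∀ v ∈ QuadF σ k, π v = 0 → ∃ l ∈ LinF σ k, v = x * l := by
    intro v hv hv0
    have := ideal_quad U hU hv ((hker v).2 hv0)
    rw [Submodule.mem_span_singleton_mul] at this
    obtain ⟨l, hl, rfl⟩ := this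
    exact ⟨l, hl, rfl⟩
  obtain ⟨p', hp', hp'ρ, hrk⟩ := mod_point U π ρ h1 hπL p (by
    intro u hu
    obtain ⟨c, rfl⟩ := Submodule.mem_span_singleton.1 hu
    simp [hxp])
  have hL' : ∀ l ∈ LinF (Fin m) k, aeval p' l = 0 → l = 0 := by
    intro l hl h
    rw [← hp'ρ] at h
    rw [← hπρ l]
    exact h0 _ (hK _ (hρL l hl) h)
  have hr' : ((Nat.card (Fin m) : ℕ) : ℕ∞) ≤ rk k (Set.range p') + 2 := by
    simp only [Nat.card_eq_fintype_card, Fintype.card_fin]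
    have h2 := hr.trans (add_le_add_left hrk 3)
    rw [← hm, hUd] at h2
    generalize rk k (Set.range p') = a at *
    by_cases ha : a = ⊤
    · simp [ha]
    · lift a to ℕ using ha
      norm_cast at *
      omega
  let Vb := V.map π.toLinearMap
  have hVbq : Vb ≤ QuadF (Fin m) k := by
    rintro _ ⟨v, hv, rfl⟩
    exact quad_mod π hπL (hV hv)
  have hVbp : ∀ v ∈ Vb, aeval p' v = 0 := by
    rintro _ ⟨v, hv, rfl⟩
    exact (hp' v).symm.trans (hVp v hv)
  by_cases hn : 3 ≤ Module.finrank k Vb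
  · obtain ⟨U', hU', hU'd, hU'V⟩ := ht2 p' hr' hL' Vb hVbq hVbp hn
    let W1 := V.map (LinearMap.id - ρ.toLinearMap ∘ₗ π.toLinearMap)
    let L' := LinF σ k ⊓ W1.comap (LinearMap.mulLeft k x)
    have hL'd : Module.finrank k L' ≤ Module.finrank k V := (finrank_div_le x hx0 W1 _).trans (Submodule.finrank_map_le _ _)
    have hL'fin : Module.Finite k L' := Submodule.finiteDimensional_of_le inf_le_left
    have hU'fin : Module.Finite k U' := Submodule.finiteDimensional_of_le hU'
    have hρU : U'.map ρ.toLinearMap ≤ LinF σ k := by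
      rintro _ ⟨y, hy, rfl⟩; exact hρL y (hU' hy)
    refine pd_vars (U'.map ρ.toLinearMap ⊔ (U ⊔ L')) (sup_le hρU (sup_le hU inf_le_left)) ?_ _ ?_
    · have h2 := Submodule.finrank_add_le_finrank_add_finrank (U'.map ρ.toLinearMap) (U ⊔ L')
      have h3 := Submodule.finrank_add_le_finrank_add_finrank U L'
      have h4 := Submodule.finrank_map_le ρ.toLinearMap U'
      omega
    · intro v hv
      have h2 : v = ρ (π v) + (v - ρ (π v)) := by ring
      rw [h2]
      have hq : v - ρ (π v) ∈ QuadF σ k := by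
        refine sub_mem (hV hv) ?_
        exact coord_hom ρ (fun i => hρL _ (X_mem_LinF i)) (quad_mod π hπL (hV hv))
      obtain ⟨l, hl, hl'⟩ := hquad _ hq (by rw [map_sub, hπρ, sub_self])
      refine Subalgebra.add_mem _ ?_ ?_
      · have h9 : Algebra.adjoin k (U' : Set (MvPolynomial (Fin m) k)) ≤
          (Algebra.adjoin k ((U'.map ρ.toLinearMap ⊔ (U ⊔ L') : Submodule k (MvPolynomial σ k)) : Set (MvPolynomial σ k))).comap ρ :=
          Algebra.adjoin_le fun y hy => Algebra.subset_adjoin (Submodule.mem_sup_left ⟨y, hy, rfl⟩)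
        exact h9 (hU'V _ ⟨v, hv, rfl⟩)
      · rw [hl']
        refine Subalgebra.mul_mem _ (Algebra.subset_adjoin ?_) (Algebra.subset_adjoin ?_)
        · exact Submodule.mem_sup_right (Submodule.mem_sup_left (Submodule.mem_span_singleton_self x))
        · refine Submodule.mem_sup_right (Submodule.mem_sup_right ⟨hl, ?_⟩)
          exact ⟨v, hv, hl'⟩
  · obtain ⟨q1, q2, hq1, hq2, hcov, hcop⟩ : ∃ q1 q2, q1 ∈ V ∧ q2 ∈ V ∧ (∀ v ∈ V, ∃ c1 c2 : k, π (v - c1 • q1 - c2 • q2) = 0) ∧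
      ∀ a b, π q1 * π a + π q2 * π b = 0 → ∃ a' b', q1 * a + q2 * b = x * (q1 * a' + q2 * b') := by
      obtain ⟨n, hn'⟩ : ∃ n, Module.finrank k Vb = n := ⟨_, rfl⟩
      let B := Module.finBasisOfFinrankEq k Vb hn'
      have hB : ∀ v ∈ V, ∃ c : Fin n → k, π v = ∑ i, c i • (B i : MvPolynomial (Fin m) k) := by
        intro v hv
        have := B.sum_repr ⟨π v, v, hv, rfl⟩
        refine ⟨B.repr ⟨π v, v, hv, rfl⟩, ?_⟩
        have h2 := congrArg Subtype.val this
        refine h2.symm.trans ?_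
        simp only [AddSubmonoidClass.coe_finsetSum, Submodule.coe_smul]
      have hq : ∀ i, ∃ q ∈ V, π q = B i := fun i => (B i).2
      have hBi : LinearIndependent k (fun i => (B i : MvPolynomial (Fin m) k)) :=
        B.linearIndependent.map' Vb.subtype (Submodule.ker_subtype _)
      have hn3 : n < 3 := by omega
      clear_value B
      clear hn hn'
      interval_cases n
      · refine ⟨0, 0, V.zero_mem, V.zero_mem, ?_, ?_⟩
        · intro v hv
          obtain ⟨c, hc⟩ := hB v hv
          exact ⟨0, 0, by simpa using hc⟩
        · intro a b _
          exact ⟨0, 0, by ring⟩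
      · obtain ⟨q, hqV, hqB⟩ := hq 0
        refine ⟨q, 0, hqV, V.zero_mem, ?_, ?_⟩
        · intro v hv
          obtain ⟨c, hc⟩ := hB v hv
          refine ⟨c 0, 0, ?_⟩
          rw [map_sub, map_sub, hc, map_smul, hqB]
          simp
        · intro a b hab
          rw [map_zero, zero_mul, add_zero] at hab
          have h3 : π q ≠ 0 := by rw [hqB]; exact hBi.ne_zero 0
          obtain ⟨a', rfl⟩ := hkerx a ((mul_eq_zero.1 hab).resolve_left h3)
          exact ⟨a', 0, by ring⟩
      · obtain ⟨q, hqV, hqB⟩ := hq 0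
        obtain ⟨q', hqV', hqB'⟩ := hq 1
        refine ⟨q, q', hqV, hqV', ?_, ?_⟩
        · intro v hv
          obtain ⟨c, hc⟩ := hB v hv
          refine ⟨c 0, c 1, ?_⟩
          rw [map_sub, map_sub, hc, map_smul, map_smul, hqB, hqB']
          simp [Fin.sum_univ_two]
        · intro a b hab
          obtain ⟨c, hca, hcb⟩ := quad_coprime p' hL' (quad_mod π hπL (hV hqV)) (quad_mod π hπL (hV hqV'))
            (hVbp _ ⟨q, hqV, rfl⟩) (by
              rw [hqB, hqB']
              convert hBi using 1
              ext i; fin_cases i <;> rfl) (π a) (π b) hab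
          obtain ⟨a', ha'⟩ := hkerx (a - q' * ρ c) (by rw [map_sub, map_mul, hπρ, hca, sub_self])
          obtain ⟨b', hb'⟩ := hkerx (b + q * ρ c) (by rw [map_add, map_mul, hπρ, hcb]; ring)
          exact ⟨a', b', by linear_combination q * ha' + q' * hb'⟩
    let L' := LinF σ k ⊓ V.comap (LinearMap.mulLeft k x)
    have hL'd : Module.finrank k L' ≤ Module.finrank k V := finrank_div_le x hx0 V _
    let I := Ideal.span (V : Set (MvPolynomial σ k))
    have hVI : ∀ v ∈ V, v ∈ I := fun v hv => Ideal.subset_span hv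
    have hvdec : ∀ v ∈ V, ∃ l ∈ L', ∃ c1 c2 : k, v = x * l + c1 • q1 + c2 • q2 := by
      intro v hv
      obtain ⟨c1, c2, hc⟩ := hcov v hv
      have hvV : v - c1 • q1 - c2 • q2 ∈ V := sub_mem (sub_mem hv (V.smul_mem _ hq1)) (V.smul_mem _ hq2)
      obtain ⟨l, hl, hl'⟩ := hquad _ (hV hvV) hc
      refine ⟨l, ⟨hl, ?_⟩, c1, c2, by rw [← hl']; ring⟩
      change x * l ∈ V
      rw [← hl']; exact hvV
    have hIdec : ∀ y ∈ I, ∃ l ∈ Ideal.span (L' : Set (MvPolynomial σ k)), ∃ a b, y = x * l + q1 * a + q2 * b := by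
      intro y hy
      induction hy using Submodule.span_induction with
      | mem v hv =>
        obtain ⟨l, hl, c1, c2, h⟩ := hvdec v hv
        exact ⟨l, Ideal.subset_span hl, C c1, C c2, by rw [h, smul_eq_C_mul, smul_eq_C_mul]; ring⟩
      | zero => exact ⟨0, zero_mem _, 0, 0, by ring⟩
      | add y z _ _ hy hz =>
        obtain ⟨l, hl, a, b, rfl⟩ := hy
        obtain ⟨l', hl', a', b', rfl⟩ := hz
        exact ⟨l + l', add_mem hl hl', a + a', b + b', by ring⟩
      | smul r y _ hy =>
        obtain ⟨l, hl, a, b, rfl⟩ := hy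
        exact ⟨r * l, Ideal.mul_mem_left _ _ hl, r * a, r * b, by rw [smul_eq_mul]; ring⟩
    refine Pd.colon_mid I (Ideal.span (L' : Set (MvPolynomial σ k)) ⊔ Ideal.span {q1} ⊔ Ideal.span {q2}) x ?_ ?_ ?_
    · intro y
      constructor
      · intro hy
        have hle : Ideal.span (L' : Set (MvPolynomial σ k)) ⊔ Ideal.span {q1} ⊔ Ideal.span {q2} ≤ Submodule.comap (LinearMap.mulLeft (MvPolynomial σ k) x) I := by
          refine sup_le (sup_le ?_ ?_) ?_
          · rw [Ideal.span_le]
            intro l hl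
            exact hVI _ hl.2
          · rw [Ideal.span_singleton_le_iff_mem]
            exact Ideal.mul_mem_left _ _ (hVI _ hq1)
          · rw [Ideal.span_singleton_le_iff_mem]
            exact Ideal.mul_mem_left _ _ (hVI _ hq2)
        exact hle hy
      · intro hy
        obtain ⟨l, hl, a, b, h⟩ := hIdec _ hy
        obtain ⟨a', b', h'⟩ := hcop a b (by
          have := congrArg π h
          simp only [map_mul, map_add, hπx, zero_mul, zero_add] at this
          exact this.symm)
        have h5 : y = l + a' * q1 + b' * q2 := by
          apply mul_left_cancel₀ hx0
          linear_combination h + h'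
        rw [h5]
        exact Submodule.add_mem_sup (Submodule.add_mem_sup hl (Ideal.mem_span_singleton'.2 ⟨_, rfl⟩)) (Ideal.mem_span_singleton'.2 ⟨_, rfl⟩)
    · have h6 : I ⊔ Ideal.span {x} = Ideal.span (U : Set (MvPolynomial σ k)) ⊔ Ideal.span {q1} ⊔ Ideal.span {q2} := by
        rw [hUI]
        apply le_antisymm
        · refine sup_le ?_ (le_sup_left.trans le_sup_left)
          intro y hy
          obtain ⟨l, hl, a, b, rfl⟩ := hIdec y hy
          exact Submodule.add_mem_sup (Submodule.add_mem_sup (Ideal.mem_span_singleton'.2 ⟨l, mul_comm _ _⟩) (Ideal.mem_span_singleton'.2 ⟨a, mul_comm _ _⟩))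
            (Ideal.mem_span_singleton'.2 ⟨b, mul_comm _ _⟩)
        · refine sup_le (sup_le le_sup_right ?_) ?_
          · rw [Ideal.span_singleton_le_iff_mem]; exact Submodule.mem_sup_left (hVI _ hq1)
          · rw [Ideal.span_singleton_le_iff_mem]; exact Submodule.mem_sup_left (hVI _ hq2)
      exact Pd.congr_ideal h6.symm ((pd_lin_two U hU hUd.le q1 q2).mono (by omega))
    · exact (pd_lin_two L' inf_le_left hL'd q1 q2).mono (by omega)

end
end

section
open MvPolynomial

section
variable {R : Type*} [CommRing R]

/-- Koszul statements modulo `J` in positive weights. -/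
def KZ (x : Fin 3 → R) (J : Ideal R) : Prop :=
  (∀ g ∈ Ideal.span (Set.range x), (∀ c, x c * g ∈ J) → g ∈ J) ∧
  (∀ u v w, u ∈ Ideal.span (Set.range x) → v ∈ Ideal.span (Set.range x) → w ∈ Ideal.span (Set.range x) →
    x 1 * u - x 0 * v ∈ J → x 2 * u - x 0 * w ∈ J → x 2 * v - x 1 * w ∈ J →
    ∃ h, u - x 0 * h ∈ J ∧ v - x 1 * h ∈ J ∧ w - x 2 * h ∈ J) ∧
  (∀ r s t, r ∈ Ideal.span (Set.range x) → s ∈ Ideal.span (Set.range x) → t ∈ Ideal.span (Set.range x) →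
    x 2 * r - x 1 * s + x 0 * t ∈ J → ∃ a b c, r - (x 1 * a - x 0 * b) ∈ J ∧ s - (x 2 * a - x 0 * c) ∈ J ∧
      t - (x 2 * b - x 1 * c) ∈ J)

theorem kz_step (x : Fin 3 → R) (f : R) (J : Ideal R) (hfM : f ∈ Ideal.span (Set.range x))
    (hN : ∀ e ∈ Ideal.span (Set.range x), f * e ∈ J → e ∈ J)
    (hl : ∀ u p, p ∈ Ideal.span (Set.range x) * Ideal.span (Set.range x) → p - u * f ∈ J →
      ∃ u' ∈ Ideal.span (Set.range x), p - u' * f ∈ J) (h : KZ x J) : KZ x (J ⊔ Ideal.span {f}) := by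
  obtain ⟨P0, P1, P2⟩ := h
  have hmem : ∀ p, p ∈ J ⊔ Ideal.span {f} ↔ ∃ u, p - u * f ∈ J := by
    intro p
    constructor
    · intro hp
      obtain ⟨j, hj, t, ht, rfl⟩ := Submodule.mem_sup.1 hp
      obtain ⟨a, rfl⟩ := Ideal.mem_span_singleton'.1 ht
      exact ⟨a, by simpa using hj⟩
    · rintro ⟨u, hu⟩
      have : p = (p - u * f) + u * f := by ring
      rw [this]
      exact Submodule.add_mem_sup hu (Ideal.mem_span_singleton'.2 ⟨_, rfl⟩)
  have hx : ∀ c, x c ∈ Ideal.span (Set.range x) := fun c => Ideal.subset_span ⟨c, rfl⟩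
  have hmem2 : ∀ p ∈ Ideal.span (Set.range x) * Ideal.span (Set.range x), p ∈ J ⊔ Ideal.span {f} →
      ∃ u ∈ Ideal.span (Set.range x), p - u * f ∈ J := by
    intro p hp h
    obtain ⟨u, hu⟩ := (hmem p).1 h
    exact hl u p hp hu
  have key : ∀ c d g g', g ∈ Ideal.span (Set.range x) → g' ∈ Ideal.span (Set.range x) →
      x c * g - x d * g' ∈ Ideal.span (Set.range x) := fun c d g g' _ _ =>
    sub_mem (Ideal.mul_mem_right _ _ (hx c)) (Ideal.mul_mem_right _ _ (hx d))
  have key2 : ∀ c d g g', g ∈ Ideal.span (Set.range x) → g' ∈ Ideal.span (Set.range x) →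
      x c * g - x d * g' ∈ Ideal.span (Set.range x) * Ideal.span (Set.range x) := fun c d g g' h h' =>
    sub_mem (Ideal.mul_mem_mul (hx c) h) (Ideal.mul_mem_mul (hx d) h')
  refine ⟨?_, ?_, ?_⟩
  · intro g hg hgJ
    obtain ⟨u, hu, hu'⟩ := hmem2 _ (Ideal.mul_mem_mul (hx 0) hg) (hgJ 0)
    obtain ⟨v, hv, hv'⟩ := hmem2 _ (Ideal.mul_mem_mul (hx 1) hg) (hgJ 1)
    obtain ⟨w, hw, hw'⟩ := hmem2 _ (Ideal.mul_mem_mul (hx 2) hg) (hgJ 2)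
    obtain ⟨h, h0, h1, h2⟩ := P1 u v w hu hv hw
      (hN _ (key _ _ _ _ hu hv) (by
        convert sub_mem (J.mul_mem_left (x 0) hv') (J.mul_mem_left (x 1) hu') using 1; ring))
      (hN _ (key _ _ _ _ hu hw) (by
        convert sub_mem (J.mul_mem_left (x 0) hw') (J.mul_mem_left (x 2) hu') using 1; ring))
      (hN _ (key _ _ _ _ hv hw) (by
        convert sub_mem (J.mul_mem_left (x 1) hw') (J.mul_mem_left (x 2) hv') using 1; ring))
    rw [hmem]
    refine ⟨h, P0 _ (sub_mem hg (Ideal.mul_mem_left _ _ hfM)) ?_⟩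
    intro c
    fin_cases c
    · convert add_mem hu' (J.mul_mem_left f h0) using 1; simp; ring
    · convert add_mem hv' (J.mul_mem_left f h1) using 1; simp; ring
    · convert add_mem hw' (J.mul_mem_left f h2) using 1; simp; ring
  · intro u v w hu hv hw h1 h2 h3
    obtain ⟨r, hr, hr'⟩ := hmem2 _ (key2 _ _ _ _ hu hv) h1
    obtain ⟨s, hs, hs'⟩ := hmem2 _ (key2 _ _ _ _ hu hw) h2
    obtain ⟨t, ht, ht'⟩ := hmem2 _ (key2 _ _ _ _ hv hw) h3
    obtain ⟨a, b, c, ha, hb, hc⟩ := P2 r s t hr hs ht (hN _ (add_mem (key _ _ _ _ hr hs) (Ideal.mul_mem_right _ _ (hx 0))) (by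
      convert neg_mem (add_mem (sub_mem (J.mul_mem_left (x 2) hr') (J.mul_mem_left (x 1) hs')) (J.mul_mem_left (x 0) ht')) using 1; ring))
    obtain ⟨h, h4, h5, h6⟩ := P1 (u - f * a) (v - f * b) (w - f * c) (sub_mem hu (Ideal.mul_mem_right _ _ hfM))
      (sub_mem hv (Ideal.mul_mem_right _ _ hfM)) (sub_mem hw (Ideal.mul_mem_right _ _ hfM))
      (by convert add_mem hr' (J.mul_mem_left f ha) using 1; ring)
      (by convert add_mem hs' (J.mul_mem_left f hb) using 1; ring)
      (by convert add_mem ht' (J.mul_mem_left f hc) using 1; ring)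
    simp only [hmem]
    refine ⟨h, ⟨a, ?_⟩, ⟨b, ?_⟩, ⟨c, ?_⟩⟩
    · convert h4 using 1; ring
    · convert h5 using 1; ring
    · convert h6 using 1; ring
  · intro r s t hr hs ht h1
    obtain ⟨q, hq, hq'⟩ := hmem2 _ (add_mem (key2 _ _ _ _ hr hs) (Ideal.mul_mem_mul (hx 0) ht)) h1
    obtain ⟨c, hc⟩ := (Ideal.mem_span_range_iff_exists_fun).1 hq
    rw [Fin.sum_univ_three] at hc
    obtain ⟨a, b, d, h2, h3, h4⟩ := P2 (r - f * c 2) (s - f * (-c 1)) (t - f * c 0) (sub_mem hr (Ideal.mul_mem_right _ _ hfM))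
      (sub_mem hs (Ideal.mul_mem_right _ _ hfM)) (sub_mem ht (Ideal.mul_mem_right _ _ hfM)) (by
        convert hq' using 1; rw [← hc]; ring)
    simp only [hmem]
    refine ⟨a, b, d, ⟨c 2, ?_⟩, ⟨- c 1, ?_⟩, ⟨c 0, ?_⟩⟩
    · convert h2 using 1; ring
    · convert h3 using 1; ring
    · convert h4 using 1; ring

/-- power torsion is already torsion -/
theorem kz_torsion (x : Fin 3 → R) (J : Ideal R) (h : KZ x J) (e : R) (he : ∀ c, ∃ N, x c ^ N * e ∈ J) (c : Fin 3) : x c * e ∈ J := by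
  choose N hN using he
  have h1 : ∀ n, ∀ e, (∀ a b d, a + b + d = n + 1 → x 0 ^ a * x 1 ^ b * x 2 ^ d * e ∈ J) → ∀ c, x c * e ∈ J := by
    intro n
    induction n with
    | zero =>
      intro e he c
      fin_cases c
      · simpa using he 1 0 0 rfl
      · simpa using he 0 1 0 rfl
      · simpa using he 0 0 1 rfl
    | succ n ih =>
      intro e he
      apply ih
      intro a b d habd
      have hx : ∀ c, x c ∈ Ideal.span (Set.range x) := fun c => Ideal.subset_span ⟨c, rfl⟩
      refine h.1 _ ?_ ?_
      · apply Ideal.mul_mem_right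
        rcases Nat.eq_zero_or_pos a with ha | ha
        · rcases Nat.eq_zero_or_pos b with hb | hb
          · exact Ideal.mul_mem_left _ _ (Ideal.pow_mem_of_mem _ (hx 2) _ (by omega))
          · exact Ideal.mul_mem_right _ _ (Ideal.mul_mem_left _ _ (Ideal.pow_mem_of_mem _ (hx 1) _ hb))
        · exact Ideal.mul_mem_right _ _ (Ideal.mul_mem_right _ _ (Ideal.pow_mem_of_mem _ (hx 0) _ ha))
      · intro c
        fin_cases c
        · convert he (a + 1) b d (by omega) using 1; simp; ring
        · convert he a (b + 1) d (by omega) using 1; simp; ring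
        · convert he a b (d + 1) (by omega) using 1; simp; ring
  refine h1 (N 0 + N 1 + N 2) e ?_ c
  intro a b d habd
  have hcase : ∀ c n, N c ≤ n → x c ^ n * e ∈ J := by
    intro c n hn
    obtain ⟨i, rfl⟩ := Nat.exists_eq_add_of_le hn
    convert J.mul_mem_left (x c ^ i) (hN c) using 1; ring
  by_cases ha : N 0 ≤ a
  · convert J.mul_mem_left (x 1 ^ b * x 2 ^ d) (hcase 0 a ha) using 1; ring
  · by_cases hb : N 1 ≤ b
    · convert J.mul_mem_left (x 0 ^ a * x 2 ^ d) (hcase 1 b hb) using 1; ring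
    · convert J.mul_mem_left (x 0 ^ a * x 1 ^ b) (hcase 2 d (by omega)) using 1; ring

end
end

section
open MvPolynomial

section
variable {k : Type u} [Field k] {ρ ι : Type}

theorem sub_mem_of_hom {σ : Type} (M : Ideal (MvPolynomial σ k)) (φ : MvPolynomial σ k →ₐ[k] MvPolynomial σ k)
    (h : ∀ i, X i - φ (X i) ∈ M) (p : MvPolynomial σ k) : p - φ p ∈ M := by
  have : (Ideal.Quotient.mkₐ k M).comp φ = Ideal.Quotient.mkₐ k M := by
    apply MvPolynomial.algHom_ext
    intro i
    exact (Ideal.Quotient.eq.2 (h i)).symm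
  exact Ideal.Quotient.eq.1 (DFunLike.congr_fun this p).symm

theorem X_dvd_cancel {σ : Type} {i j : σ} (hij : i ≠ j) {p : MvPolynomial σ k} (h : X i ∣ X j * p) : X i ∣ p := by
  refine ((X_prime (R := k) (i := i)).dvd_or_dvd h).resolve_left ?_
  rw [X_dvd_X]
  simpa using hij

theorem kz_base {σ : Type} (v : Fin 3 → σ) (hv : Function.Injective v) : KZ (fun c => (X (v c) : MvPolynomial σ k)) ⊥ := by
  classical
  have h0 : ∀ i : σ, (X i : MvPolynomial σ k) ≠ 0 := fun i => X_ne_zero i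
  have h01 : v 0 ≠ v 1 := fun h => by simpa using hv h
  have h12 : v 1 ≠ v 2 := fun h => by simpa using hv h
  refine ⟨?_, ?_, ?_⟩
  · intro g _ hg
    exact (mul_eq_zero.1 ((Submodule.mem_bot _).1 (hg 0))).resolve_left (h0 _)
  · intro u v' w _ _ _ h1 h2 _
    simp only [Submodule.mem_bot, sub_eq_zero] at *
    obtain ⟨h, rfl⟩ : X (v 0) ∣ u := X_dvd_cancel h01 ⟨v', h1⟩
    refine ⟨h, rfl, ?_, ?_⟩
    · apply mul_left_cancel₀ (h0 (v 0)); linear_combination -h1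
    · apply mul_left_cancel₀ (h0 (v 0)); linear_combination -h2
  · intro r s t _ _ _ h
    simp only [Submodule.mem_bot, sub_eq_zero] at *
    let π : MvPolynomial σ k →ₐ[k] MvPolynomial σ k := aeval (Function.update X (v 0) 0)
    have hπ : ∀ p, ∃ q, p = π p + X (v 0) * q := by
      intro p
      have := sub_mem_of_hom (Ideal.span {X (v 0)}) π (fun i => by
        by_cases hi : i = v 0
        · subst hi; simp [π, Ideal.mem_span_singleton_self]
        · simp [π, Function.update_of_ne hi]) p
      obtain ⟨q, hq⟩ := Ideal.mem_span_singleton.1 this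
      exact ⟨q, by rw [← hq]; ring⟩
    have h3 : X (v 2) * π r = X (v 1) * π s := by
      have h4 := congrArg π h
      have e1 : π (X (v 1)) = X (v 1) := by simp [π, Function.update_of_ne h01.symm]
      have e2 : π (X (v 2)) = X (v 2) := by
        have : v 2 ≠ v 0 := fun h => by simpa using hv h
        simp [π, Function.update_of_ne this]
      have e0 : π (X (v 0)) = 0 := by simp [π]
      simp only [map_add, map_sub, map_mul, e0, e1, e2, map_zero] at h4
      linear_combination h4
    obtain ⟨a, ha⟩ : X (v 1) ∣ π r := X_dvd_cancel h12 ⟨_, h3⟩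
    have hs : π s = X (v 2) * a := by
      apply mul_left_cancel₀ (h0 (v 1)); rw [← h3, ha]; ring
    obtain ⟨b, hb⟩ := hπ r
    obtain ⟨c, hc⟩ := hπ s
    refine ⟨a, -b, -c, by rw [hb, ha]; ring, by rw [hc, hs]; ring, ?_⟩
    apply mul_left_cancel₀ (h0 (v 0))
    rw [hb, hc, ha, hs] at h
    linear_combination h

abbrev PR (k : Type u) [Field k] (ρ ι : Type) := MvPolynomial (ρ ⊕ (Fin 3 ⊕ ι × Fin 3)) k

noncomputable def xx (c : Fin 3) : PR k ρ ι := X (Sum.inr (Sum.inl c))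
noncomputable def aa (i : ι) (c : Fin 3) : PR k ρ ι := X (Sum.inr (Sum.inr (i, c)))
noncomputable def FF (i : ι) : PR k ρ ι := ∑ c, xx c * aa i c
noncomputable def JT (T : Set ι) : Ideal (PR k ρ ι) := Ideal.span (FF '' T)

theorem FF_mem (i : ι) : (FF i : PR k ρ ι) ∈ Ideal.span (Set.range (xx : Fin 3 → PR k ρ ι)) :=
  sum_mem fun c _ => Ideal.mul_mem_right _ _ (Ideal.subset_span ⟨c, rfl⟩)

open TrivSqZeroExt in
theorem hl_core (T : Set ι) (j : ι) (u p : PR k ρ ι)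
    (hp : p ∈ Ideal.span (Set.range (xx : Fin 3 → PR k ρ ι)) * Ideal.span (Set.range (xx : Fin 3 → PR k ρ ι)))
    (h : p - u * FF j ∈ JT T) : ∃ u' ∈ Ideal.span (Set.range (xx : Fin 3 → PR k ρ ι)), p - u' * FF j ∈ JT T := by
  let ψ : PR k ρ ι →ₐ[k] DualNumber (PR k ρ ι) :=
    aeval (Sum.elim (fun r => inl (X (Sum.inl r))) (Sum.elim (fun c => inr (xx c)) (fun i => inl (X (Sum.inr (Sum.inr i))))))
  have hψx : ∀ c, ψ (xx c) = inr (xx c) := by intro c; simp [ψ, xx]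
  have hψa : ∀ i c, ψ (aa i c) = inl (aa i c) := by intro i c; simp [ψ, aa]
  have hψF : ∀ i, ψ (FF i) = inr (FF i) := by
    intro i
    rw [FF, map_sum]
    simp only [map_mul, hψx, hψa]
    rw [inr_sum]
    refine Finset.sum_congr rfl fun c _ => ?_
    ext <;> simp
  have hψF2 : ∀ g i, (ψ (g * FF i)).snd = (ψ g).fst * FF i := by
    intro g i
    rw [map_mul, hψF]; simp [mul_comm]
  have hψM : ∀ q ∈ Ideal.span (Set.range (xx : Fin 3 → PR k ρ ι)), (ψ q).fst = 0 := by
    intro q hq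
    refine ideal_kill ((fstHom k (PR k ρ ι) (PR k ρ ι)).comp ψ).toRingHom (Set.range xx) ?_ q hq
    rintro _ ⟨c, rfl⟩
    change (ψ (xx c)).fst = 0
    rw [hψx]; simp
  have hψp : (ψ p).snd = 0 := by
    refine Submodule.mul_induction_on hp ?_ ?_
    · intro a ha b hb
      rw [map_mul, snd_mul, hψM a ha, hψM b hb]; simp
    · intro a b ha hb
      rw [map_add, snd_add, ha, hb, add_zero]
  have hψJ : ∀ q ∈ (JT T : Ideal (PR k ρ ι)), (ψ q).snd ∈ (JT T : Ideal (PR k ρ ι)) := by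
    intro q hq
    refine Submodule.span_induction (p := fun q _ => (ψ q).snd ∈ (JT T : Ideal (PR k ρ ι))) ?_ (by simp) ?_ ?_ hq
    · rintro _ ⟨i, hi, rfl⟩
      rw [hψF, snd_inr]
      exact Ideal.subset_span ⟨i, hi, rfl⟩
    · intro a b _ _ ha hb
      rw [map_add, snd_add]; exact add_mem ha hb
    · intro a b hb hb'
      have hb0 : (ψ b).fst = 0 := by
        refine hψM b (Submodule.span_le.2 ?_ hb)
        rintro _ ⟨i, hi, rfl⟩; exact FF_mem i
      rw [smul_eq_mul, map_mul, snd_mul, hb0]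
      simp only [MulOpposite.op_zero, zero_smul, add_zero]
      exact Ideal.mul_mem_left _ _ hb'
  let ε : PR k ρ ι →ₐ[k] PR k ρ ι := (fstHom k (PR k ρ ι) (PR k ρ ι)).comp ψ
  have hε : ∀ q, ε q = (ψ q).fst := fun q => rfl
  have hεM : ∀ q, q - ε q ∈ Ideal.span (Set.range (xx : Fin 3 → PR k ρ ι)) := by
    apply sub_mem_of_hom
    rintro (r | c | i)
    · simp [hε, ψ]
    · rw [hε]
      change xx c - (ψ (xx c)).fst ∈ _
      rw [hψx]
      have : (xx c : PR k ρ ι) ∈ Ideal.span (Set.range (xx : Fin 3 → PR k ρ ι)) := Ideal.subset_span ⟨c, rfl⟩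
      simpa using this
    · simp [hε, ψ]
  refine ⟨u - ε u, hεM u, ?_⟩
  have h1 := hψJ _ h
  rw [map_sub, snd_sub, hψp, hψF2, zero_sub, neg_mem_iff] at h1
  have : p - (u - ε u) * FF j = (p - u * FF j) + ε u * FF j := by ring
  rw [this]
  exact add_mem h h1

theorem phi_core (T : Set ι) (c : Fin 3) : ∃ φ : PR k ρ ι →ₐ[k] FractionRing (PR k ρ ι),
    (∀ d, φ (xx d) = algebraMap _ _ (xx d : PR k ρ ι)) ∧ (∀ e ∈ (JT T : Ideal (PR k ρ ι)), φ e = 0) ∧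
    (∀ e, φ e = 0 → ∃ M, xx c ^ M * e ∈ (JT T : Ideal (PR k ρ ι))) := by
  classical
  let K := FractionRing (PR k ρ ι)
  let ι' : PR k ρ ι → K := algebraMap _ _
  have hx0 : (algebraMap (PR k ρ ι) K) (xx c) ≠ 0 := by
    rw [Ne, map_eq_zero_iff _ (IsFractionRing.injective (PR k ρ ι) K)]
    exact X_ne_zero _
  let S : ι → PR k ρ ι := fun i => ∑ d ∈ Finset.univ.erase c, xx d * aa i d
  let φ : PR k ρ ι →ₐ[k] K := aeval (Sum.elim (fun r => algebraMap _ _ (X (Sum.inl r) : PR k ρ ι))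
    (Sum.elim (fun c => algebraMap _ _ (xx c : PR k ρ ι))
      (fun i => if i.1 ∈ T ∧ i.2 = c then - algebraMap (PR k ρ ι) K (S i.1) / algebraMap (PR k ρ ι) K (xx c)
        else algebraMap _ _ (aa i.1 i.2 : PR k ρ ι))))
  have hφx : ∀ d, φ (xx d) = algebraMap _ _ (xx d : PR k ρ ι) := by intro d; simp [φ, xx]
  have hφa : ∀ i d, ¬ (i ∈ T ∧ d = c) → φ (aa i d) = algebraMap _ _ (aa i d : PR k ρ ι) := by
    intro i d h
    simp only [φ, aa, aeval_X, Sum.elim_inr]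
    rw [if_neg h]
  have hφa' : ∀ i, i ∈ T → φ (aa i c) = - algebraMap (PR k ρ ι) K (S i) / algebraMap (PR k ρ ι) K (xx c) := by
    intro i h
    simp only [φ, aa, aeval_X, Sum.elim_inr]
    simp [h]
  have hFS : ∀ i, (FF i : PR k ρ ι) = xx c * aa i c + S i := by
    intro i
    rw [FF, ← Finset.add_sum_erase _ _ (Finset.mem_univ c)]
  have hφS : ∀ i, φ (S i) = algebraMap _ _ (S i) := by
    intro i
    simp only [S, map_sum, map_mul]
    refine Finset.sum_congr rfl fun d hd => ?_
    rw [hφx, hφa i d (fun h => (Finset.mem_erase.1 hd).1 h.2)]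
  have hφF : ∀ i ∈ T, φ (FF i) = 0 := by
    intro i hi
    rw [hFS, map_add, map_mul, hφx, hφa' i hi, hφS, mul_div_cancel₀ _ hx0, neg_add_cancel]
  refine ⟨φ, hφx, ?_, ?_⟩
  · intro e he
    refine ideal_kill φ.toRingHom (FF '' T) ?_ e he
    rintro _ ⟨i, hi, rfl⟩
    exact hφF i hi
  · have key : ∀ e : PR k ρ ι, ∃ M, ∃ e', xx c ^ M * e - e' ∈ (JT T : Ideal (PR k ρ ι)) ∧ φ e' = algebraMap _ _ e' := by
      intro e
      induction e using MvPolynomial.induction_on with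
      | C a => 
        refine ⟨0, C a, by simp, ?_⟩
        have h1 : (C a : PR k ρ ι) = algebraMap k _ a := rfl
        rw [h1, AlgHom.commutes, ← IsScalarTower.algebraMap_apply]
      | add p q hp hq =>
        obtain ⟨M, p', hp, hp'⟩ := hp
        obtain ⟨N, q', hq, hq'⟩ := hq
        refine ⟨M + N, xx c ^ N * p' + xx c ^ M * q', ?_, ?_⟩
        · convert add_mem (Ideal.mul_mem_left _ (xx c ^ N) hp) (Ideal.mul_mem_left _ (xx c ^ M) hq) using 1; ring
        · simp only [map_add, map_mul, map_pow, hφx, hp', hq']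
      | mul_X p i hp =>
        obtain ⟨M, p', hp, hp'⟩ := hp
        have hgen : (φ (X i) = algebraMap _ _ (X i : PR k ρ ι)) ∨ ∃ j, j ∈ T ∧ (X i : PR k ρ ι) = aa j c := by
          rcases i with r | d | ⟨i, d⟩
          · left; simp [φ]
          · left; exact hφx d
          · by_cases h : i ∈ T ∧ d = c
            · right; exact ⟨i, h.1, by rw [h.2]; rfl⟩
            · left; exact hφa i d h
        rcases hgen with h | ⟨j, hj, h⟩
        · refine ⟨M, p' * X i, ?_, by rw [map_mul, hp', h, map_mul]⟩
          convert Ideal.mul_mem_left _ (X i) hp using 1; ring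
        · refine ⟨M + 1, - (p' * S j), ?_, by rw [map_neg, map_mul, hp', hφS, map_neg, map_mul]⟩
          have hF : (FF j : PR k ρ ι) ∈ (JT T : Ideal (PR k ρ ι)) := Ideal.subset_span ⟨j, hj, rfl⟩
          rw [hFS] at hF
          rw [h]
          convert add_mem (Ideal.mul_mem_left _ (xx c * aa j c) hp) (Ideal.mul_mem_left _ p' hF) using 1; ring
    intro e he
    obtain ⟨M, e', h1, h2⟩ := key e
    refine ⟨M, ?_⟩
    have h3 : φ (xx c ^ M * e - e') = 0 := ideal_kill φ.toRingHom (FF '' T) (by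
      rintro _ ⟨i, hi, rfl⟩
      exact hφF i hi) _ h1
    rw [map_sub, map_mul, he, mul_zero, zero_sub, neg_eq_zero, h2, map_eq_zero_iff _ (IsFractionRing.injective (PR k ρ ι) K)] at h3
    rwa [h3, sub_zero] at h1

theorem tors_core (T : Set ι) (f : PR k ρ ι) (τ : PR k ρ ι →ₐ[k] PR k ρ ι) (hτx : ∀ c, τ (xx c) = xx c)
    (hτF : ∀ i ∈ T, τ (FF i) = FF i) (κ : Fin 3 → k) (hκ : κ ≠ 0) (hτf : τ f = f + ∑ c, C (κ c) * xx c)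
    (e : PR k ρ ι) (he : f * e ∈ (JT T : Ideal (PR k ρ ι))) (c : Fin 3) : ∃ N, xx c ^ N * e ∈ (JT T : Ideal (PR k ρ ι)) := by
  obtain ⟨φ, hφx, hφJ, hφ⟩ := phi_core (k := k) (ρ := ρ) T c
  have hinj := IsFractionRing.injective (PR k ρ ι) (FractionRing (PR k ρ ι))
  have h1 := hφJ _ he
  rw [map_mul, mul_eq_zero] at h1
  rcases h1 with h1 | h1
  · exfalso
    obtain ⟨M, hM⟩ := hφ f h1
    have hτJ : ∀ q ∈ (JT T : Ideal (PR k ρ ι)), τ q ∈ (JT T : Ideal (PR k ρ ι)) := by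
      intro q hq
      have : (JT T : Ideal (PR k ρ ι)) ≤ (JT T : Ideal (PR k ρ ι)).comap τ := by
        rw [JT, Ideal.span_le]
        rintro _ ⟨i, hi, rfl⟩
        change τ (FF i) ∈ (JT T : Ideal (PR k ρ ι))
        rw [hτF i hi]
        exact Ideal.subset_span ⟨i, hi, rfl⟩
      exact this hq
    have h2 := hφJ _ (sub_mem (hτJ _ hM) hM)
    rw [map_mul, map_pow, hτx, hτf, ← mul_sub, add_sub_cancel_left, map_mul, map_pow, hφx, mul_eq_zero] at h2
    rcases h2 with h2 | h2
    · have := eq_zero_of_pow_eq_zero h2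
      rw [map_eq_zero_iff _ hinj] at this
      exact X_ne_zero _ this
    · have h3 : φ (∑ c, C (κ c) * xx c) = algebraMap _ _ (∑ c, C (κ c) * xx c : PR k ρ ι) := by
        simp only [map_sum, map_mul, hφx]
        refine Finset.sum_congr rfl fun d _ => ?_
        congr 1
        have h1 : (C (κ d) : PR k ρ ι) = algebraMap k _ (κ d) := rfl
        rw [h1, AlgHom.commutes, ← IsScalarTower.algebraMap_apply]
      rw [h3, map_eq_zero_iff _ hinj] at h2
      apply hκ
      have hli : LinearIndependent k (fun c => (xx c : PR k ρ ι)) :=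
        (algebraicIndependent_X _ k).linearIndependent.comp _ (Sum.inr_injective.comp Sum.inl_injective)
      rw [Fintype.linearIndependent_iff] at hli
      funext d
      exact hli κ (by simpa [smul_eq_C_mul] using h2) d
  · exact hφ e h1

theorem kz_core (T : Finset ι) : KZ (xx : Fin 3 → PR k ρ ι) (JT (T : Set ι)) := by
  classical
  induction T using Finset.induction_on with
  | empty =>
    have : (JT ((∅ : Finset ι) : Set ι) : Ideal (PR k ρ ι)) = ⊥ := by simp [JT]
    rw [this]
    exact kz_base _ (Sum.inr_injective.comp Sum.inl_injective)
  | insert j T hj ih =>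
    have : (JT ((insert j T : Finset ι) : Set ι) : Ideal (PR k ρ ι)) = JT (T : Set ι) ⊔ Ideal.span {FF j} := by
      rw [JT, Finset.coe_insert, Set.image_insert_eq, Ideal.span_insert, sup_comm, JT]
    rw [this]
    refine kz_step _ _ _ (FF_mem j) ?_ (fun u p => hl_core _ _ _ _) ih
    intro e heM he
    refine ih.1 e heM (kz_torsion _ _ ih e ?_)
    refine tors_core _ (FF j) (aeval (Function.update X (Sum.inr (Sum.inr (j, 0))) (X (Sum.inr (Sum.inr (j, 0))) + 1)))
      ?_ ?_ (Pi.single 0 1) (by simp) ?_ e he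
    · intro c; simp [xx]
    · intro i hi
      have : i ≠ j := by rintro rfl; exact hj hi
      simp [FF, xx, aa, this]
    · simp [FF, xx, aa, Fin.sum_univ_three]
      ring

end
end

section
open MvPolynomial

section
variable {k : Type u} [Field k] {σ ρ ι : Type}

theorem adjoin_range_tower {t D : ℕ}
    (Φ : MvPolynomial (Fin t) (MvPolynomial (Fin D) k) ≃ₐ[k] MvPolynomial σ k)
    (U : Submodule k (MvPolynomial σ k))
    (hU : Submodule.span k (Set.range fun i => Φ (C (X i))) = U) (x : MvPolynomial σ k)
    (hx : x ∈ Algebra.adjoin k (U : Set (MvPolynomial σ k))) : ∃ a, x = Φ (C a) := by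
  let β : MvPolynomial (Fin D) k →ₐ[k] MvPolynomial σ k :=
    Φ.toAlgHom.comp (IsScalarTower.toAlgHom k (MvPolynomial (Fin D) k) _)
  have hr : Algebra.adjoin k (U : Set (MvPolynomial σ k)) ≤ β.range := by
    refine Algebra.adjoin_le ?_
    intro x hx
    rw [← hU] at hx
    have : Submodule.span k (Set.range fun i => Φ (C (X i))) ≤ Subalgebra.toSubmodule β.range := by
      rw [Submodule.span_le]
      rintro _ ⟨i, rfl⟩
      exact ⟨X i, rfl⟩
    exact this hx
  obtain ⟨a, ha⟩ := hr hx
  exact ⟨a, ha.symm⟩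

theorem tower_mem_adjoin {t D : ℕ}
    (Φ : MvPolynomial (Fin t) (MvPolynomial (Fin D) k) ≃ₐ[k] MvPolynomial σ k)
    (U : Submodule k (MvPolynomial σ k)) (hU : ∀ i, Φ (C (X i)) ∈ U) (a : MvPolynomial (Fin D) k) :
    Φ (C a) ∈ Algebra.adjoin k (U : Set (MvPolynomial σ k)) := by
  induction a using MvPolynomial.induction_on with
  | C a =>
    have : Φ (C (C a)) = algebraMap k _ a := by
      rw [← Φ.commutes]; rfl
    rw [this]; exact Subalgebra.algebraMap_mem _ _
  | add p q hp hq => rw [C_add, map_add]; exact add_mem hp hq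
  | mul_X p i hp => rw [C_mul, map_mul]; exact mul_mem hp (Algebra.subset_adjoin (hU i))

theorem pd_colon_vars [Finite σ] (U : Submodule k (MvPolynomial σ k)) (hU : U ≤ LinF σ k) {D : ℕ}
    (hD : Module.finrank k U ≤ D) (s W : Set (MvPolynomial σ k))
    (hs : s ⊆ Algebra.adjoin k (U : Set (MvPolynomial σ k)))
    (hW : W ⊆ Algebra.adjoin k (U : Set (MvPolynomial σ k)))
    (K : Ideal (MvPolynomial σ k)) (hK : ∀ a, a ∈ K ↔ ∀ w ∈ W, w * a ∈ Ideal.span s) : PdI K D := by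
  obtain ⟨t, D', Φ, -, -, hzL, huU, husp, hzsp⟩ := exists_tower U hU
  obtain ⟨J, hJ1, hJ2⟩ := span_eq_tower Φ U husp s hs
  refine (pd_vars U hU hD {x | x ∈ K ∧ ∃ b, x = Φ (C b)} ?_).congr_ideal ?_
  · rintro _ ⟨-, b, rfl⟩
    exact tower_mem_adjoin Φ U huU b
  · apply le_antisymm
    · rw [Ideal.span_le]
      rintro x ⟨h, -⟩; exact h
    · intro p hp
      have key : ∀ m, Φ (C (coeff m (Φ.symm p))) ∈ K := by
        intro m
        rw [hK] at hp ⊢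
        intro w hw
        obtain ⟨w0, rfl⟩ := adjoin_range_tower Φ U husp w (hW hw)
        have h1 := hp _ hw
        rw [hJ1, map_mul, AlgEquiv.symm_apply_apply, mem_map_C_iff] at h1
        have h2 := h1 m
        rw [coeff_C_mul, hJ2, C_mul, map_mul] at h2
        exact h2
      rw [← Φ.apply_symm_apply p, (Φ.symm p).as_sum, map_sum]
      refine sum_mem fun m _ => ?_
      have : monomial m (coeff m (Φ.symm p)) = C (coeff m (Φ.symm p)) * monomial m 1 := by
        rw [C_mul_monomial, mul_one]
      rw [this, map_mul]
      exact Ideal.mul_mem_right _ _ (Ideal.subset_span ⟨key m, _, rfl⟩)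

theorem d3_core [Finite ρ] [Finite ι] (f : PR k ρ ι) (τ : PR k ρ ι →ₐ[k] PR k ρ ι) (hτx : ∀ c, τ (xx c) = xx c)
    (hτF : ∀ i, τ (FF i) = FF i) (κ : Fin 3 → k) (hκ : κ ≠ 0) (hτf : τ f = f + ∑ c, C (κ c) * xx c)
    (hf : f ∈ Ideal.span (Set.range (xx : Fin 3 → PR k ρ ι))) :
    PdI ((JT Set.univ : Ideal (PR k ρ ι)) ⊔ Ideal.span {f}) (3 + Nat.card ι * 3 + 1) := by
  have := Fintype.ofFinite ι
  let U : Submodule k (PR k ρ ι) := Submodule.span k (Set.range fun i => X (Sum.inr i))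
  have hU : U ≤ LinF _ k := by
    rw [Submodule.span_le]
    rintro _ ⟨i, rfl⟩
    exact X_mem_LinF _
  have hD : Module.finrank k U ≤ 3 + Nat.card ι * 3 := by
    refine (finrank_range_le_card _).trans ?_
    simp
  have hx : ∀ c, (xx c : PR k ρ ι) ∈ Algebra.adjoin k (U : Set (PR k ρ ι)) := fun c =>
    Algebra.subset_adjoin (Submodule.subset_span ⟨_, rfl⟩)
  have ha : ∀ i c, (aa i c : PR k ρ ι) ∈ Algebra.adjoin k (U : Set (PR k ρ ι)) := fun i c =>
    Algebra.subset_adjoin (Submodule.subset_span ⟨_, rfl⟩)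
  have hs : (FF '' Set.univ : Set (PR k ρ ι)) ⊆ Algebra.adjoin k (U : Set (PR k ρ ι)) := by
    rintro _ ⟨i, -, rfl⟩
    exact sum_mem fun c _ => mul_mem (hx c) (ha i c)
  have hkz : KZ (xx : Fin 3 → PR k ρ ι) (JT Set.univ) := by
    have := kz_core (k := k) (ρ := ρ) (ι := ι) Finset.univ
    rwa [Finset.coe_univ] at this
  let K : Ideal (PR k ρ ι) := (JT Set.univ : Ideal (PR k ρ ι)).colon {f}
  have hKf : ∀ a, a ∈ K ↔ f * a ∈ (JT Set.univ : Ideal (PR k ρ ι)) := by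
    intro a
    rw [mul_comm]
    exact Submodule.mem_colon_singleton
  have hKx : ∀ a, a ∈ K ↔ ∀ w ∈ Set.range (xx : Fin 3 → PR k ρ ι), w * a ∈ (JT Set.univ : Ideal (PR k ρ ι)) := by
    intro a
    rw [hKf]
    constructor
    · rintro h _ ⟨c, rfl⟩
      exact kz_torsion _ _ hkz a (tors_core _ f τ hτx (fun i _ => hτF i) κ hκ hτf a h) c
    · intro h
      refine Submodule.span_induction (p := fun q _ => q * a ∈ (JT Set.univ : Ideal (PR k ρ ι))) h (by simp) ?_ ?_ hf
      · intro x y _ _ hx hy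
        rw [add_mul]; exact add_mem hx hy
      · intro r x _ hx
        rw [smul_eq_mul, mul_assoc]; exact Ideal.mul_mem_left _ _ hx
  refine Pd.colon _ K f hKf ?_ ?_
  · exact (pd_vars U hU hD _ hs).mono (Nat.le_succ _)
  · exact pd_colon_vars U hU hD _ _ hs (by rintro _ ⟨c, rfl⟩; exact hx c) K hKx

theorem d3_comb {n : ℕ} {E : Type*} [AddCommGroup E] [Module k E] (w : Fin 3 ⊕ Fin n × Fin 3 → E) (hn : 0 < n)
    (hx : LinearIndependent k (fun c => w (Sum.inl c)))
    (hD : 3 * n + 2 ≤ Module.finrank k (Submodule.span k (Set.range w))) :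
    ∃ j : Fin n × Fin 3, LinearIndependent k (fun i : {i // i ≠ Sum.inr j} => w i.1) := by
  classical
  by_cases hli : LinearIndependent k w
  · exact ⟨(⟨0, hn⟩, 0), hli.comp _ Subtype.val_injective⟩
  · rw [Fintype.linearIndependent_iff] at hli
    push Not at hli
    obtain ⟨g, hg, i, hi⟩ := hli
    obtain ⟨j, hj⟩ : ∃ j, g (Sum.inr j) ≠ 0 := by
      by_contra h
      push Not at h
      rw [Fintype.sum_sum_type] at hg
      simp only [h, zero_smul, Finset.sum_const_zero, add_zero] at hg
      have := Fintype.linearIndependent_iff.1 hx (fun c => g (Sum.inl c)) hg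
      rcases i with c | j
      · exact hi (this c)
      · exact hi (h j)
    refine ⟨j, ?_⟩
    rw [linearIndependent_iff_card_le_finrank_span]
    have hsp : Submodule.span k (Set.range w) ≤ Submodule.span k (Set.range fun i : {i // i ≠ Sum.inr j} => w i.1) := by
      rw [Submodule.span_le]
      rintro _ ⟨i, rfl⟩
      by_cases h : i = Sum.inr j
      · subst h
        rw [← Finset.add_sum_erase _ _ (Finset.mem_univ (Sum.inr j))] at hg
        have h2 : w (Sum.inr j) = - (g (Sum.inr j))⁻¹ • ∑ x ∈ Finset.univ.erase (Sum.inr j), g x • w x := by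
          rw [← neg_eq_iff_add_eq_zero] at hg
          rw [← hg, smul_neg, neg_smul, smul_smul, inv_mul_cancel₀ hj]; simp
        rw [h2]
        refine Submodule.smul_mem _ _ (sum_mem fun x hx => Submodule.smul_mem _ _ (Submodule.subset_span ?_))
        exact ⟨⟨x, (Finset.mem_erase.1 hx).1⟩, rfl⟩
      · exact Submodule.subset_span ⟨⟨i, h⟩, rfl⟩
    have : Module.Finite k ↥(Submodule.span k (Set.range fun i : {i // i ≠ Sum.inr j} => w i.1)) :=
      FiniteDimensional.span_of_finite k (Set.finite_range _)
    have := Submodule.finrank_mono hsp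
    have hc : Fintype.card {i : Fin 3 ⊕ Fin n × Fin 3 // i ≠ Sum.inr j} = 3 * n + 2 := by
      rw [Fintype.card_subtype_compl]
      simp; omega
    rw [hc, Set.finrank]
    omega

end
end

section
open MvPolynomial

section
variable {k : Type u} {Ω : Type u} [Field k] [Field Ω] [Algebra k Ω] {σ ι : Type}

theorem symm_lin (e : MvPolynomial ι k ≃ₐ[k] MvPolynomial σ k) (h : ∀ i, e (X i) ∈ LinF σ k)
    (l : MvPolynomial σ k) (hl : l ∈ LinF σ k) : e.symm l ∈ LinF ι k := by
  have h1 : e (homogeneousComponent 1 (e.symm l)) = l := by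
    have h2 : l = e (e.symm l) := (e.apply_symm_apply l).symm
    have h3 : homogeneousComponent 1 l = l := by
      rw [homogeneousComponent_of_mem hl]; simp
    conv_rhs => rw [← h3, h2, ← sum_homogeneousComponent (e.symm l), map_sum, map_sum]
    have h4 : ∀ i, homogeneousComponent 1 (e (homogeneousComponent i (e.symm l))) =
        if i = 1 then e (homogeneousComponent i (e.symm l)) else 0 := by
      intro i
      have : (e (homogeneousComponent i (e.symm l))).IsHomogeneous i :=
        coord_hom e.toAlgHom h (homogeneousComponent_isHomogeneous i (e.symm l))
      rw [homogeneousComponent_of_mem (n := i) this]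
      simp [eq_comm]
    simp only [h4, Finset.sum_ite_eq', Finset.mem_range]
    split_ifs with h5
    · rfl
    · rw [homogeneousComponent_eq_zero _ _ (by omega), map_zero]
  rw [← h1, AlgEquiv.symm_apply_apply]
  exact homogeneousComponent_isHomogeneous _ _

theorem d3_coord [Finite σ] {n : ℕ} (x : Fin 3 → MvPolynomial σ k) (a : Fin n → Fin 3 → MvPolynomial σ k)
    (hx : ∀ c, x c ∈ LinF σ k) (ha : ∀ i c, a i c ∈ LinF σ k) (j : Fin n × Fin 3)
    (hli : LinearIndependent k (fun i : {i // i ≠ Sum.inr j} => (Sum.elim x (fun p => a p.1 p.2) : _ → MvPolynomial σ k) i.1)) :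
    PdI (Ideal.span (Set.range fun i => ∑ c, x c * a i c)) (3 * n + 1) := by
  classical
  obtain ⟨i0, c0⟩ := j
  obtain ⟨c1, hc1⟩ : ∃ c1 : Fin 3, c1 ≠ c0 := ⟨c0 + 1, by fin_cases c0 <;> decide⟩
  let ι := {i : Fin n // i ≠ i0}
  let g : Unit ⊕ (Fin 3 ⊕ ι × Fin 3) → {i : Fin 3 ⊕ Fin n × Fin 3 // i ≠ Sum.inr (i0, c0)} :=
    Sum.elim (fun _ => ⟨Sum.inr (i0, c1), by simpa using hc1⟩)
      (Sum.elim (fun c => ⟨Sum.inl c, by simp⟩) (fun p => ⟨Sum.inr (p.1.1, p.2), by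
        intro h; exact p.1.2 (by simpa using congrArg (fun z => Sum.elim (fun _ => i0) Prod.fst z) h)⟩))
  have hg : Function.Injective g := by
    rintro (_ | c | ⟨⟨i, hi⟩, c⟩) (_ | c' | ⟨⟨i', hi'⟩, c'⟩) h
    all_goals simp [g] at h ⊢
    all_goals grind
  have hli2 := hli.comp g hg
  obtain ⟨m, e0, hc, he0, hl0⟩ := exists_coord _ (by
    rintro (_ | c | p)
    · exact ha _ _
    · exact hx _
    · exact ha _ _) hli2
  let e : PR k (Fin m ⊕ Unit) ι ≃ₐ[k] MvPolynomial σ k :=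
    (renameEquiv k (Equiv.sumAssoc (Fin m) Unit (Fin 3 ⊕ ι × Fin 3))).trans e0
  have heL : ∀ i, e (X i) ∈ LinF σ k := by
    intro i; simp only [e, AlgEquiv.trans_apply, renameEquiv_apply, rename_X]; exact hl0 _
  have hex : ∀ c, e (xx c) = x c := by
    intro c
    simp only [e, xx, AlgEquiv.trans_apply, renameEquiv_apply, rename_X]
    exact he0 (Sum.inr (Sum.inl c))
  have hea : ∀ (i : ι) c, e (aa i c) = a i.1 c := by
    intro i c
    simp only [e, aa, AlgEquiv.trans_apply, renameEquiv_apply, rename_X]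
    exact he0 (Sum.inr (Sum.inr (i, c)))
  have hez : e (X (Sum.inl (Sum.inr ()))) = a i0 c1 := by
    simp only [e, AlgEquiv.trans_apply, renameEquiv_apply, rename_X]
    exact he0 (Sum.inl ())
  let l : Fin 3 → PR k (Fin m ⊕ Unit) ι := fun c => e.symm (a i0 c)
  have hl : ∀ c, l c ∈ LinF _ k := fun c => symm_lin e heL _ (ha _ _)
  have hl1 : l c1 = X (Sum.inl (Sum.inr ())) := by
    change e.symm (a i0 c1) = _
    rw [← hez]; exact e.symm_apply_apply _
  let τ : PR k (Fin m ⊕ Unit) ι →ₐ[k] PR k (Fin m ⊕ Unit) ι :=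
    aeval (Function.update X (Sum.inl (Sum.inr ())) (X (Sum.inl (Sum.inr ())) + 1))
  have hτl : ∀ p ∈ LinF _ k, ∃ κ : k, τ p = p + C κ := by
    intro p hp
    rw [LinF_eq_span] at hp
    induction hp using Submodule.span_induction with
    | mem x hx =>
      obtain ⟨i, rfl⟩ := hx
      by_cases h : i = Sum.inl (Sum.inr ())
      · exact ⟨1, by subst h; simp [τ]⟩
      · exact ⟨0, by simp [τ, h]⟩
    | zero => exact ⟨0, by simp⟩
    | add x y _ _ hx hy =>
      obtain ⟨a, ha⟩ := hx
      obtain ⟨b, hb⟩ := hy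
      exact ⟨a + b, by rw [map_add, ha, hb, C_add]; ring⟩
    | smul r x _ hx =>
      obtain ⟨a, ha⟩ := hx
      exact ⟨r * a, by rw [map_smul, ha, smul_add, C_mul, smul_eq_C_mul (C a)]⟩
  choose κ hκ using fun c => hτl (l c) (hl c)
  have hκ1 : κ c1 = 1 := by
    have h1 := hκ c1
    rw [hl1] at h1
    have h2 : τ (X (Sum.inl (Sum.inr ()))) = X (Sum.inl (Sum.inr ())) + 1 := by simp [τ]
    rw [h2] at h1
    have := add_left_cancel h1
    rw [← C_1] at this
    exact (C_injective _ _ this).symm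
  have hτx : ∀ c, τ (xx c) = xx c := by intro c; simp [τ, xx]
  have hmain := d3_core (∑ c, xx c * l c) τ hτx (by intro i; simp [τ, FF, xx, aa]) κ
    (fun h => by rw [h] at hκ1; simp at hκ1) (by
      simp only [map_sum, map_mul, hτx, hκ, mul_add, Finset.sum_add_distrib]
      congr 1
      exact Finset.sum_congr rfl fun c _ => mul_comm _ _)
    (sum_mem fun c _ => Ideal.mul_mem_right _ _ (Ideal.subset_span ⟨c, rfl⟩))
  have hcard : 3 + Nat.card ι * 3 = 3 * n := by
    have : Nat.card ι = n - 1 := by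
      rw [Nat.card_eq_fintype_card, Fintype.card_subtype_compl]; simp
    have := i0.2
    omega
  rw [hcard] at hmain
  refine (Pd.equiv_ideal e.toRingEquiv _ hmain).congr_ideal ?_
  rw [Ideal.map_sup, JT, Ideal.map_span, Ideal.map_span, ← Ideal.span_union]
  congr 1
  have hF : ∀ i : ι, e (FF i) = ∑ c, x c * a i.1 c := by
    intro i; simp only [FF, map_sum, map_mul, hex, hea]
  have hf : e (∑ c, xx c * l c) = ∑ c, x c * a i0 c := by
    simp only [map_sum, map_mul, hex, l, AlgEquiv.apply_symm_apply]
  ext y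
  constructor
  · rintro (⟨_, ⟨i, -, rfl⟩, rfl⟩ | ⟨_, h, rfl⟩)
    · exact ⟨i.1, (hF i).symm⟩
    · rw [Set.mem_singleton_iff.1 h]
      exact ⟨i0, hf.symm⟩
  · rintro ⟨i, rfl⟩
    by_cases h : i = i0
    · right
      subst h
      exact ⟨_, rfl, hf⟩
    · left
      exact ⟨_, ⟨⟨i, h⟩, trivial, rfl⟩, hF ⟨i, h⟩⟩

theorem case_d3 [Finite σ] (p : σ → Ω) (hr : ((Nat.card σ : ℕ) : ℕ∞) ≤ rk k (Set.range p) + (3 : ℕ))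
    (U : Submodule k (MvPolynomial σ k)) (hU : U ≤ LinF σ k) (hUp : ∀ l ∈ U, aeval p l = 0)
    (hU3 : Module.finrank k U = 3) (V : Submodule k (MvPolynomial σ k)) (hV : V ≤ QuadF σ k)
    (hVp : ∀ v ∈ V, aeval p v = 0) (hV0 : 0 < Module.finrank k V) :
    PdI (Ideal.span (V : Set (MvPolynomial σ k))) (3 * Module.finrank k V + 1) := by
  have hVU : V ≤ U * LinF σ k := fun v hv =>
    ideal_quad U hU (hV hv) (mem_span_of_rk p U hU hUp (by rw [hU3]; exact hr) v (hVp v hv))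
  obtain ⟨x, hxli, hxs, hxU⟩ := exists_fin_basis U hU
  have : Module.Finite k V := Submodule.finiteDimensional_of_le hV
  obtain ⟨b⟩ : Nonempty (Module.Basis (Fin (Module.finrank k V)) k V) := ⟨Module.finBasis k V⟩
  generalize Module.finrank k V = n at *
  generalize Module.finrank k U = d at *
  subst hU3
  have hdec : ∀ i, ∃ l : Fin 3 → MvPolynomial σ k, (∀ j, l j ∈ LinF σ k) ∧ (b i : MvPolynomial σ k) = ∑ j, x j * l j := by
    intro i
    apply mem_span_mul
    rw [hxs]
    exact hVU (b i).2
  choose a ha hba using hdec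
  have hspan : Ideal.span (Set.range fun i => ∑ c, x c * a i c) = Ideal.span (V : Set (MvPolynomial σ k)) := by
    apply le_antisymm
    · rw [Ideal.span_le]
      rintro _ ⟨i, rfl⟩
      simp only [← hba]
      exact Ideal.subset_span (b i).2
    · rw [Ideal.span_le]
      intro v hv
      have h1 := b.sum_repr ⟨v, hv⟩
      have h2 := congrArg Subtype.val h1
      simp only [Submodule.coe_sum, Submodule.coe_smul] at h2
      rw [← h2]
      refine sum_mem fun i _ => ?_
      rw [smul_eq_C_mul]
      refine Ideal.mul_mem_left _ _ ?_
      rw [hba]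
      exact Ideal.subset_span ⟨i, rfl⟩
  let w : Fin 3 ⊕ Fin n × Fin 3 → MvPolynomial σ k := Sum.elim x (fun p => a p.1 p.2)
  have hwL : ∀ i, w i ∈ LinF σ k := by
    rintro (c | ⟨i, c⟩)
    · exact hU (hxU c)
    · exact ha i c
  by_cases hD : Module.finrank k (Submodule.span k (Set.range w)) ≤ 3 * n + 1
  · rw [← hspan]
    refine pd_vars _ ?_ hD _ ?_
    · rw [Submodule.span_le]; rintro _ ⟨i, rfl⟩; exact hwL i
    · rintro _ ⟨i, rfl⟩
      exact sum_mem fun c _ => mul_mem (Algebra.subset_adjoin (Submodule.subset_span ⟨Sum.inl c, rfl⟩))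
        (Algebra.subset_adjoin (Submodule.subset_span ⟨Sum.inr (i, c), rfl⟩))
  · obtain ⟨j, hj⟩ := d3_comb w hV0 hxli (by omega)
    rw [← hspan]
    exact d3_coord x a (fun c => hU (hxU c)) ha j hj

end
end

section
open MvPolynomial

section
variable {k : Type u} [Field k] {σ : Type}

theorem koszul_one {R : Type*} [CommRing R] {ι : Type*} [DecidableEq ι] (m : ι → R)
    (hreg : ∀ (s : Finset ι) (j : ι), j ∉ s → ∀ a, a * m j ∈ Ideal.span (m '' s) → a ∈ Ideal.span (m '' s))
    (s : Finset ι) : ∀ h : ι → R, ∑ i ∈ s, h i * m i = 0 →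
      ∃ a : ι → ι → R, (∀ i j, a i j = - a j i) ∧ (∀ i, a i i = 0) ∧ ∀ i ∈ s, h i = ∑ j ∈ s, a i j * m j := by
  induction s using Finset.induction_on with
  | empty => intro h _; exact ⟨fun _ _ => 0, by simp, by simp, by simp⟩
  | insert t s hts ih =>
    intro h hh
    rw [Finset.sum_insert hts] at hh
    have h1 : h t * m t ∈ Ideal.span (m '' s) := by
      have : h t * m t = - ∑ i ∈ s, h i * m i := by linear_combination hh
      rw [this]
      exact neg_mem (Ideal.sum_mem _ fun i hi => Ideal.mul_mem_left _ _ (Ideal.subset_span ⟨i, hi, rfl⟩))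
    have h2 := hreg s t hts _ h1
    obtain ⟨c, hc⟩ : ∃ c : ι → R, h t = ∑ j ∈ s, c j * m j := by
      have := (Submodule.mem_span_image_finset_iff_exists_fun R).1 h2
      obtain ⟨c, hc⟩ := this
      refine ⟨fun i => if hi : i ∈ s then c ⟨i, hi⟩ else 0, ?_⟩
      rw [← hc, ← Finset.sum_coe_sort s]
      exact Finset.sum_congr rfl fun i _ => by simp
    obtain ⟨a, ha1, ha2, ha3⟩ := ih (fun i => h i + c i * m t) (by
      simp only [add_mul, Finset.sum_add_distrib]
      rw [hc, Finset.sum_mul] at hh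
      rw [← hh, add_comm]
      congr 1
      exact Finset.sum_congr rfl fun i _ => by ring)
    refine ⟨fun i j => if i = t then (if j = t then 0 else c j) else (if j = t then - c i else a i j), ?_, ?_, ?_⟩
    · intro i j
      by_cases hi : i = t <;> by_cases hj : j = t <;> simp [hi, hj]
      exact ha1 i j
    · intro i
      by_cases hi : i = t <;> simp [hi, ha2]
    · intro i hi
      rw [Finset.sum_insert hts]
      by_cases hit : i = t
      · subst hit
        simp only [if_true, zero_mul, zero_add]
        rw [hc]
        exact Finset.sum_congr rfl fun j hj => by
          rw [if_neg (by rintro rfl; exact hts hj)]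
      · have his : i ∈ s := by simpa [hit] using hi
        have := ha3 i his
        simp only [if_neg hit, if_true]
        have h4 : ∑ j ∈ s, (if j = t then - c i else a i j) * m j = ∑ j ∈ s, a i j * m j :=
          Finset.sum_congr rfl fun j hj => by
            rw [if_neg (by rintro rfl; exact hts hj)]
        rw [h4, ← this]; ring

theorem anti_sum {R : Type*} [CommRing R] {ι : Type*} [Fintype ι] (a : ι → ι → R) (F : ι → R)
    (h1 : ∀ i j, a i j = - a j i) (h2 : ∀ i, a i i = 0) : ∑ i, ∑ j, a i j * F j * F i = 0 := by
  classical
  have : ∑ p ∈ (Finset.univ : Finset (ι × ι)), a p.1 p.2 * F p.2 * F p.1 = 0 := by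
    apply Finset.sum_involution (fun p _ => (p.2, p.1))
    · rintro ⟨i, j⟩ _
      simp only
      rw [h1 j i]; ring
    · rintro ⟨i, j⟩ _ hne heq
      simp only [Prod.mk.injEq] at heq
      apply hne
      simp [heq.1, h2]
    · simp
    · simp
  rw [← this, ← Finset.univ_product_univ, Finset.sum_product]

theorem deg_reduce {S : Type*} [CommRing S] {n : ℕ} (l m : Fin n → S)
    (hreg : ∀ (s : Finset (Fin n)) (j : Fin n), j ∉ s → ∀ a, a * m j ∈ Ideal.span (m '' s) → a ∈ Ideal.span (m '' s))
    (g1 g2 : S) (d : ℕ) : ∀ h : Fin n → Polynomial S, (∀ i, (h i).natDegree ≤ d) →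
      ∑ i, h i * (Polynomial.C (l i) + Polynomial.X * Polynomial.C (m i)) = Polynomial.C g1 + Polynomial.X * Polynomial.C g2 →
      ∃ c : Fin n → S, g1 = ∑ i, c i * l i ∧ g2 = ∑ i, c i * m i := by
  induction d with
  | zero =>
    intro h hd he
    have h0 : ∀ i, h i = Polynomial.C ((h i).coeff 0) := fun i =>
      Polynomial.eq_C_of_natDegree_eq_zero (Nat.le_zero.1 (hd i))
    refine ⟨fun i => (h i).coeff 0, ?_, ?_⟩
    · have := congrArg (fun p => Polynomial.coeff p 0) he
      simp only [Polynomial.finsetSum_coeff] at this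
      simpa [Polynomial.mul_coeff_zero] using this.symm
    · have := congrArg (fun p => Polynomial.coeff p 1) he
      simp only [Polynomial.finsetSum_coeff] at this
      rw [Finset.sum_congr rfl (fun i _ => by rw [h0 i])] at this
      simpa [Polynomial.coeff_C_mul, mul_add, Polynomial.coeff_X_mul, Polynomial.coeff_C] using this.symm
  | succ d ih =>
    intro h hd he
    have h1 : ∑ i, (h i).coeff (d+1) * m i = 0 := by
      have := congrArg (fun p => Polynomial.coeff p (d+2)) he
      simp only [Polynomial.finsetSum_coeff] at this
      rw [Finset.sum_congr rfl (fun i _ => by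
        rw [mul_add, Polynomial.coeff_add, Polynomial.coeff_mul_C,
          Polynomial.coeff_eq_zero_of_natDegree_lt (lt_of_le_of_lt (hd i) (by omega)), zero_mul, zero_add,
          ← mul_assoc, Polynomial.coeff_mul_C, Polynomial.coeff_mul_X])] at this
      rw [this]
      simp [Polynomial.coeff_X_mul, Polynomial.coeff_C]
    obtain ⟨a, ha1, ha2, ha3⟩ := koszul_one m hreg Finset.univ _ h1
    refine ih (fun i => h i - ∑ j, Polynomial.C (a i j) * (Polynomial.C (l j) + Polynomial.X * Polynomial.C (m j)) * Polynomial.X ^ d) ?_ ?_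
    · intro i
      rw [Polynomial.natDegree_le_iff_coeff_eq_zero]
      intro N hN
      rw [Polynomial.coeff_sub, Polynomial.finsetSum_coeff]
      have hterm : ∀ j, (Polynomial.C (a i j) * (Polynomial.C (l j) + Polynomial.X * Polynomial.C (m j)) * Polynomial.X ^ d).coeff N
          = if N = d + 1 then a i j * m j else 0 := by
        intro j
        obtain ⟨N', rfl⟩ : ∃ N', N = N' + 1 + d := ⟨N - 1 - d, by omega⟩
        rw [Polynomial.coeff_mul_X_pow, Polynomial.coeff_C_mul, Polynomial.coeff_add, Polynomial.coeff_X_mul]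
        simp only [Polynomial.coeff_C]
        by_cases h0 : N' = 0
        · simp [h0, add_comm]
        · have hne : ¬ (N' + 1 + d = d + 1) := by omega
          simp only [h0, hne, if_false]; simp
      rw [Finset.sum_congr rfl (fun j _ => hterm j)]
      by_cases hNd : N = d + 1
      · subst hNd
        simp only [if_true]
        rw [ha3 i (Finset.mem_univ _)]; simp
      · simp only [if_neg hNd, Finset.sum_const_zero, sub_zero]
        exact Polynomial.coeff_eq_zero_of_natDegree_lt (lt_of_le_of_lt (hd i) (by omega))
    · rw [← he]
      simp only [sub_mul, Finset.sum_sub_distrib]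
      rw [sub_eq_self]
      have := anti_sum (fun i j => Polynomial.C (a i j)) (fun j => (Polynomial.C (l j) + Polynomial.X * Polynomial.C (m j)))
        (fun i j => by rw [ha1 i j]; simp) (fun i => by simp [ha2])
      have h5 : ∑ i, (∑ j, Polynomial.C (a i j) * (Polynomial.C (l j) + Polynomial.X * Polynomial.C (m j)) * Polynomial.X ^ d) *
        (Polynomial.C (l i) + Polynomial.X * Polynomial.C (m i)) = (∑ i, ∑ j, Polynomial.C (a i j) *
          (Polynomial.C (l j) + Polynomial.X * Polynomial.C (m j)) * (Polynomial.C (l i) + Polynomial.X * Polynomial.C (m i))) * Polynomial.X ^ d := by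
        simp only [Finset.sum_mul]
        refine Finset.sum_congr rfl fun i _ => Finset.sum_congr rfl fun j _ => by ring
      rw [h5, this, zero_mul]

theorem lin_mem_of_ideal [Finite σ] (U : Submodule k (MvPolynomial σ k)) (hU : U ≤ LinF σ k) {l : MvPolynomial σ k}
    (hl : l ∈ LinF σ k) (h : l ∈ Ideal.span (U : Set (MvPolynomial σ k))) : l ∈ U := by
  obtain ⟨C, hC⟩ := exists_compl_ge (LinF σ k) U ⊥ hU bot_le disjoint_bot_right
  obtain ⟨-, hC1, hC2, hC3⟩ := hC
  obtain ⟨π, h1, h2, h3, h4⟩ := exists_proj U C hC1 hC2 hC3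
  have h5 := h4 l hl
  have : π l = 0 := ideal_kill π.toRingHom _ h1 l h
  rwa [this, sub_zero] at h5

theorem lin_ideal_prime [Finite σ] (U : Submodule k (MvPolynomial σ k)) (hU : U ≤ LinF σ k) {a b : MvPolynomial σ k}
    (h : a * b ∈ Ideal.span (U : Set (MvPolynomial σ k))) : a ∈ Ideal.span (U : Set (MvPolynomial σ k)) ∨ b ∈ Ideal.span (U : Set (MvPolynomial σ k)) := by
  obtain ⟨m, π, ρ, -, h0, -, h1, -, -⟩ := mod_lin U hU
  rw [mod_ker h0 h1, map_mul, mul_eq_zero] at h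
  rwa [mod_ker h0 h1, mod_ker h0 h1]

theorem ideal_span_span {k' A : Type*} [CommRing k'] [CommRing A] [Algebra k' A] (s : Set A) :
    Ideal.span ((Submodule.span k' s : Submodule k' A) : Set A) = Ideal.span s := by
  apply le_antisymm
  · rw [Ideal.span_le]
    intro x hx
    exact Submodule.span_le_restrictScalars k' A s hx
  · exact Ideal.span_mono Submodule.subset_span

theorem lin_reg [Finite σ] {n : ℕ} (m : Fin n → MvPolynomial σ k) (hm : ∀ i, m i ∈ LinF σ k) (hli : LinearIndependent k m)
    (s : Finset (Fin n)) (j : Fin n) (hj : j ∉ s) (a : MvPolynomial σ k) (h : a * m j ∈ Ideal.span (m '' s)) :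
    a ∈ Ideal.span (m '' s) := by
  have hU : Submodule.span k (m '' s) ≤ LinF σ k := by
    rw [Submodule.span_le]; rintro _ ⟨i, -, rfl⟩; exact hm i
  rw [← ideal_span_span (k' := k)] at h ⊢
  rcases lin_ideal_prime _ hU h with h | h
  · exact h
  · exact absurd (lin_mem_of_ideal _ hU (hm j) h) (hli.notMem_span_image (by simpa using hj))

end
end

section
open MvPolynomial

section
variable {k : Type u} [Field k] {σ : Type}

/-- For a pencil of `n` linear equations, the specialised solution space at `lam` is not contained in the zero set
of more than `n` linear forms. -/
theorem pencil_sol [Fintype σ] {n : ℕ} (l m : Fin n → MvPolynomial σ k) (hl : ∀ i, l i ∈ LinF σ k) (hm : ∀ i, m i ∈ LinF σ k)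
    (Λ : Submodule k (MvPolynomial σ k)) (hΛ : Λ ≤ LinF σ k) (hn : n < Module.finrank k Λ) (lam : k) :
    ∃ w : σ → Polynomial k, (∀ i, aeval w (l i) + Polynomial.X * aeval w (m i) = 0) ∧
      ∃ v ∈ Λ, Polynomial.eval lam (aeval w v) ≠ 0 := by
  classical
  by_contra hcon
  push Not at hcon
  have hadd : ∀ l ∈ LinF σ k, ∀ w w' : σ → Polynomial k, aeval (w + w') l = aeval w l + aeval w' l := by
    intro l hl w w'
    rw [LinF_eq_span] at hl
    induction hl using Submodule.span_induction with
    | mem x hx => obtain ⟨i, rfl⟩ := hx; simp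
    | zero => simp
    | add x y _ _ hx hy => simp only [map_add, hx, hy]; ring
    | smul c x _ hx => simp only [map_smul, hx, smul_add]
  have hsmul : ∀ l ∈ LinF σ k, ∀ (c : Polynomial k) (w : σ → Polynomial k), aeval (c • w) l = c * aeval w l := by
    intro l hl c w
    rw [LinF_eq_span] at hl
    induction hl using Submodule.span_induction with
    | mem x hx => obtain ⟨i, rfl⟩ := hx; simp
    | zero => simp
    | add x y _ _ hx hy => simp only [map_add, hx, hy]; ring
    | smul d x _ hx => simp only [map_smul, hx, mul_smul_comm]
  let A : (σ → Polynomial k) →ₗ[Polynomial k] (Fin n → Polynomial k) :=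
    { toFun := fun w i => aeval w (l i) + Polynomial.X * aeval w (m i)
      map_add' := fun w w' => by
        funext i; simp only [Pi.add_apply]; rw [hadd _ (hl i), hadd _ (hm i)]; ring
      map_smul' := fun c w => by
        funext i; simp only [Pi.smul_apply, RingHom.id_apply, smul_eq_mul]
        rw [hsmul _ (hl i), hsmul _ (hm i)]; ring }
  have hA : ∀ w i, A w i = aeval w (l i) + Polynomial.X * aeval w (m i) := fun _ _ => rfl
  have hrank : Fintype.card σ ≤ Module.finrank (Polynomial k) (LinearMap.ker A) + n := by
    have h1 : Module.finrank (Polynomial k) (LinearMap.range A) + Module.finrank (Polynomial k) (LinearMap.ker A) =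
        Module.finrank (Polynomial k) (σ → Polynomial k) := by
      rw [← A.quotKerEquivRange.finrank_eq]
      exact Submodule.finrank_quotient_add_finrank _
    have h2 : Module.finrank (Polynomial k) (LinearMap.range A) ≤ n := by
      have := Submodule.finrank_le (LinearMap.range A)
      simpa using this
    rw [Module.finrank_fintype_fun_eq_card] at h1
    omega
  obtain ⟨r, b⟩ := Submodule.basisOfPid (Pi.basisFun (Polynomial k) σ) (LinearMap.ker A)
  have hr : Module.finrank (Polynomial k) (LinearMap.ker A) = r := by
    rw [Module.finrank_eq_card_basis b]; simp
  rw [hr] at hrank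
  let ev : (σ → Polynomial k) →+ (σ → k) :=
    { toFun := fun w s => Polynomial.eval lam (w s)
      map_zero' := by funext s; simp
      map_add' := by intro x y; funext s; simp }
  have hli : LinearIndependent k (fun i => ev (b i : σ → Polynomial k)) := by
    rw [Fintype.linearIndependent_iff]
    intro c hc
    let y : σ → Polynomial k := ∑ i, Polynomial.C (c i) • (b i : σ → Polynomial k)
    have hy : ∀ s, (Polynomial.X - Polynomial.C lam) ∣ y s := by
      intro s
      rw [Polynomial.dvd_iff_isRoot, Polynomial.IsRoot]
      have := congrFun hc s
      simp only [Finset.sum_apply, Pi.smul_apply, Pi.zero_apply] at this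
      rw [← this]
      simp [y, ev, Polynomial.eval_finsetSum]
    choose z hz using hy
    have hyz : y = (Polynomial.X - Polynomial.C lam) • z := by funext s; simp [hz s]
    have hyK : y ∈ LinearMap.ker A := Submodule.sum_mem _ fun i _ => Submodule.smul_mem _ _ (b i).2
    have hzK : z ∈ LinearMap.ker A := by
      rw [hyz, LinearMap.mem_ker, map_smul] at hyK
      rw [LinearMap.mem_ker]
      exact (smul_eq_zero.1 hyK).resolve_left (Polynomial.X_sub_C_ne_zero lam)
    have h3 : (⟨y, hyK⟩ : LinearMap.ker A) = ∑ i, Polynomial.C (c i) • b i := by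
      apply Subtype.ext; simp [y]
    have h4 : (⟨y, hyK⟩ : LinearMap.ker A) = (Polynomial.X - Polynomial.C lam) • ⟨z, hzK⟩ := by
      apply Subtype.ext; simp [hyz]
    intro i
    have h5 : Polynomial.C (c i) = (Polynomial.X - Polynomial.C lam) * b.repr ⟨z, hzK⟩ i := by
      have e1 : b.repr ⟨y, hyK⟩ i = Polynomial.C (c i) := by
        rw [h3, b.repr_sum_self]
      have e2 : b.repr ⟨y, hyK⟩ i = (Polynomial.X - Polynomial.C lam) * b.repr ⟨z, hzK⟩ i := by
        rw [h4, LinearEquiv.map_smul]; rfl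
      rw [← e1, e2]
    have h6 := congrArg (Polynomial.eval lam) h5
    simpa using h6
  -- the dual side
  let D : MvPolynomial σ k →ₗ[k] Module.Dual k (σ → k) :=
    { toFun := fun v => ∑ s, coeff (Finsupp.single s 1) v • LinearMap.proj s
      map_add' := by intro x y; simp [add_smul, Finset.sum_add_distrib]
      map_smul' := by intro c x; simp [Finset.smul_sum, smul_smul] }
  have hD : ∀ v ∈ LinF σ k, ∀ w : σ → k, D v w = aeval w v := by
    intro v hv w
    rw [LinF_eq_span] at hv
    induction hv using Submodule.span_induction with
    | mem x hx => obtain ⟨i, rfl⟩ := hx; simp [D, coeff_X, Finsupp.single_left_inj]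
    | zero => simp
    | add x y _ _ hx hy => simp only [map_add, LinearMap.add_apply, hx, hy]
    | smul d x _ hx => simp only [map_smul, LinearMap.smul_apply, hx]
  have hDinj : ∀ v ∈ LinF σ k, D v = 0 → v = 0 := by
    intro v hv h0
    have hv' := hv
    rw [LinF_eq_span, Submodule.mem_span_range_iff_exists_fun] at hv'
    obtain ⟨c, rfl⟩ := hv'
    have hc : ∀ s, c s = 0 := by
      intro s
      have h2 := hD _ hv (Pi.single s 1)
      rw [h0] at h2
      simpa [Pi.single_apply] using h2.symm
    simp [hc]
  have hfin : Module.finrank k (Λ.map D) = Module.finrank k Λ := by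
    have : Function.Injective (D.domRestrict Λ) := by
      rw [injective_iff_map_eq_zero]
      intro a ha
      exact Subtype.ext (hDinj a (hΛ a.2) ha)
    rw [← LinearMap.finrank_range_of_inj this, LinearMap.range_domRestrict]
  have hco := Subspace.finrank_add_finrank_dualCoannihilator_eq (Λ.map D)
  have hle : r ≤ Module.finrank k (Λ.map D).dualCoannihilator := by
    have h1 : Submodule.span k (Set.range fun i => ev (b i : σ → Polynomial k)) ≤ (Λ.map D).dualCoannihilator := by
      rw [Submodule.span_le]
      rintro _ ⟨i, rfl⟩
      rw [SetLike.mem_coe, Submodule.mem_dualCoannihilator]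
      rintro _ ⟨v, hv, rfl⟩
      rw [hD v (hΛ hv)]
      have h7 := hcon (b i : σ → Polynomial k) (fun j => by
        have := congrFun (LinearMap.mem_ker.1 (b i).2) j
        rwa [hA] at this) v hv
      have h8 : ∀ w : σ → Polynomial k, Polynomial.eval lam (aeval w v) = aeval (ev w) v := by
        intro w
        have : (Polynomial.aeval lam).comp (aeval w : MvPolynomial σ k →ₐ[k] Polynomial k) = aeval (ev w) := by
          apply MvPolynomial.algHom_ext; intro s; simp [ev]
        rw [← this]; simp [Polynomial.coe_aeval_eq_eval]
      rw [← h8]; exact h7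
    have h2 := Submodule.finrank_mono h1
    rw [finrank_span_eq_card hli] at h2
    simpa using h2
  rw [Module.finrank_fintype_fun_eq_card] at hco
  omega

end
end

section
open MvPolynomial

section
variable {k : Type u} [Field k] {σ : Type}

theorem pencil_translate {n : ℕ} (l m : Fin n → MvPolynomial σ k) (hl : ∀ i, l i ∈ LinF σ k) (hm : ∀ i, m i ∈ LinF σ k)
    (w : σ → Polynomial k) (hw : ∀ i, aeval w (l i) + Polynomial.X * aeval w (m i) = 0)
    (𝔞 : Ideal (Polynomial (MvPolynomial σ k)))
    (h𝔞 : 𝔞 = Ideal.span (Set.range fun i => Polynomial.C (l i) + Polynomial.X * Polynomial.C (m i)))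
    (v : MvPolynomial σ k) (hv : v ∈ LinF σ k) (g : Polynomial (MvPolynomial σ k)) (hg : Polynomial.C v * g ∈ 𝔞) :
    ∃ N, (Polynomial.mapRingHom (C : k →+* MvPolynomial σ k) (aeval w v)) ^ N * g ∈ 𝔞 := by
  let ι : Polynomial k →+* Polynomial (MvPolynomial σ k) := Polynomial.mapRingHom (C : k →+* MvPolynomial σ k)
  let T0 : MvPolynomial σ k →+* Polynomial (Polynomial (MvPolynomial σ k)) :=
    eval₂Hom ((Polynomial.C.comp Polynomial.C).comp C) (fun s => Polynomial.C (Polynomial.C (X s)) + Polynomial.X * Polynomial.C (ι (w s)))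
  let T : Polynomial (MvPolynomial σ k) →+* Polynomial (Polynomial (MvPolynomial σ k)) :=
    Polynomial.eval₂RingHom (R := MvPolynomial σ k) (S := Polynomial (Polynomial (MvPolynomial σ k))) T0 (Polynomial.C Polynomial.X)
  have hTC : ∀ a, T (Polynomial.C a) = T0 a := fun a => by simp [T]
  have hTX : T Polynomial.X = Polynomial.C Polynomial.X := by simp [T]
  have hιX : ι Polynomial.X = Polynomial.X := by simp [ι]
  have hT0 : ∀ l ∈ LinF σ k, T0 l = Polynomial.C (Polynomial.C l) + Polynomial.X * Polynomial.C (ι (aeval w l)) := by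
    intro l hl
    rw [LinF_eq_span] at hl
    induction hl using Submodule.span_induction with
    | mem x hx => obtain ⟨i, rfl⟩ := hx; simp [T0]
    | zero => simp
    | add x y _ _ hx hy => simp only [map_add, hx, hy]; ring
    | smul c x _ hx =>
      have h1 : T0 (c • x) = Polynomial.C (Polynomial.C (C c)) * T0 x := by
        rw [smul_eq_C_mul, map_mul]; simp [T0]
      have h2 : ι (aeval w (c • x)) = Polynomial.C (C c) * ι (aeval w x) := by
        rw [smul_eq_C_mul, map_mul, map_mul]
        simp [ι]
      rw [h1, h2, hx, smul_eq_C_mul, map_mul, map_mul, map_mul]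
      ring
  have hTF : ∀ i, T (Polynomial.C (l i) + Polynomial.X * Polynomial.C (m i)) =
      Polynomial.C (Polynomial.C (l i) + Polynomial.X * Polynomial.C (m i)) := by
    intro i
    rw [map_add, map_mul, hTC, hTC, hTX, hT0 _ (hl i), hT0 _ (hm i)]
    have h3 : ι (aeval w (l i)) + Polynomial.X * ι (aeval w (m i)) = 0 := by
      rw [← hιX, ← map_mul, ← map_add, hw i, map_zero]
    have h4 : Polynomial.C (Polynomial.C (l i)) + Polynomial.X * Polynomial.C (ι (aeval w (l i))) +
        Polynomial.C Polynomial.X * (Polynomial.C (Polynomial.C (m i)) + Polynomial.X * Polynomial.C (ι (aeval w (m i)))) =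
      Polynomial.C (Polynomial.C (l i) + Polynomial.X * Polynomial.C (m i)) +
        Polynomial.X * Polynomial.C (ι (aeval w (l i)) + Polynomial.X * ι (aeval w (m i))) := by
      simp only [map_add, map_mul]; ring
    rw [h4, h3]; simp
  have hTa : ∀ p ∈ 𝔞, T p ∈ 𝔞.map (Polynomial.C : _ →+* Polynomial (Polynomial (MvPolynomial σ k))) := by
    intro p hp
    have : 𝔞 ≤ (𝔞.map (Polynomial.C : _ →+* Polynomial (Polynomial (MvPolynomial σ k)))).comap T := by
      conv_lhs => rw [h𝔞]
      rw [Ideal.span_le]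
      rintro _ ⟨i, rfl⟩
      simp only [SetLike.mem_coe, Ideal.mem_comap]
      rw [hTF]
      exact Ideal.mem_map_of_mem _ (by rw [h𝔞]; exact Ideal.subset_span ⟨i, rfl⟩)
    exact this hp
  have hT00 : ∀ p, (T p).coeff 0 = p := by
    intro p
    have : (Polynomial.constantCoeff.comp T) = RingHom.id _ := by
      apply Polynomial.ringHom_ext'
      · apply MvPolynomial.ringHom_ext
        · intro r; simp [T, T0]
        · intro i; simp [T, T0]
      · simp [T]
    have h5 := DFunLike.congr_fun this p
    simpa using h5
  let c := ι (aeval w v)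
  let G := T g
  have h6 : ∀ j, Polynomial.C v * G.coeff (j+1) + c * G.coeff j ∈ 𝔞 := by
    intro j
    have := hTa _ hg
    rw [map_mul, hTC, hT0 v hv, Ideal.mem_map_C_iff] at this
    have := this (j+1)
    rwa [add_mul, Polynomial.coeff_add, Polynomial.coeff_C_mul, mul_assoc, Polynomial.coeff_X_mul, Polynomial.coeff_C_mul] at this
  have h7 : ∀ e j, G.natDegree < j + e → c ^ e * G.coeff j ∈ 𝔞 := by
    intro e
    induction e with
    | zero =>
      intro j hj
      rw [Polynomial.coeff_eq_zero_of_natDegree_lt (by simpa using hj)]; simp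
    | succ e ih =>
      intro j hj
      have h8 := ih (j+1) (by omega)
      have h9 : c ^ (e+1) * G.coeff j = c ^ e * (Polynomial.C v * G.coeff (j+1) + c * G.coeff j) - Polynomial.C v * (c ^ e * G.coeff (j+1)) := by
        ring
      rw [h9]
      exact sub_mem (Ideal.mul_mem_left _ _ (h6 j)) (Ideal.mul_mem_left _ _ h8)
  refine ⟨G.natDegree + 1, ?_⟩
  have := h7 (G.natDegree + 1) 0 (by omega)
  rwa [hT00] at this

theorem pencil_main [IsAlgClosed k] [Fintype σ] {n : ℕ} (l m : Fin n → MvPolynomial σ k) (hl : ∀ i, l i ∈ LinF σ k) (hm : ∀ i, m i ∈ LinF σ k)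
    (hli : LinearIndependent k m)
    (Λ : Submodule k (MvPolynomial σ k)) (hΛ : Λ ≤ LinF σ k) (hn : n < Module.finrank k Λ) (g1 g2 : MvPolynomial σ k)
    (hg : ∀ v ∈ Λ, ∃ c : Fin n → MvPolynomial σ k, v * g1 = ∑ i, c i * l i ∧ v * g2 = ∑ i, c i * m i) :
    ∃ c : Fin n → MvPolynomial σ k, g1 = ∑ i, c i * l i ∧ g2 = ∑ i, c i * m i := by
  classical
  obtain ⟨𝔞, h𝔞⟩ : ∃ 𝔞, 𝔞 = Ideal.span (Set.range fun i => Polynomial.C (l i) + Polynomial.X * Polynomial.C (m i)) := ⟨_, rfl⟩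
  let g : Polynomial (MvPolynomial σ k) := Polynomial.C g1 + Polynomial.X * Polynomial.C g2
  have hmem : g ∈ 𝔞 := by
    let ι : Polynomial k →+* Polynomial (MvPolynomial σ k) := Polynomial.mapRingHom (C : k →+* MvPolynomial σ k)
    let 𝔟 : Ideal (Polynomial k) :=
      { carrier := {c | ι c * g ∈ 𝔞}
        add_mem' := by
          intro a b ha hb
          simp only [Set.mem_ofPred_eq, map_add, add_mul] at *
          exact add_mem ha hb
        zero_mem' := by simp
        smul_mem' := by
          intro c a ha
          simp only [Set.mem_ofPred_eq, smul_eq_mul, map_mul, mul_assoc] at *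
          exact Ideal.mul_mem_left _ _ ha }
    have h𝔟 : ∀ c, c ∈ 𝔟 ↔ ι c * g ∈ 𝔞 := fun _ => Iff.rfl
    by_contra hcon
    have hne : 𝔟 ≠ ⊤ := by
      intro h
      have : (1 : Polynomial k) ∈ 𝔟 := by rw [h]; trivial
      rw [h𝔟] at this
      exact hcon (by simpa using this)
    obtain ⟨M, hM, hbM⟩ := Ideal.exists_le_maximal _ hne
    obtain ⟨p, hp⟩ := (IsPrincipalIdealRing.principal M).principal
    have hpu : ¬ IsUnit p := by
      intro hu
      apply hM.ne_top
      rw [hp]; exact Ideal.span_singleton_eq_top.2 hu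
    obtain ⟨lam, hlam⟩ : ∃ lam, Polynomial.eval lam p = 0 := by
      by_cases h0 : p = 0
      · exact ⟨0, by simp [h0]⟩
      · exact IsAlgClosed.exists_root p (fun h => hpu (Polynomial.isUnit_iff_degree_eq_zero.2 h))
    obtain ⟨w, hw, v, hv, hne⟩ := pencil_sol l m hl hm Λ hΛ hn lam
    obtain ⟨c, hc1, hc2⟩ := hg v hv
    obtain ⟨N, hN⟩ := pencil_translate l m hl hm w hw 𝔞 h𝔞 v (hΛ hv) g (by
      have : Polynomial.C v * g = ∑ i, Polynomial.C (c i) * (Polynomial.C (l i) + Polynomial.X * Polynomial.C (m i)) := by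
        have : Polynomial.C v * g = Polynomial.C (v * g1) + Polynomial.X * Polynomial.C (v * g2) := by
          simp only [g, map_mul]; ring
        rw [this, hc1, hc2]
        simp only [map_sum, map_mul, Finset.mul_sum, ← Finset.sum_add_distrib]
        exact Finset.sum_congr rfl fun i _ => by ring
      rw [this, h𝔞]
      exact Ideal.sum_mem _ fun i _ => Ideal.mul_mem_left _ _ (Ideal.subset_span ⟨i, rfl⟩))
    have h1 : (aeval w v) ^ N ∈ 𝔟 := by rw [h𝔟, map_pow]; exact hN
    have h2 := hM.isPrime.mem_of_pow_mem N (hbM h1)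
    rw [hp] at h2
    obtain ⟨r, hr⟩ := Ideal.mem_span_singleton'.1 h2
    apply hne
    rw [← hr, Polynomial.eval_mul, hlam, mul_zero]
  rw [h𝔞, Ideal.mem_span_range_iff_exists_fun] at hmem
  obtain ⟨h, hh⟩ := hmem
  exact deg_reduce l m (lin_reg m hm hli) g1 g2 (Finset.univ.sup fun i => (h i).natDegree) h
    (fun i => Finset.le_sup (f := fun i => (h i).natDegree) (Finset.mem_univ i)) hh

end
end

section
open MvPolynomial

section
variable {k : Type u} [Field k] {E : Type*} [AddCommGroup E] [Module k E]

/-- span of all entries of a space of pairs -/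
def ent (C : Submodule k (E × E)) : Submodule k E :=
  C.map (LinearMap.fst k E E) ⊔ C.map (LinearMap.snd k E E)

theorem ent_mono {C C' : Submodule k (E × E)} (h : C ≤ C') : ent C ≤ ent C' :=
  sup_le_sup (Submodule.map_mono h) (Submodule.map_mono h)

theorem fst_mem_ent {C : Submodule k (E × E)} {c : E × E} (h : c ∈ C) : c.1 ∈ ent C :=
  Submodule.mem_sup_left ⟨c, h, rfl⟩

theorem snd_mem_ent {C : Submodule k (E × E)} {c : E × E} (h : c ∈ C) : c.2 ∈ ent C :=
  Submodule.mem_sup_right ⟨c, h, rfl⟩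

theorem ent_le {C : Submodule k (E × E)} {Y : Submodule k E} (h : ∀ c ∈ C, c.1 ∈ Y ∧ c.2 ∈ Y) : ent C ≤ Y := by
  refine sup_le ?_ ?_
  · rintro _ ⟨c, hc, rfl⟩; exact (h c hc).1
  · rintro _ ⟨c, hc, rfl⟩; exact (h c hc).2

instance ent_fin (C : Submodule k (E × E)) [FiniteDimensional k C] : FiniteDimensional k (ent C) :=
  Submodule.finiteDimensional_sup _ _

theorem finrank_ent_le (C : Submodule k (E × E)) [FiniteDimensional k C] : Module.finrank k (ent C) ≤ 2 * Module.finrank k C := by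
  have h1 := Submodule.finrank_add_le_finrank_add_finrank (C.map (LinearMap.fst k E E)) (C.map (LinearMap.snd k E E))
  have h2 := Submodule.finrank_map_le (LinearMap.fst k E E) C
  have h3 := Submodule.finrank_map_le (LinearMap.snd k E E) C
  unfold ent
  omega

theorem ent_loss (C W : Submodule k (E × E)) [FiniteDimensional k C] (hW : W ≤ C) (Y : Submodule k E) [FiniteDimensional k Y]
    (hY : ent W ≤ Y) :
    Module.finrank k (ent C) + 2 * Module.finrank k W ≤ Module.finrank k Y + 2 * Module.finrank k C := by
  obtain ⟨W', -, h1, h2, h3⟩ := exists_compl_ge C W ⊥ hW bot_le disjoint_bot_right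
  have : FiniteDimensional k W' := Submodule.finiteDimensional_of_le h1
  have : FiniteDimensional k W := Submodule.finiteDimensional_of_le hW
  have h4 : ent C ≤ Y ⊔ ent W' := by
    rw [← h3]
    unfold ent at hY ⊢
    simp only [Submodule.map_sup]
    refine sup_le (sup_le ?_ ?_) (sup_le ?_ ?_)
    · exact le_trans (le_trans le_sup_left hY) le_sup_left
    · exact le_trans le_sup_left le_sup_right
    · exact le_trans (le_trans le_sup_right hY) le_sup_left
    · exact le_trans le_sup_right le_sup_right
  have h5 := Submodule.finrank_mono h4
  have h6 := Submodule.finrank_add_le_finrank_add_finrank Y (ent W')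
  have h7 := finrank_ent_le W'
  have h8 := Submodule.finrank_sup_add_finrank_inf_eq W W'
  rw [h3, h2.eq_bot, finrank_bot] at h8
  omega

theorem pair_indep {j : ℕ} (lam : Fin (j+1) → k) (hlam : Function.Injective lam) (m : Fin (j+1) → E)
    (hm : LinearIndependent k (fun i : Fin j => m i.castSucc)) (h0 : m (Fin.last j) ≠ 0) :
    LinearIndependent k (fun i => ((-(lam i) • m i, m i) : E × E)) := by
  rw [Fintype.linearIndependent_iff] at hm ⊢
  intro a ha
  have e1 : ∑ i, a i • m i = 0 := by
    have := congrArg Prod.snd ha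
    simpa [Prod.snd_sum] using this
  have e2 : ∑ i, (a i * lam i) • m i = 0 := by
    have := congrArg Prod.fst ha
    simpa [Prod.fst_sum, smul_smul] using this
  have e3 : ∑ i : Fin j, (a i.castSucc * (lam i.castSucc - lam (Fin.last j))) • m i.castSucc = 0 := by
    have h1 : ∑ i, (a i * (lam i - lam (Fin.last j))) • m i = 0 := by
      have : ∑ i, (a i * (lam i - lam (Fin.last j))) • m i = ∑ i, (a i * lam i) • m i - lam (Fin.last j) • ∑ i, a i • m i := by
        rw [Finset.smul_sum, ← Finset.sum_sub_distrib]
        refine Finset.sum_congr rfl fun i _ => ?_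
        rw [smul_smul, ← sub_smul]; congr 1; ring
      rw [this, e1, e2]; simp
    rw [Fin.sum_univ_castSucc] at h1
    simpa using h1
  have h2 : ∀ i : Fin j, a i.castSucc = 0 := by
    intro i
    have := hm _ e3 i
    refine (mul_eq_zero.1 this).resolve_right (sub_ne_zero.2 fun h => ?_)
    exact absurd (hlam h) (Fin.castSucc_lt_last i).ne
  have h3 : a (Fin.last j) = 0 := by
    rw [Fin.sum_univ_castSucc] at e1
    simp only [h2, zero_smul, Finset.sum_const_zero, zero_add] at e1
    exact (smul_eq_zero.1 e1).resolve_right h0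
  intro i
  induction i using Fin.lastCases with
  | last => exact h3
  | cast i => exact h2 i

theorem pair_case {C : Submodule k (E × E)} {a b : k} (hab : a ≠ b) {u : E} (h1 : (-a • u, u) ∈ C) (h2 : (-b • u, u) ∈ C) :
    (u, 0) ∈ C ∧ ((0 : E), u) ∈ C := by
  have h3 : (u, (0 : E)) ∈ C := by
    have h4 := C.smul_mem (b - a)⁻¹ (C.sub_mem h1 h2)
    have h5 : (b - a)⁻¹ • ((-a • u, u) - (-b • u, u) : E × E) = (u, 0) := by
      rw [Prod.mk_sub_mk, sub_self, ← sub_smul, Prod.smul_mk, smul_smul, smul_zero]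
      have : (b - a)⁻¹ * (-a - -b) = 1 := by
        have : b - a ≠ 0 := sub_ne_zero.2 hab.symm
        field_simp; ring
      rw [this, one_smul]
    rwa [h5] at h4
  refine ⟨h3, ?_⟩
  have h6 := C.add_mem h1 (C.smul_mem a h3)
  have h7 : ((-a • u, u) + a • (u, 0) : E × E) = (0, u) := by simp
  rwa [h7] at h6

theorem pencil_tri [Infinite k] (C : Submodule k (E × E)) [FiniteDimensional k C]
    (h : ∀ lam : k, ∃ m : E, m ≠ 0 ∧ (-lam • m, m) ∈ C) :
    (∃ u : E, u ≠ 0 ∧ (u, 0) ∈ C ∧ ((0 : E), u) ∈ C) ∨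
    (∃ (m1 m2 : E) (a b c : k), LinearIndependent k ![m1, m2] ∧ a ≠ b ∧ c ≠ 0 ∧ (-a • m1, m1) ∈ C ∧ (-b • m2, m2) ∈ C ∧
      ((-b • m1, m1) - c • (-a • m2, m2) : E × E) ∈ C) ∨
    Module.finrank k (ent C) + 5 ≤ 2 * Module.finrank k C := by
  classical
  let lam : Fin 5 → k := fun i => Infinite.natEmbedding k i
  have hlam : Function.Injective lam := fun i j hij => Fin.ext ((Infinite.natEmbedding k).injective hij)
  choose mm hmm0 hmmC using h
  let m : Fin 5 → E := fun i => mm (lam i)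
  have hm0 : ∀ i, m i ≠ 0 := fun i => hmm0 _
  have hmC : ∀ i, (-lam i • m i, m i) ∈ C := fun i => hmmC _
  by_cases hi : ∃ u : E, u ≠ 0 ∧ (u, 0) ∈ C ∧ ((0 : E), u) ∈ C
  · exact Or.inl hi
  right
  have hpair : ∀ i j, i ≠ j → ∀ a : k, m j ≠ a • m i := by
    intro i j hij a ha
    apply hi
    have ha0 : a ≠ 0 := by rintro rfl; exact hm0 j (by simpa using ha)
    have h2 : (-lam j • m i, m i) ∈ C := by
      have := C.smul_mem a⁻¹ (hmC j)
      rw [ha, Prod.smul_mk, smul_smul, smul_smul, smul_smul, inv_mul_cancel₀ ha0, one_smul] at this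
      have e : a⁻¹ * -lam j * a = - lam j := by field_simp
      rwa [e] at this
    exact ⟨m i, hm0 i, pair_case (fun h => hij (hlam h)) (hmC i) h2⟩
  have h01 : LinearIndependent k ![m 0, m 1] := by
    rw [LinearIndependent.pair_iff' (hm0 0)]
    intro a ha
    exact hpair 0 1 (by decide) a ha.symm
  by_cases h012 : LinearIndependent k ![m 0, m 1, m 2]
  swap
  · left
    have hmem : m 2 ∈ Submodule.span k {m 0, m 1} := by
      by_contra hcon
      apply h012
      have h5 : LinearIndependent k (Fin.snoc ![m 0, m 1] (m 2) : Fin 3 → E) :=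
        linearIndependent_finSnoc.2 ⟨h01, by rw [Set.pair_comm] at hcon; simpa [Matrix.range_cons] using hcon⟩
      convert h5 using 1
      funext i; fin_cases i <;> rfl
    obtain ⟨a, b, hab⟩ := Submodule.mem_span_pair.1 hmem
    have ha : a ≠ 0 := by
      rintro rfl
      exact hpair 1 2 (by decide) b (by rw [← hab]; simp)
    have hb : b ≠ 0 := by
      rintro rfl
      exact hpair 0 2 (by decide) a (by rw [← hab]; simp)
    have d01 : lam 0 - lam 1 ≠ 0 := sub_ne_zero.2 fun h => absurd (hlam h) (by decide)
    have d02 : lam 0 - lam 2 ≠ 0 := sub_ne_zero.2 fun h => absurd (hlam h) (by decide)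
    have d12 : lam 1 - lam 2 ≠ 0 := sub_ne_zero.2 fun h => absurd (hlam h) (by decide)
    -- (-l2,1) = α (-l0,1) + β (-l1,1)
    let α := (lam 1 - lam 2) / (lam 1 - lam 0)
    let β := (lam 2 - lam 0) / (lam 1 - lam 0)
    have d10 : lam 1 - lam 0 ≠ 0 := sub_ne_zero.2 fun h => absurd (hlam h) (by decide)
    have d20 : lam 2 - lam 0 ≠ 0 := sub_ne_zero.2 fun h => absurd (hlam h) (by decide)
    have hα : α ≠ 0 := div_ne_zero d12 d10
    have hβ : β ≠ 0 := div_ne_zero d20 d10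
    have e1 : α + β = 1 := by simp only [α, β]; field_simp; ring
    have e2 : α * lam 0 + β * lam 1 = lam 2 := by simp only [α, β]; field_simp; ring
    refine ⟨m 0, m 1, lam 0, lam 1, -(b * α) / (a * β), h01, sub_ne_zero.1 d01, ?_, hmC 0, hmC 1, ?_⟩
    · exact div_ne_zero (neg_ne_zero.2 (mul_ne_zero hb hα)) (mul_ne_zero ha hβ)
    · have h6 := C.smul_mem (a * β)⁻¹ (C.sub_mem (C.sub_mem (hmC 2) (C.smul_mem (a * α) (hmC 0))) (C.smul_mem (b * β) (hmC 1)))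
      have h7 : (a * β)⁻¹ • ((-lam 2 • m 2, m 2) - (a * α) • (-lam 0 • m 0, m 0) - (b * β) • (-lam 1 • m 1, m 1) : E × E) =
        (-lam 1 • m 0, m 0) - (-(b * α) / (a * β)) • (-lam 0 • m 1, m 1) := by
        rw [← hab, ← e2]
        ext
        · simp only [Prod.smul_fst, Prod.fst_sub, smul_add, smul_sub, smul_smul]
          have h8 : α = 1 - β := by rw [← e1]; ring
          match_scalars
          · rw [h8]; field_simp; ring
          · rw [h8]; field_simp; ring
        · simp only [Prod.smul_snd, Prod.snd_sub, smul_add, smul_sub, smul_smul]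
          have h8 : α = 1 - β := by rw [← e1]; ring
          match_scalars
          · rw [h8]; field_simp; ring
          · rw [h8]; field_simp
      rwa [h7] at h6
  right
  have final : ∀ (j : ℕ) (hj : j + 1 ≤ 5) (s : ℕ), LinearIndependent k (fun i : Fin j => m (Fin.castLE hj i.castSucc)) →
      Module.finrank k (Submodule.span k (Set.range fun i : Fin (j+1) => m (Fin.castLE hj i))) ≤ s →
      Module.finrank k (ent C) + 2 * (j + 1) ≤ s + 2 * Module.finrank k C := by
    intro j hj s hli hs
    have h1 := pair_indep (fun i : Fin (j+1) => lam (Fin.castLE hj i)) (fun a b hab => Fin.castLE_injective hj (hlam hab))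
      (fun i => m (Fin.castLE hj i)) hli (hm0 _)
    have : FiniteDimensional k (Submodule.span k (Set.range fun i : Fin (j+1) => m (Fin.castLE hj i))) :=
      FiniteDimensional.span_of_finite k (Set.finite_range _)
    have h2 := ent_loss C (Submodule.span k (Set.range fun i : Fin (j+1) => ((-(lam (Fin.castLE hj i)) • m (Fin.castLE hj i), m (Fin.castLE hj i)) : E × E)))
      (by rw [Submodule.span_le]; rintro _ ⟨i, rfl⟩; exact hmC _)
      (Submodule.span k (Set.range fun i : Fin (j+1) => m (Fin.castLE hj i))) (by
        apply ent_le
        intro c hc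
        have : Submodule.span k (Set.range fun i : Fin (j+1) => ((-(lam (Fin.castLE hj i)) • m (Fin.castLE hj i), m (Fin.castLE hj i)) : E × E)) ≤
          (Submodule.span k (Set.range fun i : Fin (j+1) => m (Fin.castLE hj i))).prod (Submodule.span k (Set.range fun i : Fin (j+1) => m (Fin.castLE hj i))) := by
          rw [Submodule.span_le]
          rintro _ ⟨i, rfl⟩
          exact ⟨Submodule.smul_mem _ _ (Submodule.subset_span ⟨i, rfl⟩), Submodule.subset_span ⟨i, rfl⟩⟩
        exact this hc)
    rw [finrank_span_eq_card h1, Fintype.card_fin] at h2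
    omega
  by_cases h4 : LinearIndependent k (fun i : Fin 4 => m (Fin.castLE (by decide : 4 + 1 ≤ 5) i.castSucc))
  · have := final 4 (by decide) 5 h4 (by
      have := finrank_range_le_card (R := k) (fun i : Fin (4+1) => m (Fin.castLE (by decide : 4 + 1 ≤ 5) i))
      simpa [Set.finrank] using this)
    omega
  · have := final 3 (by decide) 3 (by
      convert h012 using 1
      funext i; fin_cases i <;> rfl) (by
      by_contra hcon
      apply h4
      have h5 : LinearIndependent k (fun i : Fin (3+1) => m (Fin.castLE (by decide : 3 + 1 ≤ 5) i)) := by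
        rw [linearIndependent_iff_card_le_finrank_span, Set.finrank]
        simp only [Fintype.card_fin]; omega
      exact h5)
    omega

theorem tri_w2 (C : Submodule k (E × E)) [FiniteDimensional k C] {u : E} (hu : u ≠ 0) (h1 : (u, 0) ∈ C) (h2 : ((0 : E), u) ∈ C) :
    2 ≤ Module.finrank k ↥(C ⊓ (Submodule.span k {u}).prod (Submodule.span k {u})) := by
  have hli : LinearIndependent k ![((u, 0) : E × E), (0, u)] := by
    rw [LinearIndependent.pair_iff]
    intro s t hst
    have e1 := congrArg Prod.fst hst
    have e2 := congrArg Prod.snd hst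
    simp only [Prod.smul_mk, Prod.mk_add_mk, smul_zero, add_zero, zero_add, Prod.fst_zero, Prod.snd_zero] at e1 e2
    exact ⟨(smul_eq_zero.1 e1).resolve_right hu, (smul_eq_zero.1 e2).resolve_right hu⟩
  have hle : Submodule.span k (Set.range ![((u, 0) : E × E), (0, u)]) ≤ C ⊓ (Submodule.span k {u}).prod (Submodule.span k {u}) := by
    rw [Submodule.span_le]
    rintro _ ⟨i, rfl⟩; fin_cases i
    · exact ⟨h1, Submodule.mem_span_singleton_self u, zero_mem _⟩
    · exact ⟨h2, zero_mem _, Submodule.mem_span_singleton_self u⟩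
  have : FiniteDimensional k ↥(C ⊓ (Submodule.span k {u}).prod (Submodule.span k {u})) := Submodule.finiteDimensional_of_le inf_le_left
  have := Submodule.finrank_mono hle
  rw [finrank_span_eq_card hli] at this
  simpa using this

theorem tri_w3 (C : Submodule k (E × E)) [FiniteDimensional k C] {m1 m2 : E} {a b c : k} (hli : LinearIndependent k ![m1, m2])
    (hab : a ≠ b) (h1 : (-a • m1, m1) ∈ C) (h2 : (-b • m2, m2) ∈ C)
    (h3 : ((-b • m1, m1) - c • (-a • m2, m2) : E × E) ∈ C) :
    Module.finrank k (Submodule.span k {m1, m2}) = 2 ∧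
    3 ≤ Module.finrank k ↥(C ⊓ (Submodule.span k {m1, m2}).prod (Submodule.span k {m1, m2})) := by
  have hr : Set.range ![m1, m2] = {m1, m2} := by simp [Matrix.range_cons, Set.pair_comm]
  have hli' : LinearIndependent k ![((-a • m1, m1) : E × E), (-b • m2, m2), ((-b • m1, m1) - c • (-a • m2, m2))] := by
    rw [Fintype.linearIndependent_iff]
    intro g hg
    simp only [Fin.sum_univ_three, Matrix.cons_val_zero, Matrix.cons_val_one, Matrix.cons_val_two] at hg
    rw [LinearIndependent.pair_iff] at hli
    have e1 := congrArg Prod.fst hg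
    have e2 := congrArg Prod.snd hg
    simp at e1 e2
    have f1 := hli (-(g 0 * a) - g 2 * b) (-(g 1 * b) + g 2 * c * a) (by rw [← e1]; module)
    have f2 := hli (g 0 + g 2) (g 1 - g 2 * c) (by rw [← e2]; module)
    have g2 : g 2 = 0 := by
      have : g 2 * (a - b) = 0 := by linear_combination f1.1 + a * f2.1
      exact (mul_eq_zero.1 this).resolve_right (sub_ne_zero.2 hab)
    have g0 : g 0 = 0 := by have := f2.1; rwa [g2, add_zero] at this
    have g1 : g 1 = 0 := by have := f2.2; rwa [g2, zero_mul, sub_zero] at this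
    intro i; fin_cases i
    · exact g0
    · exact g1
    · exact g2
  have h2' := finrank_span_eq_card hli
  rw [hr] at h2'
  refine ⟨by simpa using h2', ?_⟩
  have m1m : m1 ∈ Submodule.span k {m1, m2} := Submodule.subset_span (by simp)
  have m2m : m2 ∈ Submodule.span k {m1, m2} := Submodule.subset_span (by simp)
  have hle : Submodule.span k (Set.range ![((-a • m1, m1) : E × E), (-b • m2, m2), ((-b • m1, m1) - c • (-a • m2, m2))]) ≤
      C ⊓ (Submodule.span k {m1, m2}).prod (Submodule.span k {m1, m2}) := by
    rw [Submodule.span_le]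
    rintro _ ⟨i, rfl⟩; fin_cases i
    · exact ⟨h1, Submodule.smul_mem _ _ m1m, m1m⟩
    · exact ⟨h2, Submodule.smul_mem _ _ m2m, m2m⟩
    · refine ⟨h3, ?_⟩
      exact ((Submodule.span k {m1, m2}).prod (Submodule.span k {m1, m2})).sub_mem
          ⟨Submodule.smul_mem _ _ m1m, m1m⟩ (Submodule.smul_mem _ _ ⟨Submodule.smul_mem _ _ m2m, m2m⟩)
  have : FiniteDimensional k ↥(C ⊓ (Submodule.span k {m1, m2}).prod (Submodule.span k {m1, m2})) := Submodule.finiteDimensional_of_le inf_le_left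
  have := Submodule.finrank_mono hle
  rw [finrank_span_eq_card hli'] at this
  simpa using this

theorem pencil_la [Infinite k] (C : Submodule k (E × E)) [FiniteDimensional k C]
    (h4 : 2 * Module.finrank k C ≤ Module.finrank k (ent C) + 4) :
    ∃ Y : Submodule k E, Y ≤ ent C ∧
      Module.finrank k Y ≤ Module.finrank k ↥(C ⊓ Y.prod Y) + 1 ∧
      (∃ lam : k, ∀ c ∈ C, c.1 + lam • c.2 ∈ Y → c.1 ∈ Y ∧ c.2 ∈ Y) ∧
      ((Y = ⊥) ∨ (∃ u : E, Y = Submodule.span k {u} ∧ (u, 0) ∈ C ∧ ((0 : E), u) ∈ C) ∨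
      (∃ (m1 m2 : E) (a b c : k), Y = Submodule.span k {m1, m2} ∧ a ≠ b ∧ c ≠ 0 ∧ (-a • m1, m1) ∈ C ∧ (-b • m2, m2) ∈ C ∧
      ((-b • m1, m1) - c • (-a • m2, m2) : E × E) ∈ C)) := by
  classical
  -- reduction: if no good lam modulo Y then loss at least three
  have key : ∀ Y : Submodule k E, Y ≤ ent C → (∀ lam : k, ∃ c ∈ C, c.1 + lam • c.2 ∈ Y ∧ ¬ (c.1 ∈ Y ∧ c.2 ∈ Y)) →
      Module.finrank k (ent C) + 2 * Module.finrank k ↥(C ⊓ Y.prod Y) + 3 ≤ Module.finrank k Y + 2 * Module.finrank k C ∧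
      (Y = ⊥ → (∃ u : E, u ≠ 0 ∧ (u, 0) ∈ C ∧ ((0 : E), u) ∈ C) ∨
    (∃ (m1 m2 : E) (a b c : k), LinearIndependent k ![m1, m2] ∧ a ≠ b ∧ c ≠ 0 ∧ (-a • m1, m1) ∈ C ∧ (-b • m2, m2) ∈ C ∧
      ((-b • m1, m1) - c • (-a • m2, m2) : E × E) ∈ C) ∨
    Module.finrank k (ent C) + 5 ≤ 2 * Module.finrank k C) := by
    intro Y hY hno
    have hYf : FiniteDimensional k Y := Submodule.finiteDimensional_of_le hY
    constructor
    swap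
    · rintro rfl
      apply pencil_tri
      intro lam
      obtain ⟨c, hc, h1, h2⟩ := hno lam
      have h3 : c.1 = - lam • c.2 := by
        rw [neg_smul]; exact eq_neg_of_add_eq_zero_left ((Submodule.mem_bot k).1 h1)
      refine ⟨c.2, ?_, ?_⟩
      · intro h0
        apply h2
        rw [h3, h0]; simp
      · rw [← h3]; exact hc
    · let f : E × E →ₗ[k] (E ⧸ Y) × (E ⧸ Y) := LinearMap.prodMap Y.mkQ Y.mkQ
      let C' := C.map f
      have hC'r : Module.finrank k C' + Module.finrank k ↥(C ⊓ Y.prod Y) = Module.finrank k C := by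
        have h1 := LinearMap.finrank_range_add_finrank_ker (f.domRestrict C)
        rw [LinearMap.range_domRestrict] at h1
        have h2 : Module.finrank k (LinearMap.ker (f.domRestrict C)) = Module.finrank k ↥(C ⊓ Y.prod Y) := by
          have : C ⊓ Y.prod Y = (LinearMap.ker (f.domRestrict C)).map C.subtype := by
            ext c
            simp only [Submodule.mem_inf, Submodule.mem_map, LinearMap.mem_ker, LinearMap.domRestrict_apply, Submodule.subtype_apply]
            constructor
            · rintro ⟨h1, h2⟩
              refine ⟨⟨c, h1⟩, ?_, rfl⟩
              rw [Submodule.mem_prod] at h2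
              ext1
              · exact (Submodule.Quotient.mk_eq_zero Y).2 h2.1
              · exact (Submodule.Quotient.mk_eq_zero Y).2 h2.2
            · rintro ⟨c, h1, rfl⟩
              refine ⟨c.2, ?_, ?_⟩
              · exact (Submodule.Quotient.mk_eq_zero Y).1 (congrArg Prod.fst h1)
              · exact (Submodule.Quotient.mk_eq_zero Y).1 (congrArg Prod.snd h1)
          rw [this]
          exact (Submodule.equivMapOfInjective _ C.injective_subtype _).finrank_eq
        rw [← h1, h2]
      have hent : Module.finrank k (ent C) ≤ Module.finrank k (ent C') + Module.finrank k Y := by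
        have h1 := LinearMap.finrank_range_add_finrank_ker (Y.mkQ.domRestrict (ent C))
        rw [LinearMap.range_domRestrict] at h1
        have h2 : Module.finrank k (LinearMap.ker (Y.mkQ.domRestrict (ent C))) ≤ Module.finrank k Y := by
          have h3 : (LinearMap.ker (Y.mkQ.domRestrict (ent C))).map (ent C).subtype ≤ Y := by
            rintro _ ⟨c, hc, rfl⟩
            exact (Submodule.Quotient.mk_eq_zero Y).1 hc
          have := Submodule.finrank_mono h3
          rwa [← (Submodule.equivMapOfInjective _ (ent C).injective_subtype _).finrank_eq] at this
        have h4 : (ent C).map Y.mkQ ≤ ent C' := by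
          unfold ent
          rw [Submodule.map_sup, ← Submodule.map_comp, ← Submodule.map_comp]
          refine sup_le ?_ ?_
          · rintro _ ⟨c, hc, rfl⟩
            exact fst_mem_ent (C := C') (c := f c) ⟨c, hc, rfl⟩
          · rintro _ ⟨c, hc, rfl⟩
            exact snd_mem_ent (C := C') (c := f c) ⟨c, hc, rfl⟩
        have := Submodule.finrank_mono h4
        omega
      have htri := pencil_tri C' (by
        intro lam
        obtain ⟨c, hc, h1, h2⟩ := hno lam
        have h3 : (Y.mkQ c.1) = - lam • Y.mkQ c.2 := by
          rw [neg_smul]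
          apply eq_neg_of_add_eq_zero_left
          rw [← map_smul, ← map_add]
          exact (Submodule.Quotient.mk_eq_zero Y).2 h1
        refine ⟨Y.mkQ c.2, ?_, ?_⟩
        · intro h0
          apply h2
          rw [h0, smul_zero] at h3
          exact ⟨(Submodule.Quotient.mk_eq_zero Y).1 h3, (Submodule.Quotient.mk_eq_zero Y).1 h0⟩
        · rw [← h3]; exact ⟨c, hc, rfl⟩)
      have h5 : Module.finrank k (ent C') + 3 ≤ 2 * Module.finrank k C' := by
        rcases htri with ⟨u, hu, h1, h2⟩ | ⟨m1, m2, a, b, c, hli, hab, hc, h1, h2, h3⟩ | h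
        · have hl := ent_loss C' _ (inf_le_left : C' ⊓ (Submodule.span k {u}).prod (Submodule.span k {u}) ≤ C') (Submodule.span k {u})
            (ent_le fun c hc => hc.2)
          rw [finrank_span_singleton hu] at hl
          have := tri_w2 C' hu h1 h2
          omega
        · have : FiniteDimensional k (Submodule.span k {m1, m2}) := FiniteDimensional.span_of_finite k (by simp)
          have hl := ent_loss C' _ (inf_le_left : C' ⊓ (Submodule.span k {m1, m2}).prod (Submodule.span k {m1, m2}) ≤ C') (Submodule.span k {m1, m2})
            (ent_le fun c hc => hc.2)
          obtain ⟨hd, hd'⟩ := tri_w3 C' hli hab h1 h2 h3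
          rw [hd] at hl
          omega
        · omega
      omega
  have key2 : ∀ Y : Submodule k E, Y ≤ ent C → Module.finrank k Y + 2 ≤ 2 * Module.finrank k ↥(C ⊓ Y.prod Y) →
      ∃ lam : k, ∀ c ∈ C, c.1 + lam • c.2 ∈ Y → c.1 ∈ Y ∧ c.2 ∈ Y := by
    intro Y hY hd
    by_contra hcon
    push Not at hcon
    have := (key Y hY (fun lam => by
      obtain ⟨c, h1, h2, h3⟩ := hcon lam
      exact ⟨c, h1, h2, fun h => h3 h.1 h.2⟩)).1
    omega
  by_cases hgood : ∃ lam : k, ∀ c ∈ C, c.1 + lam • c.2 ∈ (⊥ : Submodule k E) → c.1 ∈ (⊥ : Submodule k E) ∧ c.2 ∈ (⊥ : Submodule k E)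
  · exact ⟨⊥, bot_le, by simp, hgood, Or.inl rfl⟩
  push Not at hgood
  rcases (key ⊥ bot_le (fun lam => by
      obtain ⟨c, h1, h2, h3⟩ := hgood lam
      exact ⟨c, h1, h2, fun h => h3 h.1 h.2⟩)).2 rfl with ⟨u, hu, h1, h2⟩ | ⟨m1, m2, a, b, c, hli, hab, hc, h1, h2, h3⟩ | h
  · have h6 := tri_w2 C hu h1 h2
    have h7 := finrank_span_singleton (K := k) hu
    have hle : Submodule.span k {u} ≤ ent C := by
      rw [Submodule.span_le]; simpa using fst_mem_ent h1
    exact ⟨_, hle, by omega, key2 _ hle (by omega), Or.inr (Or.inl ⟨u, rfl, h1, h2⟩)⟩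
  · obtain ⟨h6, h7⟩ := tri_w3 C hli hab h1 h2 h3
    have hle : Submodule.span k {m1, m2} ≤ ent C := by
      rw [Submodule.span_le]
      rintro x (rfl | rfl)
      · exact snd_mem_ent h1
      · exact snd_mem_ent h2
    exact ⟨_, hle, by omega, key2 _ hle (by omega), Or.inr (Or.inr ⟨m1, m2, a, b, c, rfl, hab, hc, h1, h2, h3⟩)⟩
  · omega

end
end

section
open MvPolynomial

section
variable {k : Type u} [Field k] {σ : Type}

theorem d2_ring {A : Type*} [CommRing A] (x y m1 m2 a b c i c' l m : A) (hi : i * (b - a) = 1) (hc : c' * c = 1)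
    (h1 : m1 * (y - a * x) = 0) (h2 : m2 * (y - b * x) = 0) (h3 : m1 * (y - b * x) - c * (m2 * (y - a * x)) = 0)
    (h4 : x * l + y * m = 0) : (l * m1 * x = 0 ∧ l * m1 * y = 0 ∧ l * m2 * x = 0 ∧ l * m2 * y = 0) ∧
      (m * m1 * x = 0 ∧ m * m1 * y = 0 ∧ m * m2 * x = 0 ∧ m * m2 * y = 0) := by
  have e1 : m2 * (y - a * x) * (l + b * m) = 0 := by
    linear_combination m2 * (b - a) * h4 + (l + a * m) * h2
  have e2 : m1 * (y - b * x) * (l + b * m) = 0 := by linear_combination c * e1 + (l + b * m) * h3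
  have e3 : m1 * (y - b * x) * (l + a * m) = 0 := by
    linear_combination (l + b * m) * h1 - m1 * (b - a) * h4
  have p1 : m1 * (y - b * x) * m = 0 := by
    linear_combination i * (e2 - e3) - m1 * (y - b * x) * m * hi
  have p2 : m1 * (y - b * x) * l = 0 := by linear_combination e2 - b * p1
  have p3 : m2 * (y - a * x) * m = 0 := by
    linear_combination c' * p1 - c' * m * h3 - m2 * (y - a * x) * m * hc
  have p4 : m2 * (y - a * x) * l = 0 := by linear_combination e1 - b * p3
  have fx : ∀ f w, w * (y - a * x) * f = 0 → w * (y - b * x) * f = 0 → f * w * x = 0 ∧ f * w * y = 0 := by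
    intro f w ha hb
    have hx : f * w * x = 0 := by linear_combination i * (ha - hb) - f * w * x * hi
    exact ⟨hx, by linear_combination ha + a * hx⟩
  have q1 := fx l m1 (by linear_combination l * h1) p2
  have q2 := fx l m2 p4 (by linear_combination l * h2)
  have q3 := fx m m1 (by linear_combination m * h1) p1
  have q4 := fx m m2 p3 (by linear_combination m * h2)
  exact ⟨⟨q1.1, q1.2, q2.1, q2.2⟩, ⟨q3.1, q3.2, q4.1, q4.2⟩⟩

theorem d2_kill (C : Submodule k (MvPolynomial σ k × MvPolynomial σ k)) (Y : Submodule k (MvPolynomial σ k)) (x y : MvPolynomial σ k)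
    (J : Ideal (MvPolynomial σ k)) (hJ : ∀ c ∈ C, x * c.1 + y * c.2 ∈ J)
    (hY : (Y = ⊥) ∨ (∃ u, Y = Submodule.span k {u} ∧ (u, 0) ∈ C ∧ (0, u) ∈ C) ∨
      (∃ (m1 m2 : MvPolynomial σ k) (a b c : k), Y = Submodule.span k {m1, m2} ∧ a ≠ b ∧ c ≠ 0 ∧ (-a • m1, m1) ∈ C ∧ (-b • m2, m2) ∈ C ∧
      ((-b • m1, m1) - c • (-a • m2, m2)) ∈ C)) (u w : MvPolynomial σ k) (hu : u ∈ ent C) (hw : w ∈ Y) :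
    u * (w * x) ∈ J ∧ u * (w * y) ∈ J := by
  rcases hY with rfl | ⟨v, rfl, h1, h2⟩ | ⟨m1, m2, a, b, c, rfl, hab, hc, h1, h2, h3⟩
  · rw [(Submodule.mem_bot k).1 hw]; simp
  · obtain ⟨κ, rfl⟩ := Submodule.mem_span_singleton.1 hw
    have e1 : x * v ∈ J := by simpa using hJ _ h1
    have e2 : y * v ∈ J := by simpa using hJ _ h2
    constructor
    · refine Ideal.mul_mem_left _ _ ?_
      rw [smul_mul_assoc, mul_comm]; exact Submodule.smul_of_tower_mem _ _ e1
    · refine Ideal.mul_mem_left _ _ ?_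
      rw [smul_mul_assoc, mul_comm]; exact Submodule.smul_of_tower_mem _ _ e2
  · let φ := Ideal.Quotient.mk J
    have hφ : ∀ z, z ∈ J ↔ φ z = 0 := fun z => Ideal.Quotient.eq_zero_iff_mem.symm
    have hba : b - a ≠ 0 := sub_ne_zero.2 hab.symm
    have e1 := (hφ _).1 (hJ _ h1)
    have e2 := (hφ _).1 (hJ _ h2)
    have e3 := (hφ _).1 (hJ _ h3)
    simp only [Prod.fst_sub, Prod.snd_sub, Prod.smul_fst, Prod.smul_snd, smul_eq_C_mul, map_add, map_sub, map_mul, map_neg] at e1 e2 e3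
    have hall : ∀ d ∈ C, (φ d.1 * φ m1 * φ x = 0 ∧ φ d.1 * φ m1 * φ y = 0 ∧ φ d.1 * φ m2 * φ x = 0 ∧ φ d.1 * φ m2 * φ y = 0) ∧
      (φ d.2 * φ m1 * φ x = 0 ∧ φ d.2 * φ m1 * φ y = 0 ∧ φ d.2 * φ m2 * φ x = 0 ∧ φ d.2 * φ m2 * φ y = 0) := by
      intro d hd
      have e4 := (hφ _).1 (hJ _ hd)
      simp only [map_add, map_mul] at e4
      refine d2_ring (φ x) (φ y) (φ m1) (φ m2) (φ (MvPolynomial.C a)) (φ (MvPolynomial.C b)) (φ (MvPolynomial.C c)) (φ (MvPolynomial.C (b - a)⁻¹)) (φ (MvPolynomial.C c⁻¹)) _ _ ?_ ?_ ?_ ?_ ?_ e4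
      · rw [← map_sub, ← map_sub, ← map_mul, ← map_mul, inv_mul_cancel₀ hba, map_one, map_one]
      · rw [← map_mul, ← map_mul, inv_mul_cancel₀ hc, map_one, map_one]
      · linear_combination e1
      · linear_combination e2
      · linear_combination e3
    have hu' : (φ u * φ m1 * φ x = 0 ∧ φ u * φ m1 * φ y = 0 ∧ φ u * φ m2 * φ x = 0 ∧ φ u * φ m2 * φ y = 0) := by
      let T : Submodule k (MvPolynomial σ k) :=
        { carrier := {u | φ u * φ m1 * φ x = 0 ∧ φ u * φ m1 * φ y = 0 ∧ φ u * φ m2 * φ x = 0 ∧ φ u * φ m2 * φ y = 0}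
          add_mem' := by
            rintro a b ⟨a1, a2, a3, a4⟩ ⟨b1, b2, b3, b4⟩
            refine ⟨?_, ?_, ?_, ?_⟩ <;> rw [map_add]
            · linear_combination a1 + b1
            · linear_combination a2 + b2
            · linear_combination a3 + b3
            · linear_combination a4 + b4
          zero_mem' := by simp
          smul_mem' := by
            rintro c a ⟨a1, a2, a3, a4⟩
            refine ⟨?_, ?_, ?_, ?_⟩ <;> rw [smul_eq_C_mul, map_mul]
            · linear_combination φ (MvPolynomial.C c) * a1
            · linear_combination φ (MvPolynomial.C c) * a2
            · linear_combination φ (MvPolynomial.C c) * a3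
            · linear_combination φ (MvPolynomial.C c) * a4 }
      have : ent C ≤ T := ent_le fun d hd => hall d hd
      exact this hu
    obtain ⟨κ, κ', rfl⟩ := Submodule.mem_span_pair.1 hw
    obtain ⟨a1, a2, a3, a4⟩ := hu'
    rw [hφ, hφ]
    simp only [smul_eq_C_mul, map_add, map_mul]
    constructor
    · linear_combination φ (MvPolynomial.C κ) * a1 + φ (MvPolynomial.C κ') * a3
    · linear_combination φ (MvPolynomial.C κ) * a2 + φ (MvPolynomial.C κ') * a4

def dset (C : Submodule k (MvPolynomial σ k × MvPolynomial σ k)) (Y : Submodule k (MvPolynomial σ k)) (x y : MvPolynomial σ k) :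
    Set (MvPolynomial σ k) := {p | (∃ c ∈ C, p = x * c.1 + y * c.2) ∨ ∃ w ∈ Y, p = w * x ∨ p = w * y}

theorem d2_span {τ : Type} (x y : MvPolynomial σ k) (C : Submodule k (MvPolynomial σ k × MvPolynomial σ k)) (Y : Submodule k (MvPolynomial σ k))
    (π : MvPolynomial σ k →ₐ[k] MvPolynomial τ k) (p0 : ∀ w ∈ Y, π w = 0) (P : MvPolynomial τ k → MvPolynomial τ k → Prop)
    (P0 : P 0 0) (Padd : ∀ a b a' b', P a b → P a' b' → P (a + a') (b + b')) (Pmul : ∀ r a b, P a b → P (r * a) (r * b))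
    (PC : ∀ e ∈ C, P (π e.1) (π e.2)) :
    ∀ z ∈ Ideal.span (dset C Y x y), ∃ z1 z2, z = x * z1 + y * z2 ∧ P (π z1) (π z2) := by
  intro z hz
  induction hz using Submodule.span_induction with
  | mem z hz =>
    rcases hz with ⟨e, he, rfl⟩ | ⟨w, hw, rfl | rfl⟩
    · exact ⟨e.1, e.2, rfl, PC e he⟩
    · exact ⟨w, 0, by ring, by rw [p0 w hw, map_zero]; exact P0⟩
    · exact ⟨0, w, by ring, by rw [p0 w hw, map_zero]; exact P0⟩
  | zero => exact ⟨0, 0, by simp, by rw [map_zero]; exact P0⟩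
  | add z z' _ _ h h' =>
    obtain ⟨z1, z2, rfl, h⟩ := h
    obtain ⟨z1', z2', rfl, h'⟩ := h'
    refine ⟨z1 + z1', z2 + z2', by ring, ?_⟩
    rw [map_add, map_add]
    exact Padd _ _ _ _ h h'
  | smul r z _ h =>
    obtain ⟨z1, z2, rfl, h⟩ := h
    refine ⟨r * z1, r * z2, by simp only [smul_eq_mul]; ring, ?_⟩
    rw [map_mul, map_mul]
    exact Pmul _ _ _ h

set_option maxHeartbeats 1000000 in
theorem d2_tors [Fintype σ] [IsAlgClosed k] (x y : MvPolynomial σ k) (hx : x ∈ LinF σ k) (hy : y ∈ LinF σ k)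
    (hxy : LinearIndependent k ![x, y])
    (C : Submodule k (MvPolynomial σ k × MvPolynomial σ k)) [FiniteDimensional k C] (hC : ∀ c ∈ C, c.1 ∈ LinF σ k ∧ c.2 ∈ LinF σ k)
    (hyx : (-y, x) ∈ C) (Y : Submodule k (MvPolynomial σ k)) (hY : Y ≤ LinF σ k)
    (hlam : ∃ lam : k, ∀ c ∈ C, c.1 + lam • c.2 ∈ Y → c.1 ∈ Y ∧ c.2 ∈ Y)
    (Λ : Submodule k (MvPolynomial σ k)) (hΛ : Λ ≤ LinF σ k)
    (hd : Module.finrank k C + Module.finrank k Y < Module.finrank k Λ + Module.finrank k ↥(C ⊓ Y.prod Y))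
    (B : MvPolynomial σ k) (hB : B ∈ Ideal.span {x, y})
    (hBΛ : ∀ v ∈ Λ, v * B ∈ Ideal.span (dset C Y x y)) : B ∈ Ideal.span (dset C Y x y) := by
  classical
  obtain ⟨lam, hlam⟩ := hlam
  obtain ⟨g1, g2, hg⟩ := Ideal.mem_span_pair.1 hB
  obtain ⟨m, π, ρ, hm, p0, pρ, p1, pL, -⟩ := mod_lin Y hY
  have hΛf : FiniteDimensional k Λ := Submodule.finiteDimensional_of_le hΛ
  have hYf : FiniteDimensional k Y := Submodule.finiteDimensional_of_le hY
  let f : (MvPolynomial σ k × MvPolynomial σ k) →ₗ[k] (MvPolynomial (Fin m) k × MvPolynomial (Fin m) k) :=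
    LinearMap.prodMap π.toLinearMap π.toLinearMap
  have hf : ∀ c, f c = (π c.1, π c.2) := fun _ => rfl
  let C' := C.map f
  have hlin : ∀ l ∈ LinF σ k, π l = 0 → l ∈ Y := fun l hl h0 => lin_mem_of_ideal Y hY hl ((mod_ker p0 p1 l).2 h0)
  have hC'r : Module.finrank k C' + Module.finrank k ↥(C ⊓ Y.prod Y) ≤ Module.finrank k C := by
    have h1 := LinearMap.finrank_range_add_finrank_ker (f.domRestrict C)
    rw [LinearMap.range_domRestrict] at h1
    have h2 : Module.finrank k ↥(C ⊓ Y.prod Y) ≤ Module.finrank k (LinearMap.ker (f.domRestrict C)) := by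
      have : C ⊓ Y.prod Y ≤ (LinearMap.ker (f.domRestrict C)).map C.subtype := by
        rintro c ⟨h1, h2⟩
        exact ⟨⟨c, h1⟩, Prod.ext (p0 _ h2.1) (p0 _ h2.2), rfl⟩
      rw [(Submodule.equivMapOfInjective _ C.injective_subtype _).finrank_eq]
      exact Submodule.finrank_mono this
    change Module.finrank k C' + _ = _ at h1
    omega
  have hΛ' : Module.finrank k Λ ≤ Module.finrank k (Λ.map π.toLinearMap) + Module.finrank k Y := by
    have h1 := LinearMap.finrank_range_add_finrank_ker (π.toLinearMap.domRestrict Λ)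
    rw [LinearMap.range_domRestrict] at h1
    have h2 : Module.finrank k (LinearMap.ker (π.toLinearMap.domRestrict Λ)) ≤ Module.finrank k Y := by
      have : (LinearMap.ker (π.toLinearMap.domRestrict Λ)).map Λ.subtype ≤ Y := by
        rintro _ ⟨c, hc, rfl⟩
        exact hlin _ (hΛ c.2) hc
      rw [(Submodule.equivMapOfInjective _ Λ.injective_subtype _).finrank_eq]
      exact Submodule.finrank_mono this
    omega
  obtain ⟨b⟩ : Nonempty (Module.Basis (Fin (Module.finrank k C')) k C') := ⟨Module.finBasis k C'⟩
  generalize Module.finrank k C' = n' at *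
  have hlift : ∀ i, ∃ c ∈ C, f c = (b i : MvPolynomial (Fin m) k × MvPolynomial (Fin m) k) := fun i => (b i).2
  choose c hcC hcb using hlift
  have hcl : ∃ P : MvPolynomial (Fin m) k → MvPolynomial (Fin m) k → Prop, P 0 0 ∧ (∀ a b a' b', P a b → P a' b' → P (a + a') (b + b')) ∧
      (∀ r a b, P a b → P (r * a) (r * b)) ∧ (∀ e ∈ C, P (π e.1) (π e.2)) ∧
      ∀ z z', P z z' → ∃ d : Fin n' → MvPolynomial (Fin m) k, z = ∑ i, d i * π (c i).1 ∧ z' = ∑ i, d i * π (c i).2 := by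
    refine ⟨fun z z' => ∃ d : Fin n' → MvPolynomial (Fin m) k, z = ∑ i, d i * π (c i).1 ∧ z' = ∑ i, d i * π (c i).2,
      ⟨0, by simp, by simp⟩, ?_, ?_, ?_, fun _ _ h => h⟩
    · rintro _ _ _ _ ⟨d, rfl, rfl⟩ ⟨d', rfl, rfl⟩
      refine ⟨fun i => d i + d' i, ?_, ?_⟩ <;> rw [← Finset.sum_add_distrib] <;>
        exact Finset.sum_congr rfl fun i _ => (add_mul _ _ _).symm
    · rintro r _ _ ⟨d, rfl, rfl⟩
      refine ⟨fun i => r * d i, ?_, ?_⟩ <;> rw [Finset.mul_sum] <;>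
        exact Finset.sum_congr rfl fun i _ => (mul_assoc _ _ _).symm
    · intro e he
      have h1 : (⟨f e, ⟨e, he, rfl⟩⟩ : C') ∈ Submodule.span k (Set.range b) := by rw [b.span_eq]; trivial
      obtain ⟨a, ha⟩ := (Submodule.mem_span_range_iff_exists_fun k).1 h1
      have h2 := congrArg Subtype.val ha
      simp only [Submodule.coe_sum, Submodule.coe_smul, ← hcb] at h2
      refine ⟨fun i => MvPolynomial.C (a i), ?_, ?_⟩
      · have := congrArg Prod.fst h2
        simp only [Prod.fst_sum, Prod.smul_fst, hf, smul_eq_C_mul] at this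
        exact this.symm
      · have := congrArg Prod.snd h2
        simp only [Prod.snd_sum, Prod.smul_snd, hf, smul_eq_C_mul] at this
        exact this.symm
  obtain ⟨P, P0, Padd, Pmul, PC, hP⟩ := hcl
  have hK := d2_span x y C Y π p0 P P0 Padd Pmul PC
  have hx0 : x ≠ 0 := hxy.ne_zero 0
  have hndvd : ¬ x ∣ y := by
    intro hdv
    have h1 : y ∈ Ideal.span ((Submodule.span k {x} : Submodule k (MvPolynomial σ k)) : Set (MvPolynomial σ k)) := by
      rw [ideal_span_span]; exact Ideal.mem_span_singleton.2 hdv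
    have h2 := lin_mem_of_ideal _ (by rw [Submodule.span_le]; simpa using hx) hy h1
    obtain ⟨a, ha⟩ := Submodule.mem_span_singleton.1 h2
    exact (LinearIndependent.pair_iff' hx0).1 hxy a ha
  have hkos : ∀ s t, x * s + y * t = 0 → ∃ r, s = r * (-y) ∧ t = r * x := by
    intro s t h
    have h1 : x ∣ y * t := ⟨-s, by linear_combination h⟩
    obtain ⟨r, rfl⟩ := ((lin_prime hx hx0).dvd_or_dvd h1).resolve_left hndvd
    refine ⟨r, ?_, by ring⟩
    apply mul_left_cancel₀ hx0
    linear_combination h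
  have hfin := pencil_main (fun i => π (c i).2) (fun i => π (c i).1 + lam • π (c i).2) (fun i => pL _ (hC _ (hcC i)).2)
    (fun i => (LinF (Fin m) k).add_mem (pL _ (hC _ (hcC i)).1) (Submodule.smul_mem _ _ (pL _ (hC _ (hcC i)).2))) (by
      rw [Fintype.linearIndependent_iff]
      intro a ha
      let e := ∑ i, a i • c i
      have he : e ∈ C := Submodule.sum_mem _ fun i _ => C.smul_mem _ (hcC i)
      have h1 : π (e.1 + lam • e.2) = 0 := by
        rw [← ha]
        simp only [e, Prod.fst_sum, Prod.snd_sum, Prod.smul_fst, Prod.smul_snd, map_add, map_smul, map_sum, smul_add, Finset.smul_sum,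
          Finset.sum_add_distrib]
        congr 1
        exact Finset.sum_congr rfl fun i _ => smul_comm _ _ _
      have h2 := hlam e he (hlin _ ((LinF σ k).add_mem (hC e he).1 (Submodule.smul_mem _ _ (hC e he).2)) h1)
      have h3 : f e = 0 := Prod.ext (p0 _ h2.1) (p0 _ h2.2)
      have h4 : ∑ i, a i • b i = 0 := by
        apply Subtype.ext
        simp only [Submodule.coe_sum, Submodule.coe_smul, Submodule.coe_zero, ← hcb, ← h3, e, map_sum, map_smul]
      exact Fintype.linearIndependent_iff.1 b.linearIndependent a h4)
    (Λ.map π.toLinearMap) (by rintro _ ⟨v, hv, rfl⟩; exact pL v (hΛ hv)) (by omega) (π g2) (π g1 + lam • π g2) (by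
      rintro _ ⟨v, hv, rfl⟩
      obtain ⟨z1, z2, hz, hzM⟩ := hK _ (hBΛ v hv)
      obtain ⟨r, hr1, hr2⟩ := hkos (v * g1 - z1) (v * g2 - z2) (by
        rw [← hg] at hz; linear_combination hz)
      have h5 : P (π (v * g1)) (π (v * g2)) := by
        have e1 : v * g1 = z1 + r * (-y) := by rw [← hr1]; ring
        have e2 : v * g2 = z2 + r * x := by rw [← hr2]; ring
        rw [e1, e2, map_add, map_add, map_mul, map_mul]
        exact Padd _ _ _ _ hzM (Pmul (π r) _ _ (PC _ hyx))
      obtain ⟨d, d1, d2⟩ := hP _ _ h5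
      simp only [map_mul] at d1 d2
      refine ⟨d, d2, ?_⟩
      simp only [AlgHom.toLinearMap_apply]
      rw [mul_add, d1, mul_smul_comm, d2]
      simp only [mul_add, Finset.sum_add_distrib, Finset.smul_sum, mul_smul_comm])
  obtain ⟨d, d1, d2⟩ := hfin
  have d3 : π g1 = ∑ i, d i * π (c i).1 := by
    simp only [mul_add, Finset.sum_add_distrib, mul_smul_comm, ← Finset.smul_sum] at d2
    rw [← d1] at d2
    exact add_right_cancel d2
  have hker : ∀ (g : MvPolynomial σ k) (s : MvPolynomial σ k × MvPolynomial σ k → MvPolynomial σ k),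
      π g = ∑ i, d i * π (s (c i)) → g - ∑ i, ρ (d i) * s (c i) ∈ Ideal.span (Y : Set (MvPolynomial σ k)) := by
    intro g s h
    rw [mod_ker p0 p1, map_sub, h, map_sum]
    simp [pρ]
  have hYK : ∀ z, (z = x ∨ z = y) → ∀ g ∈ Ideal.span (Y : Set (MvPolynomial σ k)), g * z ∈ Ideal.span (dset C Y x y) := by
    intro z hz g hg
    induction hg using Submodule.span_induction with
    | mem w hw =>
      apply Ideal.subset_span
      right
      refine ⟨w, hw, ?_⟩
      rcases hz with rfl | rfl
      · left; rfl
      · right; rfl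
    | zero => simp
    | add a b _ _ ha hb => rw [add_mul]; exact add_mem ha hb
    | smul r a _ ha => rw [smul_eq_mul, mul_assoc]; exact Ideal.mul_mem_left _ _ ha
  have k1 := hYK x (Or.inl rfl) _ (hker g1 Prod.fst d3)
  have k2 := hYK y (Or.inr rfl) _ (hker g2 Prod.snd d1)
  have k3 : ∑ i, ρ (d i) * (x * (c i).1 + y * (c i).2) ∈ Ideal.span (dset C Y x y) :=
    Ideal.sum_mem _ fun i _ => Ideal.mul_mem_left _ _ (Ideal.subset_span (Or.inl ⟨c i, hcC i, rfl⟩))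
  have k4 : B = (g1 - ∑ i, ρ (d i) * (c i).1) * x + (g2 - ∑ i, ρ (d i) * (c i).2) * y +
      ∑ i, ρ (d i) * (x * (c i).1 + y * (c i).2) := by
    have : ∑ i, ρ (d i) * (x * (c i).1 + y * (c i).2) = (∑ i, ρ (d i) * (c i).1) * x + (∑ i, ρ (d i) * (c i).2) * y := by
      rw [Finset.sum_mul, Finset.sum_mul, ← Finset.sum_add_distrib]
      exact Finset.sum_congr rfl fun i _ => by ring
    rw [this, ← hg]; ring
  rw [k4]
  exact add_mem (add_mem k1 k2) k3

end
end

section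
open MvPolynomial

section
variable {k : Type u} [Field k] {σ : Type}

theorem d2_core [Fintype σ] [IsAlgClosed k] (x y : MvPolynomial σ k) (hx : x ∈ LinF σ k) (hy : y ∈ LinF σ k)
    (hxy : LinearIndependent k ![x, y])
    (P : Submodule k (MvPolynomial σ k × MvPolynomial σ k)) [FiniteDimensional k P] (hP : ∀ c ∈ P, c.1 ∈ LinF σ k ∧ c.2 ∈ LinF σ k)
    (hyx : (-y, x) ∈ P) (q : MvPolynomial σ k) (hq : q ∈ QuadF σ k) (hqx : q ∉ Ideal.span {x, y}) :
    PdI (Ideal.span (dset P ⊥ x y) ⊔ Ideal.span {q}) (max (3 * Module.finrank k P + 1) (4 * Module.finrank k P - 10)) := by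
  classical
  have hUL : ent P ≤ LinF σ k := ent_le hP
  have hxU : x ∈ ent P := snd_mem_ent hyx
  have hyU : y ∈ ent P := by
    have := fst_mem_ent hyx
    simpa using (ent P).neg_mem this
  have hDn := finrank_ent_le P
  have hsub : ∀ Y ≤ ent P, dset P Y x y ⊆ Algebra.adjoin k (ent P : Set (MvPolynomial σ k)) := by
    rintro Y hY z (⟨c, hc, rfl⟩ | ⟨w, hw, rfl | rfl⟩)
    · exact add_mem (mul_mem (Algebra.subset_adjoin hxU) (Algebra.subset_adjoin (fst_mem_ent hc)))
        (mul_mem (Algebra.subset_adjoin hyU) (Algebra.subset_adjoin (snd_mem_ent hc)))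
    · exact mul_mem (Algebra.subset_adjoin (hY hw)) (Algebra.subset_adjoin hxU)
    · exact mul_mem (Algebra.subset_adjoin (hY hw)) (Algebra.subset_adjoin hyU)
  have hfin : FiniteDimensional k (ent P) := inferInstance
  by_cases hqU : q ∈ Ideal.span (ent P : Set (MvPolynomial σ k))
  swap
  · refine (pd_pure_quad (ent P) hUL hDn _ (hsub ⊥ bot_le) q hq hqU).mono ?_
    omega
  obtain ⟨t, D, Φ, hDe, -, hzL, huU, husp, hzsp⟩ := exists_tower (ent P) hUL
  have hqm : q ∈ ent P * LinF σ k := ideal_quad _ hUL hq hqU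
  rw [← hzsp, Submodule.mul_sup, mul_comm] at hqm
  obtain ⟨qa, hqa, qb, hqb, hqab⟩ := Submodule.mem_sup.1 hqm
  obtain ⟨l, hl, hqal⟩ := mem_span_mul _ _ hqa
  let Λ := Submodule.span k (Set.range l)
  have hΛU : Λ ≤ ent P := Submodule.span_le.2 (by rintro _ ⟨j, rfl⟩; exact hl j)
  have hΛL : Λ ≤ LinF σ k := hΛU.trans hUL
  have hΛd : Module.finrank k Λ ≤ Module.finrank k (ent P) := Submodule.finrank_mono hΛU
  by_cases hbig : Module.finrank k (ent P) + Module.finrank k Λ ≤ max (3 * Module.finrank k P + 1) (4 * Module.finrank k P - 10)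
  · have hqa' : qa ∈ Λ * LinF σ k := by
      rw [hqal]
      refine Submodule.sum_mem _ fun j _ => ?_
      rw [mul_comm Λ]
      exact Submodule.mul_mem_mul (hzL j) (Submodule.subset_span ⟨j, rfl⟩)
    obtain ⟨W', hW', hWd, hqW⟩ := mul_few Λ _ hΛL hqa'
    have hWf : FiniteDimensional k W' := Submodule.finiteDimensional_of_le hW'
    have h1 := Submodule.finrank_add_le_finrank_add_finrank (ent P) W'
    rw [← Ideal.span_union]
    refine (pd_vars (ent P ⊔ W') (sup_le hUL hW') (D := Module.finrank k (ent P) + Module.finrank k Λ) (by omega) _ ?_).mono hbig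
    rintro z (hz | hz)
    · exact Algebra.adjoin_mono (SetLike.coe_subset_coe.2 le_sup_left) (hsub ⊥ bot_le hz)
    · rw [Set.mem_singleton_iff.1 hz, ← hqab]
      exact add_mem (mul_adjoin (hΛU.trans le_sup_left) le_sup_right hqW) (mul_adjoin le_sup_left le_sup_left hqb)
  have h2 : 2 * Module.finrank k P ≤ Module.finrank k (ent P) + 4 := by omega
  have h3 : Module.finrank k P + 2 ≤ Module.finrank k Λ := by omega
  obtain ⟨Y, hYU, hYd, hlam, hYc⟩ := pencil_la P h2
  have hJ0 : ∀ c ∈ P, x * c.1 + y * c.2 ∈ Ideal.span (dset P ⊥ x y) := fun c hc => Ideal.subset_span (Or.inl ⟨c, hc, rfl⟩)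
  have hJK : Ideal.span (dset P ⊥ x y) ≤ Ideal.span (dset P Y x y) := by
    refine Ideal.span_mono ?_
    rintro z (h | ⟨w, hw, h⟩)
    · exact Or.inl h
    · exact Or.inr ⟨w, (bot_le : ⊥ ≤ Y) hw, h⟩
  refine (Pd.colon (n := 3 * Module.finrank k P) _ (Ideal.span (dset P Y x y)) q ?_ ?_ ?_).mono (le_max_left _ _)
  · intro a
    constructor
    · intro ha
      have hstep : ∀ u ∈ Ideal.span (ent P : Set (MvPolynomial σ k)), u * a ∈ Ideal.span (dset P ⊥ x y) := by
        intro u hu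
        induction hu using Submodule.span_induction with
        | mem u hu =>
          induction ha using Submodule.span_induction with
          | mem z hz =>
            rcases hz with ⟨c, hc, rfl⟩ | ⟨w, hw, rfl | rfl⟩
            · exact Ideal.mul_mem_left _ _ (hJ0 c hc)
            · exact (d2_kill P Y x y _ hJ0 hYc u w hu hw).1
            · exact (d2_kill P Y x y _ hJ0 hYc u w hu hw).2
          | zero => simp
          | add a b _ _ ha hb => rw [mul_add]; exact add_mem ha hb
          | smul r a _ ha => rw [smul_eq_mul, mul_left_comm]; exact Ideal.mul_mem_left _ _ ha
        | zero => simp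
        | add a b _ _ ha hb => rw [add_mul]; exact add_mem ha hb
        | smul r b _ hb => rw [smul_eq_mul, mul_assoc]; exact Ideal.mul_mem_left _ _ hb
      exact hstep q hqU
    · intro ha
      by_contra hna
      have haK := hJK ha
      have hExy : Ideal.span (dset P ⊥ x y) ≤ Ideal.span {x, y} := by
        rw [Ideal.span_le]
        have hx' : x ∈ Ideal.span {x, y} := Ideal.subset_span (by simp)
        have hy' : y ∈ Ideal.span {x, y} := Ideal.subset_span (by simp)
        rintro z (⟨c, hc, rfl⟩ | ⟨w, hw, rfl | rfl⟩)
        · exact add_mem (Ideal.mul_mem_right _ _ hx') (Ideal.mul_mem_right _ _ hy')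
        · exact Ideal.mul_mem_left _ _ hx'
        · exact Ideal.mul_mem_left _ _ hy'
      have haE : a ∈ Ideal.span {x, y} := by
        have h5 := hExy ha
        rw [← ideal_span_span (k' := k)] at h5 hqx ⊢
        refine (lin_ideal_prime _ ?_ h5).resolve_left hqx
        rw [Submodule.span_le]
        rintro z (rfl | rfl)
        · exact hx
        · exact hy
      obtain ⟨J', hJ1, hJ2⟩ := span_eq_tower Φ _ husp _ (hsub Y hYU)
      obtain ⟨E', hE1, hE2⟩ := span_eq_tower Φ _ husp {x, y} (by
        rintro z (rfl | rfl)
        · exact Algebra.subset_adjoin hxU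
        · exact Algebra.subset_adjoin hyU)
      rw [hJ1, map_mul] at haK
      rw [hJ1] at hna
      rw [hE1, mem_map_C_iff] at haE
      obtain ⟨b, hbE, hbJ, hbm⟩ := mccoy J' E' _ _ hna haE haK
      rw [hJ2] at hbJ
      rw [hE2] at hbE
      apply hbJ
      refine d2_tors x y hx hy hxy P hP hyx Y (hYU.trans hUL) hlam Λ hΛL (by omega) _ hbE ?_
      have hl' : ∀ j, ∃ a, l j = Φ (C a) := fun j => adjoin_range_tower Φ _ husp _ (Algebra.subset_adjoin (hl j))
      choose l' hl' using hl'
      obtain ⟨q0, hq0⟩ := adjoin_range_tower Φ _ husp qb (mul_adjoin le_rfl le_rfl hqb)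
      have hdec : Φ.symm q = ∑ j, X j * C (l' j) + C q0 := by
        rw [← hqab, hqal, hq0, map_add, Φ.symm_apply_apply, map_sum]
        congr 1
        refine Finset.sum_congr rfl fun j _ => ?_
        rw [hl', ← map_mul, Φ.symm_apply_apply]
      have hco : ∀ j, coeff (Finsupp.single j 1) (Φ.symm q) = l' j := by
        intro j
        rw [hdec, coeff_add, coeff_sum, coeff_C, if_neg, add_zero, Finset.sum_eq_single j]
        · rw [mul_comm, coeff_C_mul, coeff_X, if_pos rfl, mul_one]
        · intro i _ hij
          rw [mul_comm, coeff_C_mul, coeff_X, if_neg, mul_zero]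
          intro h
          exact hij (Finsupp.single_left_injective one_ne_zero h)
        · simp
        · intro h
          have := congrArg Finsupp.degree h
          simp at this
      intro v hv
      induction hv using Submodule.span_induction with
      | mem v hv =>
        obtain ⟨j, rfl⟩ := hv
        have := hbm (Finsupp.single j 1)
        rw [hco, hJ2, C_mul, map_mul, ← hl'] at this
        exact this
      | zero => simp
      | add a b _ _ ha hb => rw [add_mul]; exact add_mem ha hb
      | smul r a _ ha => rw [smul_mul_assoc]; exact Submodule.smul_of_tower_mem _ _ ha
  · exact (pd_vars (ent P) hUL hDn _ (hsub ⊥ bot_le)).mono (by omega)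
  · exact (pd_vars (ent P) hUL hDn _ (hsub Y hYU)).mono (by omega)

end
end

section
open MvPolynomial

section
variable {k : Type u} [Field k] {σ : Type} {Ω : Type u} [Field Ω] [Algebra k Ω]

theorem case_d2 [Finite σ] [IsAlgClosed k] (p : σ → Ω)
    (hr : ((Nat.card σ : ℕ) : ℕ∞) ≤ rk k (Set.range p) + 3)
    (x y : MvPolynomial σ k) (hx : x ∈ LinF σ k) (hy : y ∈ LinF σ k) (hxy : LinearIndependent k ![x, y])
    (hxp : aeval p x = 0) (hyp : aeval p y = 0)
    (hK : ∀ l ∈ LinF σ k, aeval p l = 0 → l ∈ Submodule.span k {x, y}) (V : Submodule k (MvPolynomial σ k)) (hV : V ≤ QuadF σ k)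
    (hVp : ∀ v ∈ V, aeval p v = 0) (hc : 1 ≤ Module.finrank k V) :
    PdI (Ideal.span (V : Set (MvPolynomial σ k))) (max (3 * Module.finrank k V + 1) (4 * Module.finrank k V - 10)) := by
  have := Fintype.ofFinite σ
  have hVfin : Module.Finite k V := Submodule.finiteDimensional_of_le hV
  let U := Submodule.span k {x, y}
  have hxU : x ∈ U := Submodule.subset_span (by simp)
  have hyU : y ∈ U := Submodule.subset_span (by simp)
  have hU : U ≤ LinF σ k := by
    rw [Submodule.span_le]
    rintro z (rfl | rfl)
    · exact hx
    · exact hy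
  have hUd : Module.finrank k U = 2 := by
    have := finrank_span_eq_card hxy
    rw [Matrix.range_cons, Matrix.range_cons, Matrix.range_empty, Set.union_empty] at this
    exact this
  have hUI : Ideal.span (U : Set (MvPolynomial σ k)) = Ideal.span {x, y} := ideal_span_span _
  have hquad : ∀ v ∈ QuadF σ k, v ∈ Ideal.span (U : Set (MvPolynomial σ k)) →
      ∃ l ∈ LinF σ k, ∃ m ∈ LinF σ k, v = x * l + y * m := by
    intro v hv h
    have h1 := ideal_quad U hU hv h
    rw [show U = Submodule.span k {x} ⊔ Submodule.span k {y} from by rw [← Submodule.span_union]; rfl, Submodule.sup_mul] at h1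
    obtain ⟨a, ha, b, hb, rfl⟩ := Submodule.mem_sup.1 h1
    rw [Submodule.mem_span_singleton_mul] at ha hb
    obtain ⟨l, hl, rfl⟩ := ha
    obtain ⟨m, hm, rfl⟩ := hb
    exact ⟨l, hl, m, hm, rfl⟩
  -- the pencil
  let A : Submodule k (MvPolynomial σ k) := (Ideal.span (U : Set (MvPolynomial σ k))).restrictScalars k
  let f : (MvPolynomial σ k × MvPolynomial σ k) →ₗ[k] MvPolynomial σ k :=
    (LinearMap.mulLeft k x).coprod (LinearMap.mulLeft k y)
  have hf : ∀ c, f c = x * c.1 + y * c.2 := fun _ => rfl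
  have hfA : ∀ c, f c ∈ A := fun c =>
    Ideal.add_mem _ (Ideal.mul_mem_right _ _ (Ideal.subset_span hxU)) (Ideal.mul_mem_right _ _ (Ideal.subset_span hyU))
  let P : Submodule k (MvPolynomial σ k × MvPolynomial σ k) := (LinF σ k).prod (LinF σ k) ⊓ (V ⊓ A).comap f
  have hPfin : FiniteDimensional k P := by
    have : FiniteDimensional k ↥((LinF σ k).prod (LinF σ k)) :=
      Module.Finite.iff_fg.2 (Submodule.FG.prod (Module.Finite.iff_fg.1 inferInstance) (Module.Finite.iff_fg.1 inferInstance))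
    exact Submodule.finiteDimensional_of_le inf_le_left
  have hPL : ∀ c ∈ P, c.1 ∈ LinF σ k ∧ c.2 ∈ LinF σ k := fun c hc => hc.1
  have hyx : (-y, x) ∈ P := by
    refine ⟨⟨(LinF σ k).neg_mem hy, hx⟩, ?_⟩
    change f (-y, x) ∈ V ⊓ A
    rw [hf]
    convert zero_mem (V ⊓ A) using 1
    ring
  have hPd : Module.finrank k P ≤ Module.finrank k ↥(V ⊓ A) + 1 := by
    have h1 := LinearMap.finrank_range_add_finrank_ker (f.domRestrict P)
    rw [LinearMap.range_domRestrict] at h1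
    have h2 : Module.finrank k (P.map f) ≤ Module.finrank k ↥(V ⊓ A) := by
      have : FiniteDimensional k ↥(V ⊓ A) := Submodule.finiteDimensional_of_le inf_le_left
      refine Submodule.finrank_mono ?_
      rintro _ ⟨c, hc, rfl⟩
      exact hc.2
    have h3 : Module.finrank k (LinearMap.ker (f.domRestrict P)) ≤ 1 := by
      refine finrank_le_one ⟨⟨(-y, x), hyx⟩, ?_⟩ ?_
      · change f (-y, x) = 0
        rw [hf]; ring
      · rintro ⟨⟨⟨a, b⟩, hP⟩, hk⟩
        have hk : x * a + y * b = 0 := hk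
        have hx0 : x ≠ 0 := hxy.ne_zero 0
        have hmem : ∀ z ∈ LinF σ k, x ∣ z → ∃ κ : k, κ • x = z := by
          intro z hz hd
          have h4 : z ∈ Ideal.span ((Submodule.span k {x} : Submodule k (MvPolynomial σ k)) : Set (MvPolynomial σ k)) := by
            rw [ideal_span_span]; exact Ideal.mem_span_singleton.2 hd
          exact Submodule.mem_span_singleton.1 (lin_mem_of_ideal _ (by rw [Submodule.span_le]; simpa using hx) hz h4)
        have h5 : x ∣ y * b := ⟨-a, by linear_combination hk⟩
        have h6 : x ∣ b := by
          refine ((lin_prime hx hx0).dvd_or_dvd h5).resolve_left fun hd => ?_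
          obtain ⟨κ, hκ⟩ := hmem y hy hd
          exact (LinearIndependent.pair_iff' hx0).1 hxy κ hκ
        obtain ⟨κ, rfl⟩ := hmem b hP.1.2 h6
        refine ⟨κ, Subtype.ext (Subtype.ext (Prod.ext ?_ rfl))⟩
        change κ • (-y) = a
        apply mul_left_cancel₀ hx0
        rw [smul_eq_C_mul] at hk ⊢
        linear_combination -hk
    omega
  have hset : Ideal.span (dset P ⊥ x y) = Ideal.span ((V ⊓ A : Submodule k (MvPolynomial σ k)) : Set (MvPolynomial σ k)) := by
    apply le_antisymm
    · rw [Ideal.span_le]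
      rintro z (⟨c, hc, rfl⟩ | ⟨w, hw, h⟩)
      · exact Ideal.subset_span hc.2
      · rw [(Submodule.mem_bot k).1 hw] at h
        simp only [zero_mul, or_self] at h
        rw [h]; exact zero_mem _
    · refine Ideal.span_mono ?_
      rintro v hv
      obtain ⟨l, hl, m, hm, rfl⟩ := hquad v (hV hv.1) hv.2
      exact Or.inl ⟨(l, m), ⟨⟨hl, hm⟩, hv⟩, rfl⟩
  by_cases hVA : V ≤ A
  · rw [inf_eq_left.2 hVA] at hset hPd
    have hDn := finrank_ent_le P
    refine Pd.congr_ideal hset ?_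
    refine (pd_vars (ent P) (ent_le hPL) hDn _ ?_).mono ((show _ ≤ 3 * Module.finrank k V + 1 by omega).trans (le_max_left _ _))
    have hxE : x ∈ ent P := snd_mem_ent hyx
    have hyE : y ∈ ent P := by
      have := fst_mem_ent hyx
      simpa using (ent P).neg_mem this
    rintro z (⟨c, hc, rfl⟩ | ⟨w, hw, h⟩)
    · exact add_mem (mul_mem (Algebra.subset_adjoin hxE) (Algebra.subset_adjoin (fst_mem_ent hc)))
        (mul_mem (Algebra.subset_adjoin hyE) (Algebra.subset_adjoin (snd_mem_ent hc)))
    · rw [(Submodule.mem_bot k).1 hw] at h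
      simp only [zero_mul, or_self] at h
      rw [h]; exact zero_mem _
  · obtain ⟨q, hqV, hqA⟩ := SetLike.not_le_iff_exists.1 hVA
    obtain ⟨m, π, ρ, hm, h0, hπρ, h1, hπL, hρL⟩ := mod_lin U hU
    have hker := mod_ker h0 h1
    obtain ⟨p', hp', hp'ρ, hrk⟩ := mod_point U π ρ h1 hπL p (by
      intro u hu
      obtain ⟨c, d, rfl⟩ := Submodule.mem_span_pair.1 hu
      simp [hxp, hyp])
    have hL' : ∀ l ∈ LinF (Fin m) k, aeval p' l = 0 → l = 0 := by
      intro l hl h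
      rw [← hp'ρ] at h
      rw [← hπρ l]
      exact h0 _ (hK _ (hρL l hl) h)
    have hr' : ((m - 1 : ℕ) : ℕ∞) ≤ rk k (Set.range p') := by
      have h2 := hr.trans (add_le_add_left hrk 3)
      rw [← hm, hUd] at h2
      generalize rk k (Set.range p') = a at *
      by_cases ha : a = ⊤
      · simp [ha]
      · lift a to ℕ using ha
        norm_cast at *
        omega
    have hq0 : π q ≠ 0 := fun h => hqA ((hker q).2 h)
    have hπq := quad_mod π hπL (hV hqV)
    have hpr : Prime (π q) := (quad_irr p' hL' hπq hq0 ((hp' q).symm.trans (hVp q hqV))).prime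
    have hco : ∀ v ∈ V, ∃ κ : k, v - κ • q ∈ A := by
      intro v hv
      have hd : π q ∣ π v := principal_of_rk p' _ _ hpr ((hp' q).symm.trans (hVp q hqV)) ((hp' v).symm.trans (hVp v hv))
        (m := m - 1) (by simp; omega) hr'
      have e1 : (π q).totalDegree = 2 := IsHomogeneous.totalDegree hπq hq0
      have e2 : (π v).totalDegree ≤ 2 := IsHomogeneous.totalDegree_le (quad_mod π hπL (hV hv))
      obtain ⟨κ, hκ⟩ := dvd_prop hq0 hd (by omega)
      refine ⟨κ, (hker _).2 ?_⟩
      rw [map_sub, map_smul, hκ, smul_eq_C_mul, sub_self]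
    obtain ⟨c1, c2⟩ := codim_one V A q hqV hco
    have hlt : Module.finrank k ↥(V ⊓ A) < Module.finrank k V := by
      refine Submodule.finrank_lt_finrank_of_lt (lt_of_le_of_ne inf_le_left ?_)
      intro h
      exact hVA (inf_eq_left.1 h)
    have := d2_core x y hx hy hxy P hPL hyx q (hV hqV) (by rw [← hUI]; exact hqA)
    refine Pd.congr_ideal ?_ (this.mono (by omega))
    rw [hset]
    apply le_antisymm
    · refine sup_le (Ideal.span_mono inf_le_left) (Ideal.span_mono (Set.singleton_subset_iff.2 hqV))
    · rw [Ideal.span_le]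
      intro v hv
      obtain ⟨a, ha, b, hb, rfl⟩ := Submodule.mem_sup.1 (c1 hv)
      obtain ⟨κ, rfl⟩ := Submodule.mem_span_singleton.1 hb
      refine add_mem (Ideal.mem_sup_left (Ideal.subset_span ha)) (Ideal.mem_sup_right ?_)
      rw [smul_eq_C_mul]
      exact Ideal.mul_mem_left _ _ (Ideal.mem_span_singleton_self q)

end
end

section
open MvPolynomial

section
variable {k : Type u} [Field k] {σ : Type} {Ω : Type u} [Field Ω] [Algebra k Ω]

theorem core_closed [Finite σ] [IsAlgClosed k] [IsAlgClosed Ω] (p : σ → Ω)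
    (hr : ((Nat.card σ : ℕ) : ℕ∞) ≤ rk k (Set.range p) + 3) (V : Submodule k (MvPolynomial σ k)) (hV : V ≤ QuadF σ k)
    (hVp : ∀ v ∈ V, aeval p v = 0) (hc : 4 ≤ Module.finrank k V) :
    PdI (Ideal.span (V : Set (MvPolynomial σ k))) (max (3 * Module.finrank k V + 1) (4 * Module.finrank k V - 10)) := by
  let U : Submodule k (MvPolynomial σ k) := LinF σ k ⊓ LinearMap.ker (aeval p : MvPolynomial σ k →ₐ[k] Ω).toLinearMap
  have hU : U ≤ LinF σ k := inf_le_left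
  have hUp : ∀ l ∈ U, aeval p l = 0 := fun l hl => hl.2
  have hUm : ∀ l ∈ LinF σ k, aeval p l = 0 → l ∈ U := fun l h1 h2 => ⟨h1, h2⟩
  have hd : Module.finrank k U ≤ 3 := by
    have h1 := rk_add_finrank_le p U hU hUp
    have h2 := add_le_add_left hr (Module.finrank k U : ℕ∞)
    generalize rk k (Set.range p) = a at *
    have ha : a ≠ ⊤ := by
      rintro rfl
      simp at h1
    lift a to ℕ using ha
    norm_cast at *
    omega
  clear_value U
  have hbas := exists_fin_basis U hU
  obtain h0 | h0 | h0 | h0 : Module.finrank k U = 0 ∨ Module.finrank k U = 1 ∨ Module.finrank k U = 2 ∨ Module.finrank k U = 3 := by omega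
  · refine (case_d0 p hr ?_ V hV hVp hc).mono (by omega)
    intro l hl h
    have hf : Module.Finite k U := Submodule.finiteDimensional_of_le hU
    have := hUm l hl h
    rw [Submodule.finrank_eq_zero.1 h0] at this
    exact (Submodule.mem_bot k).1 this
  · rw [h0] at hbas
    obtain ⟨x, hli, hs, hxU⟩ := hbas
    refine (case_d1 p hr (x 0) (hU (hxU 0)) (hli.ne_zero 0) (hUp _ (hxU 0)) ?_ V hV hVp hc).mono (le_max_left _ _)
    intro l hl h
    have := hUm l hl h
    rwa [← hs, Set.range_unique] at this
  · rw [h0] at hbas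
    obtain ⟨x, hli, hs, hxU⟩ := hbas
    have he : x = ![x 0, x 1] := by ext1 i; fin_cases i <;> rfl
    refine case_d2 p hr (x 0) (x 1) (hU (hxU 0)) (hU (hxU 1)) (he ▸ hli) (hUp _ (hxU 0)) (hUp _ (hxU 1)) ?_ V hV hVp (by omega)
    intro l hl h
    have := hUm l hl h
    rw [← hs, he, Matrix.range_cons, Matrix.range_cons, Matrix.range_empty, Set.union_empty] at this
    exact this
  · exact (case_d3 p hr U hU hUp h0 V hV hVp (by omega)).mono (le_max_left _ _)

end
end

section
open MvPolynomial

section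

theorem max_height {L : Type u} [Field L] : ∀ (c : ℕ) (P : Ideal (MvPolynomial (Fin c) L)) [P.IsMaximal], P.height = c := by
  intro c
  induction c with
  | zero =>
    intro P hP
    have hd := MvPolynomial.ringKrullDim_of_isNoetherianRing (R := L) (ι := Fin 0)
    rw [ringKrullDim_eq_zero_of_field] at hd
    have h1 := Ideal.height_le_ringKrullDim_of_ne_top hP.ne_top
    rw [hd] at h1
    have h2 : P.height ≤ 0 := by
      simpa using h1
    simpa using h2
  | succ c ih =>
    intro P hP
    let e := (finSuccEquiv L c).toRingEquiv
    let P' := P.map e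
    have hP' : P'.IsMaximal := Ideal.map_isMaximal_of_equiv e
    let p := P'.comap (Polynomial.C : _ →+* Polynomial (MvPolynomial (Fin c) L))
    have hp : p.IsMaximal := Polynomial.isMaximal_comap_C_of_isJacobsonRing P'
    have hl : P'.LiesOver p := ⟨rfl⟩
    have := Polynomial.height_eq_height_add_one p P'
    rw [RingEquiv.height_map, ih p] at this
    rw [this]; simp

attribute [local instance] MvPolynomial.algebraMvPolynomial in
theorem height_T {R L : Type u} [CommRing R] [IsDomain R] [Field L] [Algebra R L] [IsFractionRing R L] {c : ℕ}
    (Q : Ideal (MvPolynomial (Fin c) R)) [Q.IsPrime] (h0 : ∀ a, C a ∈ Q → a = 0)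
    (hg : ∀ i, ∃ g : Polynomial R, g ≠ 0 ∧ Polynomial.aeval (X i : MvPolynomial (Fin c) R) g ∈ Q) : Q.height = c := by
  let M := (nonZeroDivisors R).map (C (σ := Fin c) : R →+* MvPolynomial (Fin c) R)
  have hdisj : Disjoint (M : Set (MvPolynomial (Fin c) R)) Q := by
    rw [Set.disjoint_left]
    rintro _ ⟨a, ha, rfl⟩ hQ
    exact nonZeroDivisors.ne_zero ha (h0 a hQ)
  let T' := MvPolynomial (Fin c) L
  let P := Q.map (algebraMap (MvPolynomial (Fin c) R) T')
  have hPp : P.IsPrime := IsLocalization.isPrime_of_isPrime_disjoint M T' Q inferInstance hdisj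
  have hPm : P.IsMaximal := by
    apply Ideal.Quotient.maximal_of_isField
    have hIntegral : Algebra.IsIntegral L (T' ⧸ P) := by
      constructor
      intro z
      obtain ⟨z, rfl⟩ := Ideal.Quotient.mk_surjective z
      induction z using MvPolynomial.induction_on with
      | C a => exact isIntegral_algebraMap (R := L) (A := T' ⧸ P) (x := a)
      | add a b ha hb => rw [map_add]; exact ha.add hb
      | mul_X a i ha =>
        rw [map_mul]
        refine ha.mul ?_
        rw [← isAlgebraic_iff_isIntegral]
        obtain ⟨g, hg0, hgQ⟩ := hg i
        refine ⟨g.map (algebraMap R L), ?_, ?_⟩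
        · rwa [Ne, Polynomial.map_eq_zero_iff (IsFractionRing.injective R L)]
        · have h1 : algebraMap (MvPolynomial (Fin c) R) T' (Polynomial.aeval (X i : MvPolynomial (Fin c) R) g) ∈ P :=
            Ideal.mem_map_of_mem _ hgQ
          have h2 : algebraMap (MvPolynomial (Fin c) R) T' (Polynomial.aeval (X i : MvPolynomial (Fin c) R) g) =
              Polynomial.aeval (X i : T') (g.map (algebraMap R L)) := by
            rw [MvPolynomial.algebraMap_def, Polynomial.aeval_def, Polynomial.hom_eval₂, Polynomial.aeval_def, Polynomial.eval₂_map]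
            congr 1
            · ext a : 1
              simp [MvPolynomial.algebraMap_eq]
            · simp
          rw [h2] at h1
          rw [← Ideal.Quotient.eq_zero_iff_mem] at h1
          rw [← h1]
          exact (Polynomial.aeval_algHom_apply (Ideal.Quotient.mkₐ L P) _ _)
    exact isField_of_isIntegral_of_isField' (Field.toIsField L)
  rw [← IsLocalization.height_map_of_disjoint M (S := T') Q hdisj]
  exact max_height c P

end
end

section
open MvPolynomial

section
variable {k Ω : Type u} [Field k] [Field Ω] [Algebra k Ω]

theorem noether_setup {σ : Type} [Finite σ] (p : σ → Ω) :
    ∃ (B : Set σ) (c : ℕ) (e : MvPolynomial (Fin c) (MvPolynomial B k) ≃+* MvPolynomial σ k),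
      (Nat.card σ : ℕ∞) ≤ rk k (Set.range p) + c ∧ (∀ a, aeval p (e (C a)) = 0 → a = 0) ∧
      ∀ i, ∃ g : Polynomial (MvPolynomial B k), g ≠ 0 ∧
        aeval p (e (Polynomial.aeval (X i : MvPolynomial (Fin c) (MvPolynomial B k)) g)) = 0 := by
  classical
  have hne : AlgebraicIndepOn k p (∅ : Set σ) := by
    have : IsEmpty ((∅ : Set σ) : Type) := inferInstance
    exact algebraicIndependent_empty_type_iff.2 (algebraMap k Ω).injective
  obtain ⟨B, -, hB⟩ := Finite.exists_le_maximal (p := fun B : Set σ => AlgebraicIndepOn k p B) hne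
  have hBi : AlgebraicIndependent k (fun b : B => p b) := hB.prop
  let c := Nat.card (Bᶜ : Set σ)
  let ε : Fin c ≃ (Bᶜ : Set σ) := (Finite.equivFin _).symm
  let τ : Fin c ⊕ B ≃ σ := ((Equiv.sumCongr ε (Equiv.refl B)).trans (Equiv.sumComm _ _)).trans (Equiv.Set.sumCompl B)
  let e : MvPolynomial (Fin c) (MvPolynomial B k) ≃ₐ[k] MvPolynomial σ k :=
    (sumAlgEquiv k (Fin c) B).symm.trans (renameEquiv k τ)
  have heC : ∀ a, aeval p (e (C a)) = aeval (fun b : B => p b) a := by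
    intro a
    have : ((aeval p).comp e.toAlgHom).comp (IsScalarTower.toAlgHom k (MvPolynomial B k) (MvPolynomial (Fin c) (MvPolynomial B k))) = aeval (fun b : B => p b) := by
      ext b
      simp [e, τ, MvPolynomial.algebraMap_eq]
    exact DFunLike.congr_fun this a
  have heX : ∀ i, aeval p (e (X i)) = p (ε i) := by
    intro i
    simp [e, τ]
  refine ⟨B, c, e.toRingEquiv, ?_, ?_, ?_⟩
  · have h1 := rk_range_of_indep _ hBi
    have h2 : rk k (Set.range fun b : B => p b) ≤ rk k (Set.range p) := rk_mono (by
      rintro _ ⟨b, rfl⟩; exact ⟨b, rfl⟩)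
    have h3 : Nat.card σ = Nat.card B + c := by
      rw [← Nat.card_congr (Equiv.Set.sumCompl B), Nat.card_sum]
    rw [h3, Nat.cast_add, ← h1]
    gcongr
  · intro a ha
    have ha' : aeval p (e (C a)) = 0 := ha
    rw [heC] at ha'
    exact hBi.eq_zero_of_aeval_eq_zero _ ha'
  · intro i
    have hni : (ε i : σ) ∉ B := (ε i).2
    have h1 : ¬ AlgebraicIndepOn k p (insert (ε i : σ) B) := by
      intro h
      exact hni (hB.le_of_ge h (Set.subset_insert _ _) (Set.mem_insert _ _))
    rw [AlgebraicIndepOn.insert_iff hni] at h1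
    have h2 : IsAlgebraic (Algebra.adjoin k (p '' B)) (p (ε i)) := by
      by_contra h; exact h1 ⟨hBi, h⟩
    rw [Set.image_eq_range] at h2
    obtain ⟨h, hh0, hh⟩ := h2
    let w := hBi.aevalEquiv
    refine ⟨h.map (w.symm.toRingEquiv : _ →+* _), ?_, ?_⟩
    · rwa [Ne, Polynomial.map_eq_zero_iff (w.symm.injective)]
    · change aeval p (e _) = 0
      let φ : MvPolynomial (Fin c) (MvPolynomial B k) →+* Ω := ((aeval p).comp e.toAlgHom).toRingHom
      change φ _ = 0
      rw [Polynomial.aeval_def, Polynomial.hom_eval₂, Polynomial.eval₂_map]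
      have h3 : φ (X i) = p (ε i) := heX i
      rw [h3, ← hh, Polynomial.aeval_def]
      congr 1
      ext z
      obtain ⟨z, rfl⟩ := w.surjective z
      change aeval p (e (C (w.symm (w z)))) = _
      rw [heC, AlgEquiv.symm_apply_apply]
      exact (hBi.algebraMap_aevalEquiv z).symm

end
end

section
open MvPolynomial

section
variable {k Ω : Type u} [Field k] [Field Ω] [Algebra k Ω]

/-- regularity of a polynomial up to powers of its leading coefficient -/
theorem lc_kill {A : Type*} [CommRing A] (g : Polynomial A) (n : ℕ) (hn : g.natDegree ≤ n) :
    ∀ (D : ℕ) (a : Polynomial A), a.degree < D → g * a = 0 → Polynomial.C (g.coeff n ^ D) * a = 0 := by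
  intro D
  induction D with
  | zero =>
    intro a ha _
    have : a = 0 := by
      rw [← Polynomial.degree_eq_bot]
      simpa using ha
    simp [this]
  | succ D ih =>
    intro a ha h
    have ha' : a.natDegree ≤ D := by
      rw [Polynomial.natDegree_le_iff_coeff_eq_zero]
      intro m hm
      rw [Polynomial.degree_lt_iff_coeff_zero] at ha
      exact ha m hm
    have h1 : g.coeff n * a.coeff D = 0 := by
      rw [← Polynomial.coeff_mul_add_eq_of_natDegree_le hn ha', h, Polynomial.coeff_zero]
    have h2 := ih (Polynomial.C (g.coeff n) * a) ?_ ?_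
    · rw [← h2, pow_succ, Polynomial.C_mul]; ring
    · rw [Polynomial.degree_lt_iff_coeff_zero]
      intro m hm
      rw [Polynomial.coeff_C_mul]
      rcases hm.eq_or_lt with h | h
      · rw [← h, h1]
      · rw [Polynomial.coeff_eq_zero_of_natDegree_lt (lt_of_le_of_lt ha' h), mul_zero]
    · rw [mul_left_comm, h, mul_zero]

theorem sep_var {R : Type*} [CommRing R] {σ : Type} [DecidableEq σ] (i : σ) :
    ∃ E : MvPolynomial σ R ≃ₐ[R] Polynomial (MvPolynomial {j // j ≠ i} R), E (X i) = Polynomial.X ∧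
      ∀ j (h : j ≠ i), E (X j) = Polynomial.C (X ⟨j, h⟩) := by
  refine ⟨(renameEquiv R (Equiv.optionSubtypeNe i).symm).trans (optionEquivLeft R _), ?_, ?_⟩
  · simp [optionEquivLeft_X_none]
  · intro j h
    simp [Equiv.optionSubtypeNe_symm_of_ne h, optionEquivLeft_X_some]

theorem poly_reg {R : Type*} [CommRing R] {σ : Type} [DecidableEq σ] (i : σ) (g : Polynomial R)
    (s : Set (MvPolynomial σ R)) (hs : ∀ x ∈ s, ∃ j, j ≠ i ∧ ∃ q : Polynomial R, x = Polynomial.aeval (X j) q)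
    (a : MvPolynomial σ R) (h : Polynomial.aeval (X i) g * a ∈ Ideal.span s) :
    ∃ m : ℕ, C (g.leadingCoeff ^ m) * a ∈ Ideal.span s := by
  obtain ⟨E, hE1, hE2⟩ := sep_var (R := R) i
  let ι : MvPolynomial {j // j ≠ i} R →+* MvPolynomial σ R :=
    (E.symm.toRingEquiv : _ →+* _).comp Polynomial.C
  let J := (Ideal.span s).comap ι
  have hmem : ∀ x, x ∈ Ideal.span s ↔ E x ∈ J.map Polynomial.C := by
    intro x
    constructor
    · intro hx
      have : Ideal.span s ≤ (J.map Polynomial.C).comap (E.toRingEquiv : _ →+* _) := by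
        rw [Ideal.span_le]
        intro y hy
        obtain ⟨j, hj, q, hq⟩ := hs y hy
        have h1 : E y = Polynomial.C (Polynomial.aeval (X ⟨j, hj⟩) q) := by
          rw [hq, ← AlgEquiv.coe_toAlgHom, ← Polynomial.aeval_algHom_apply, AlgEquiv.coe_toAlgHom, hE2 j hj]
          exact Polynomial.aeval_algHom_apply (IsScalarTower.toAlgHom R (MvPolynomial {j // j ≠ i} R) (Polynomial (MvPolynomial {j // j ≠ i} R))) _ _
        change E y ∈ J.map Polynomial.C
        rw [h1]
        apply Ideal.mem_map_of_mem
        change E.symm (Polynomial.C _) ∈ Ideal.span s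
        rw [← h1, E.symm_apply_apply]
        exact Ideal.subset_span hy
      exact this hx
    · intro hx
      have : J.map Polynomial.C ≤ (Ideal.span s).comap (E.symm.toRingEquiv : _ →+* _) := by
        rw [Ideal.map_le_iff_le_comap]
        intro z hz
        exact hz
      have := this hx
      change E.symm (E x) ∈ Ideal.span s at this
      rwa [E.symm_apply_apply] at this
  let π := Polynomial.mapRingHom (Ideal.Quotient.mk J)
  have hπ : ∀ y, y ∈ J.map Polynomial.C ↔ π y = 0 := by
    intro y
    rw [Ideal.mem_map_C_iff, Polynomial.ext_iff]
    simp [π, Ideal.Quotient.eq_zero_iff_mem]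
  let G : Polynomial (MvPolynomial {j // j ≠ i} R) := g.map C
  have hG : E (Polynomial.aeval (X i) g) = G := by
    rw [← AlgEquiv.coe_toAlgHom, ← Polynomial.aeval_algHom_apply, AlgEquiv.coe_toAlgHom, hE1]
    rfl
  rw [hmem, map_mul, hG, hπ, map_mul] at h
  have h3 := lc_kill (π G) g.natDegree ((Polynomial.natDegree_map_le).trans (Polynomial.natDegree_map_le))
    ((π (E a)).natDegree + 1) (π (E a)) (lt_of_le_of_lt Polynomial.degree_le_natDegree (by exact_mod_cast Nat.lt_succ_self _)) h
  refine ⟨(π (E a)).natDegree + 1, ?_⟩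
  rw [hmem, hπ, map_mul, map_mul, ← h3]
  congr 1
  have : E (C (g.leadingCoeff ^ ((π (E a)).natDegree + 1))) = Polynomial.C (C (g.leadingCoeff ^ ((π (E a)).natDegree + 1))) := E.commutes _
  rw [this]
  simp [π, G]

end
end

section
open MvPolynomial

section

theorem exchange {R : Type*} [CommRing R] [IsDomain R] {σ : Type} [DecidableEq σ] {i j l : σ} (hij : i ≠ j)
    (hil : i ≠ l) (hjl : j ≠ l) (g : σ → Polynomial R) (hg : ∀ x, g x ≠ 0)
    (f1 f2 u : MvPolynomial σ R) (hf2 : f2 ≠ 0) (hk : ∀ a, f2 ∣ f1 * a → f2 ∣ a)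
    (hu : ∀ x, Polynomial.aeval (X x : MvPolynomial σ R) (g x) * u ∈ Ideal.span {f1, f2}) :
    ∃ d : R, d ≠ 0 ∧ C d * u ∈ Ideal.span {f1, f2} := by
  let G : σ → MvPolynomial σ R := fun x => Polynomial.aeval (X x : MvPolynomial σ R) (g x)
  have hu' : ∀ x, ∃ a b, a * f1 + b * f2 = G x * u := fun x => Ideal.mem_span_pair.1 (hu x)
  choose a b hab using hu'
  have key : ∀ x y, ∃ c, G y * a x - G x * a y = f2 * c ∧ G y * b x - G x * b y = - (f1 * c) := by
    intro x y
    have h0 : f1 * (G y * a x - G x * a y) = f2 * (- (G y * b x - G x * b y)) := by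
      linear_combination G y * hab x - G x * hab y
    obtain ⟨c, hc⟩ := hk _ (Dvd.intro _ h0.symm)
    refine ⟨c, hc, ?_⟩
    rw [hc] at h0
    apply mul_left_cancel₀ hf2
    linear_combination h0
  obtain ⟨cij, h1, h1'⟩ := key i j
  obtain ⟨cil, h2, h2'⟩ := key i l
  obtain ⟨cjl, h3, h3'⟩ := key j l
  have hlc : ∀ x m, (g x).leadingCoeff ^ m ≠ 0 := fun x m => pow_ne_zero _ (by
    rw [Ne, Polynomial.leadingCoeff_eq_zero]; exact hg x)
  have h4 : G l * cij ∈ Ideal.span {G i, G j} := by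
    rw [Ideal.mem_span_pair]
    refine ⟨- cjl, cil, ?_⟩
    apply mul_left_cancel₀ hf2
    linear_combination G i * h3 - G j * h2 + G l * h1
  obtain ⟨m, hm⟩ := poly_reg l (g l) {G i, G j} (by
    rintro x (rfl | rfl)
    · exact ⟨i, hil, _, rfl⟩
    · exact ⟨j, hjl, _, rfl⟩) cij h4
  obtain ⟨s, t, hst⟩ := Ideal.mem_span_pair.1 hm
  have hreg : ∀ z w, G j * z = G i * w → ∃ m h, C ((g j).leadingCoeff ^ m) * z = h * G i := by
    intro z w h
    obtain ⟨m, hm⟩ := poly_reg j (g j) {G i} (by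
      rintro x rfl
      exact ⟨i, hij, _, rfl⟩) z (by
        change G j * z ∈ _
        rw [h]; exact Ideal.mul_mem_right _ _ (Ideal.mem_span_singleton_self _))
    obtain ⟨h, hh⟩ := Ideal.mem_span_singleton'.1 hm
    exact ⟨m, h, hh.symm⟩
  set d := (g l).leadingCoeff ^ m with hd
  obtain ⟨m1, e1, he1⟩ := hreg (C d * a i - t * f2) (C d * a j + s * f2) (by
    linear_combination C d * h1 - f2 * hst)
  obtain ⟨m2, e2, he2⟩ := hreg (C d * b i + t * f1) (C d * b j - s * f1) (by
    linear_combination C d * h1' + f1 * hst)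
  have hGi : G i ≠ 0 := by
    intro h0
    have hX : Transcendental R (X i : MvPolynomial σ R) := transcendental_X R i
    exact hg i (by
      by_contra hne
      exact hX ⟨g i, hne, h0⟩)
  set d1 := (g j).leadingCoeff ^ m1 with hd1
  set d2 := (g j).leadingCoeff ^ m2 with hd2
  refine ⟨d1 * d2 * d, mul_ne_zero (mul_ne_zero (hlc _ _) (hlc _ _)) (hlc _ _), ?_⟩
  rw [Ideal.mem_span_pair]
  refine ⟨C d2 * e1, C d1 * e2, ?_⟩
  apply mul_left_cancel₀ hGi
  rw [C_mul, C_mul]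
  linear_combination (- C d2 * f1) * he1 + (- C d1 * f2) * he2 + C d1 * C d2 * C d * hab i

variable {k : Type u} [Field k]

theorem factor_unit {σ : Type} {f q a : MvPolynomial σ k} (hf : f.IsHomogeneous 2) (h0 : f ≠ 0)
    (h : f = q * a) (hq : constantCoeff q ≠ 0) : IsUnit q := by
  classical
  have ha0 : a ≠ 0 := by rintro rfl; simp at h; exact h0 h
  have hq0 : q ≠ 0 := by rintro rfl; simp at hq
  have hz : coeff 0 a = 0 := by
    have h1 : constantCoeff f = 0 := by
      rw [constantCoeff_eq]; exact hf.coeff_eq_zero (by simp)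
    rw [h, map_mul] at h1
    exact (mul_eq_zero.1 h1).resolve_left hq
  have hs : ∀ i, coeff (Finsupp.single i 1) a = 0 := by
    intro i
    have h1 : coeff (Finsupp.single i 1) f = 0 := hf.coeff_eq_zero (by simp)
    rw [h, coeff_mul, Finsupp.antidiagonal_single] at h1
    simp [Finset.Nat.antidiagonal_succ, hz] at h1
    exact h1.resolve_left hq
  have hdeg : 2 ≤ a.totalDegree := by
    by_contra hlt
    apply ha0
    ext m
    rw [coeff_zero]
    by_contra hm
    have h2 := le_totalDegree (mem_support_iff.2 hm)
    have h3 : m.degree ≤ 1 := by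
      have : (m.sum fun _ e => e) = m.degree := rfl
      omega
    rcases Nat.le_one_iff_eq_zero_or_eq_one.1 h3 with h4 | h4
    · rw [Finsupp.degree_eq_zero_iff] at h4
      rw [h4] at hm; exact hm hz
    · obtain ⟨i, rfl⟩ := (Finsupp.sum_eq_one_iff m).1 h4
      exact hm (hs i)
  have h5 := totalDegree_mul_of_isDomain hq0 ha0
  rw [← h, hf.totalDegree h0] at h5
  have h6 : q.totalDegree = 0 := by omega
  rw [totalDegree_eq_zero_iff_eq_C] at h6
  rw [h6]
  exact (isUnit_iff_ne_zero.2 hq).map C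

theorem quad_relprime {N : ℕ} (f : Fin 3 → MvPolynomial (Fin N) k) (hf : ∀ i, (f i).IsHomogeneous 2)
    (h0 : f 0 ≠ 0)
    (hht : ∀ P : Ideal (MvPolynomial (Fin N) k), P.IsPrime → Ideal.span (Set.range f) ≤ P → 3 ≤ P.height) :
    IsRelPrime (f 0) (f 1) := by
  intro q hq0 hq1
  by_contra hu
  obtain ⟨a, ha⟩ := hq0
  obtain ⟨b, hb⟩ := hq1
  have hc : constantCoeff q = 0 := by
    by_contra h; exact hu (factor_unit (hf 0) h0 ha h)
  have hc2 : constantCoeff (f 2) = 0 := by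
    rw [constantCoeff_eq]; exact (hf 2).coeff_eq_zero (by simp)
  classical
  have hne : Ideal.span ((({q, f 2} : Finset (MvPolynomial (Fin N) k)) : Set (MvPolynomial (Fin N) k))) ≠ ⊤ := by
    intro h
    have h1 : Ideal.span ((({q, f 2} : Finset (MvPolynomial (Fin N) k)) : Set (MvPolynomial (Fin N) k))) ≤ RingHom.ker (constantCoeff (R := k) (σ := Fin N)) := by
      rw [Ideal.span_le]
      intro x hx
      simp at hx
      rcases hx with rfl | rfl
      · exact hc
      · exact hc2
    rw [h] at h1
    have := h1 (x := 1) trivial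
    simp [RingHom.mem_ker] at this
  obtain ⟨P, hP⟩ := Ideal.nonempty_minimalPrimes hne
  have h2 := Ideal.height_le_card_of_mem_minimalPrimes_span_finset hP
  have h3 : ((({q, f 2} : Finset (MvPolynomial (Fin N) k)).card : ℕ) : ℕ∞) ≤ 2 := by
    exact_mod_cast Finset.card_le_two
  have hPl := hP.1.2
  rw [Ideal.span_le] at hPl
  have hqP : q ∈ P := hPl (by simp)
  have h4 := hht P hP.1.1 (by
    rw [Ideal.span_le]
    rintro _ ⟨i, rfl⟩
    fin_cases i
    · change f 0 ∈ P; rw [ha]; exact P.mul_mem_right _ hqP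
    · change f 1 ∈ P; rw [hb]; exact P.mul_mem_right _ hqP
    · exact hPl (by simp))
  have h5 := (h4.trans h2).trans h3
  exact absurd h5 (by decide)

end
end

section
open MvPolynomial

section
variable {k : Type u} [Field k]

theorem aeval_frac {σ : Type} (Q : Ideal (MvPolynomial σ k)) [Q.IsPrime] {Ω : Type u} [Field Ω]
    [Algebra (MvPolynomial σ k ⧸ Q) Ω] [Algebra k Ω] [IsScalarTower k (MvPolynomial σ k ⧸ Q) Ω] (y : MvPolynomial σ k) :
    aeval (fun i => algebraMap (MvPolynomial σ k ⧸ Q) Ω (Ideal.Quotient.mk Q (X i))) y =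
      algebraMap (MvPolynomial σ k ⧸ Q) Ω (Ideal.Quotient.mk Q y) := by
  have : aeval (fun i => algebraMap (MvPolynomial σ k ⧸ Q) Ω (Ideal.Quotient.mk Q (X i))) =
      (IsScalarTower.toAlgHom k (MvPolynomial σ k ⧸ Q) Ω).comp (Ideal.Quotient.mkₐ k Q) := by
    ext i
    simp
  rw [this]; rfl

theorem height_setup {σ : Type} [Finite σ] (Q : Ideal (MvPolynomial σ k)) [Q.IsPrime] {Ω : Type u} [Field Ω]
    [Algebra k Ω] (p : σ → Ω) (hp : ∀ y, aeval p y = 0 ↔ y ∈ Q) :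
    ∃ (B : Set σ) (c : ℕ) (e : MvPolynomial (Fin c) (MvPolynomial B k) ≃+* MvPolynomial σ k),
      Q.height = c ∧
      (Nat.card σ : ℕ∞) ≤ rk k (Set.range p) + c ∧ (∀ a, e (C a) ∈ Q → a = 0) ∧
      ∃ g : Fin c → Polynomial (MvPolynomial B k), (∀ i, g i ≠ 0) ∧
        ∀ i, e (Polynomial.aeval (X i : MvPolynomial (Fin c) (MvPolynomial B k)) (g i)) ∈ Q := by
  obtain ⟨B, c, e, h1, h2, h3⟩ := noether_setup (k := k) p
  simp only [hp] at h2 h3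
  have hht : (Q.comap e).height = c :=
    height_T (L := FractionRing (MvPolynomial B k)) (Q.comap e) h2 h3
  rw [RingEquiv.height_comap] at hht
  choose g hg hgQ using h3
  exact ⟨B, c, e, hht, h1, h2, g, hg, hgQ⟩

theorem three_pd {N : ℕ} (f : Fin 3 → MvPolynomial (Fin N) k) (hf : ∀ i, (f i).IsHomogeneous 2)
    (h0 : f 0 ≠ 0) (h1 : f 1 ≠ 0)
    (hht : ∀ P : Ideal (MvPolynomial (Fin N) k), P.IsPrime → Ideal.span (Set.range f) ≤ P → 3 ≤ P.height) :
    PdI (Ideal.span (Set.range f)) 3 := by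
  have hrel := quad_relprime f hf h0 hht
  let J := Ideal.span {f 0, f 1}
  have hJ : PdI J 2 := by
    have := pd_lin_two (⊥ : Submodule k (MvPolynomial (Fin N) k)) bot_le (D := 0) (by simp) (f 0) (f 1)
    refine Pd.congr_ideal ?_ this
    simp [J, Ideal.span_insert]
  have hreg : ∀ a, f 2 * a ∈ J → a ∈ J := by
    intro a ha
    by_contra haJ
    obtain ⟨Q, hQ, hle⟩ := exists_le_isAssociatedPrime_of_isNoetherianRing (MvPolynomial (Fin N) k)
      (Ideal.Quotient.mk J a) (by rwa [Ne, Ideal.Quotient.eq_zero_iff_mem])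
    rw [isAssociatedPrime_iff] at hQ
    obtain ⟨hQp, v, hv⟩ := hQ
    obtain ⟨v, rfl⟩ := Ideal.Quotient.mk_surjective v
    have hmk : ∀ x b : MvPolynomial (Fin N) k, x ∈ (⊥ : Submodule (MvPolynomial (Fin N) k) (MvPolynomial (Fin N) k ⧸ J)).colon {Ideal.Quotient.mk J b} ↔ x * b ∈ J := by
      intro x b
      rw [Submodule.mem_colon_singleton, Submodule.mem_bot]
      change Ideal.Quotient.mk J (x * b) = 0 ↔ _
      rw [Ideal.Quotient.eq_zero_iff_mem]
    have hQv : ∀ x, x ∈ Q ↔ x * v ∈ J := fun x => by rw [hv, hmk]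
    have hJQ : J ≤ Q := fun x hx => (hQv x).2 (J.mul_mem_right _ hx)
    have h2Q : f 2 ∈ Q := hle ((hmk _ _).2 ha)
    have hIQ : Ideal.span (Set.range f) ≤ Q := by
      rw [Ideal.span_le]
      rintro _ ⟨i, rfl⟩
      fin_cases i
      · exact hJQ (Ideal.subset_span (by simp))
      · exact hJQ (Ideal.subset_span (by simp))
      · exact h2Q
    have h3 := hht Q hQp hIQ
    let Ω := FractionRing (MvPolynomial (Fin N) k ⧸ Q)
    let p : Fin N → Ω := fun i => algebraMap (MvPolynomial (Fin N) k ⧸ Q) Ω (Ideal.Quotient.mk Q (X i))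
    obtain ⟨B, c, e, hc, -, hz, g, hg0, hg⟩ := height_setup Q p (by
      intro y
      rw [aeval_frac, map_eq_zero_iff _ (IsFractionRing.injective _ _), Ideal.Quotient.eq_zero_iff_mem])
    have hc3 : 3 ≤ c := by rw [hc] at h3; exact_mod_cast h3
    have hmem : ∀ y, y ∈ Ideal.span {e.symm (f 0), e.symm (f 1)} ↔ e y ∈ J := by
      intro y
      rw [Ideal.mem_span_pair, Ideal.mem_span_pair]
      constructor
      · rintro ⟨a, b, h⟩
        exact ⟨e a, e b, by simp [← h]⟩
      · rintro ⟨a, b, h⟩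
        exact ⟨e.symm a, e.symm b, by rw [← map_mul, ← map_mul, ← map_add, h, e.symm_apply_apply]⟩
    have := exchange (i := (⟨0, by omega⟩ : Fin c)) (j := ⟨1, by omega⟩) (l := ⟨2, by omega⟩) (by simp) (by simp) (by simp)
      g hg0 (e.symm (f 0)) (e.symm (f 1)) (e.symm v) (by simpa using h1) (by
        intro a ha
        have h4 : f 1 ∣ f 0 * e a := by
          have := map_dvd e ha
          simpa using this
        have h5 : f 1 ∣ e a := hrel.symm.dvd_of_dvd_mul_left h4
        have := map_dvd e.symm h5
        simpa using this) (by
        intro x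
        rw [hmem, map_mul, e.apply_symm_apply, ← hQv]
        exact hg x)
    obtain ⟨d, hd0, hd⟩ := this
    rw [hmem, map_mul, e.apply_symm_apply, ← hQv] at hd
    exact hd0 (hz d hd)
  refine Pd.congr_ideal ?_ (Pd.regular J (f 2) hreg hJ)
  rw [← Ideal.span_union]
  congr 1
  ext x
  simp [Fin.exists_fin_succ, eq_comm]
  tauto

end
end

section
open MvPolynomial

section
variable {k : Type u} [Field k]

theorem rk_algebraic {Ω : Type u} [Field Ω] [Algebra k Ω] (s : Set Ω) (hs : s.Finite) :
    rk k s ≤ rk (algebraicClosure k Ω) s := by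
  have h1 := rk_tower (algebraicClosure k Ω) s hs
  have h2 : rk k ((algebraicClosure k Ω : IntermediateField k Ω) : Set Ω) ≤ rk k (∅ : Set Ω) :=
    rk_le_of_algOver (fun a ha => algOver_empty ((mem_algebraicClosure_iff).1 ha))
  have h3 : rk k (∅ : Set Ω) = 0 := by simp [rk]
  rw [h3] at h2
  rw [nonpos_iff_eq_zero.1 h2, zero_add] at h1
  rw [← h1]
  exact rk_mono Set.subset_union_right

theorem many_pd {N r : ℕ} (v : Fin r → MvPolynomial (Fin N) k) (hv : ∀ i, (v i).IsHomogeneous 2)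
    (hli : LinearIndependent k v) (hr : 4 ≤ r) (P : Ideal (MvPolynomial (Fin N) k)) [P.IsPrime]
    (hle : Ideal.span (Set.range v) ≤ P) (hP : P.height = 3) :
    PdI (Ideal.span (Set.range v)) (max (3 * r + 1) (4 * r - 10)) := by
  let F := FractionRing (MvPolynomial (Fin N) k ⧸ P)
  let Ω := AlgebraicClosure F
  let K := algebraicClosure k Ω
  have hK : IsAlgClosed K := algClosed_aux k Ω
  let q : Fin N → F := fun i => algebraMap (MvPolynomial (Fin N) k ⧸ P) F (Ideal.Quotient.mk P (X i))
  let p : Fin N → Ω := fun i => algebraMap F Ω (q i)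
  have hp : ∀ y, aeval p y = 0 ↔ y ∈ P := by
    intro y
    have h1 : aeval p y = algebraMap F Ω (aeval q y) := aeval_algebraMap_apply Ω q y
    rw [h1, map_eq_zero_iff _ (algebraMap F Ω).injective, aeval_frac,
      map_eq_zero_iff _ (IsFractionRing.injective _ _), Ideal.Quotient.eq_zero_iff_mem]
  obtain ⟨B, c, e, hc, hrk, -⟩ := height_setup P p hp
  have hc3 : c = 3 := by rw [hP] at hc; exact_mod_cast hc.symm
  subst hc3
  let w : Fin r → MvPolynomial (Fin N) K := fun i => map (algebraMap k K) (v i)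
  have hw : LinearIndependent K w := linearIndependent_map v hli
  let V : Submodule K (MvPolynomial (Fin N) K) := Submodule.span K (Set.range w)
  have hfr : Module.finrank K V = r := by
    have := finrank_span_eq_card hw
    simpa using this
  have hcore := core_closed (k := K) (Ω := Ω) p (by
      refine hrk.trans ?_
      gcongr
      · exact rk_algebraic _ (Set.finite_range p)
      · rfl) V (by
      rw [Submodule.span_le]
      rintro _ ⟨i, rfl⟩
      exact (hv i).map _) (by
      have : V ≤ LinearMap.ker (aeval p : MvPolynomial (Fin N) K →ₐ[K] Ω).toLinearMap := by
        rw [Submodule.span_le]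
        rintro _ ⟨i, rfl⟩
        change aeval p (map (algebraMap k K) (v i)) = 0
        rw [aeval_map_algebraMap, hp]
        exact hle (Ideal.subset_span ⟨i, rfl⟩)
      exact fun v hv => this hv) (by rw [hfr]; exact hr)
  rw [hfr] at hcore
  apply pd_descend (K := K)
  refine Pd.congr_ideal ?_ hcore
  rw [ideal_span_span, Ideal.map_span, ← Set.range_comp]
  rfl

theorem height_prime {R : Type u} [CommRing R] (I P : Ideal R) [hP : P.IsPrime] (h : I ≤ P) : I.heightENat ≤ P.height := by
  have := PrimeSpectrum.height_eq_orderHeight ⟨P, hP⟩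
  change P.height = _ at this
  rw [this]
  exact iInf₂_le (f := fun (p : PrimeSpectrum R) (_ : I ≤ p.asIdeal) => Order.height p) ⟨P, hP⟩ h

theorem exists_prime_three {R : Type u} [CommRing R] (I : Ideal R) (h : I.heightENat = 3) :
    ∃ P : Ideal R, P.IsPrime ∧ I ≤ P ∧ P.height = 3 := by
  by_contra hcon
  push Not at hcon
  have h4 : (4 : ℕ∞) ≤ I.heightENat := by
    refine le_iInf₂ fun p hp => ?_
    rw [← PrimeSpectrum.height_eq_orderHeight]
    have h1 := height_prime I p.asIdeal hp
    rw [h] at h1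
    have h2 := hcon p.asIdeal p.2 hp
    have := Order.add_one_le_of_lt (lt_of_le_of_ne h1 h2.symm)
    exact le_trans (by norm_num) this
  rw [h] at h4
  exact absurd h4 (by decide)

theorem main_indep {N r : ℕ} (v : Fin r → MvPolynomial (Fin N) k) (hv : ∀ i, (v i).IsHomogeneous 2)
    (hli : LinearIndependent k v) (hht : (Ideal.span (Set.range v)).heightENat = 3) :
    PdI (Ideal.span (Set.range v)) (max (3 * r + 1) (4 * r - 10)) := by
  have hU := fun q1 q2 => pd_lin_two (⊥ : Submodule k (MvPolynomial (Fin N) k)) bot_le (D := 0) (by simp) q1 q2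
  rcases Nat.lt_or_ge r 4 with h | h
  · match r, h with
    | 0, _ =>
      refine Pd.congr_ideal ?_ (Pd.bot.mono (Nat.zero_le _))
      simp
    | 1, _ =>
      refine Pd.congr_ideal ?_ ((hU (v 0) 0).mono (by omega))
      simp [Set.range_unique]
    | 2, _ =>
      refine Pd.congr_ideal ?_ ((hU (v 0) (v 1)).mono (by omega))
      rw [show Set.range v = {v 0, v 1} by ext x; simp [Fin.exists_fin_two, eq_comm], Ideal.span_insert]
      simp
    | 3, _ =>
      exact (three_pd v hv (hli.ne_zero 0) (hli.ne_zero 1) (fun P hP hle => by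
        rw [← hht]; exact height_prime _ P hle)).mono (by omega)
  · obtain ⟨P, hP, hle, hP3⟩ := exists_prime_three _ hht
    exact many_pd v hv hli h P hle hP3

theorem main_pd {N n : ℕ} (f : Fin n → MvPolynomial (Fin N) k) (hf : ∀ i, (f i).IsHomogeneous 2)
    (hht : (Ideal.span (Set.range f)).heightENat = 3) :
    PdI (Ideal.span (Set.range f)) (max (3 * n + 1) (4 * n - 10)) := by
  let V := Submodule.span k (Set.range f)
  have hfin : Module.Finite k V := Module.Finite.span_of_finite k (Set.finite_range f)
  let b := Module.finBasis k V
  let v : Fin (Module.finrank k V) → MvPolynomial (Fin N) k := fun i => (b i : MvPolynomial (Fin N) k)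
  have hli : LinearIndependent k v := b.linearIndependent.map' V.subtype (Submodule.ker_subtype V)
  have hsp : Submodule.span k (Set.range v) = V := by
    have h1 : Set.range v = V.subtype '' Set.range b := by rw [← Set.range_comp]; rfl
    rw [h1, Submodule.span_image, b.span_eq, Submodule.map_top, Submodule.range_subtype]
  have hI : Ideal.span (Set.range v) = Ideal.span (Set.range f) := by
    rw [← ideal_span_span (k' := k) (Set.range v), hsp, ideal_span_span]
  have hV : V ≤ homogeneousSubmodule (Fin N) k 2 := by
    rw [Submodule.span_le]
    rintro _ ⟨i, rfl⟩
    exact hf i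
  have h := main_indep v (fun i => hV (b i).2) hli (by rw [hI]; exact hht)
  have hn : Module.finrank k V ≤ n := by
    have := finrank_range_le_card (R := k) f
    simpa [Set.finrank] using this
  refine Pd.congr_ideal hI (h.mono ?_)
  omega

end
end

/-- If `I` is a homogeneous ideal of height `3` in a polynomial ring `S`
over a field `k`, generated by `n` homogeneous polynomials of degree `2`, then
`pd_S(S/I) ≤ max {3n+1, 4n-10}`. -/
theorem pd_le_of_height_three_quadrics (k : Type u) [Field k] (N : ℕ) (n : ℕ)
    (f : Fin n → MvPolynomial (Fin N) k)
    (hf : ∀ i, (f i).IsHomogeneous 2)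
    (I : Ideal (MvPolynomial (Fin N) k))
    (hI : I = Ideal.span (Set.range f))
    (hht : I.heightENat = 3) :
    projDim (MvPolynomial (Fin N) k) (MvPolynomial (Fin N) k ⧸ I)
      ≤ (max (3 * n + 1) (4 * n - 10) : ℕ) := by
  subst hI
  exact (main_pd f hf hht).projDim_le
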